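/- Let G be a non-hamiltonian 1-tough graph on n ≥ 3 vertices with σ₃(G) ≥ n. Then G contains a longest cycle C avoiding a vertex u of maximum degree among vertices off longest cycles, such that the number of length-2 intervals of C whose endpoints both lie in N(u) is at least σ₃(G) − n + 4. -/

import Mathlib

open scoped Classical

namespace Paper

noncomputable section

variable {V : Type*}

/-- degree as cardinality of neighbor set -/
def deg (G : SimpleGraph V) (x : V) : ℕ := (G.neighborSet x).ncard

/-- G is 1-tough -/
def OneTough (G : SimpleGraph V) : Prop :=
  ∀ S : Set V, S.Nonempty → Nat.card ((G.induce Sᶜ).ConnectedComponent) ≤ S.ncard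

def IsIndepTriple (G : SimpleGraph V) (s : Finset V) : Prop :=
  s.card = 3 ∧ ∀ x ∈ s, ∀ y ∈ s, x ≠ y → ¬ G.Adj x y

def sigma3 [Fintype V] (G : SimpleGraph V) : ℕ :=
  if ∃ s : Finset V, IsIndepTriple G s then
    sInf {k | ∃ s : Finset V, IsIndepTriple G s ∧ ∑ x ∈ s, deg G x = k}
  else 3 * (Fintype.card V - 1)

def NC2 [Fintype V] (G : SimpleGraph V) : ℕ :=
  if G = ⊤ then Fintype.card V - 1
  else sInf {k | ∃ x y : V, G.dist x y = 2 ∧ (G.neighborSet x ∪ G.neighborSet y).ncard = k}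

def circumference (G : SimpleGraph V) : ℕ :=
  sSup {k | ∃ (a : V) (w : G.Walk a a), w.IsCycle ∧ w.length = k}

def IsLongestCycle (G : SimpleGraph V) {a : V} (c : G.Walk a a) : Prop :=
  c.IsCycle ∧ ∀ (b : V) (w : G.Walk b b), w.IsCycle → w.length ≤ c.length

/-- successor of a vertex along the oriented cycle `c` (identity off the cycle) -/
def cSucc [DecidableEq V] {G : SimpleGraph V} {a : V} (c : G.Walk a a) (x : V) : V :=
  if h : x ∈ c.support.tail then c.support.tail.next x h else x

/-- predecessor of a vertex along the oriented cycle `c` (identity off the cycle) -/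
def cPred [DecidableEq V] {G : SimpleGraph V} {a : V} (c : G.Walk a a) (x : V) : V :=
  if h : x ∈ c.support.tail then c.support.tail.prev x h else x

/-- vertices strictly between `x` and `y` going forward along `c` -/
def arc [DecidableEq V] {G : SimpleGraph V} {a : V} (c : G.Walk a a) (x y : V) : Set V :=
  {z | ∃ i k : ℕ, 0 < i ∧ i < k ∧ k < c.length ∧ (cSucc c)^[k] x = y ∧ z = (cSucc c)^[i] x}

/-- length of the interval of the cycle `c` starting at `b` determined by `B` -/
def intervalLen [DecidableEq V] {G : SimpleGraph V} {a : V} (c : G.Walk a a)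
    (B : Set V) (b : V) : ℕ :=
  sInf {k | 0 < k ∧ (cSucc c)^[k] b ∈ B}

/-- inner vertices of the interval of the cycle `c` starting at `b` determined by `B` -/
def innerVerts [DecidableEq V] {G : SimpleGraph V} {a : V} (c : G.Walk a a)
    (B : Set V) (b : V) : Set V :=
  {x | ∃ i, 0 < i ∧ i < intervalLen c B b ∧ x = (cSucc c)^[i] b}

/-- the union of the neighborhoods of the vertices in `S` -/
def nbhdSet (G : SimpleGraph V) (S : Set V) : Set V := {z | ∃ y ∈ S, G.Adj y z}

/-- a set of vertices is independent -/
def IsIndepSet (G : SimpleGraph V) (S : Set V) : Prop :=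
  ∀ x ∈ S, ∀ y ∈ S, ¬ G.Adj x y

/-- maximum, over longest cycles `C`, of the maximum degree of a vertex off `C` -/
def muG {V : Type*} (G : SimpleGraph V) : ℕ :=
  sSup {d | ∃ (a : V) (c : G.Walk a a), IsLongestCycle G c ∧
    ∃ x : V, x ∉ c.support ∧ deg G x = d}

/-- `Pth G s x y`: some path of `G` from `x` to `y` has vertex set exactly `s`. -/
inductive Pth (G : SimpleGraph V) : Finset V → V → V → Prop
  | single (x : V) : Pth G {x} x x
  | cons {x y z : V} {s : Finset V} : G.Adj x y → x ∉ s → Pth G s y z → Pth G (insert x s) x z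

namespace Pth

variable {G : SimpleGraph V} {s t : Finset V} {x y z w : V}

theorem left_mem (h : Pth G s x y) : x ∈ s := by
  cases h <;> simp

theorem right_mem (h : Pth G s x y) : y ∈ s := by
  induction h <;> simp_all

theorem append (h : Pth G s x y) (h' : Pth G t z w) (hyz : G.Adj y z) (hd : Disjoint s t) :
    Pth G (s ∪ t) x w := by
  induction h with
  | single x =>
    rw [← Finset.insert_eq]
    exact cons hyz (by simpa using hd) h'
  | @cons a b c s hab has _ ih =>
    rw [Finset.insert_union]
    rw [Finset.disjoint_insert_left] at hd
    refine cons hab ?_ (ih hyz hd.2)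
    simp [has, hd.1]

theorem symm (h : Pth G s x y) : Pth G s y x := by
  induction h with
  | single x => exact single x
  | @cons a b c s hab has _ ih =>
    have := append ih (single a) hab.symm (by simpa using has)
    rwa [Finset.union_comm, ← Finset.insert_eq] at this

theorem eq_of_card_le_one (h : Pth G s x y) (hs : s.card ≤ 1) : x = y :=
  Finset.card_le_one.1 hs x h.left_mem y h.right_mem

theorem exists_walk (h : Pth G s x y) :
    ∃ p : G.Walk x y, p.IsPath ∧ p.support.toFinset = s := by
  induction h with
  | single x => exact ⟨.nil, by simp, by simp⟩
  | @cons a b c s hab has _ ih =>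
    obtain ⟨p, hp, hps⟩ := ih
    refine ⟨.cons hab p, ?_, by simp [hps]⟩
    rw [SimpleGraph.Walk.cons_isPath_iff]
    refine ⟨hp, fun hm => has ?_⟩
    rw [← hps]; simpa using hm

theorem of_walk {p : G.Walk x y} (hp : p.IsPath) : Pth G p.support.toFinset x y := by
  induction p with
  | nil => simpa using single _
  | cons hab p ih =>
    rw [SimpleGraph.Walk.cons_isPath_iff] at hp
    rw [SimpleGraph.Walk.support_cons, List.toFinset_cons]
    exact cons hab (by simpa using hp.2) (ih hp.1)

theorem exists_cycle (h : Pth G s x y) (hxy : G.Adj y x) (hs : 3 ≤ s.card) :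
    ∃ c : G.Walk y y, c.IsCycle ∧ c.length = s.card ∧ c.support.toFinset = s := by
  obtain ⟨p, hp, hps⟩ := h.exists_walk
  have hc : s.card = p.length + 1 := by
    rw [← hps, List.toFinset_card_of_nodup hp.support_nodup, SimpleGraph.Walk.length_support]
  refine ⟨.cons hxy p, ?_, by simp [hc], ?_⟩
  · rw [SimpleGraph.Walk.cons_isCycle_iff]
    refine ⟨hp, fun he => ?_⟩
    have hl := hp.length_eq_one_of_mem_edges (by rwa [Sym2.eq_swap] at he)
    omega
  · have := h.right_mem
    rw [SimpleGraph.Walk.support_cons, List.toFinset_cons, hps]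
    simpa using this

end Pth

/-- A cycle of length `c`, given as a `c`-periodic sequence. -/
structure Cyc (G : SimpleGraph V) (c : ℤ) (f : ℤ → V) : Prop where
  three_le : 3 ≤ c
  per : ∀ i, f (i + c) = f i
  inj : ∀ i j, f i = f j → c ∣ i - j
  adj : ∀ i, G.Adj (f i) (f (i + 1))

/-- The vertices `f a, …, f b`. -/
def seg (f : ℤ → V) (a b : ℤ) : Finset V := (Finset.Icc a b).image f

theorem mem_seg {f : ℤ → V} {a b : ℤ} {v : V} : v ∈ seg f a b ↔ ∃ i, a ≤ i ∧ i ≤ b ∧ f i = v := by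
  simp [seg, and_assoc]

theorem mem_seg_of {f : ℤ → V} {a b i : ℤ} (h : a ≤ i) (h' : i ≤ b) : f i ∈ seg f a b :=
  mem_seg.2 ⟨i, h, h', rfl⟩

/-- Segments of an injectively indexed walk are paths. -/
theorem pth_seg {G : SimpleGraph V} {f : ℤ → V} {a b : ℤ} (hab : a ≤ b)
    (hadj : ∀ i, a ≤ i → i < b → G.Adj (f i) (f (i + 1)))
    (hinj : ∀ i j, a ≤ i → i < j → j ≤ b → f i ≠ f j) : Pth G (seg f a b) (f a) (f b) := by
  obtain ⟨n, rfl⟩ : ∃ n : ℕ, b = a + n := ⟨(b - a).toNat, by omega⟩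
  clear hab
  induction n with
  | zero => simpa [seg] using Pth.single (G := G) (f a)
  | succ n ih =>
    have h1 := ih (fun i h h' => hadj i h (by push_cast; omega))
      (fun i j h h' h'' => hinj i j h h' (by push_cast; omega))
    have h2 := Pth.append h1 (Pth.single (f (a + n + 1))) (hadj _ (by omega) (by push_cast; omega))
      (by
        rw [Finset.disjoint_singleton_right, mem_seg]
        rintro ⟨i, hi, hi', he⟩
        exact hinj i (a + n + 1) hi (by omega) (by push_cast; omega) he)
    have he : seg f a (a + (n + 1 : ℕ)) = seg f a (a + n) ∪ {f (a + n + 1)} := by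
      ext v
      simp only [mem_seg, Finset.mem_union, Finset.mem_singleton]
      constructor
      · rintro ⟨i, h, h', rfl⟩
        by_cases hi : i ≤ a + n
        · exact Or.inl ⟨i, h, hi, rfl⟩
        · exact Or.inr (by congr 1; push_cast at h'; omega)
      · rintro (⟨i, h, h', rfl⟩ | rfl)
        · exact ⟨i, h, by push_cast; omega, rfl⟩
        · exact ⟨_, by omega, by push_cast; omega, rfl⟩
    rw [he]
    simpa [add_assoc] using h2

namespace Cyc

variable {G : SimpleGraph V} {c : ℤ} {f : ℤ → V}

theorem per_mul (h : Cyc G c f) (i k : ℤ) : f (i + k * c) = f i := by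
  induction k using Int.induction_on with
  | zero => simp
  | succ k ih => rw [← ih, ← h.per (i + k * c)]; congr 1; ring
  | pred k ih => rw [← ih, ← h.per (i + (-k - 1) * c)]; congr 1; ring

theorem eq_iff (h : Cyc G c f) {i j : ℤ} : f i = f j ↔ c ∣ i - j := by
  refine ⟨h.inj i j, ?_⟩
  rintro ⟨k, hk⟩
  rw [← h.per_mul j k]; congr 1; linarith [mul_comm c k]

theorem ne (h : Cyc G c f) {i j : ℤ} (hij : i < j) (hj : j < i + c) : f i ≠ f j := by
  intro he
  have h1 := h.inj j i he.symm
  have := Int.le_of_dvd (by omega) h1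
  omega

theorem eq_of (h : Cyc G c f) {i j : ℤ} (he : f i = f j) (h1 : i < j + c) (h2 : j < i + c) :
    i = j := by
  rcases lt_trichotomy i j with hl | hl | hl
  · exact absurd he (h.ne hl h2)
  · exact hl
  · exact absurd he.symm (h.ne hl h1)

theorem pth (h : Cyc G c f) {a b : ℤ} (hab : a ≤ b) (hb : b < a + c) :
    Pth G (seg f a b) (f a) (f b) :=
  pth_seg hab (fun i _ _ => h.adj i) (fun _ _ _ h2 _ => h.ne h2 (by omega))

theorem disj (h : Cyc G c f) {a b a' b' : ℤ} (h1 : b < a') (h2 : b' < a + c) :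
    Disjoint (seg f a b) (seg f a' b') := by
  rw [Finset.disjoint_left]
  intro v hv hv'
  obtain ⟨i, hi, hi', rfl⟩ := mem_seg.1 hv
  obtain ⟨j, hj, hj', he⟩ := mem_seg.1 hv'
  exact h.ne (i := i) (j := j) (by omega) (by omega) he.symm

theorem card_seg (h : Cyc G c f) {a b : ℤ} (hb : b < a + c) (hab : a ≤ b + 1) :
    ((seg f a b).card : ℤ) = b - a + 1 := by
  rw [seg, Finset.card_image_of_injOn, Int.card_Icc]
  · omega
  · intro i hi j hj he
    simp only [Finset.coe_Icc, Set.mem_Icc] at hi hj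
    exact h.eq_of he (by omega) (by omega)

theorem mirror (h : Cyc G c f) : Cyc G c (fun i => f (-i)) where
  three_le := h.three_le
  per i := by rw [← h.per (-(i + c))]; congr 1; ring
  inj i j he := by
    have := h.inj _ _ he
    rw [show i - j = -(-i - -j) by ring]; exact (dvd_neg).2 this
  adj i := by
    have := (h.adj (-(i + 1))).symm
    rwa [show -(i + 1) + 1 = -i by ring] at this

theorem exists_rep (h : Cyc G c f) (i a : ℤ) : ∃ j, a ≤ j ∧ j < a + c ∧ f j = f i := by
  have hc : 0 < c := by linarith [h.three_le]
  refine ⟨a + (i - a) % c, ?_, ?_, ?_⟩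
  · linarith [Int.emod_nonneg (i - a) hc.ne']
  · linarith [Int.emod_lt_of_pos (i - a) hc]
  · rw [h.eq_iff, ← dvd_neg]
    rw [show -(a + (i - a) % c - i) = i - a - (i-a) % c by ring]
    exact Int.dvd_self_sub_emod

end Cyc

/-- A path from `v` to `w` using, in the window `[lo, lo + c)` of the cycle `f`, exactly the
positions satisfying `S`, and otherwise only vertices of `E`. -/
def IP (G : SimpleGraph V) (f : ℤ → V) (lo c : ℤ) (E : Set V) (S : ℤ → Prop) (v w : V) : Prop :=
  ∃ Q, Pth G Q v w ∧ (∀ k, lo ≤ k → k < lo + c → (f k ∈ Q ↔ S k)) ∧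
    ∀ x ∈ Q, (∃ k, f k = x) ∨ x ∈ E

/-- `v` and `w` are adjacent or joined by a path through `O`. -/
def Cn (G : SimpleGraph V) (O : Set V) (v w : V) : Prop :=
  G.Adj v w ∨ ∃ M p q, Pth G M p q ∧ (∀ x ∈ M, x ∈ O) ∧ G.Adj v p ∧ G.Adj q w

theorem Cn.symm {G : SimpleGraph V} {O : Set V} {v w : V} (h : Cn G O v w) : Cn G O w v := by
  rcases h with h | ⟨M, p, q, h1, h2, h3, h4⟩
  · exact .inl h.symm
  · exact .inr ⟨M, q, p, h1.symm, h2, h4.symm, h3.symm⟩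

theorem Cn.of_common {G : SimpleGraph V} {O : Set V} {v w r : V} (hr : r ∈ O) (h : G.Adj v r)
    (h' : G.Adj w r) : Cn G O v w :=
  .inr ⟨{r}, r, r, .single r, by simpa using hr, h, h'.symm⟩

namespace IP

variable {G : SimpleGraph V} {f : ℤ → V} {lo c : ℤ} {E E' : Set V} {S T : ℤ → Prop} {v w v' w' : V}

theorem symm (h : IP G f lo c E S v w) : IP G f lo c E S w v := by
  obtain ⟨Q, h1, h2, h3⟩ := h
  exact ⟨Q, h1.symm, h2, h3⟩

theorem seg (hf : Cyc G c f) {a b : ℤ} (h1 : lo ≤ a) (h2 : a ≤ b) (h3 : b < lo + c) :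
    IP G f lo c ∅ (fun k => a ≤ k ∧ k ≤ b) (f a) (f b) := by
  refine ⟨Paper.seg f a b, hf.pth h2 (by omega), fun k hk hk' => ?_, fun x hx => ?_⟩
  · rw [mem_seg]
    constructor
    · rintro ⟨i, hi, hi', he⟩
      rw [← hf.eq_of he (by omega) (by omega)]
      exact ⟨hi, hi'⟩
    · rintro ⟨h, h'⟩
      exact ⟨k, h, h', rfl⟩
  · obtain ⟨i, -, -, h⟩ := mem_seg.1 hx
    exact .inl ⟨i, h⟩

theorem mono (h : IP G f lo c E S v w) (hE : E ⊆ E') : IP G f lo c E' S v w := by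
  obtain ⟨Q, h1, h2, h3⟩ := h
  exact ⟨Q, h1, h2, fun x hx => (h3 x hx).imp_right fun h => hE h⟩

theorem congr (h : IP G f lo c E S v w) (hST : ∀ k, lo ≤ k → k < lo + c → (S k ↔ T k)) :
    IP G f lo c E T v w := by
  obtain ⟨Q, h1, h2, h3⟩ := h
  exact ⟨Q, h1, fun k hk hk' => (h2 k hk hk').trans (hST k hk hk'), h3⟩

theorem append' (hf : Cyc G c f) (h : IP G f lo c E S v w) (h' : IP G f lo c E' T v' w')
    (hadj : G.Adj w v') (hd : ∀ k, lo ≤ k → k < lo + c → S k → ¬ T k)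
    (hEE : ∀ x ∈ E, x ∉ E') (hE : ∀ x ∈ E, ∀ k, f k ≠ x) :
    IP G f lo c (E ∪ E') (fun k => S k ∨ T k) v w' := by
  obtain ⟨Q, h1, h2, h3⟩ := h
  obtain ⟨Q', h1', h2', h3'⟩ := h'
  refine ⟨Q ∪ Q', h1.append h1' hadj ?_, fun k hk hk' => ?_, fun x hx => ?_⟩
  · rw [Finset.disjoint_left]
    intro x hx hx'
    rcases h3 x hx with ⟨k, rfl⟩ | hk
    · obtain ⟨j, hj, hj', he⟩ := hf.exists_rep k lo
      rw [← he] at hx hx'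
      exact hd j hj hj' ((h2 j hj hj').1 hx) ((h2' j hj hj').1 hx')
    · rcases h3' x hx' with ⟨j, hj⟩ | hj
      · exact hE x hk j hj
      · exact hEE x hk hj
  · rw [Finset.mem_union, h2 k hk hk', h2' k hk hk']
  · rcases Finset.mem_union.1 hx with hx | hx
    · exact (h3 x hx).imp_right .inl
    · exact (h3' x hx).imp_right .inr

theorem append (hf : Cyc G c f) (h : IP G f lo c ∅ S v w) (h' : IP G f lo c ∅ T v' w')
    (hadj : G.Adj w v') (hd : ∀ k, lo ≤ k → k < lo + c → S k → ¬ T k) :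
    IP G f lo c ∅ (fun k => S k ∨ T k) v w' := by
  have := append' hf h h' hadj hd (by simp) (by simp)
  simpa using this

theorem join (hf : Cyc G c f) (h : IP G f lo c ∅ S v w) (h' : IP G f lo c ∅ T v' w') {O : Set V}
    (hO : ∀ x ∈ O, ∀ k, f k ≠ x)
    (hadj : Cn G O w v') (hd : ∀ k, lo ≤ k → k < lo + c → S k → ¬ T k) :
    IP G f lo c O (fun k => S k ∨ T k) v w' := by
  rcases hadj with hadj | ⟨M, p, q, hM, hMO, h1, h2⟩
  · exact (append hf h h' hadj hd).mono (by simp)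
  · have hm : IP G f lo c O (fun _ => False) p q :=
      ⟨M, hM, fun k _ _ => iff_of_false (fun hk => hO _ (hMO _ hk) k rfl) id,
        fun x hx => .inr (hMO x hx)⟩
    have h3 := append' hf h hm h1 (by simp) (by simp) (by simp)
    have h4 := append' hf h3 h' h2 (by simpa using hd) (by simp) (by simpa using hO)
    simpa using h4

theorem appendO (hf : Cyc G c f) {O : Set V} (h : IP G f lo c ∅ S v w)
    (h' : IP G f lo c O T v' w') (hadj : G.Adj w v') (hd : ∀ k, lo ≤ k → k < lo + c → S k → ¬ T k) :
    IP G f lo c O (fun k => S k ∨ T k) v w' := by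
  have := append' hf h h' hadj hd (by simp) (by simp)
  simpa using this

end IP

theorem deg_eq [Fintype V] (G : SimpleGraph V) (v : V) :
    deg G v = (Finset.univ.filter fun w => G.Adj v w).card := by
  rw [deg, ← Set.ncard_coe_finset]
  congr 1
  ext w; simp

theorem label_count [Fintype V] {G : SimpleGraph V} {g : ℤ → V} {a b e : ℤ} (hab : a ≤ b)
    (hbe : b < e)
    (hinj : ∀ i j, a ≤ i → i < j → j ≤ e → g i ≠ g j) {z z' : V} (hz : z = g a)
    (hz' : z' = g (b + 1)) {O : Finset V} (hgO : ∀ k, a ≤ k → k ≤ e → g k ∉ O)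
    (hNz : ∀ v, G.Adj z v → v ∈ O ∨ ∃ k, a ≤ k ∧ k ≤ e ∧ g k = v)
    (hNz' : ∀ v, G.Adj z' v → v ∈ O ∨ ∃ k, a ≤ k ∧ k ≤ e ∧ g k = v)
    (h1 : ∀ k, a ≤ k → k < b → ¬ (G.Adj z' (g k) ∧ G.Adj z (g (k + 1))))
    (h2 : ∀ k, b < k → k < e → ¬ (G.Adj z (g k) ∧ G.Adj z' (g (k + 1))))
    (h3 : ∀ r ∈ O, ¬ (G.Adj z r ∧ G.Adj z' r))
    (U : Finset V)
    (hU : ∀ v ∈ U, (∃ k, a ≤ k ∧ k ≤ b ∧ g k = v ∧ ¬ G.Adj z' (g k) ∧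
        (k < b → ¬ G.Adj z (g (k + 1)))) ∨
      (∃ k, b < k ∧ k ≤ e ∧ g k = v ∧ ¬ G.Adj z (g k) ∧ (k < e → ¬ G.Adj z' (g (k + 1)))) ∨
      (v ∈ O ∧ ¬ G.Adj z v ∧ ¬ G.Adj z' v)) :
    ((deg G z + deg G z' + U.card : ℕ) : ℤ) ≤ e - a + 1 + O.card := by
  set P : Finset V := (Finset.Icc a e).image g with hP
  have hinj' : Set.InjOn g (Set.Icc a e) := by
    intro i hi j hj he
    rcases lt_trichotomy i j with h | h | h
    · exact absurd he (hinj i j hi.1 h hj.2)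
    · exact h
    · exact absurd he.symm (hinj j i hj.1 h hi.2)
  have hPc : ((P ∪ O).card : ℤ) = e - a + 1 + O.card := by
    rw [Finset.card_union_of_disjoint, hP, Finset.card_image_of_injOn (by simpa using hinj'),
      Int.card_Icc]
    · push_cast; omega
    · rw [Finset.disjoint_left]
      intro v hv
      simp only [hP, Finset.mem_image, Finset.mem_Icc] at hv
      obtain ⟨k, ⟨hk, hk'⟩, rfl⟩ := hv
      exact hgO k hk hk'
  rw [← hPc]
  norm_cast
  -- shift the neighbours
  have key : ∀ (y : V) (p q : ℤ), a ≤ p → q ≤ e → y = g p → p ≤ q → 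
      (∀ v, G.Adj y v → v ∈ O ∨ ∃ k, a ≤ k ∧ k ≤ e ∧ g k = v) →
      deg G y ≤ ((P ∪ O).filter fun v => (v ∈ O ∧ G.Adj y v) ∨ ∃ k, a ≤ k ∧ k ≤ e ∧ g k = v ∧
        ((p ≤ k ∧ k < q ∧ G.Adj y (g (k + 1))) ∨ (¬ (p ≤ k ∧ k ≤ q) ∧ G.Adj y (g k)))).card := by
    intro y p q hp hq hy hpq hN
    rw [deg_eq]
    set inv : V → V := fun v => if h : ∃ k, p ≤ k ∧ k < q ∧ g (k + 1) = v then g h.choose else v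
      with hinv
    have hs : ∀ k, p ≤ k → k < q → inv (g (k + 1)) = g k := by
      intro k hk hk'
      have h : ∃ k', p ≤ k' ∧ k' < q ∧ g (k' + 1) = g (k + 1) := ⟨k, hk, hk', rfl⟩
      have h4 := h.choose_spec
      have : h.choose + 1 = k + 1 := hinj' (by constructor <;> omega) (by constructor <;> omega) h4.2.2
      simp only [hinv]
      rw [dif_pos h]
      congr 1; omega
    have hn : ∀ v, (∀ k, p ≤ k → k < q → g (k + 1) ≠ v) → inv v = v := by
      intro v hv
      simp only [hinv]
      rw [dif_neg]
      rintro ⟨k, hk, hk', he⟩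
      exact hv k hk hk' he
    have hform : ∀ v, G.Adj y v → (v ∈ O ∧ inv v = v) ∨
        (∃ k, p ≤ k ∧ k < q ∧ g (k + 1) = v ∧ inv v = g k) ∨
        (∃ k, a ≤ k ∧ k ≤ e ∧ ¬ (p ≤ k ∧ k ≤ q) ∧ g k = v ∧ inv v = v) := by
      intro v hv
      rcases hN v hv with h | ⟨k, hk, hk', rfl⟩
      · refine .inl ⟨h, hn v fun k hk hk' he => hgO (k + 1) (by omega) (by omega) (he ▸ h)⟩
      · by_cases hkq : p ≤ k ∧ k ≤ q
        · have : k ≠ p := by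
            rintro rfl
            rw [hy] at hv; exact hv.ne rfl
          refine .inr (.inl ⟨k - 1, by omega, by omega, by simp, ?_⟩)
          have := hs (k - 1) (by omega) (by omega)
          simpa using this
        · refine .inr (.inr ⟨k, hk, hk', hkq, rfl, hn _ fun j hj hj' he => hkq ?_⟩)
          have : j + 1 = k := hinj' (by constructor <;> omega) (by constructor <;> omega) he
          omega
    have himg : ∀ i j, a ≤ i → i ≤ e → a ≤ j → j ≤ e → g i = g j → i = j := by
      intro i j hi hi' hj hj' he
      exact hinj' ⟨hi, hi'⟩ ⟨hj, hj'⟩ he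
    apply Finset.card_le_card_of_injOn inv
    · intro v hv
      have hv' : G.Adj y v := by simpa using hv
      simp only [Finset.coe_filter, Set.mem_ofPred_eq, Finset.mem_union]
      rcases hform v hv' with ⟨h, he⟩ | ⟨k, hk, hk', rfl, he⟩ | ⟨k, hk, hk', hnk, rfl, he⟩ <;> rw [he]
      · exact ⟨.inr h, .inl ⟨h, hv'⟩⟩
      · refine ⟨.inl ?_, .inr ⟨k, by omega, by omega, rfl, .inl ⟨hk, hk', hv'⟩⟩⟩
        simp only [hP, Finset.mem_image, Finset.mem_Icc]
        exact ⟨k, ⟨by omega, by omega⟩, rfl⟩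
      · refine ⟨.inl ?_, .inr ⟨k, hk, hk', rfl, .inr ⟨hnk, hv'⟩⟩⟩
        simp only [hP, Finset.mem_image, Finset.mem_Icc]
        exact ⟨k, ⟨hk, hk'⟩, rfl⟩
    · intro v hv w hw he
      have hv' : G.Adj y v := by simpa using hv
      have hw' : G.Adj y w := by simpa using hw
      rcases hform v hv' with ⟨h, he1⟩ | ⟨k, hk, hk', rfl, he1⟩ | ⟨k, hk, hk', hnk, rfl, he1⟩ <;>
      rcases hform w hw' with ⟨h', he2⟩ | ⟨j, hj, hj', rfl, he2⟩ | ⟨j, hj, hj', hnj, rfl, he2⟩ <;>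
      rw [he1, he2] at he
      · exact he
      · exact absurd (he ▸ h) (hgO j (by omega) (by omega))
      · exact he
      · exact absurd (he ▸ h') (hgO k (by omega) (by omega))
      · rw [himg k j (by omega) (by omega) (by omega) (by omega) he]
      · have := himg k j (by omega) (by omega) (by omega) (by omega) he
        omega
      · exact he
      · have := himg k j (by omega) (by omega) (by omega) (by omega) he
        omega
      · exact he
  have k1 := key z a b le_rfl hbe.le hz hab hNz
  have k2 := key z' (b + 1) e (by omega) le_rfl hz' (by omega) hNz'
  have himg : ∀ i j, a ≤ i → i ≤ e → a ≤ j → j ≤ e → g i = g j → i = j := by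
    intro i j hi hi' hj hj' he
    exact hinj' ⟨hi, hi'⟩ ⟨hj, hj'⟩ he
  refine le_trans (Nat.add_le_add_right (Nat.add_le_add k1 k2) _) ?_
  rw [← Finset.card_union_of_disjoint, ← Finset.card_union_of_disjoint]
  · apply Finset.card_le_card
    refine Finset.union_subset (Finset.union_subset (Finset.filter_subset _ _)
      (Finset.filter_subset _ _)) fun v hv => ?_
    simp only [hP, Finset.mem_union, Finset.mem_image, Finset.mem_Icc]
    rcases hU v hv with ⟨k, hk, hk', he, -⟩ | ⟨k, hk, hk', he, -⟩ | ⟨h, -⟩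
    · exact .inl ⟨k, ⟨by omega, by omega⟩, he⟩
    · exact .inl ⟨k, ⟨by omega, by omega⟩, he⟩
    · exact .inr h
  · rw [Finset.disjoint_left]
    intro v hv hvU
    simp only [Finset.mem_union, Finset.mem_filter] at hv
    rcases hU v hvU with ⟨k, hk, hk', he, hb1, hb2⟩ | ⟨k, hk, hk', he, hb1, hb2⟩ | ⟨h, hb1, hb2⟩
    · subst he
      have hkO := hgO k (by omega) (by omega)
      rcases hv with ⟨-, ⟨h, -⟩ | ⟨j, hj, hj', he, hh⟩⟩ | ⟨-, ⟨h, -⟩ | ⟨j, hj, hj', he, hh⟩⟩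
      · exact hkO h
      · obtain rfl := himg j k hj hj' (by omega) (by omega) he
        rcases hh with ⟨_, h5, h6⟩ | ⟨h5, h6⟩
        · exact hb2 h5 h6
        · exact h5 ⟨hk, hk'⟩
      · exact hkO h
      · obtain rfl := himg j k hj hj' (by omega) (by omega) he
        rcases hh with ⟨h5, _, h6⟩ | ⟨h5, h6⟩
        · omega
        · exact hb1 h6
    · subst he
      have hkO := hgO k (by omega) (by omega)
      rcases hv with ⟨-, ⟨h, -⟩ | ⟨j, hj, hj', he, hh⟩⟩ | ⟨-, ⟨h, -⟩ | ⟨j, hj, hj', he, hh⟩⟩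
      · exact hkO h
      · obtain rfl := himg j k hj hj' (by omega) (by omega) he
        rcases hh with ⟨h5, h7, h6⟩ | ⟨h5, h6⟩
        · omega
        · exact hb1 h6
      · exact hkO h
      · obtain rfl := himg j k hj hj' (by omega) (by omega) he
        rcases hh with ⟨_, h5, h6⟩ | ⟨h5, h6⟩
        · exact hb2 h5 h6
        · exact h5 ⟨by omega, hk'⟩
    · rcases hv with ⟨-, ⟨_, h6⟩ | ⟨j, hj, hj', he, hh⟩⟩ | ⟨-, ⟨_, h6⟩ | ⟨j, hj, hj', he, hh⟩⟩
      · exact hb1 h6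
      · exact hgO j hj hj' (he ▸ h)
      · exact hb2 h6
      · exact hgO j hj hj' (he ▸ h)
  · rw [Finset.disjoint_left]
    intro v hv hv'
    simp only [Finset.mem_filter] at hv hv'
    rcases hv.2 with ⟨h, h4⟩ | ⟨k, hk, hk', he, hh⟩
    · rcases hv'.2 with ⟨h', h4'⟩ | ⟨j, hj, hj', he', hh'⟩
      · exact h3 v h ⟨h4, h4'⟩
      · exact hgO j hj hj' (he' ▸ h)
    · rcases hv'.2 with ⟨h', h4'⟩ | ⟨j, hj, hj', he', hh'⟩
      · exact hgO k hk hk' (he ▸ h')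
      · obtain rfl := himg j k hj hj' (by omega) (by omega) (he'.trans he.symm)
        rcases hh with ⟨h5, h7, h6⟩ | ⟨h5, h6⟩ <;> rcases hh' with ⟨h5', h7', h6'⟩ | ⟨h5', h6'⟩
        · omega
        · exact h1 j hj h7 ⟨h6', h6⟩
        · exact h2 j (by omega) h7' ⟨h6, h6'⟩
        · omega

variable [Fintype V] in
/-- The vertices of the cycle `f` whose two cycle neighbours lie in `A`. -/
def sing (f : ℤ → V) (A : Finset V) : Finset V :=
  Finset.univ.filter fun v => ∃ i, f i = v ∧ f (i - 1) ∈ A ∧ f (i + 1) ∈ A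

variable [Fintype V] in
/-- A longest cycle `f` with a set `H` of vertices off it, attached to the cycle at `A`; the other
vertices off the cycle form `O`. Links replacing the cycle cannot miss at most one vertex. -/
structure Dn (G : SimpleGraph V) (c : ℤ) (f : ℤ → V) (A O H : Finset V) : Prop where
  cyc : Cyc G c f
  cover : ∀ v, (∃ i, f i = v) ∨ v ∈ O ∨ v ∈ H
  fO : ∀ i, f i ∉ O
  fH : ∀ i, f i ∉ H
  OH : Disjoint O H
  A_sub : ∀ v ∈ A, ∃ i, f i = v
  HN : ∀ h ∈ H, ∀ v, G.Adj h v → v ∈ A ∨ v ∈ H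
  kill : ∀ Q s t w, Pth G Q s t → s ∈ A → t ∈ A → s ≠ t → (∀ h ∈ Q, h ∉ H) →
    (∀ i, f i ∈ Q ∨ (f i = w ∧ f i ∉ A ∧ ¬ (f (i - 1) ∈ A ∧ f (i + 1) ∈ A))) → False
  deg_le : ∀ z z', z ∉ A → z' ∉ A → z ∉ H → z' ∉ H → z ∉ sing f A → z' ∉ sing f A → z ≠ z' →
    ¬ G.Adj z z' →
    c + O.card + 1 + (sing f A).card ≤ deg G z + deg G z' + A.card

/-- Positions `i < j` of consecutive vertices of `A`, at distance at least three. -/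
structure Gap (f : ℤ → V) (A : Finset V) (i j : ℤ) : Prop where
  left : f i ∈ A
  right : f j ∈ A
  len : i + 3 ≤ j
  not_mem : ∀ k, i < k → k < j → f k ∉ A

/-- Two gaps in cyclic order. -/
structure Pr (f : ℤ → V) (c : ℤ) (A : Finset V) (i0 i1 j0 j1 : ℤ) : Prop where
  gi : Gap f A i0 i1
  gj : Gap f A j0 j1
  ij : i1 ≤ j0
  ji : j1 ≤ i0 + c

theorem Cyc.congr_shift {G : SimpleGraph V} {c : ℤ} {f : ℤ → V} (h : Cyc G c f) {i j : ℤ}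
    (he : f i = f j) (k : ℤ) : f (i + k) = f (j + k) := by
  rw [h.eq_iff] at he ⊢
  simpa using he

namespace Gap

variable {G : SimpleGraph V} {c : ℤ} {f : ℤ → V} {A : Finset V} {i0 i1 : ℤ}

theorem not_sing [Fintype V] (h : Gap f A i0 i1) (hf : Cyc G c f) {p : ℤ} (h1 : i0 < p)
    (h2 : p < i1) : f p ∉ sing f A := by
  intro hs
  obtain ⟨m, hm, h3, h4⟩ := (Finset.mem_filter.1 hs).2
  rw [show m - 1 = m + -1 by ring, hf.congr_shift hm] at h3
  rw [hf.congr_shift hm] at h4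
  have := h.len
  by_cases h5 : p + 1 < i1
  · exact h.not_mem _ (by omega) h5 h4
  · exact h.not_mem _ (by omega) (by omega) h3

theorem mirror (h : Gap f A i0 i1) : Gap (fun k => f (-k)) A (-i1) (-i0) where
  left := by simpa using h.right
  right := by simpa using h.left
  len := by linarith [h.len]
  not_mem k hk hk' := h.not_mem (-k) (by omega) (by omega)

theorem add (hf : Cyc G c f) (h : Gap f A i0 i1) : Gap f A (i0 + c) (i1 + c) where
  left := by rw [hf.per]; exact h.left
  right := by rw [hf.per]; exact h.right
  len := by linarith [h.len]
  not_mem k hk hk' := by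
    have := h.not_mem (k - c) (by omega) (by omega)
    rwa [← hf.per, sub_add_cancel] at this

theorem sub (hf : Cyc G c f) (h : Gap f A i0 i1) : Gap f A (i0 - c) (i1 - c) where
  left := by rw [← hf.per, sub_add_cancel]; exact h.left
  right := by rw [← hf.per, sub_add_cancel]; exact h.right
  len := by linarith [h.len]
  not_mem k hk hk' := by rw [← hf.per]; exact h.not_mem (k + c) (by omega) (by omega)

end Gap

namespace Pr

variable {G : SimpleGraph V} {c : ℤ} {f : ℤ → V} {A : Finset V} {i0 i1 j0 j1 : ℤ}

theorem mirror (h : Pr f c A i0 i1 j0 j1) :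
    Pr (fun k => f (-k)) c A (-j1) (-j0) (-i1) (-i0) where
  gi := h.gj.mirror
  gj := h.gi.mirror
  ij := by linarith [h.ij]
  ji := by linarith [h.ji]

theorem swap (hf : Cyc G c f) (h : Pr f c A i0 i1 j0 j1) : Pr f c A j0 j1 (i0 + c) (i1 + c) where
  gi := h.gj
  gj := h.gi.add hf
  ij := h.ji
  ji := by linarith [h.ij]

theorem mirror' (hf : Cyc G c f) (h : Pr f c A i0 i1 j0 j1) :
    Pr (fun k => f (-k)) c A (-i1) (-i0) (-j1 + c) (-j0 + c) :=
  h.mirror.swap hf.mirror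

end Pr

namespace Dn

variable [Fintype V] {G : SimpleGraph V} {c : ℤ} {f : ℤ → V} {A O H : Finset V}
  {i0 i1 j0 j1 : ℤ}

theorem mirror (h : Dn G c f A O H) : Dn G c (fun k => f (-k)) A O H where
  cyc := h.cyc.mirror
  cover v := by
    rcases h.cover v with ⟨i, hi⟩ | h
    · exact .inl ⟨-i, by simpa using hi⟩
    · exact .inr h
  fO i := h.fO _
  fH i := h.fH _
  OH := h.OH
  A_sub v hv := by
    obtain ⟨i, hi⟩ := h.A_sub v hv
    exact ⟨-i, by simpa using hi⟩
  HN := h.HN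
  kill Q s t w h1 h2 h3 h4 h5 h6 := by
    refine h.kill Q s t w h1 h2 h3 h4 h5 fun i => ?_
    have := h6 (-i)
    simp only [neg_neg] at this
    rw [show -(-i - 1) = i + 1 by ring, show -(-i + 1) = i - 1 by ring] at this
    tauto
  deg_le z z' h1 h2 h3 h4 hs hs' h5 h6 := by
    have he : sing (fun k => f (-k)) A = sing f A := by
      ext v
      simp only [sing, Finset.mem_filter, Finset.mem_univ, true_and]
      constructor
      · rintro ⟨i, hi, hi1, hi2⟩
        refine ⟨-i, hi, ?_, ?_⟩
        · rwa [show -i - 1 = -(i + 1) by ring]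
        · rwa [show -i + 1 = -(i - 1) by ring]
      · rintro ⟨i, hi, hi1, hi2⟩
        refine ⟨-i, by simpa using hi, ?_, ?_⟩
        · rwa [show -(-i - 1) = i + 1 by ring]
        · rwa [show -(-i + 1) = i - 1 by ring]
    rw [he] at hs hs' ⊢
    exact h.deg_le z z' h1 h2 h3 h4 hs hs' h5 h6

theorem kill_ip (h : Dn G c f A O H) {lo : ℤ} {S : ℤ → Prop} {s t : V} (k0 : ℤ)
    (hQ : IP G f lo c O S s t) (hs : s ∈ A) (ht : t ∈ A) (hst : s ≠ t)
    (hS : ∀ k, lo ≤ k → k < lo + c →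
      S k ∨ (k = k0 ∧ f k ∉ A ∧ ¬ (f (k - 1) ∈ A ∧ f (k + 1) ∈ A))) : False := by
  obtain ⟨Q, h1, h2, h3⟩ := hQ
  refine h.kill Q s t (f k0) h1 hs ht hst (fun v hv hvH => ?_) fun i => ?_
  · rcases h3 v hv with ⟨k, rfl⟩ | hO
    · exact h.fH k hvH
    · exact Finset.disjoint_left.1 h.OH hO hvH
  · obtain ⟨j, hj, hj', he⟩ := h.cyc.exists_rep i lo
    rcases hS j hj hj' with hSj | ⟨rfl, ha, hb⟩
    · exact .inl (he ▸ (h2 j hj hj').2 hSj)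
    · refine .inr ⟨he.symm, he ▸ ha, ?_⟩
      rwa [show i - 1 = i + -1 by ring, h.cyc.congr_shift he.symm, h.cyc.congr_shift he.symm]

theorem not_consec (h : Dn G c f A O H) {i : ℤ} (hi : f i ∈ A) : f (i + 1) ∉ A := by
  intro hi1
  have hc := h.cyc.three_le
  refine h.kill_ip 0 ((IP.seg h.cyc (lo := i + 1) (a := i + 1) (b := i + c) le_rfl (by omega)
    (by omega)).mono (by simp)) hi1 (by rwa [h.cyc.per]) ?_ fun k hk hk' => .inl ⟨hk, by omega⟩
  rw [h.cyc.per]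
  exact (h.cyc.adj i).ne'

variable {S : ℤ → Prop} {s t : V}

theorem gap_aux (_h : Dn G c f A O H) (hg : Gap f A i0 i1) {k : ℤ} (h1 : i0 < k) (h2 : k < i1) :
    f k ∉ A ∧ ¬ (f (k - 1) ∈ A ∧ f (k + 1) ∈ A) := by
  refine ⟨hg.not_mem k h1 h2, ?_⟩
  rintro ⟨ha, hb⟩
  have h3 : ¬ (i0 < k - 1) := fun h => hg.not_mem _ h (by omega) ha
  have h4 : ¬ (k + 1 < i1) := fun h => hg.not_mem _ (by omega) h hb
  have := hg.len
  omega

theorem hOne (h : Dn G c f A O H) : ∀ x ∈ (O : Set V), ∀ k, f k ≠ x := by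
  rintro x hx k rfl
  exact h.fO k hx

/-- The interior positions of the two gaps. -/
def inG (i0 i1 j0 j1 k : ℤ) : Prop := (i0 < k ∧ k < i1) ∨ (j0 < k ∧ k < j1)

theorem kill_R (h : Dn G c f A O H) (p : Pr f c A i0 i1 j0 j1) (k0 : ℤ)
    (hQ : IP G f (i0 + 1) c O S s t) (hS : ∀ k, i0 < k → k ≤ i0 + c → S k → inG i0 i1 j0 j1 k)
    (hc : ∀ k, inG i0 i1 j0 j1 k → S k ∨ k = k0)
    (hs : G.Adj (f i1) s) (ht : G.Adj t (f j1)) : False := by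
  obtain ⟨gi, gj, ij, ji⟩ := p
  have hi := gi.len
  have hj := gj.len
  unfold inG at hS hc
  have h1 := IP.seg h.cyc (lo := i0 + 1) (a := i1) (b := j0) (by omega) (by omega) (by omega)
  have h2 := IP.seg h.cyc (lo := i0 + 1) (a := j1) (b := i0 + c) (by omega) (by omega) (by omega)
  have h3 := h1.symm.appendO h.cyc hQ hs fun k hk hk' a b => by
    have := hS k (by omega) (by omega) b
    omega
  have h4 := h2.symm.appendO h.cyc h3.symm ht.symm fun k hk hk' a b => by
    rcases b with b | b
    · omega
    · have := hS k (by omega) (by omega) b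
      omega
  refine h.kill_ip k0 h4 (by rw [h.cyc.per]; exact gi.left) gj.left
    (h.cyc.ne (by omega) (by omega)).symm fun k hk hk' => ?_
  by_cases h5 : (i0 < k ∧ k < i1) ∨ (j0 < k ∧ k < j1)
  · rcases hc k h5 with h6 | h6
    · exact .inl (.inr (.inr h6))
    · exact .inr ⟨h6, h5.elim (fun h' => h.gap_aux gi h'.1 h'.2) fun h' => h.gap_aux gj h'.1 h'.2⟩
  · left; omega

theorem kill_X (h : Dn G c f A O H) (p : Pr f c A i0 i1 j0 j1) (k0 : ℤ)
    (hQ : IP G f (i0 + 1) c O S s t) (hS : ∀ k, i0 < k → k ≤ i0 + c → S k → inG i0 i1 j0 j1 k)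
    (hc : ∀ k, inG i0 i1 j0 j1 k → S k ∨ k = k0)
    (hs : G.Adj (f i0) s) (ht : G.Adj t (f i1)) : False := by
  obtain ⟨gi, gj, ij, ji⟩ := p
  have hi := gi.len
  have hj := gj.len
  unfold inG at hS hc
  have h1 := IP.seg h.cyc (lo := i0 + 1) (a := i1) (b := j0) (by omega) (by omega) (by omega)
  have h2 := IP.seg h.cyc (lo := i0 + 1) (a := j1) (b := i0 + c) (by omega) (by omega) (by omega)
  have h3 := h1.symm.appendO h.cyc hQ.symm ht.symm fun k hk hk' a b => by
    have := hS k (by omega) (by omega) b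
    omega
  have h4 := h2.appendO h.cyc h3.symm (by rw [h.cyc.per]; exact hs) fun k hk hk' a b => by
    rcases b with b | b
    · omega
    · have := hS k (by omega) (by omega) b
      omega
  refine h.kill_ip k0 h4 gj.right gj.left
    (h.cyc.ne (by omega) (by omega)).symm fun k hk hk' => ?_
  by_cases h5 : (i0 < k ∧ k < i1) ∨ (j0 < k ∧ k < j1)
  · rcases hc k h5 with h6 | h6
    · exact .inl (.inr (.inr h6))
    · exact .inr ⟨h6, h5.elim (fun h' => h.gap_aux gi h'.1 h'.2) fun h' => h.gap_aux gj h'.1 h'.2⟩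
  · left; omega

theorem kill_Y (h : Dn G c f A O H) (p : Pr f c A i0 i1 j0 j1) (k0 : ℤ)
    (hQ : IP G f (i0 + 1) c O S s t) (hS : ∀ k, i0 < k → k ≤ i0 + c → S k → inG i0 i1 j0 j1 k)
    (hc : ∀ k, inG i0 i1 j0 j1 k → S k ∨ k = k0)
    (hs : G.Adj (f j0) s) (ht : G.Adj t (f j1)) : False := by
  obtain ⟨gi, gj, ij, ji⟩ := p
  have hi := gi.len
  have hj := gj.len
  unfold inG at hS hc
  have h1 := IP.seg h.cyc (lo := i0 + 1) (a := i1) (b := j0) (by omega) (by omega) (by omega)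
  have h2 := IP.seg h.cyc (lo := i0 + 1) (a := j1) (b := i0 + c) (by omega) (by omega) (by omega)
  have h3 := h1.appendO h.cyc hQ hs fun k hk hk' a b => by
    have := hS k (by omega) (by omega) b
    omega
  have h4 := h2.symm.appendO h.cyc h3.symm ht.symm fun k hk hk' a b => by
    rcases b with b | b
    · omega
    · have := hS k (by omega) (by omega) b
      omega
  refine h.kill_ip k0 h4 (by rw [h.cyc.per]; exact gi.left) gi.right
    (by rw [h.cyc.per]; exact h.cyc.ne (by omega) (by omega)) fun k hk hk' => ?_
  by_cases h5 : (i0 < k ∧ k < i1) ∨ (j0 < k ∧ k < j1)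
  · rcases hc k h5 with h6 | h6
    · exact .inl (.inr (.inr h6))
    · exact .inr ⟨h6, h5.elim (fun h' => h.gap_aux gi h'.1 h'.2) fun h' => h.gap_aux gj h'.1 h'.2⟩
  · left; omega

end Dn

/-- The successor along the cycle `f`. -/
def nxt (f : ℤ → V) (v : V) : V := if h : ∃ i, f i = v then f (h.choose + 1) else v

theorem nxt_apply {G : SimpleGraph V} {c : ℤ} {f : ℤ → V} (h : Cyc G c f) (i : ℤ) :
    nxt f (f i) = f (i + 1) := by
  have hi : ∃ j, f j = f i := ⟨i, rfl⟩
  rw [nxt, dif_pos hi]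
  exact h.congr_shift hi.choose_spec 1

/-- `p` is the first vertex of a Hamiltonian path of the gap `(i0, i1)` ending next to `f i1`. -/
structure RH (G : SimpleGraph V) (f : ℤ → V) (i0 i1 p : ℤ) : Prop where
  lt : i0 < p
  gt : p < i1
  adj : G.Adj (f (i0 + 1)) (f (p + 1))

namespace RH

variable {G : SimpleGraph V} {c : ℤ} {f : ℤ → V} {i0 i1 p lo : ℤ}

theorem path (hf : Cyc G c f) (h : RH G f i0 i1 p) (hlo : lo ≤ i0 + 1) (hi1 : i1 ≤ lo + c) :
    ∃ t, IP G f lo c ∅ (fun k => i0 < k ∧ k < i1) (f p) t ∧ G.Adj t (f i1) := by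
  obtain ⟨h1, h2, h3⟩ := h
  have ha := IP.seg hf (lo := lo) (a := i0 + 1) (b := p) (by omega) (by omega) (by omega)
  by_cases hp : p + 1 = i1
  · exact ⟨_, ha.symm.congr fun k _ _ => by omega, by rwa [hp] at h3⟩
  · have hb := IP.seg hf (lo := lo) (a := p + 1) (b := i1 - 1) (by omega) (by omega) (by omega)
    refine ⟨_, (IP.append hf ha.symm hb h3 fun k _ _ => by omega).congr fun k _ _ => by omega, ?_⟩
    have := hf.adj (i1 - 1)
    rwa [sub_add_cancel] at this

theorem base (hf : Cyc G c f) (h : i0 + 1 < i1) : RH G f i0 i1 (i0 + 1) :=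
  ⟨by omega, h, hf.adj _⟩

theorem add (hf : Cyc G c f) (h : RH G f i0 i1 p) : RH G f (i0 + c) (i1 + c) (p + c) where
  lt := by linarith [h.lt]
  gt := by linarith [h.gt]
  adj := by
    rw [show i0 + c + 1 = i0 + 1 + c by ring, show p + c + 1 = p + 1 + c by ring, hf.per, hf.per]
    exact h.adj

end RH

theorem exists_next {P : ℤ → Prop} {a b : ℤ} (hab : a ≤ b) (hb : P b) :
    ∃ k, a ≤ k ∧ k ≤ b ∧ P k ∧ ∀ j, a ≤ j → j < k → ¬ P j := by
  obtain ⟨n, rfl⟩ : ∃ n : ℕ, b = a + n := ⟨(b - a).toNat, by omega⟩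
  have h : ∃ n : ℕ, P (a + n) := ⟨n, hb⟩
  refine ⟨a + Nat.find h, by omega, ?_, Nat.find_spec h, fun j hj hj' hP => ?_⟩
  · have := Nat.find_min' h hb
    omega
  · refine Nat.find_min h (m := (j - a).toNat) (by omega) ?_
    rwa [show a + ((j - a).toNat : ℤ) = j by omega]

namespace Dn

variable [Fintype V] {G : SimpleGraph V} {c : ℤ} {f : ℤ → V} {A O H : Finset V}
  {i0 i1 j0 j1 p p' : ℤ}

theorem not_conn_heads (h : Dn G c f A O H) (pr : Pr f c A i0 i1 j0 j1) (hp : RH G f i0 i1 p)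
    (hp' : RH G f j0 j1 p') : ¬ Cn G O (f p) (f p') := by
  intro hc
  have := pr.ij
  have := pr.ji
  have := pr.gi.len
  have := pr.gj.len
  obtain ⟨t, ht, ht'⟩ := hp.path h.cyc (lo := i0 + 1) (by omega) (by omega)
  obtain ⟨s, hs, hs'⟩ := hp'.path h.cyc (lo := i0 + 1) (by omega) (by omega)
  refine h.kill_R pr 0 (ht.symm.join h.cyc hs h.hOne hc fun k _ _ => by omega)
    (fun k hk hk' hS => hS) (fun k hk => .inl hk) ht'.symm hs'

theorem not_adj_second (h : Dn G c f A O H) (pr : Pr f c A i0 i1 j0 j1) (hp : RH G f i0 i1 p) :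
    ¬ G.Adj (f p) (f (j0 + 2)) := by
  intro hc
  have := pr.ij
  have := pr.ji
  have := pr.gi.len
  have := pr.gj.len
  obtain ⟨t, ht, ht'⟩ := hp.path h.cyc (lo := i0 + 1) (by omega) (by omega)
  have hs := IP.seg h.cyc (lo := i0 + 1) (a := j0 + 2) (b := j1 - 1) (by omega) (by omega)
    (by omega)
  refine h.kill_R pr (j0 + 1) (ht.symm.join h.cyc hs h.hOne (.inl hc) fun k _ _ => by omega)
    (fun k hk hk' hS => by unfold inG; omega) (fun k hk => by unfold inG at hk; omega) ht'.symm ?_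
  have := h.cyc.adj (j1 - 1)
  rwa [sub_add_cancel] at this

theorem not_adj_next (h : Dn G c f A O H) (gi : Gap f A i0 i1) (hi : i1 < i0 + c)
    (hp : RH G f i0 i1 p) : ¬ G.Adj (f p) (f (i1 + 1)) := by
  intro hc
  have := gi.len
  obtain ⟨t, ht, ht'⟩ := hp.path h.cyc (lo := i0 + 1) (by omega) (by omega)
  have h1 := IP.seg h.cyc (lo := i0 + 1) (a := i1) (b := i1) (by omega) (by omega) (by omega)
  have h2 := IP.seg h.cyc (lo := i0 + 1) (a := i1 + 1) (b := i0 + c) (by omega) (by omega)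
    (by omega)
  have h3 := (h1.append h.cyc ht.symm ht'.symm fun k _ _ => by omega).append h.cyc h2 hc
    fun k _ _ => by omega
  refine h.kill_ip 0 (h3.mono (by simp)) gi.right (by rw [h.cyc.per]; exact gi.left)
    (h.cyc.ne (by omega) (by omega)) fun k _ _ => .inl ?_
  omega

/-- The `nxt`-images of `A` not in `sing`, other than the two given ones. -/
theorem card_firsts (h : Dn G c f A O H) :
    A.card ≤ ((A.image (nxt f) \ sing f A) \ {f (i0 + 1), f (j0 + 1)}).card + (sing f A).card
      + 2 := by
  have h1 : (A.image (nxt f)).card = A.card := by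
    apply Finset.card_image_of_injOn
    intro v hv w hw he
    obtain ⟨i, rfl⟩ := h.A_sub v hv
    obtain ⟨j, rfl⟩ := h.A_sub w hw
    rw [nxt_apply h.cyc, nxt_apply h.cyc] at he
    have := h.cyc.congr_shift he (-1)
    simpa using this
  have h2 := Finset.le_card_sdiff (sing f A) (A.image (nxt f))
  have h3 := Finset.le_card_sdiff {f (i0 + 1), f (j0 + 1)} (A.image (nxt f) \ sing f A)
  have h4 : ({f (i0 + 1), f (j0 + 1)} : Finset V).card ≤ 2 := Finset.card_le_two
  omega

/-- The successor of `k` in the order `p, p - 1, …, a + 1, p + 1, p + 2, …`. -/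
def rot (a p k : ℤ) : ℤ := if k ≤ p then (if k = a + 1 then p + 1 else k - 1) else k + 1

/-- Vertices that are unlabelled with respect to the pair of heads `f p`, `f p'`. -/
def Item (G : SimpleGraph V) (f : ℤ → V) (O : Finset V) (i0 i1 j0 j1 p p' : ℤ) (v : V) : Prop :=
  (∃ k, i0 < k ∧ k < i1 ∧ f k = v ∧ ¬ G.Adj (f p') (f k) ∧ ¬ G.Adj (f p) (f (rot i0 p k))) ∨
  (∃ k, j0 < k ∧ k < j1 ∧ f k = v ∧ ¬ G.Adj (f p) (f k) ∧ ¬ G.Adj (f p') (f (rot j0 p' k))) ∨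
  (f i1 = v ∧ ¬ G.Adj (f p') (f i1)) ∨ (f j1 = v ∧ ¬ G.Adj (f p) (f j1)) ∨
  (v ∈ O ∧ ¬ G.Adj (f p) v ∧ ¬ G.Adj (f p') v)

theorem item_unique (h : Dn G c f A O H) (pr : Pr f c A i0 i1 j0 j1) (hp : RH G f i0 i1 p)
    (hp' : RH G f j0 j1 p') {v w : V} (hv : Item G f O i0 i1 j0 j1 p p' v)
    (hw : Item G f O i0 i1 j0 j1 p p' w) : v = w := by
  by_contra hvw
  have hnc := h.not_conn_heads pr hp hp'
  obtain ⟨gi, gj, ij, ji⟩ := id pr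
  have li := gi.len
  have lj := gj.len
  have hp1 := hp.lt
  have hp2 := hp.gt
  have hp1' := hp'.lt
  have hp2' := hp'.gt
  set σ : ℤ → ℤ := fun k => if k ≤ p then i0 + 1 + p - k else
    if j0 < k ∧ k ≤ p' then j0 + 1 + p' - k else k with hσ
  have σ1 : ∀ k, k ≤ p → σ k = i0 + 1 + p - k := fun k hk => by simp only [hσ]; rw [if_pos hk]
  have σ2 : ∀ k, j0 < k → k ≤ p' → σ k = j0 + 1 + p' - k := fun k hk hk' => by
    simp only [hσ]; rw [if_neg (by omega), if_pos ⟨hk, hk'⟩]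
  have σ3 : ∀ k, p < k → k ≤ j0 → σ k = k := fun k hk hk' => by
    simp only [hσ]; rw [if_neg (by omega), if_neg (by omega)]
  have σ4 : ∀ k, p' < k → σ k = k := fun k hk => by
    simp only [hσ]; rw [if_neg (by omega), if_neg (by omega)]
  have σc : ∀ k, (k ≤ p ∧ σ k = i0 + 1 + p - k) ∨ (p < k ∧ k ≤ j0 ∧ σ k = k) ∨
      (j0 < k ∧ k ≤ p' ∧ σ k = j0 + 1 + p' - k) ∨ (p' < k ∧ σ k = k) := by
    intro k
    rcases le_or_gt k p with h1 | h1
    · exact .inl ⟨h1, σ1 k h1⟩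
    rcases le_or_gt k j0 with h2 | h2
    · exact .inr (.inl ⟨h1, h2, σ3 k h1 h2⟩)
    rcases le_or_gt k p' with h3 | h3
    · exact .inr (.inr (.inl ⟨h2, h3, σ2 k h2 h3⟩))
    · exact .inr (.inr (.inr ⟨h3, σ4 k h3⟩))
  have σw : ∀ k, i0 < k → k ≤ i0 + c → i0 < σ k ∧ σ k ≤ i0 + c ∧ σ (σ k) = k := by
    intro k hk hk'
    have h1 := σc k
    have h2 := σc (σ k)
    omega
  set g : ℤ → V := fun k => f (σ k) with hg
  have ginj : ∀ i j, i0 + 1 ≤ i → i < j → j ≤ i0 + c → g i ≠ g j := by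
    intro i j h1 h2 h3 he
    have hi := σw i (by omega) (by omega)
    have hj := σw j (by omega) (by omega)
    have := h.cyc.eq_of he (by omega) (by omega)
    rw [this] at hi
    omega
  have gsurj : ∀ i, ∃ k, i0 + 1 ≤ k ∧ k ≤ i0 + c ∧ g k = f i := by
    intro i
    obtain ⟨j, hj, hj', he⟩ := h.cyc.exists_rep i (i0 + 1)
    have := σw j (by omega) (by omega)
    refine ⟨σ j, by omega, by omega, ?_⟩
    simp only [hg]
    rw [this.2.2, he]
  have gadj : ∀ k, i0 < k → k < i0 + c → k ≠ j0 → G.Adj (g k) (g (k + 1)) := by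
    intro k h1 h2 h3
    simp only [hg]
    rcases σc k with ⟨h4, h5⟩ | ⟨h4, h4', h5⟩ | ⟨h4, h4', h5⟩ | ⟨h4, h5⟩
    · rcases eq_or_lt_of_le h4 with rfl | h6
      · rw [h5, σ3 _ (by omega) (by omega), show i0 + 1 + k - k = i0 + 1 by ring]
        exact hp.adj
      · rw [h5, σ1 _ (by omega)]
        have := (h.cyc.adj (i0 + 1 + p - (k + 1))).symm
        rwa [show i0 + 1 + p - (k + 1) + 1 = i0 + 1 + p - k by ring] at this
    · rw [h5, σ3 _ (by omega) (by omega)]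
      exact h.cyc.adj k
    · rcases eq_or_lt_of_le h4' with rfl | h6
      · rw [h5, σ4 _ (by omega), show j0 + 1 + k - k = j0 + 1 by ring]
        exact hp'.adj
      · rw [h5, σ2 _ (by omega) (by omega)]
        have := (h.cyc.adj (j0 + 1 + p' - (k + 1))).symm
        rwa [show j0 + 1 + p' - (k + 1) + 1 = j0 + 1 + p' - k by ring] at this
    · rw [h5, σ4 _ (by omega)]
      exact h.cyc.adj k
  have gp : g (i0 + 1) = f p := by
    simp only [hg]; rw [σ1 _ (by omega)]; congr 1; ring
  have gp' : g (j0 + 1) = f p' := by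
    simp only [hg]; rw [σ2 _ (by omega) (by omega)]; congr 1; ring
  have gpath : ∀ x y, i0 < x → x ≤ y → y ≤ i0 + c → (y ≤ j0 ∨ j0 < x) →
      Pth G (seg g x y) (g x) (g y) := by
    intro x y h1 h2 h3 h4
    exact pth_seg h2 (fun i h5 h6 => gadj i (by omega) (by omega) (by omega))
      (fun i j h5 h6 h7 => ginj i j (by omega) h6 (by omega))
  have gdisj : ∀ x y x' y', i0 < x → y < x' → y' ≤ i0 + c → Disjoint (seg g x y) (seg g x' y') := by
    intro x y x' y' h1 h2 h3
    rw [Finset.disjoint_left]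
    intro v hv hv'
    obtain ⟨i, hi, hi', rfl⟩ := mem_seg.1 hv
    obtain ⟨j, hj, hj', he⟩ := mem_seg.1 hv'
    exact ginj i j (by omega) (by omega) (by omega) he.symm
  have gend : g j0 = f j0 := by simp only [hg]; rw [σ3 _ (by omega) le_rfl]
  have gend' : g (i0 + c) = f i0 := by
    simp only [hg]; rw [σ4 _ (by omega), h.cyc.per]
  have hne : f j0 ≠ f i0 := (h.cyc.ne (by omega) (by omega)).symm
  have segH : ∀ x y, ∀ v ∈ seg g x y, v ∉ H := by
    intro x y v hv
    obtain ⟨i, -, -, rfl⟩ := mem_seg.1 hv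
    exact h.fH _
  -- exclusion of crossing pairs
  have h1 : ∀ k, i0 + 1 ≤ k → k < j0 → ¬ (G.Adj (f p') (g k) ∧ G.Adj (f p) (g (k + 1))) := by
    rintro k hk hk' ⟨ha, hb⟩
    have q1 := gpath (i0 + 1) k (by omega) (by omega) (by omega) (by omega)
    have q2 := gpath (k + 1) j0 (by omega) (by omega) (by omega) (by omega)
    have q3 := gpath (j0 + 1) (i0 + c) (by omega) (by omega) (by omega) (by omega)
    rw [gp] at q1
    rw [gp'] at q3
    have q4 := q2.symm.append q1 hb.symm (gdisj _ _ _ _ (by omega) (by omega) (by omega)).symm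
    have q5 := q4.append q3 ha.symm (by
      rw [Finset.disjoint_union_left]
      exact ⟨gdisj _ _ _ _ (by omega) (by omega) (by omega),
        gdisj _ _ _ _ (by omega) (by omega) (by omega)⟩)
    rw [gend, gend'] at q5
    refine h.kill _ _ _ (f 0) q5 gj.left gi.left hne (fun v hv => ?_) fun i => .inl ?_
    · rcases Finset.mem_union.1 hv with hv | hv
      · rcases Finset.mem_union.1 hv with hv | hv <;> exact segH _ _ v hv
      · exact segH _ _ v hv
    · obtain ⟨j, hj, hj', he⟩ := gsurj i
      rw [← he]
      simp only [Finset.mem_union]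
      by_cases h5 : j ≤ k
      · exact .inl (.inr (mem_seg_of hj h5))
      by_cases h6 : j ≤ j0
      · exact .inl (.inl (mem_seg_of (by omega) h6))
      · exact .inr (mem_seg_of (by omega) hj')
  have h2 : ∀ k, j0 < k → k < i0 + c → ¬ (G.Adj (f p) (g k) ∧ G.Adj (f p') (g (k + 1))) := by
    rintro k hk hk' ⟨ha, hb⟩
    have q1 := gpath (j0 + 1) k (by omega) (by omega) (by omega) (by omega)
    have q2 := gpath (k + 1) (i0 + c) (by omega) (by omega) (by omega) (by omega)
    have q3 := gpath (i0 + 1) j0 (by omega) (by omega) (by omega) (by omega)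
    rw [gp'] at q1
    rw [gp] at q3
    have q4 := q2.symm.append q1 hb.symm (gdisj _ _ _ _ (by omega) (by omega) (by omega)).symm
    have q5 := q4.append q3 ha.symm (by
      rw [Finset.disjoint_union_left]
      exact ⟨(gdisj _ _ _ _ (by omega) (by omega) (by omega)).symm,
        (gdisj _ _ _ _ (by omega) (by omega) (by omega)).symm⟩)
    rw [gend, gend'] at q5
    refine h.kill _ _ _ (f 0) q5 gi.left gj.left hne.symm (fun v hv => ?_) fun i => .inl ?_
    · rcases Finset.mem_union.1 hv with hv | hv
      · rcases Finset.mem_union.1 hv with hv | hv <;> exact segH _ _ v hv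
      · exact segH _ _ v hv
    · obtain ⟨j, hj, hj', he⟩ := gsurj i
      rw [← he]
      simp only [Finset.mem_union]
      by_cases h5 : j ≤ j0
      · exact .inr (mem_seg_of hj h5)
      by_cases h6 : j ≤ k
      · exact .inl (.inr (mem_seg_of (by omega) h6))
      · exact .inl (.inl (mem_seg_of (by omega) hj'))
  have hN : ∀ q, f q ∉ A → ∀ v, G.Adj (f q) v → v ∈ O ∨ ∃ k, i0 + 1 ≤ k ∧ k ≤ i0 + c ∧ g k = v := by
    intro q hq v hqv
    rcases h.cover v with ⟨i, rfl⟩ | hO | hH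
    · exact .inr (gsurj i)
    · exact .inl hO
    · rcases h.HN v hH _ hqv.symm with h3 | h3
      · exact absurd h3 hq
      · exact absurd h3 (h.fH q)
  have hpA : f p ∉ A := gi.not_mem p hp1 hp2
  have hpA' : f p' ∉ A := gj.not_mem p' hp1' hp2'
  have hFA : ∀ v ∈ A.image (nxt f), v ∉ A := by
    intro v hv
    obtain ⟨a, ha, rfl⟩ := Finset.mem_image.1 hv
    obtain ⟨i, rfl⟩ := h.A_sub a ha
    rw [nxt_apply h.cyc]
    exact h.not_consec ha
  have hItemF : ∀ v, Item G f O i0 i1 j0 j1 p p' v →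
      v ∉ (A.image (nxt f) \ sing f A) \ {f (i0 + 1), f (j0 + 1)} := by
    intro v hv hvF
    simp only [Finset.mem_sdiff, Finset.mem_insert, Finset.mem_singleton, not_or] at hvF
    obtain ⟨⟨hF, -⟩, hne1, hne2⟩ := hvF
    have hpre : ∀ k, f k = v → f (k - 1) ∈ A := by
      rintro k rfl
      obtain ⟨a, ha, he⟩ := Finset.mem_image.1 hF
      obtain ⟨i, rfl⟩ := h.A_sub a ha
      rw [nxt_apply h.cyc] at he
      have := h.cyc.congr_shift he (-1)
      simp only [add_neg_cancel_right] at this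
      rw [this] at ha
      exact ha
    rcases hv with ⟨k, hk, hk', rfl, -⟩ | ⟨k, hk, hk', rfl, -⟩ | ⟨rfl, -⟩ | ⟨rfl, -⟩ | ⟨hO, -⟩
    · by_cases hk0 : k = i0 + 1
      · exact hne1 (by rw [hk0])
      · exact gi.not_mem (k - 1) (by omega) (by omega) (hpre k rfl)
    · by_cases hk0 : k = j0 + 1
      · exact hne2 (by rw [hk0])
      · exact gj.not_mem (k - 1) (by omega) (by omega) (hpre k rfl)
    · exact hFA _ hF gi.right
    · exact hFA _ hF gj.right
    · obtain ⟨a, ha, he⟩ := Finset.mem_image.1 hF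
      obtain ⟨i, rfl⟩ := h.A_sub a ha
      rw [nxt_apply h.cyc] at he
      exact h.fO _ (he ▸ hO)
  have hcount := label_count (G := G) (g := g) (a := i0 + 1) (b := j0) (e := i0 + c)
    (by omega) (by omega) ginj gp.symm gp'.symm (O := O) (fun k _ _ => h.fO _) (hN p hpA)
    (hN p' hpA') h1 h2 (fun r hr hh => hnc (.of_common hr hh.1 hh.2))
    (insert v (insert w ((A.image (nxt f) \ sing f A) \ {f (i0 + 1), f (j0 + 1)}))) (by
      have hItem : ∀ v, Item G f O i0 i1 j0 j1 p p' v →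
        (∃ k, i0 + 1 ≤ k ∧ k ≤ j0 ∧ g k = v ∧ ¬ G.Adj (f p') (g k) ∧
          (k < j0 → ¬ G.Adj (f p) (g (k + 1)))) ∨
        (∃ k, j0 < k ∧ k ≤ i0 + c ∧ g k = v ∧ ¬ G.Adj (f p) (g k) ∧
          (k < i0 + c → ¬ G.Adj (f p') (g (k + 1)))) ∨
        (v ∈ O ∧ ¬ G.Adj (f p) v ∧ ¬ G.Adj (f p') v) := by
        intro v hv
        rcases hv with ⟨k, hk, hk', rfl, ha, hb⟩ | ⟨k, hk, hk', rfl, ha, hb⟩ | ⟨rfl, ha⟩ |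
          ⟨rfl, ha⟩ | hO
        · have e0 := σc k
          have e1 : g (σ k) = f k := by
            have := σw k (by omega) (by omega)
            simp only [hg]; congr 1; omega
          have e2 : g (σ k + 1) = f (rot i0 p k) := by
            have := σc (σ k + 1)
            simp only [hg, rot]; congr 1
            split_ifs <;> omega
          exact .inl ⟨σ k, by omega, by omega, e1, by rwa [e1], fun _ => by rwa [e2]⟩
        · have e0 := σc k
          have e1 : g (σ k) = f k := by
            have := σw k (by omega) (by omega)
            simp only [hg]; congr 1; omega
          have e2 : g (σ k + 1) = f (rot j0 p' k) := by
            have := σc (σ k + 1)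
            simp only [hg, rot]; congr 1
            split_ifs <;> omega
          exact .inr (.inl ⟨σ k, by omega, by omega, e1, by rwa [e1], fun _ => by rwa [e2]⟩)
        · have e1 : g i1 = f i1 := by
            have := σc i1
            simp only [hg]; congr 1; omega
          refine .inl ⟨i1, by omega, by omega, e1, by rwa [e1], fun hlt => ?_⟩
          have e2 : g (i1 + 1) = f (i1 + 1) := by
            have := σc (i1 + 1)
            simp only [hg]; congr 1; omega
          rw [e2]
          exact h.not_adj_next gi (by omega) hp
        · have e1 : g j1 = f j1 := by
            have := σc j1
            simp only [hg]; congr 1; omega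
          refine .inr (.inl ⟨j1, by omega, by omega, e1, by rwa [e1], fun hlt => ?_⟩)
          have e2 : g (j1 + 1) = f (j1 + 1) := by
            have := σc (j1 + 1)
            simp only [hg]; congr 1; omega
          rw [e2]
          exact h.not_adj_next gj (by omega) hp'
        · exact .inr (.inr hO)
      intro x hx
      rcases Finset.mem_insert.1 hx with rfl | hx
      · exact hItem _ hv
      rcases Finset.mem_insert.1 hx with rfl | hx
      · exact hItem _ hw
      simp only [Finset.mem_sdiff, Finset.mem_insert, Finset.mem_singleton, not_or] at hx
      obtain ⟨⟨hF, hsg⟩, hne1, hne2⟩ := hx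
      obtain ⟨a, ha, rfl⟩ := Finset.mem_image.1 hF
      obtain ⟨i, rfl⟩ := h.A_sub a ha
      obtain ⟨l, hl, hl', he⟩ := h.cyc.exists_rep i i0
      rw [← he] at ha hF hsg hne1 hne2 ⊢
      rw [nxt_apply h.cyc] at hF hsg hne1 hne2 ⊢
      have hl1 : f (l + 1) ∉ A := h.not_consec ha
      have hl2 : f (l + 2) ∉ A := by
        intro h3
        apply hsg
        simp only [sing, Finset.mem_filter, Finset.mem_univ, true_and]
        exact ⟨l + 1, rfl, by simpa using ha, by rwa [show l + 1 + 1 = l + 2 by ring]⟩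
      have hli : l ≠ i0 := fun h3 => hne1 (by rw [h3])
      have hlj : l ≠ j0 := fun h3 => hne2 (by rw [h3])
      have hX : ¬ (l < i1) := fun h3 => gi.not_mem l (by omega) h3 ha
      have hY : ¬ (j0 < l ∧ l < j1) := fun h3 => gj.not_mem l h3.1 h3.2 ha
      have hgap : ∀ b, l < b → f b ∈ A → ∃ l', l' ≤ b ∧ Gap f A l l' := by
        intro b hb hbA
        obtain ⟨l', h3, h4, h5, h6⟩ := exists_next (P := fun k => f k ∈ A) (a := l + 1) hb hbA
        refine ⟨l', h4, ha, h5, ?_, fun k hk => h6 k (by omega)⟩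
        have h7 : l' ≠ l + 1 := by rintro rfl; exact hl1 h5
        have h8 : l' ≠ l + 2 := by rintro rfl; exact hl2 h5
        omega
      rcases lt_or_gt_of_ne hlj with hlt | hgt
      · obtain ⟨l', hl3, gl⟩ := hgap j0 hlt gj.left
        have := gl.len
        have e1 : g (l + 1) = f (l + 1) := by
          have := σc (l + 1)
          simp only [hg]; congr 1; omega
        have e2 : g (l + 1 + 1) = f (l + 2) := by
          have := σc (l + 1 + 1)
          simp only [hg]; congr 1; omega
        refine .inl ⟨l + 1, by omega, by omega, e1, ?_, fun _ => ?_⟩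
        · rw [e1]
          exact fun hadj => h.not_conn_heads ⟨gl, gj, hl3, by omega⟩ (.base h.cyc (by omega)) hp'
            (.inl hadj.symm)
        · rw [e2]
          exact h.not_adj_second ⟨gi, gl, by omega, by omega⟩ hp
      · obtain ⟨l', hl3, gl⟩ := hgap (i0 + c) hl' (by rw [h.cyc.per]; exact gi.left)
        have := gl.len
        have e1 : g (l + 1) = f (l + 1) := by
          have := σc (l + 1)
          simp only [hg]; congr 1; omega
        have e2 : g (l + 1 + 1) = f (l + 2) := by
          have := σc (l + 1 + 1)
          simp only [hg]; congr 1; omega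
        refine .inr (.inl ⟨l + 1, by omega, by omega, e1, ?_, fun _ => ?_⟩)
        · rw [e1]
          have hpc := hp.add h.cyc
          intro hadj
          refine h.not_conn_heads ⟨gl, gi.add h.cyc, hl3, by omega⟩ (.base h.cyc (by omega)) hpc
            (.inl ?_)
          rw [h.cyc.per]
          exact hadj.symm
        · rw [e2]
          exact h.not_adj_second ⟨gj, gl, by omega, by omega⟩ hp')
  have hdeg := h.deg_le (f p) (f p') hpA hpA' (h.fH _) (h.fH _)
    (gi.not_sing h.cyc hp1 hp2) (gj.not_sing h.cyc hp1' hp2')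
    (h.cyc.ne (by omega) (by omega)) fun hadj => hnc (.inl hadj)
  have hfst := h.card_firsts (i0 := i0) (j0 := j0)
  rw [Finset.card_insert_of_notMem, Finset.card_insert_of_notMem (hItemF w hw)] at hcount
  · push_cast at hcount
    omega
  · rw [Finset.mem_insert, not_or]
    exact ⟨hvw, hItemF v hv⟩

end Dn

namespace IP

variable {G : SimpleGraph V} {f : ℤ → V} {lo c : ℤ} {E : Set V} {S : ℤ → Prop} {v w : V}

theorem fwd (hf : Cyc G c f) (h : IP G f lo c E S v w) (a b : ℤ) (hadj : G.Adj w (f a))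
    (h1 : lo ≤ a) (h2 : a ≤ b) (h3 : b < lo + c) (hd : ∀ k, a ≤ k → k ≤ b → ¬ S k) :
    IP G f lo c E (fun k => S k ∨ a ≤ k ∧ k ≤ b) v (f b) := by
  refine ((IP.seg hf h1 h2 h3).symm.appendO hf h.symm hadj.symm fun k _ _ hk => ?_).symm.congr
    fun k _ _ => ?_
  · exact hd k hk.1 hk.2
  · tauto

theorem bwd (hf : Cyc G c f) (h : IP G f lo c E S v w) (a b : ℤ) (hadj : G.Adj w (f b))
    (h1 : lo ≤ a) (h2 : a ≤ b) (h3 : b < lo + c) (hd : ∀ k, a ≤ k → k ≤ b → ¬ S k) :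
    IP G f lo c E (fun k => S k ∨ a ≤ k ∧ k ≤ b) v (f a) := by
  refine ((IP.seg hf h1 h2 h3).appendO hf h.symm hadj.symm fun k _ _ hk => ?_).symm.congr
    fun k _ _ => ?_
  · exact hd k hk.1 hk.2
  · tauto

theorem tail (hf : Cyc G c f) (h : IP G f lo c E S v w) (a b : ℤ) (hadj : G.Adj w (f a))
    (h1 : lo ≤ a) (h2 : a ≤ b) (h3 : b ≤ lo + c) (hd : ∀ k, a ≤ k → k < b → ¬ S k) :
    ∃ t, IP G f lo c E (fun k => S k ∨ a ≤ k ∧ k < b) v t ∧ G.Adj t (f b) := by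
  rcases eq_or_lt_of_le h2 with rfl | h4
  · exact ⟨w, h.congr fun k _ _ => ⟨.inl, fun h => h.resolve_right (by omega)⟩, hadj⟩
  · refine ⟨_, (h.fwd hf a (b - 1) hadj h1 (by omega) (by omega) fun k hk hk' =>
      hd k hk (by omega)).congr fun k _ _ => ?_, ?_⟩
    · constructor <;> rintro (h | h) <;> first | exact .inl h | (right; omega)
    · have := hf.adj (b - 1)
      rwa [sub_add_cancel] at this

end IP

namespace Dn

theorem rot_base (a k : ℤ) : rot a (a + 1) k = if k ≤ a then k - 1 else k + 1 := by
  unfold rot; split_ifs <;> omega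

theorem itemX {G : SimpleGraph V} {f : ℤ → V} {O : Finset V} {i0 i1 j0 j1 p' k : ℤ}
    (h1 : i0 < k) (h2 : k < i1)
    (h3 : ¬ G.Adj (f p') (f k)) (h4 : ¬ G.Adj (f (i0 + 1)) (f (k + 1))) :
    Item G f O i0 i1 j0 j1 (i0 + 1) p' (f k) :=
  .inl ⟨k, h1, h2, rfl, h3, by rwa [rot_base, if_neg (by omega)]⟩

theorem itemY {G : SimpleGraph V} {f : ℤ → V} {O : Finset V} {i0 i1 j0 j1 p k : ℤ}
    (h1 : j0 < k) (h2 : k < j1)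
    (h3 : ¬ G.Adj (f p) (f k)) (h4 : ¬ G.Adj (f (j0 + 1)) (f (k + 1))) :
    Item G f O i0 i1 j0 j1 p (j0 + 1) (f k) :=
  .inr (.inl ⟨k, h1, h2, rfl, h3, by rwa [rot_base, if_neg (by omega)]⟩)

variable [Fintype V] {G : SimpleGraph V} {c : ℤ} {f : ℤ → V} {A O H : Finset V}
  {i0 i1 j0 j1 p p' : ℤ}

theorem item_pos_unique (h : Dn G c f A O H) (pr : Pr f c A i0 i1 j0 j1) (hp : RH G f i0 i1 p)
    (hp' : RH G f j0 j1 p') {k l : ℤ} (hk : Item G f O i0 i1 j0 j1 p p' (f k))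
    (hl : Item G f O i0 i1 j0 j1 p p' (f l)) (h1 : k < l + c) (h2 : l < k + c) : k = l :=
  h.cyc.eq_of (h.item_unique pr hp hp' hk hl) h1 h2

theorem tight_X (h : Dn G c f A O H) (pr : Pr f c A i0 i1 j0 j1)
    (hX : ∀ k, i0 < k → k < i1 → G.Adj (f (j0 + 1)) (f k) ∨ G.Adj (f (i0 + 1)) (f (k + 1)))
    (hX1 : G.Adj (f (j0 + 1)) (f i1)) : ∀ k, i0 < k → k < i1 → RH G f i0 i1 k := by
  by_contra! hcon
  obtain ⟨gi, gj, ij, ji⟩ := id pr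
  have li := gi.len
  have lj := gj.len
  have hf := h.cyc
  have hO := h.hOne
  have bi := RH.base hf (i0 := i0) (i1 := i1) (by omega)
  have bj := RH.base hf (i0 := j0) (i1 := j1) (by omega)
  have nc := fun {p p'} (hp : RH G f i0 i1 p) (hp' : RH G f j0 j1 p') (ha : G.Adj (f p) (f p')) =>
    h.not_conn_heads pr hp hp' (.inl ha)
  have hP0 : ∃ k, i0 < k ∧ k < i1 ∧ G.Adj (f (j0 + 1)) (f k) := by
    obtain ⟨k, hk, hk', hr⟩ := hcon
    refine ⟨k, hk, hk', ?_⟩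
    by_contra hn
    exact hr ⟨hk, hk', (hX k hk hk').resolve_left hn⟩
  obtain ⟨m, hm, hm', hm2⟩ := hP0
  obtain ⟨P, hP1, hP2, hP3, hP4⟩ := exists_next (P := fun k => G.Adj (f (j0 + 1)) (f k))
    (a := i0 + 1) (b := m) (by omega) hm2
  have hPne : P ≠ i0 + 1 := by
    rintro rfl; exact nc bi bj hP3.symm
  have hxP : G.Adj (f (i0 + 1)) (f P) := by
    have := (hX (P - 1) (by omega) (by omega)).resolve_left (hP4 _ (by omega) (by omega))
    rwa [sub_add_cancel] at this
  have hmj : G.Adj (f (j1 - 1)) (f j1) := by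
    have := hf.adj (j1 - 1)
    rwa [sub_add_cancel] at this
  have hnx : ∀ k, i0 < k → k < i1 → G.Adj (f (j0 + 1)) (f k) → ¬ G.Adj (f (i0 + 1)) (f (k + 1)) :=
    fun k h1 h2 h3 h4 => nc ⟨h1, h2, h4⟩ bj h3.symm
  have s1 := IP.seg hf (lo := i0 + 1) (a := i0 + 1) (b := P) (by omega) (by omega) (by omega)
  have hyP1 : G.Adj (f (j0 + 1)) (f (P + 1)) := by
    by_contra hn
    have hlt : P + 1 < i1 := by
      by_contra h1
      have : P + 1 = i1 := by omega
      exact hn (this ▸ hX1)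
    have hx2 := (hX (P + 1) (by omega) hlt).resolve_left hn
    obtain ⟨t, ht, ht'⟩ := s1.symm.tail hf (P + 1 + 1) i1 hx2 (by omega) (by omega) (by omega)
      fun k _ _ => by omega
    have h3 := ht.symm.fwd hf (j0 + 1) (j1 - 1) hP3.symm (by omega) (by omega) (by omega)
      fun k _ _ => by omega
    exact h.kill_R pr (P + 1) (h3.mono (by simp)) (fun k _ _ => by unfold inG; omega)
      (fun k => by unfold inG; omega) ht'.symm hmj
  obtain ⟨q, hq1, hq2, hq3, hq4⟩ := exists_next
    (P := fun q => G.Adj (f (i0 + 1)) (f q) ∨ q = j1) (a := j0 + 2) (b := j1) (by omega) (.inr rfl)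
  have hq4' : ∀ k, j0 < k → k < q → ¬ G.Adj (f (i0 + 1)) (f k) := by
    intro k hk hk' ha
    by_cases h1 : k = j0 + 1
    · subst h1; exact nc bi bj ha
    · exact hq4 k (by omega) hk' (.inl ha)
  obtain ⟨r, hr1, hr2, hr⟩ : ∃ r, (r = q - 1 ∨ r = q - 2) ∧ j0 < r ∧
      G.Adj (f (j0 + 1)) (f (r + 1)) := by
    by_cases h1 : G.Adj (f (j0 + 1)) (f q)
    · exact ⟨q - 1, .inl rfl, by omega, by rwa [sub_add_cancel]⟩
    have h2 : q ≠ j0 + 2 := by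
      rintro rfl
      apply h1
      have := hf.adj (j0 + 1)
      rwa [show j0 + 1 + 1 = j0 + 2 by ring] at this
    refine ⟨q - 2, .inr rfl, by omega, ?_⟩
    by_contra h3
    have := h.item_pos_unique pr bi bj (k := q - 1) (l := q - 2)
      (itemY (by omega) (by omega) (hq4' _ (by omega) (by omega)) (by rwa [sub_add_cancel]))
      (itemY (by omega) (by omega) (hq4' _ (by omega) (by omega)) h3) (by omega) (by omega)
    omega
  have hRr : RH G f j0 j1 r := ⟨hr2, by omega, hr⟩
  have ins : ∃ t, IP G f (i0 + 1) c ∅ (fun k => (i0 < k ∧ k < i1) ∨ (j0 < k ∧ k ≤ r))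
      (f (i0 + 1)) t ∧ G.Adj t (f i1) := by
    have hor : G.Adj (f r) (f P) ∨ G.Adj (f r) (f (P + 1)) := by
      by_contra! hn
      have i1' : Item G f O i0 i1 j0 j1 (i0 + 1) r (f P) :=
        itemX (by omega) (by omega) hn.1 (hnx P (by omega) (by omega) hP3)
      have i2 : Item G f O i0 i1 j0 j1 (i0 + 1) r (f (P + 1)) := by
        by_cases h1 : P + 1 = i1
        · exact .inr (.inr (.inl ⟨by rw [h1], by rw [← h1]; exact hn.2⟩))
        · exact itemX (by omega) (by omega) hn.2 (hnx _ (by omega) (by omega) hyP1)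
      have := h.item_pos_unique pr bi hRr i1' i2 (by omega) (by omega)
      omega
    rcases hor with h1 | h1
    · have s2 := s1.bwd hf (j0 + 1) r h1.symm (by omega) (by omega) (by omega) fun k _ _ => by omega
      obtain ⟨t, ht, ht'⟩ := s2.tail hf (P + 1) i1 hyP1 (by omega) (by omega) (by omega)
        fun k _ _ => by omega
      exact ⟨t, ht.congr fun k _ _ => by omega, ht'⟩
    · have s2 := s1.fwd hf (j0 + 1) r hP3.symm (by omega) (by omega) (by omega)
        fun k _ _ => by omega
      obtain ⟨t, ht, ht'⟩ := s2.tail hf (P + 1) i1 h1 (by omega) (by omega) (by omega)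
        fun k _ _ => by omega
      exact ⟨t, ht.congr fun k _ _ => by omega, ht'⟩
  obtain ⟨t, ht, ht'⟩ := ins
  by_cases hq5 : q = j1
  · exact h.kill_X pr (q - 1) (ht.mono (by simp)) (fun k _ _ => by unfold inG; omega)
      (fun k => by unfold inG; omega) (hf.adj i0) ht'
  · have hxq := hq3.resolve_right hq5
    have h3 := ht.symm.fwd hf q (j1 - 1) hxq (by omega) (by omega) (by omega)
      fun k _ _ => by omega
    exact h.kill_R pr (q - 1) (h3.mono (by simp)) (fun k _ _ => by unfold inG; omega)
      (fun k => by unfold inG; omega) ht'.symm hmj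

end Dn

/-- All interior positions of the gap are heads. -/
def AllR (G : SimpleGraph V) (f : ℤ → V) (i0 i1 : ℤ) : Prop :=
  ∀ k, i0 < k → k < i1 → G.Adj (f (i0 + 1)) (f (k + 1))

/-- All interior positions of the gap are heads of the reversed gap. -/
def AllL (G : SimpleGraph V) (f : ℤ → V) (i0 i1 : ℤ) : Prop :=
  ∀ k, i0 < k → k < i1 → G.Adj (f (i1 - 1)) (f (k - 1))

/-- A gap with five vertices whose first two vertices are not connected to the last two. -/
def Center (G : SimpleGraph V) (f : ℤ → V) (O : Finset V) (a b : ℤ) : Prop :=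
  b = a + 6 ∧ ∀ k l, (k = a + 1 ∨ k = a + 2) → (l = a + 4 ∨ l = a + 5) → ¬ Cn G O (f k) (f l)

theorem AllR.mirror {G : SimpleGraph V} {f : ℤ → V} {i0 i1 : ℤ} (h : AllR G f i0 i1) :
    AllL G (fun k => f (-k)) (-i1) (-i0) := by
  intro k hk hk'
  have := h (-k) (by omega) (by omega)
  simp only
  rwa [show -(-i0 - 1) = i0 + 1 by ring, show -(k - 1) = -k + 1 by ring]

theorem AllL.mirror {G : SimpleGraph V} {f : ℤ → V} {i0 i1 : ℤ} (h : AllL G f i0 i1) :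
    AllR G (fun k => f (-k)) (-i1) (-i0) := by
  intro k hk hk'
  have := h (-k) (by omega) (by omega)
  simp only
  rwa [show -(-i1 + 1) = i1 - 1 by ring, show -(k + 1) = -k - 1 by ring]

theorem AllL.add {G : SimpleGraph V} {f : ℤ → V} {i0 i1 c : ℤ} (hf : Cyc G c f)
    (h : AllL G f i0 i1) : AllL G f (i0 + c) (i1 + c) := by
  intro k hk hk'
  have := h (k - c) (by omega) (by omega)
  rw [← hf.per, ← hf.per (k - c - 1)] at this
  rwa [show i1 + c - 1 = i1 - 1 + c by ring, show k - 1 = k - c - 1 + c by ring]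

theorem AllR.of_mirror {G : SimpleGraph V} {f : ℤ → V} {i0 i1 : ℤ}
    (h : AllR G (fun k => f (-k)) (-i1) (-i0)) : AllL G f i0 i1 := by
  intro k hk hk'
  have := h (-k) (by omega) (by omega)
  simp only at this
  rwa [show -(-i1 + 1) = i1 - 1 by ring, show -(-k + 1) = k - 1 by ring] at this

theorem Center.of_add {G : SimpleGraph V} {f : ℤ → V} {O : Finset V} {i0 i1 c : ℤ} (hf : Cyc G c f)
    (h : Center G f O (i0 + c) (i1 + c)) : Center G f O i0 i1 := by
  refine ⟨by have := h.1; omega, fun k l hk hl => ?_⟩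
  have := h.2 (k + c) (l + c) (by omega) (by omega)
  rwa [hf.per, hf.per] at this

namespace Dn

variable [Fintype V] {G : SimpleGraph V} {c : ℤ} {f : ℤ → V} {A O H : Finset V}
  {i0 i1 j0 j1 : ℤ}

theorem allR_or (h : Dn G c f A O H) (pr : Pr f c A i0 i1 j0 j1) :
    AllR G f i0 i1 ∨ AllR G f j0 j1 := by
  obtain ⟨gi, gj, ij, ji⟩ := id pr
  have li := gi.len
  have lj := gj.len
  have hf := h.cyc
  have bi := RH.base hf (i0 := i0) (i1 := i1) (by omega)
  have bj := RH.base hf (i0 := j0) (i1 := j1) (by omega)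
  by_cases hX : (∀ k, i0 < k → k < i1 →
      G.Adj (f (j0 + 1)) (f k) ∨ G.Adj (f (i0 + 1)) (f (k + 1))) ∧ G.Adj (f (j0 + 1)) (f i1)
  · exact .inl fun k hk hk' => (h.tight_X pr hX.1 hX.2 k hk hk').adj
  by_cases hY : (∀ k, j0 < k → k < j1 →
      G.Adj (f (i0 + 1)) (f k) ∨ G.Adj (f (j0 + 1)) (f (k + 1))) ∧ G.Adj (f (i0 + 1)) (f j1)
  · refine .inr fun k hk hk' => (h.tight_X (pr.swap hf) ?_ ?_ k hk hk').adj
    · rw [show i0 + c + 1 = i0 + 1 + c by ring, hf.per]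
      exact hY.1
    · rw [show i0 + c + 1 = i0 + 1 + c by ring, hf.per]
      exact hY.2
  exfalso
  have h1 : ∃ k, i0 < k ∧ k ≤ i1 ∧ Item G f O i0 i1 j0 j1 (i0 + 1) (j0 + 1) (f k) := by
    by_contra! hn
    refine hX ⟨fun k hk hk' => ?_, ?_⟩
    · by_contra! h2
      exact hn k hk hk'.le (itemX hk hk' h2.1 h2.2)
    · by_contra h2
      exact hn i1 (by omega) le_rfl (.inr (.inr (.inl ⟨rfl, h2⟩)))
  have h2 : ∃ k, j0 < k ∧ k ≤ j1 ∧ Item G f O i0 i1 j0 j1 (i0 + 1) (j0 + 1) (f k) := by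
    by_contra! hn
    refine hY ⟨fun k hk hk' => ?_, ?_⟩
    · by_contra! h2
      exact hn k hk hk'.le (itemY hk hk' h2.1 h2.2)
    · by_contra h2
      exact hn j1 (by omega) le_rfl (.inr (.inr (.inr (.inl ⟨rfl, h2⟩))))
  obtain ⟨k, h3, h4, h5⟩ := h1
  obtain ⟨l, h6, h7, h8⟩ := h2
  have := h.item_pos_unique pr bi bj h5 h8 (by omega) (by omega)
  omega

theorem allL_or (h : Dn G c f A O H) (pr : Pr f c A i0 i1 j0 j1) :
    AllL G f i0 i1 ∨ AllL G f j0 j1 :=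
  (h.mirror.allR_or pr.mirror).symm.imp (·.of_mirror) (·.of_mirror)

/-- The positions of `(j0, j1]` that must be adjacent to all heads with at most one exception. -/
def Bad (G : SimpleGraph V) (f : ℤ → V) (j0 j1 k : ℤ) : Prop :=
  j0 < k ∧ k ≤ j1 ∧ (k = j1 ∨ ¬ G.Adj (f (j0 + 1)) (f (k + 1)))

theorem bad_unique (h : Dn G c f A O H) (pr : Pr f c A i0 i1 j0 j1) (hR : AllR G f i0 i1) {t k l : ℤ}
    (ht : i0 < t) (ht' : t < i1) (hk : Bad G f j0 j1 k) (hl : Bad G f j0 j1 l)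
    (hk' : ¬ G.Adj (f t) (f k)) (hl' : ¬ G.Adj (f t) (f l)) : k = l := by
  have lj := pr.gj.len
  have := pr.ij
  have := pr.ji
  have key : ∀ k, Bad G f j0 j1 k → ¬ G.Adj (f t) (f k) →
      Item G f O i0 i1 j0 j1 t (j0 + 1) (f k) := by
    rintro k ⟨h1, h2, h3⟩ h4
    by_cases h5 : k = j1
    · subst h5; exact .inr (.inr (.inr (.inl ⟨rfl, h4⟩)))
    · exact itemY h1 (by omega) h4 (h3.resolve_left h5)
  have h1 := hk.1
  have h2 := hk.2.1
  have h3 := hl.1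
  have h4 := hl.2.1
  exact h.item_pos_unique pr ⟨ht, ht', hR t ht ht'⟩ (RH.base h.cyc (by omega)) (key k hk hk')
    (key l hl hl') (by omega) (by omega)

theorem bad_of_conn (h : Dn G c f A O H) (pr : Pr f c A i0 i1 j0 j1) (hR : AllR G f i0 i1) {t k : ℤ}
    (ht : i0 < t) (ht' : t < i1) (hk : j0 < k) (hk' : k < j1) (hc : Cn G O (f t) (f k)) :
    ¬ G.Adj (f (j0 + 1)) (f (k + 1)) := fun ha =>
  h.not_conn_heads pr ⟨ht, ht', hR t ht ht'⟩ ⟨hk, hk', ha⟩ hc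

theorem bad_succ_of_conn (h : Dn G c f A O H) (pr : Pr f c A i0 i1 j0 j1) (hR : AllR G f i0 i1)
    {t k : ℤ} (ht : i0 < t) (ht' : t < i1) (hk : j0 < k) (hk' : k + 1 < j1)
    (hc : Cn G O (f t) (f k)) : ¬ G.Adj (f (j0 + 1)) (f (k + 2)) := by
  intro ha
  obtain ⟨gi, gj, ij, ji⟩ := id pr
  have li := gi.len
  have lj := gj.len
  have hf := h.cyc
  obtain ⟨s, hs, hs'⟩ := RH.path hf (lo := i0 + 1) ⟨ht, ht', hR t ht ht'⟩ (by omega) (by omega)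
  have s1 := IP.seg hf (lo := i0 + 1) (a := j0 + 1) (b := k) (by omega) (by omega) (by omega)
  have s2 := hs.symm.join hf s1.symm h.hOne hc fun k _ _ => by omega
  obtain ⟨t, ht, ht'⟩ := s2.tail hf (k + 2) j1 ha (by omega) (by omega) (by omega)
    fun k _ _ => by omega
  exact h.kill_R pr (k + 1) ht (fun k _ _ => by unfold inG; omega)
    (fun k => by unfold inG; omega) hs'.symm ht'

theorem not_insert (h : Dn G c f A O H) (pr : Pr f c A i0 i1 j0 j1) {k l : ℤ} (hk : j0 < k)
    (hkl : l = k + 1 ∨ l = k + 2) (hl : l ≤ j1) (hc : Cn G O (f (i0 + 1)) (f k))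
    (ha : G.Adj (f (i1 - 1)) (f l)) : False := by
  obtain ⟨gi, gj, ij, ji⟩ := id pr
  have li := gi.len
  have lj := gj.len
  have hf := h.cyc
  have s1 := IP.seg hf (lo := i0 + 1) (a := j0 + 1) (b := k) (by omega) (by omega) (by omega)
  have s2 := IP.seg hf (lo := i0 + 1) (a := i0 + 1) (b := i1 - 1) (by omega) (by omega) (by omega)
  have s3 := s1.join hf s2 h.hOne hc.symm fun k _ _ => by omega
  obtain ⟨t, ht, ht'⟩ := s3.tail hf l j1 ha (by omega) (by omega) (by omega)
    fun k _ _ => by omega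
  exact h.kill_Y pr (k + 1) ht (fun k _ _ => by unfold inG; omega)
    (fun k => by unfold inG; omega) (hf.adj _) ht'

theorem not_insert' (h : Dn G c f A O H) (pr : Pr f c A i0 i1 j0 j1) {k l : ℤ} (hk : j0 < k)
    (hkl : l = k + 1 ∨ l = k + 2) (hl : l ≤ j1) (hc : Cn G O (f (i1 - 1)) (f k))
    (ha : G.Adj (f (i0 + 1)) (f l)) : False := by
  obtain ⟨gi, gj, ij, ji⟩ := id pr
  have li := gi.len
  have lj := gj.len
  have hf := h.cyc
  have s1 := IP.seg hf (lo := i0 + 1) (a := j0 + 1) (b := k) (by omega) (by omega) (by omega)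
  have s2 := IP.seg hf (lo := i0 + 1) (a := i0 + 1) (b := i1 - 1) (by omega) (by omega) (by omega)
  have s3 := s1.join hf s2.symm h.hOne hc.symm fun k _ _ => by omega
  obtain ⟨t, ht, ht'⟩ := s3.tail hf l j1 ha (by omega) (by omega) (by omega)
    fun k _ _ => by omega
  exact h.kill_Y pr (k + 1) ht (fun k _ _ => by unfold inG; omega)
    (fun k => by unfold inG; omega) (hf.adj _) ht'

theorem opposite_aux (h : Dn G c f A O H) (pr : Pr f c A i0 i1 j0 j1) (hR : AllR G f i0 i1)
    (hL : AllL G f j0 j1) {t k : ℤ} (ht : i0 < t) (ht' : t < i1) (hk : j0 < k) (hk' : k < j1)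
    (hc : Cn G O (f t) (f k)) : k = j1 - 1 ∧ G.Adj (f (i1 - 1)) (f j1) := by
  obtain ⟨gi, gj, ij, ji⟩ := id pr
  have li := gi.len
  have lj := gj.len
  have hm : ∀ k, j0 < k → k < j1 → ¬ Cn G O (f (i1 - 1)) (f k) := by
    intro k hk hk' hc
    refine h.mirror.not_conn_heads pr.mirror (p := -k) (p' := -(i1 - 1))
      ⟨by omega, by omega, hL.mirror _ (by omega) (by omega)⟩ ?_ (by simpa using hc.symm)
    rw [show -(i1 - 1) = -i1 + 1 by ring]
    exact .base h.mirror.cyc (by omega)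
  have hb : Bad G f j0 j1 k := ⟨hk, hk'.le, .inr (h.bad_of_conn pr hR ht ht' hk hk' hc)⟩
  have huniq : ∀ l, Bad G f j0 j1 l → ¬ G.Adj (f (i1 - 1)) (f l) → k = l := fun l hl hl' =>
    h.bad_unique pr hR (t := i1 - 1) (by omega) (by omega) hb hl
      (fun ha => hm k hk hk' (.inl ha)) hl'
  have hk1 : k = j1 - 1 := by
    by_contra hne
    have h1 := h.bad_succ_of_conn pr hR ht ht' hk (by omega) hc
    have h2 := huniq (k + 1) ⟨by omega, by omega, .inr (by rwa [add_assoc])⟩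
      fun ha => hm (k + 1) (by omega) (by omega) (.inl ha)
    omega
  refine ⟨hk1, ?_⟩
  by_contra h1
  have := huniq j1 ⟨by omega, le_rfl, .inl rfl⟩ h1
  omega

theorem opposite (h : Dn G c f A O H) (pr : Pr f c A i0 i1 j0 j1) (hR : AllR G f i0 i1)
    (hL : AllL G f j0 j1) {t k : ℤ} (ht : i0 < t) (ht' : t < i1) (hk : j0 < k) (hk' : k < j1)
    (hc : Cn G O (f t) (f k)) : False := by
  obtain ⟨h1, h2⟩ := h.opposite_aux pr hR hL ht ht' hk hk' hc
  obtain ⟨h3, -⟩ := h.mirror.opposite_aux pr.mirror hL.mirror hR.mirror (t := -k) (k := -t)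
    (by omega) (by omega) (by omega) (by omega) (by simpa using hc.symm)
  obtain rfl : t = i0 + 1 := by omega
  exact h.not_insert pr hk (.inl (by omega)) le_rfl hc h2

theorem conn_lt (h : Dn G c f A O H) (pr : Pr f c A i0 i1 j0 j1)
    (hL : AllL G f i0 i1) {t k : ℤ} (ht : i0 < t) (ht' : t < i1) (hk' : k < j1)
    (hc : Cn G O (f t) (f k)) : k + 1 < j1 := by
  have lj := pr.gj.len
  by_contra hn
  refine h.mirror.not_conn_heads pr.mirror (p := -k) (p' := -t) ?_
    ⟨by omega, by omega, hL.mirror _ (by omega) (by omega)⟩ (by simpa using hc.symm)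
  rw [show -k = -j1 + 1 by omega]
  exact .base h.mirror.cyc (by omega)

theorem same_aux (h : Dn G c f A O H) (pr : Pr f c A i0 i1 j0 j1) (hR : AllR G f i0 i1)
    (hL : AllL G f i0 i1) {t k : ℤ} (ht : i0 < t) (ht' : t < i1) (hk : j0 < k) (hk' : k < j1)
    (hc : Cn G O (f t) (f k)) :
    k + 3 ≤ j1 ∧ G.Adj (f (i0 + 1)) (f k) ∧
    (∀ l, j0 < l → l < j1 → l ≠ k → l ≠ k + 1 → G.Adj (f (j0 + 1)) (f (l + 1))) ∧
    ¬ G.Adj (f (j0 + 1)) (f (k + 2)) := by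
  obtain ⟨gi, gj, ij, ji⟩ := id pr
  have li := gi.len
  have lj := gj.len
  have hf := h.cyc
  have hk2 := h.conn_lt pr hL ht ht' hk' hc
  have bk := h.bad_of_conn pr hR ht ht' hk hk' hc
  have sc : ∀ {t k : ℤ}, i0 < t → t < i1 → j0 < k → k + 1 < j1 → Cn G O (f t) (f k) →
      Bad G f j0 j1 (k + 1) := fun {t k} h1 h2 h3 h4 h5 =>
    ⟨by omega, by omega, .inr (by
      rw [add_assoc]; exact h.bad_succ_of_conn pr hR h1 h2 h3 h4 h5)⟩
  have uniq : ∀ {t k l : ℤ}, i0 < t → t < i1 → Bad G f j0 j1 k → ¬ G.Adj (f t) (f k) →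
      Bad G f j0 j1 l → k ≠ l → G.Adj (f t) (f l) := fun {t k l} h1 h2 h3 h4 h5 h6 => by
    by_contra h7
    exact h6 (h.bad_unique pr hR h1 h2 h3 h5 h4 h7)
  have bj1 : Bad G f j0 j1 j1 := ⟨by omega, le_rfl, .inl rfl⟩
  obtain ⟨e, he1, he2, he3, he4⟩ := exists_next (P := fun l => ¬ G.Adj (f (j0 + 1)) (f (l + 1)))
    (a := j0 + 1) (b := k) (by omega) bk
  have be : Bad G f j0 j1 e := ⟨by omega, by omega, .inr he3⟩
  have hA : G.Adj (f (i0 + 1)) (f e) ∨ G.Adj (f (i1 - 1)) (f e) := by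
    by_contra! hn
    obtain ⟨e2, h1, h2, h3⟩ : ∃ e2, e < e2 ∧ e2 < j1 ∧ Bad G f j0 j1 e2 := by
      by_cases hek : e = k
      · exact ⟨k + 1, by omega, by omega, sc ht ht' hk hk2 hc⟩
      · exact ⟨k, by omega, hk', hk, by omega, .inr bk⟩
    have h4 := uniq (by omega) (by omega) be hn.1 h3 (by omega)
    by_cases h5 : e2 + 1 < j1
    · have h6 := sc (t := i0 + 1) (by omega) (by omega) (by omega) h5 (.inl h4)
      exact h.not_insert pr (l := e2 + 1) (by omega) (.inl rfl) (by omega) (.inl h4)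
        (uniq (by omega) (by omega) be hn.2 h6 (by omega))
    · exact h.not_insert pr (l := j1) (k := e2) (by omega) (by omega) (by omega) (.inl h4)
        (uniq (by omega) (by omega) be hn.2 bj1 (by omega))
  obtain ⟨hx, hx', hm, hm', be1⟩ : G.Adj (f (i0 + 1)) (f e) ∧ ¬ G.Adj (f (i0 + 1)) (f (e + 1)) ∧
      G.Adj (f (i1 - 1)) (f e) ∧ ¬ G.Adj (f (i1 - 1)) (f (e + 1)) ∧ Bad G f j0 j1 (e + 1) := by
    rcases hA with h1 | h1
    · have b1 := sc (t := i0 + 1) (by omega) (by omega) (by omega) (by omega) (.inl h1)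
      have h2 : ¬ G.Adj (f (i1 - 1)) (f (e + 1)) := fun ha =>
        h.not_insert pr (k := e) (by omega) (.inl rfl) (by omega) (.inl h1) ha
      have h3 := uniq (by omega) (by omega) b1 h2 be (by omega)
      exact ⟨h1, fun ha => h.not_insert' pr (k := e) (by omega) (.inl rfl) (by omega) (.inl h3) ha,
        h3, h2, b1⟩
    · have b1 := sc (t := i1 - 1) (by omega) (by omega) (by omega) (by omega) (.inl h1)
      have h2 : ¬ G.Adj (f (i0 + 1)) (f (e + 1)) := fun ha =>
        h.not_insert' pr (k := e) (by omega) (.inl rfl) (by omega) (.inl h1) ha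
      have h3 := uniq (by omega) (by omega) b1 h2 be (by omega)
      exact ⟨h3, h2, h1,
        fun ha => h.not_insert pr (k := e) (by omega) (.inl rfl) (by omega) (.inl h3) ha, b1⟩
  have hC : ∀ l, Bad G f j0 j1 l → l < j1 → l = e ∨ l = e + 1 := by
    intro l hl hl'
    by_contra! hn
    have h1 : e < l := by
      by_contra h1
      have h2 := hl.1
      exact he4 l (by omega) (by omega) (hl.2.2.resolve_left (by omega))
    have h2 := uniq (by omega) (by omega) be1 hx' hl (by omega)
    by_cases h3 : l + 1 < j1
    · have h4 := sc (t := i0 + 1) (by omega) (by omega) (by omega) h3 (.inl h2)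
      exact h.not_insert pr (k := l) (by omega) (.inl rfl) (by omega) (.inl h2)
        (uniq (by omega) (by omega) be1 hm' h4 (by omega))
    · exact h.not_insert pr (k := l) (l := j1) (by omega) (by omega) (by omega) (.inl h2)
        (uniq (by omega) (by omega) be1 hm' bj1 (by omega))
  have hek : k = e := by
    rcases hC k ⟨hk, by omega, .inr bk⟩ hk' with h1 | h1
    · exact h1
    · have b1 := sc ht ht' hk hk2 hc
      rcases hC _ b1 hk2 with h2 | h2 <;> omega
  subst hek
  refine ⟨?_, hx, fun l h1 h2 h3 h4 => ?_, ?_⟩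
  · by_contra h1
    exact h.not_insert pr (k := k) (l := j1) hk (by omega) le_rfl (.inl hx)
      (uniq (by omega) (by omega) be1 hm' bj1 (by omega))
  · by_contra h5
    rcases hC l ⟨h1, by omega, .inr h5⟩ h2 with h6 | h6 <;> omega
  · have := be1.2.2.resolve_left (by omega)
    rwa [add_assoc] at this

theorem same_len (h : Dn G c f A O H) (pr : Pr f c A i0 i1 j0 j1) (hR : AllR G f i0 i1)
    (hL : AllL G f i0 i1) {t k : ℤ} (ht : i0 < t) (ht' : t < i1) (hk : j0 < k) (hk' : k < j1)
    (hc : Cn G O (f t) (f k)) : k + 3 = j1 := by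
  obtain ⟨gi, gj, ij, ji⟩ := id pr
  have li := gi.len
  have lj := gj.len
  have hf := h.cyc
  obtain ⟨r1, r2, r3, r4⟩ := h.same_aux pr hR hL ht ht' hk hk' hc
  have r5 := h.bad_of_conn pr hR ht ht' hk hk' hc
  obtain ⟨l1, l2, l3, l4⟩ := h.mirror.same_aux (pr.mirror' hf) hL.mirror hR.mirror
    (t := -t) (k := -k + c) (by omega) (by omega) (by omega) (by omega) (by
      simp only [neg_neg]
      rwa [show -(-k + c) = k - c by ring, ← hf.per (k - c), sub_add_cancel])
  have l3' : ∀ l, j0 < l → l < j1 → l ≠ k → l ≠ k - 1 → G.Adj (f (j1 - 1)) (f (l - 1)) := by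
    intro l h1 h2 h3 h4
    have := l3 (-l + c) (by omega) (by omega) (by omega) (by omega)
    rwa [← hf.per, show -(-j1 + c + 1) + c = j1 - 1 by ring, ← hf.per (-(-l + c + 1)),
      show -(-l + c + 1) + c = l - 1 by ring] at this
  have honly : ∀ l, j0 < l → l < j1 → l ≠ k → ¬ G.Adj (f (i0 + 1)) (f l) := by
    intro l h1 h2 h3 ha
    obtain ⟨m1, m2, m3, m4⟩ := h.same_aux pr hR hL (by omega) (by omega) h1 h2
      (.inl ha)
    have m5 := h.bad_of_conn pr hR (by omega) (by omega) h1 h2 (.inl ha)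
    rcases lt_or_gt_of_ne h3 with h4 | h4
    · exact r4 (by simpa [add_assoc] using m3 (k + 1) (by omega) (by omega) (by omega) (by omega))
    · exact m4 (by simpa [add_assoc] using r3 (l + 1) (by omega) (by omega) (by omega) (by omega))
  obtain ⟨s, hs, hs'⟩ := RH.path hf (lo := i0 + 1) (RH.base hf (i0 := i0) (i1 := i1) (by omega))
    (by omega) (by omega)
  by_contra hn
  have hR2 : RH G f j0 j1 (k + 2) := ⟨by omega, by omega, r3 _ (by omega) (by omega) (by omega)
    (by omega)⟩
  have hend : G.Adj (f (k + 2)) (f j1) := by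
    by_contra hn2
    have := h.item_pos_unique pr (RH.base hf (by omega)) hR2 (k := j1 - 1) (l := j0 + 2)
      (.inr (.inl ⟨j1 - 1, by omega, by omega, rfl,
        honly _ (by omega) (by omega) (by omega), by
          rwa [rot, if_neg (by omega), sub_add_cancel]⟩))
      (.inr (.inl ⟨j0 + 2, by omega, by omega, rfl,
        honly _ (by omega) (by omega) (by omega), by
          rw [rot, if_pos (by omega), if_neg (by omega), show j0 + 2 - 1 = j0 + 1 by ring]
          exact fun ha => r4 ha.symm⟩)) (by omega) (by omega)
    omega
  have q1 := hs.symm.bwd hf (j0 + 1) k r2 (by omega) (by omega) (by omega) fun k _ _ => by omega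
  have q2 := q1.fwd hf (k + 3) (j1 - 1) (by
    simpa [add_assoc] using r3 (k + 2) (by omega) (by omega) (by omega) (by omega))
    (by omega) (by omega) (by omega) fun k _ _ => by omega
  have q3 := q2.fwd hf (k + 1) (k + 2) (by
    have := l3' (k + 2) (by omega) (by omega) (by omega) (by omega)
    rwa [show k + 2 - 1 = k + 1 by ring] at this) (by omega) (by omega) (by omega)
    fun k _ _ => by omega
  exact h.kill_R pr 0 (q3.mono (by simp)) (fun k _ _ => by unfold inG; omega)
    (fun k => by unfold inG; omega) hs'.symm hend

theorem same (h : Dn G c f A O H) (pr : Pr f c A i0 i1 j0 j1) (hR : AllR G f i0 i1)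
    (hL : AllL G f i0 i1) {t k : ℤ} (ht : i0 < t) (ht' : t < i1) (hk : j0 < k) (hk' : k < j1)
    (hc : Cn G O (f t) (f k)) : Center G f O j0 j1 ∧ k = j0 + 3 := by
  obtain ⟨gi, gj, ij, ji⟩ := id pr
  have li := gi.len
  have lj := gj.len
  have hf := h.cyc
  obtain ⟨-, r2, r3, r4⟩ := h.same_aux pr hR hL ht ht' hk hk' hc
  have hk3 := h.same_len pr hR hL ht ht' hk hk' hc
  have hmc : Cn G O (f (- -t)) (f (-(-k + c))) := by
    rwa [neg_neg, show -(-k + c) = k - c by ring, ← hf.per (k - c), sub_add_cancel]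
  have hk0 := h.mirror.same_len (pr.mirror' hf) hL.mirror hR.mirror
    (t := -t) (k := -k + c) (by omega) (by omega) (by omega) (by omega) hmc
  obtain ⟨-, -, l3, -⟩ := h.mirror.same_aux (pr.mirror' hf) hL.mirror hR.mirror
    (t := -t) (k := -k + c) (by omega) (by omega) (by omega) (by omega) hmc
  obtain rfl : k = j0 + 3 := by omega
  obtain rfl : j1 = j0 + 6 := by omega
  have y53 : G.Adj (f (j0 + 5)) (f (j0 + 3)) := by
    have := l3 (-(j0 + 4) + c) (by omega) (by omega) (by omega) (by omega)
    rwa [← hf.per, show -(-(j0 + 6) + c + 1) + c = j0 + 5 by ring, ← hf.per (-(-(j0 + 4) + c + 1)),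
      show -(-(j0 + 4) + c + 1) + c = j0 + 3 by ring] at this
  have y16 : G.Adj (f (j0 + 1)) (f (j0 + 6)) := by
    have := r3 (j0 + 5) (by omega) (by omega) (by omega) (by omega)
    rwa [show j0 + 5 + 1 = j0 + 6 by ring] at this
  have e : ∀ a b : ℤ, b = a + 1 → G.Adj (f a) (f b) := by
    rintro a b rfl; exact hf.adj a
  obtain ⟨s, hs, hs'⟩ := RH.path hf (lo := i0 + 1) (RH.base hf (i0 := i0) (i1 := i1) (by omega))
    (by omega) (by omega)
  refine ⟨⟨rfl, fun k l hk hl hcn => ?_⟩, rfl⟩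
  have fin : ∀ (k0 : ℤ) {S : ℤ → Prop} {w : V},
      IP G f (i0 + 1) c O (fun k => i0 < k ∧ k < i1 ∨ S k) s w → G.Adj w (f (j0 + 6)) →
      (∀ k, S k → j0 < k ∧ k < j0 + 6) → (∀ k, j0 < k → k < j0 + 6 → S k ∨ k = k0) → False := by
    intro k0 S w hq hw h1 h2
    refine h.kill_R pr k0 hq (fun k _ _ hk => ?_) (fun k hk => ?_) hs'.symm hw
    · exact hk.imp_right (h1 k)
    · rcases hk with hk | hk
      · exact .inl (.inl hk)
      · exact (h2 k hk.1 hk.2).imp_left .inr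
  have q3 := hs.symm.fwd hf (j0 + 3) (j0 + 3) r2 (by omega) (by omega) (by omega)
    fun k _ _ => by omega
  have q35 := q3.fwd hf (j0 + 5) (j0 + 5) y53.symm (by omega) (by omega) (by omega)
    fun k _ _ => by omega
  have q354 := q35.fwd hf (j0 + 4) (j0 + 4) (e _ _ (by ring)).symm (by omega) (by omega) (by omega)
    fun k _ _ => by omega
  have q345 := q3.fwd hf (j0 + 4) (j0 + 5) (e _ _ (by ring)) (by omega) (by omega) (by omega)
    fun k _ _ => by omega
  have g1 := IP.seg hf (lo := i0 + 1) (a := j0 + 1) (b := j0 + 1) (by omega) (by omega) (by omega)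
  have g2 := IP.seg hf (lo := i0 + 1) (a := j0 + 1) (b := j0 + 2) (by omega) (by omega) (by omega)
  rcases hk with rfl | rfl <;> rcases hl with rfl | rfl
  · have := q354.join hf g1 h.hOne hcn.symm fun k _ _ => by omega
    exact fin (j0 + 2) (this.congr fun k _ _ => by rw [or_assoc, or_assoc, or_assoc]) y16
      (fun k _ => by omega) (fun k _ _ => by omega)
  · have := q345.join hf g1 h.hOne hcn.symm fun k _ _ => by omega
    exact fin (j0 + 2) (this.congr fun k _ _ => by rw [or_assoc, or_assoc]) y16
      (fun k _ => by omega) (fun k _ _ => by omega)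
  · have := q354.join hf g2.symm h.hOne hcn.symm fun k _ _ => by omega
    exact fin 0 (this.congr fun k _ _ => by rw [or_assoc, or_assoc, or_assoc]) y16
      (fun k _ => by omega) (fun k _ _ => by omega)
  · have := q345.join hf g2.symm h.hOne hcn.symm fun k _ _ => by omega
    exact fin 0 (this.congr fun k _ _ => by rw [or_assoc, or_assoc]) y16
      (fun k _ => by omega) (fun k _ _ => by omega)

theorem local_lemma (h : Dn G c f A O H) (pr : Pr f c A i0 i1 j0 j1) {t k : ℤ}
    (ht : i0 < t) (ht' : t < i1) (hk : j0 < k) (hk' : k < j1) (hc : Cn G O (f t) (f k)) :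
    (Center G f O j0 j1 ∧ k = j0 + 3) ∨ (Center G f O i0 i1 ∧ t = i0 + 3) := by
  have hf := h.cyc
  have hc' : Cn G O (f k) (f (t + c)) := by rw [hf.per]; exact hc.symm
  rcases h.allR_or pr with hR | hR <;> rcases h.allL_or pr with hL | hL
  · exact .inl (h.same pr hR hL ht ht' hk hk' hc)
  · exact (h.opposite pr hR hL ht ht' hk hk' hc).elim
  · exact (h.opposite (pr.swap hf) hR (hL.add hf) hk hk' (by omega) (by omega) hc').elim
  · obtain ⟨h1, h2⟩ := h.same (pr.swap hf) hR hL hk hk' (by omega) (by omega) hc'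
    exact .inr ⟨h1.of_add hf, by omega⟩

end Dn

/-- In a 1-tough graph, vertices outside `S` in pairwise different components of the complement of
`S` are at most as many as the vertices of `S`. -/
theorem OneTough.reps [Fintype V] {G : SimpleGraph V} (hT : OneTough G) {S R : Finset V}
    (hS : S.Nonempty) (hRS : ∀ r ∈ R, r ∉ S)
    (hC : ∀ r ∈ R, ∃ C : Set V, r ∈ C ∧ (∀ v ∈ C, ∀ w, w ∉ S → G.Adj v w → w ∈ C) ∧
      ∀ r' ∈ R, r' ∈ C → r' = r) : R.card ≤ S.card := by
  have h1 := hT (S : Set V) (by simpa using hS)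
  rw [Set.ncard_coe_finset] at h1
  refine le_trans ?_ h1
  have hm : ∀ r : R, (r : V) ∈ (S : Set V)ᶜ := fun r => by simpa using hRS r r.2
  rw [← Fintype.card_coe R, ← Nat.card_eq_fintype_card]
  refine Nat.card_le_card_of_injective
    (fun r : R => (G.induce (S : Set V)ᶜ).connectedComponentMk ⟨r, hm r⟩) fun r r' he => ?_
  obtain ⟨C, h2, h3, h4⟩ := hC r r.2
  have he' := SimpleGraph.ConnectedComponent.exact he
  obtain ⟨p⟩ := he'
  have key : ∀ (x y : ((S : Set V)ᶜ : Set V)), (G.induce (S : Set V)ᶜ).Walk x y → (x : V) ∈ C →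
      (y : V) ∈ C := by
    intro x y p
    induction p with
    | nil => exact id
    | @cons u v w h _ ih => exact fun hx => ih (h3 _ hx _ (fun hS => v.2 (Finset.mem_coe.2 hS)) h)
  exact (Subtype.ext (h4 r' r'.2 (key _ _ p h2))).symm

theorem Pth.prefix_of_mem {G : SimpleGraph V} {M : Finset V} {x y w : V} (h : Pth G M x y)
    (hw : w ∈ M) : ∃ M', M' ⊆ M ∧ Pth G M' x w := by
  induction h with
  | single x =>
    obtain rfl : w = x := by simpa using hw
    exact ⟨{w}, subset_rfl, .single w⟩
  | @cons x y z s h1 h2 h3 ih =>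
    rcases Finset.mem_insert.1 hw with rfl | hw
    · exact ⟨{w}, by simp, .single w⟩
    · obtain ⟨M', h4, h5⟩ := ih hw
      exact ⟨insert x M', Finset.insert_subset_insert x h4, .cons h1 (fun h => h2 (h4 h)) h5⟩

theorem Pth.extend {G : SimpleGraph V} {M : Finset V} {x y w : V} {O : Set V} (h : Pth G M x y)
    (hM : ∀ v ∈ M, v ∈ O) (hw : w ∈ O) (ha : G.Adj y w) :
    ∃ M', (∀ v ∈ M', v ∈ O) ∧ Pth G M' x w := by
  by_cases hwM : w ∈ M
  · obtain ⟨M', h1, h2⟩ := h.prefix_of_mem hwM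
    exact ⟨M', fun v hv => hM v (h1 hv), h2⟩
  · refine ⟨M ∪ {w}, fun v hv => ?_, h.append (.single w) ha (by simpa using hwM)⟩
    rcases Finset.mem_union.1 hv with hv | hv
    · exact hM v hv
    · rw [Finset.mem_singleton.1 hv]; exact hw

/-- Cutting a cycle `f` at a set `S` without consecutive vertices gives too many components if
connected vertices always lie in the same arc and some vertex `x` lies in none of these
components. -/
theorem OneTough.arcs [Fintype V] {G : SimpleGraph V} (hT : OneTough G) {c : ℤ} {f : ℤ → V}
    (hf : Cyc G c f) {S O H : Finset V} {x : V} (hx : x ∈ H) (hS : S.Nonempty)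
    (cover : ∀ v, (∃ i, f i = v) ∨ v ∈ O ∨ v ∈ H) (fO : ∀ i, f i ∉ O) (fH : ∀ i, f i ∉ H)
    (OH : Disjoint O H) (HN : ∀ h ∈ H, ∀ v, G.Adj h v → v ∈ S ∨ v ∈ H)
    (hSf : ∀ v ∈ S, ∃ i, f i = v) (hcons : ∀ i, f i ∈ S → f (i + 1) ∉ S)
    (hconn : ∀ i j, f i ∉ S → f j ∉ S → Cn G O (f i) (f j) →
      ∃ j', f j' = f j ∧ ∀ k, (i ≤ k ∨ j' ≤ k) → (k ≤ i ∨ k ≤ j') → f k ∉ S) : False := by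
  have hxf : ∀ i, f i ≠ x := fun i hi => fH i (hi ▸ hx)
  have hinj : Set.InjOn (nxt f) S := by
    intro v hv w hw he
    obtain ⟨i, rfl⟩ := hSf v hv
    obtain ⟨j, rfl⟩ := hSf w hw
    rw [nxt_apply hf, nxt_apply hf] at he
    have := hf.congr_shift he (-1)
    simpa using this
  have hR := hT.reps (S := S) (R := insert x (S.image (nxt f))) hS ?_ ?_
  · rw [Finset.card_insert_of_notMem, Finset.card_image_of_injOn hinj] at hR
    · omega
    · intro hm
      obtain ⟨v, hv, he⟩ := Finset.mem_image.1 hm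
      obtain ⟨i, rfl⟩ := hSf v hv
      rw [nxt_apply hf] at he
      exact hxf _ he
  · intro r hr
    rcases Finset.mem_insert.1 hr with rfl | hr
    · intro h1
      obtain ⟨i, hi⟩ := hSf _ h1
      exact hxf i hi
    · obtain ⟨v, hv, rfl⟩ := Finset.mem_image.1 hr
      obtain ⟨i, rfl⟩ := hSf v hv
      rw [nxt_apply hf]
      exact hcons i hv
  · intro r hr
    rcases Finset.mem_insert.1 hr with rfl | hr
    · refine ⟨H, hx, fun v hv w hw ha => (HN v hv w ha).resolve_left hw, fun r' hr' hr'H => ?_⟩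
      rcases Finset.mem_insert.1 hr' with rfl | hr'
      · rfl
      · obtain ⟨v, hv, rfl⟩ := Finset.mem_image.1 hr'
        obtain ⟨i, rfl⟩ := hSf v hv
        rw [nxt_apply hf] at hr'H
        exact absurd hr'H (fH _)
    · obtain ⟨v, hv, rfl⟩ := Finset.mem_image.1 hr
      obtain ⟨i, rfl⟩ := hSf v hv
      rw [nxt_apply hf]
      set arc : Set V := {v | ∃ j, i + 1 ≤ j ∧ f j = v ∧ ∀ k, i + 1 ≤ k → k ≤ j → f k ∉ S} with harc
      have harcS : ∀ v ∈ arc, v ∉ S := by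
        rintro v ⟨j, h1, rfl, h2⟩
        exact h2 j h1 le_rfl
      have hstep : ∀ v ∈ arc, ∀ l, f l ∉ S → Cn G O v (f l) → f l ∈ arc := by
        rintro v ⟨j, h1, rfl, h2⟩ l hl hc
        obtain ⟨l', h3, h4⟩ := hconn j l (h2 j h1 le_rfl) hl hc
        rw [← h3]
        have h5 : i + 1 ≤ l' := by
          by_contra h5
          exact h4 i (by omega) (by omega) hv
        refine ⟨l', h5, rfl, fun k hk hk' => ?_⟩
        by_cases h6 : k ≤ j
        · exact h2 k hk h6
        · exact h4 k (by omega) (by omega)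
      refine ⟨arc ∪ {o | o ∈ O ∧ ∃ v ∈ arc, ∃ M p, Pth G M p o ∧ (∀ w ∈ M, w ∈ O) ∧ G.Adj v p},
        .inl ⟨i + 1, le_rfl, rfl, fun k hk hk' => ?_⟩, ?_, ?_⟩
      · rw [show k = i + 1 by omega]
        exact hcons i hv
      · rintro v (hv' | ⟨hvO, u, hu, M, p, h1, h2, h3⟩) w hw ha
        · rcases cover w with ⟨l, rfl⟩ | hO | hH
          · exact .inl (hstep v hv' l hw (.inl ha))
          · exact .inr ⟨hO, v, hv', {w}, w, .single w, by simpa using hO, ha⟩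
          · rcases HN w hH v ha.symm with h3 | h3
            · exact absurd h3 (harcS v hv')
            · obtain ⟨j, -, rfl, -⟩ := hv'
              exact absurd h3 (fH j)
        · rcases cover w with ⟨l, rfl⟩ | hO | hH
          · exact .inl (hstep u hu l hw (.inr ⟨M, p, v, h1, h2, h3, ha⟩))
          · obtain ⟨M', h4, h5⟩ := h1.extend (O := (O : Set V)) h2 hO ha
            exact .inr ⟨hO, u, hu, M', p, h5, h4, h3⟩
          · rcases HN w hH v ha.symm with h3 | h3
            · obtain ⟨j, rfl⟩ := hSf v h3
              exact absurd hvO (fO j)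
            · exact absurd h3 (Finset.disjoint_left.1 OH hvO)
      · intro r' hr' hr'C
        rcases Finset.mem_insert.1 hr' with rfl | hr'
        · rcases hr'C with ⟨j, -, h1, -⟩ | ⟨h1, -⟩
          · exact absurd h1 (hxf j)
          · exact absurd hx (Finset.disjoint_left.1 OH h1)
        · obtain ⟨w, hw, rfl⟩ := Finset.mem_image.1 hr'
          obtain ⟨m, rfl⟩ := hSf w hw
          rw [nxt_apply hf] at hr'C ⊢
          rcases hr'C with ⟨j, h1, h2, h3⟩ | ⟨h1, -⟩
          · by_cases h4 : j = i + 1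
            · rw [← h2, h4]
            · have h5 := hf.congr_shift h2 (-1)
              rw [add_neg_cancel_right] at h5
              exact absurd (h5 ▸ hw) (h3 (j + -1) (by omega) (by omega))
          · exact absurd h1 (fO _)

theorem exists_prev {P : ℤ → Prop} {a b : ℤ} (hab : a ≤ b) (ha : P a) :
    ∃ k, a ≤ k ∧ k ≤ b ∧ P k ∧ ∀ j, k < j → j ≤ b → ¬ P j := by
  obtain ⟨k, h1, h2, h3, h4⟩ := exists_next (P := fun k => P (-k)) (a := -b) (b := -a) (by omega)
    (by simpa using ha)
  refine ⟨-k, by omega, by omega, h3, fun j hj hj' hP => ?_⟩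
  exact h4 (-j) (by omega) (by omega) (by simpa using hP)

theorem Cyc.exists_gap {G : SimpleGraph V} {c : ℤ} {f : ℤ → V} (hf : Cyc G c f) {A : Finset V}
    (hA : ∃ i, f i ∈ A) (i : ℤ) (hi : f i ∉ A) :
    ∃ a b, a < i ∧ i < b ∧ b ≤ a + c ∧ f a ∈ A ∧ f b ∈ A ∧ ∀ k, a < k → k < b → f k ∉ A := by
  obtain ⟨m, hm⟩ := hA
  have hc := hf.three_le
  obtain ⟨x, hx1, hx2, hx3⟩ := hf.exists_rep m (i - c)
  obtain ⟨a, ha1, ha2, ha3, ha4⟩ := exists_prev (P := fun k => f k ∈ A) (a := x) (b := i) (by omega)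
    (by rwa [hx3])
  have hai : a ≠ i := by rintro rfl; exact hi ha3
  obtain ⟨b, hb1, hb2, hb3, hb4⟩ := exists_next (P := fun k => f k ∈ A) (a := i) (b := a + c)
    (by omega) (by rwa [hf.per])
  have hbi : b ≠ i := by rintro rfl; exact hi hb3
  refine ⟨a, b, by omega, by omega, hb2, ha3, hb3, fun k hk hk' => ?_⟩
  rcases le_or_gt k i with h | h
  · exact ha4 k hk h
  · exact hb4 k h.le hk'

namespace Dn

variable [Fintype V] {G : SimpleGraph V} {c : ℤ} {f : ℤ → V} {A O H : Finset V}

theorem not_tough (h : Dn G c f A O H) {G' : SimpleGraph V} (hT : OneTough G') (hf' : Cyc G' c f) (hH : H.Nonempty)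
    (hA : A.Nonempty) (hs : ∀ i, f (i - 1) ∈ A → f (i + 1) ∈ A → ∀ v, G'.Adj (f i) v → v ∈ A)
    (hN : ∀ h ∈ H, ∀ v, G'.Adj h v → v ∈ A ∨ v ∈ H)
    (hG : ∀ i j, f i ∉ A → f j ∉ A → f i ∉ sing f A → f j ∉ sing f A → Cn G' O (f i) (f j) →
      Cn G O (f i) (f j)) : False := by
  have hf := h.cyc
  obtain ⟨x, hx⟩ := hH
  have hA' : ∃ i, f i ∈ A := by
    obtain ⟨v, hv⟩ := hA
    obtain ⟨i, rfl⟩ := h.A_sub v hv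
    exact ⟨i, hv⟩
  set P : Finset V := Finset.univ.filter fun v => ∃ m, f m = v ∧ Center G f O (m - 3) (m + 3) ∧
    Gap f A (m - 3) (m + 3) with hP
  have hPm : ∀ k, f k ∈ P → Center G f O (k - 3) (k + 3) ∧ Gap f A (k - 3) (k + 3) := by
    intro k hk
    obtain ⟨m, hm, ⟨hc1, hc2⟩, hg⟩ := (Finset.mem_filter.1 hk).2
    have hsh := fun x => hf.congr_shift hm.symm x
    refine ⟨⟨by ring, fun a b ha hb => ?_⟩, ?_, ?_, by omega, fun l hl hl' => ?_⟩
    · have := hc2 (m + (a - k)) (m + (b - k)) (by omega) (by omega)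
      rwa [← hsh, ← hsh, add_sub_cancel, add_sub_cancel] at this
    · have := hg.left
      rwa [show k - 3 = k + -3 by ring, hsh]
    · have := hg.right
      rwa [hsh]
    · have := hg.not_mem (m + (l - k)) (by omega) (by omega)
      rwa [← hsh, add_sub_cancel] at this
  refine hT.arcs hf' (S := A ∪ P) (O := O) hx (hA.mono Finset.subset_union_left) h.cover h.fO h.fH
    h.OH (fun y hy v hv => (hN y hy v hv).imp_left fun h => Finset.mem_union_left _ h) ?_ ?_ ?_
  · intro v hv
    rcases Finset.mem_union.1 hv with hv | hv
    · exact h.A_sub v hv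
    · obtain ⟨m, hm, -⟩ := (Finset.mem_filter.1 hv).2
      exact ⟨m, hm⟩
  · intro i hi hi'
    rcases Finset.mem_union.1 hi with hi | hi <;> rcases Finset.mem_union.1 hi' with hi' | hi'
    · exact h.not_consec hi hi'
    · exact (hPm _ hi').2.not_mem i (by omega) (by omega) hi
    · exact (hPm _ hi).2.not_mem (i + 1) (by omega) (by omega) hi'
    · have := (hPm _ hi').2.left
      exact (hPm _ hi).2.not_mem (i + 1 - 3) (by omega) (by omega) this
  · intro i j hi hj hc
    have hiA : f i ∉ A := fun h => hi (Finset.mem_union_left _ h)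
    have hjA : f j ∉ A := fun h => hj (Finset.mem_union_left _ h)
    have hsing : ∀ i a b, a < i → i < b → f a ∈ A → f b ∈ A → b < a + 3 → ∀ w, w ∉ A →
        ¬ Cn G' O (f i) w := by
      intro i a b h1 h2 h3 h4 h5 w hw hc
      obtain rfl : a = i - 1 := by omega
      obtain rfl : b = i + 1 := by omega
      rcases hc with hc | ⟨M, p, q, h6, h7, h8, h9⟩
      · exact hw (hs i h3 h4 _ hc)
      · obtain ⟨l, hl⟩ := h.A_sub _ (hs i h3 h4 _ h8)
        exact h.fO l (hl ▸ h7 _ h6.left_mem)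
    obtain ⟨a, b, h1, h2, h3, h4, h5, h6⟩ := hf.exists_gap hA' i hiA
    have hab : a + 3 ≤ b := by
      by_contra hn
      exact hsing i a b h1 h2 h4 h5 (by omega) _ hjA hc
    obtain ⟨j', hj1, hj2, hj3⟩ := hf.exists_rep j a
    rw [← hj3] at hj hjA hc ⊢
    have hja : j' ≠ a := by rintro rfl; exact hjA h4
    have hjb : j' ≠ b := by rintro rfl; exact hjA h5
    have gi : Gap f A a b := ⟨h4, h5, hab, h6⟩
    by_cases hjb' : j' < b
    · refine ⟨j', rfl, fun k hk hk' hkS => ?_⟩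
      have hkA : f k ∉ A := h6 k (by omega) (by omega)
      have hkP := (Finset.mem_union.1 hkS).resolve_left hkA
      obtain ⟨hc1, hg⟩ := hPm k hkP
      have hki : k ≠ i := by rintro rfl; exact hi hkS
      have hkj : k ≠ j' := by rintro rfl; exact hj hkS
      have e1 : ¬ a < k - 3 := fun h => h6 _ h (by omega) hg.left
      have e2 : ¬ k - 3 < a := fun h => hg.not_mem a h (by omega) h4
      have e3 : ¬ k + 3 < b := fun h => h6 _ (by omega) h hg.right
      have e4 : ¬ b < k + 3 := fun h => hg.not_mem b (by omega) h h5
      have hc := hG _ _ hiA hjA (gi.not_sing hf h1 h2) (gi.not_sing hf (by omega) hjb') hc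
      rcases lt_or_gt_of_ne hki with h7 | h7
      · exact hc1.2 j' i (by omega) (by omega) hc.symm
      · exact hc1.2 i j' (by omega) (by omega) hc
    · exfalso
      obtain ⟨a2, b2, g1, g2, g3, g4, g5, g6⟩ := hf.exists_gap hA' j' hjA
      have hab2 : a2 + 3 ≤ b2 := by
        by_contra hn
        exact hsing j' a2 b2 g1 g2 g4 g5 (by omega) _ hiA hc.symm
      have gj : Gap f A a2 b2 := ⟨g4, g5, hab2, g6⟩
      have e1 : ¬ a2 < b := fun h => g6 b h (by omega) h5
      have e2 : ¬ a + c < b2 := fun h' => g6 (a + c) (by omega) h' (by rwa [hf.per])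
      have hpr : Pr f c A a b a2 b2 := ⟨gi, gj, by omega, by omega⟩
      have hc := hG _ _ hiA hjA (gi.not_sing hf h1 h2) (gj.not_sing hf g1 g2) hc
      rcases h.local_lemma hpr h1 h2 g1 g2 hc with ⟨h7, h8⟩ | ⟨h7, h8⟩
      · refine hj (Finset.mem_union_right _ (Finset.mem_filter.2 ⟨Finset.mem_univ _, j', rfl, ?_⟩))
        have := h7.1
        rw [show j' - 3 = a2 by omega, show j' + 3 = b2 by omega]
        exact ⟨h7, gj⟩
      · refine hi (Finset.mem_union_right _ (Finset.mem_filter.2 ⟨Finset.mem_univ _, i, rfl, ?_⟩))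
        have := h7.1
        rw [show i - 3 = a by omega, show i + 3 = b by omega]
        exact ⟨h7, gi⟩

end Dn

namespace IP

variable {G : SimpleGraph V} {f : ℤ → V} {lo c : ℤ} {E : Set V} {S : ℤ → Prop} {v w : V}

theorem sg (hf : Cyc G c f) (a b : ℤ) (h1 : lo ≤ a := by omega) (h2 : a ≤ b := by omega)
    (h3 : b < lo + c := by omega) : IP G f lo c ∅ (fun k => a ≤ k ∧ k ≤ b) (f a) (f b) :=
  IP.seg hf h1 h2 h3

theorem sgr (hf : Cyc G c f) (a b : ℤ) (h1 : lo ≤ a := by omega) (h2 : a ≤ b := by omega)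
    (h3 : b < lo + c := by omega) : IP G f lo c ∅ (fun k => a ≤ k ∧ k ≤ b) (f b) (f a) :=
  (IP.seg hf h1 h2 h3).symm

theorem fw (h : IP G f lo c E S v w) (hf : Cyc G c f) (a b : ℤ) (hadj : G.Adj w (f a))
    (h1 : lo ≤ a := by omega) (h2 : a ≤ b := by omega) (h3 : b < lo + c := by omega)
    (hd : ∀ k, a ≤ k → k ≤ b → ¬ S k := by intro k _ _; omega) :
    IP G f lo c E (fun k => S k ∨ a ≤ k ∧ k ≤ b) v (f b) :=
  h.fwd hf a b hadj h1 h2 h3 hd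

theorem bw (h : IP G f lo c E S v w) (hf : Cyc G c f) (a b : ℤ) (hadj : G.Adj w (f b))
    (h1 : lo ≤ a := by omega) (h2 : a ≤ b := by omega) (h3 : b < lo + c := by omega)
    (hd : ∀ k, a ≤ k → k ≤ b → ¬ S k := by intro k _ _; omega) :
    IP G f lo c E (fun k => S k ∨ a ≤ k ∧ k ≤ b) v (f a) :=
  h.bwd hf a b hadj h1 h2 h3 hd

end IP

namespace Pth

variable {G G' : SimpleGraph V} {Q : Finset V} {x y z : V}

theorem imp (h : Pth G Q x y) (hG : ∀ v w, v ∈ Q → w ∈ Q → G.Adj v w → G'.Adj v w) :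
    Pth G' Q x y := by
  induction h with
  | single x => exact .single x
  | @cons a b c s hab has h ih =>
    refine .cons (hG _ _ (by simp) (by simp [h.left_mem]) hab) has (ih fun v w hv hw => ?_)
    exact hG v w (by simp [hv]) (by simp [hw])

/-- Splitting a path at an inner vertex. -/
theorem split (h : Pth G Q x y) (hz : z ∈ Q) (hx : z ≠ x) (hy : z ≠ y) :
    ∃ Q1 Q2 a b, Pth G Q1 x a ∧ Pth G Q2 b y ∧ G.Adj a z ∧ G.Adj z b ∧ Disjoint Q1 Q2 ∧
      z ∉ Q1 ∧ z ∉ Q2 ∧ Q = insert z (Q1 ∪ Q2) := by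
  induction h with
  | single x => exact absurd (Finset.mem_singleton.1 hz) hx
  | @cons a b d s hab has h ih =>
    have hzs : z ∈ s := (Finset.mem_insert.1 hz).resolve_left hx
    by_cases hzb : z = b
    · subst hzb
      cases h with
      | single => exact absurd rfl hy
      | @cons _ b' _ s' hzb' hzs' h' =>
        refine ⟨{a}, s', a, b', .single a, h', hab, hzb', ?_, ?_, hzs', ?_⟩
        · simp only [Finset.disjoint_singleton_left]
          exact fun h => has (Finset.mem_insert_of_mem h)
        · simpa using hx
        · ext v; simp; tauto
    · obtain ⟨Q1, Q2, a', b', h1, h2, h3, h4, h5, h6, h7, h8⟩ := ih hzs hzb hy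
      rw [h8] at has hzs
      simp only [Finset.mem_insert, Finset.mem_union, not_or] at has
      refine ⟨insert a Q1, Q2, a', b', .cons hab has.2.1 h1, h2, h3, h4, ?_, ?_, h7, ?_⟩
      · rw [Finset.disjoint_insert_left]
        exact ⟨has.2.2, h5⟩
      · simp [hx, h6]
      · rw [h8]; ext v; simp; tauto

theorem exists_enum (h : Pth G Q x y) : ∃ g : ℕ → V, g 0 = x ∧ g (Q.card - 1) = y ∧
    (∀ i j, i < Q.card → j < Q.card → g i = g j → i = j) ∧
    (∀ i, i + 1 < Q.card → G.Adj (g i) (g (i + 1))) ∧ ∀ v, v ∈ Q ↔ ∃ i < Q.card, g i = v := by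
  induction h with
  | single x => exact ⟨fun _ => x, rfl, rfl, by simp, by simp, by simp [eq_comm]⟩
  | @cons a b d s hab has h ih =>
    obtain ⟨g, h1, h2, h3, h4, h5⟩ := ih
    have hpos : 0 < s.card := Finset.card_pos.2 ⟨b, h.left_mem⟩
    rw [Finset.card_insert_of_notMem has]
    have hne : ∀ i < s.card, g i ≠ a := fun i hi he => has ((h5 a).2 ⟨i, hi, he⟩)
    refine ⟨fun i => if i = 0 then a else g (i - 1), by simp, ?_, ?_, ?_, ?_⟩
    · simpa [hpos.ne'] using h2
    · intro i j hi hj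
      dsimp only
      split_ifs with e1 e2 e2
      · omega
      · exact fun he => absurd he.symm (hne _ (by omega))
      · exact fun he => absurd he (hne _ (by omega))
      · intro he
        have := h3 _ _ (by omega) (by omega) he
        omega
    · intro i hi
      simp only [Nat.add_sub_cancel, Nat.succ_ne_zero, if_false]
      by_cases hi0 : i = 0
      · subst hi0; simpa [h1] using hab
      · rw [if_neg hi0]
        have := h4 (i - 1) (by omega)
        rwa [show i - 1 + 1 = i by omega] at this
    · intro v
      rw [Finset.mem_insert, h5]
      constructor
      · rintro (rfl | ⟨i, hi, rfl⟩)
        · exact ⟨0, by omega, by simp⟩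
        · exact ⟨i + 1, by omega, by simp⟩
      · rintro ⟨i, hi, rfl⟩
        dsimp only
        split_ifs with e1
        · exact .inl rfl
        · exact .inr ⟨i - 1, by omega, rfl⟩

theorem exists_cyc (h : Pth G Q x y) (hyx : G.Adj y x) (hQ : 3 ≤ Q.card) :
    ∃ f, Cyc G Q.card f ∧ ∀ v, v ∈ Q ↔ ∃ i, f i = v := by
  obtain ⟨g, h1, h2, h3, h4, h5⟩ := h.exists_enum
  have hb : ∀ i : ℤ, 0 ≤ i % Q.card ∧ i % Q.card < Q.card := fun i =>
    ⟨Int.emod_nonneg _ (by omega), Int.emod_lt_of_pos _ (by omega)⟩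
  refine ⟨fun i => g (i % Q.card).toNat, ⟨by omega, fun i => by simp, fun i j he => ?_,
    fun i => ?_⟩, fun v => ?_⟩
  · have b1 := hb i
    have b2 := hb j
    have := h3 _ _ (by omega) (by omega) he
    exact Int.ModEq.dvd (show j % Q.card = i % Q.card by omega)
  · have b1 := hb i
    by_cases hl : i % Q.card + 1 < Q.card
    · have : (i + 1) % Q.card = i % Q.card + 1 := by
        rw [← Int.emod_add_emod, Int.emod_eq_of_lt (by omega) hl]
      rw [this, show (i % Q.card + 1).toNat = (i % Q.card).toNat + 1 by omega]
      exact h4 _ (by omega)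
    · have : (i + 1) % Q.card = 0 := by
        rw [← Int.emod_add_emod, show i % Q.card + 1 = Q.card by omega, Int.emod_self]
      rw [this, show (i % Q.card).toNat = Q.card - 1 by omega, h2]
      simpa [h1] using hyx
  · rw [h5]
    constructor
    · rintro ⟨i, hi, rfl⟩
      refine ⟨i, ?_⟩
      dsimp only
      rw [Int.emod_eq_of_lt (by omega) (by omega), Int.toNat_natCast]
    · rintro ⟨i, rfl⟩
      have b1 := hb i
      exact ⟨_, by omega, rfl⟩

end Pth

/-- The graph obtained by keeping only the cycle edges at the vertices of `Z`. -/
def Gz (G : SimpleGraph V) (f : ℤ → V) (Z : Finset V) : SimpleGraph V where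
  Adj v w := G.Adj v w ∧
    (v ∈ Z ∨ w ∈ Z → ∃ i, f i = v ∧ f (i + 1) = w ∨ f i = w ∧ f (i + 1) = v)
  symm := ⟨fun v w h => ⟨h.1.symm, fun hm => by
    obtain ⟨i, hi⟩ := h.2 hm.symm
    exact ⟨i, hi.symm⟩⟩⟩
  loopless := ⟨fun v h => G.loopless.irrefl v h.1⟩

theorem Cyc.gz {G : SimpleGraph V} {c : ℤ} {f : ℤ → V} (h : Cyc G c f) (Z : Finset V) :
    Cyc (Gz G f Z) c f :=
  ⟨h.three_le, h.per, h.inj, fun i => ⟨h.adj i, fun _ => ⟨i, .inl ⟨rfl, rfl⟩⟩⟩⟩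

namespace Gz

variable {G : SimpleGraph V} {c : ℤ} {f : ℤ → V} {Z Z' Q : Finset V} {s t y v w : V}

theorem anti (hZ : Z' ⊆ Z) (h : (Gz G f Z).Adj v w) : (Gz G f Z').Adj v w :=
  ⟨h.1, fun hm => h.2 (hm.imp (@hZ _) (@hZ _))⟩

theorem of_notMem (h : G.Adj v w) (hv : v ∉ Z) (hw : w ∉ Z) : (Gz G f Z).Adj v w :=
  ⟨h, fun hm => (hm.elim hv hw).elim⟩

theorem adj_mem (hf : Cyc G c f) {i : ℤ} (h : (Gz G f Z).Adj (f i) v) (hi : f i ∈ Z) :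
    v = f (i - 1) ∨ v = f (i + 1) := by
  obtain ⟨j, ⟨h1, h2⟩ | ⟨h1, h2⟩⟩ := h.2 (.inl hi)
  · exact .inr (by rw [← h2, hf.congr_shift h1])
  · refine .inl ?_
    have := hf.congr_shift h2 (-1)
    rw [← h1, show i - 1 = i + -1 by ring, ← this]; congr 1; ring

/-- A path through a vertex `f i` all of whose edges in the graph are cycle edges. -/
theorem split (hf : Cyc G c f) (h : Pth (Gz G f Z) Q s t) {i : ℤ} (hi : f i ∈ Z) (hQ : f i ∈ Q)
    (hs : f i ≠ s) (ht : f i ≠ t) :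
    ∃ Q1 Q2 a b, Pth (Gz G f Z) Q1 s a ∧ Pth (Gz G f Z) Q2 b t ∧ Disjoint Q1 Q2 ∧
      f i ∉ Q1 ∧ f i ∉ Q2 ∧ Q = insert (f i) (Q1 ∪ Q2) ∧ G.Adj (f i) a ∧ G.Adj (f i) b ∧ 
      (a = f (i - 1) ∨ a = f (i + 1)) ∧ (b = f (i - 1) ∨ b = f (i + 1)) := by
  obtain ⟨Q1, Q2, a, b, h1, h2, h3, h4, h5, h6, h7, h8⟩ := h.split hQ hs ht
  exact ⟨Q1, Q2, a, b, h1, h2, h5, h6, h7, h8, h3.1.symm, h4.1, adj_mem hf h3.symm hi,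
    adj_mem hf h4 hi⟩

/-- Rotating a path at a vertex of `Z` adjacent to its first vertex. -/
theorem rotate (hf : Cyc G c f) (h : Pth (Gz G f Z) Q s t) {i : ℤ} (hi : f i ∈ Z) (hQ : f i ∈ Q)
    (hs : s ∉ Z) (ht : t ∉ Z) (hst : G.Adj (f i) s) (hZ : Z' ⊆ Z) (hi' : f i ∉ Z') :
    ∃ a, (a = f (i - 1) ∨ a = f (i + 1)) ∧ a ≠ t ∧ Pth (Gz G f Z') Q a t := by
  obtain ⟨Q1, Q2, a, b, h1, h2, h3, h4, h5, rfl, h7, h8, h9, h10⟩ := split hf h hi hQ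
    (fun e => hs (e ▸ hi)) (fun e => ht (e ▸ hi))
  have hb : (Gz G f Z').Adj (f i) b := by
    obtain rfl | rfl := h10
    · exact ⟨h8, fun _ => ⟨i - 1, .inr ⟨rfl, by simp⟩⟩⟩
    · exact ⟨h8, fun _ => ⟨i, .inl ⟨rfl, rfl⟩⟩⟩
  have h1' := h1.symm.imp (G' := Gz G f Z') fun _ _ _ _ => anti hZ
  have h2' := h2.imp (G' := Gz G f Z') fun _ _ _ _ => anti hZ
  have p1 := h1'.append (.single (f i)) (of_notMem hst.symm (fun h => hs (hZ h)) hi')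
    (by simpa using h4)
  have p2 := p1.append h2' hb (by
    rw [Finset.disjoint_union_left]; exact ⟨h3, by simpa using h5⟩)
  refine ⟨a, h9, ?_, ?_⟩
  · rintro rfl
    exact Finset.disjoint_left.1 h3 h1.right_mem h2.right_mem
  · convert p2 using 1
    ext v; simp

/-- Rotating a path at a vertex of `Z` adjacent to both its ends. -/
theorem rotate₂ (hf : Cyc G c f) (h : Pth (Gz G f Z) Q s t) {i : ℤ} (hi : f i ∈ Z) (hQ : f i ∈ Q)
    (hs : s ∉ Z) (ht : t ∉ Z) (hs' : G.Adj (f i) s) (ht' : G.Adj (f i) t) (hZ : Z' ⊆ Z)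
    (hi' : f i ∉ Z') :
    ∃ a b, (a = f (i - 1) ∨ a = f (i + 1)) ∧ (b = f (i - 1) ∨ b = f (i + 1)) ∧ a ≠ b ∧
      Pth (Gz G f Z') Q a b := by
  obtain ⟨Q1, Q2, a, b, h1, h2, h3, h4, h5, rfl, h7, h8, h9, h10⟩ := split hf h hi hQ
    (fun e => hs (e ▸ hi)) (fun e => ht (e ▸ hi))
  have h1' := h1.symm.imp (G' := Gz G f Z') fun _ _ _ _ => anti hZ
  have h2' := h2.symm.imp (G' := Gz G f Z') fun _ _ _ _ => anti hZ
  have p1 := h1'.append (.single (f i)) (of_notMem hs'.symm (fun h => hs (hZ h)) hi')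
    (by simpa using h4)
  have p2 := p1.append h2' (of_notMem ht' hi' (fun h => ht (hZ h))) (by
    rw [Finset.disjoint_union_left]; exact ⟨h3, by simpa using h5⟩)
  refine ⟨a, b, h9, h10, ?_, ?_⟩
  · rintro rfl
    exact Finset.disjoint_left.1 h3 h1.right_mem h2.left_mem
  · convert p2 using 1
    ext v; simp

end Gz

/-- The neighbourhood of a vertex as a finset. -/
def nb [Fintype V] (G : SimpleGraph V) (v : V) : Finset V := Finset.univ.filter fun w => G.Adj v w

theorem mem_nb [Fintype V] {G : SimpleGraph V} {v w : V} : w ∈ nb G v ↔ G.Adj v w := by simp [nb]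

theorem card_nb [Fintype V] (G : SimpleGraph V) (v : V) : (nb G v).card = deg G v :=
  (deg_eq G v).symm

theorem mem_sing [Fintype V] {G : SimpleGraph V} {c : ℤ} {f : ℤ → V} (hf : Cyc G c f)
    {A : Finset V} {i : ℤ} : f i ∈ sing f A ↔ f (i - 1) ∈ A ∧ f (i + 1) ∈ A := by
  simp only [sing, Finset.mem_filter, Finset.mem_univ, true_and]
  constructor
  · rintro ⟨m, hm, h3, h4⟩
    rw [show m - 1 = m + -1 by ring, hf.congr_shift hm] at h3
    rw [hf.congr_shift hm] at h4
    exact ⟨h3, h4⟩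
  · exact fun h => ⟨i, rfl, h.1, h.2⟩

theorem exists_of_mem_sing [Fintype V] {f : ℤ → V} {A : Finset V} {v : V} (h : v ∈ sing f A) :
    ∃ i, f i = v ∧ f (i - 1) ∈ A ∧ f (i + 1) ∈ A := by simpa [sing] using h

theorem sing_mono [Fintype V] {f : ℤ → V} {A B : Finset V} (h : A ⊆ B) : sing f A ⊆ sing f B := by
  intro v hv
  obtain ⟨i, h1, h2, h3⟩ := exists_of_mem_sing hv
  simp only [sing, Finset.mem_filter, Finset.mem_univ, true_and]
  exact ⟨i, h1, h h2, h h3⟩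

theorem Pth.two_le_card {G : SimpleGraph V} {Q : Finset V} {s t : V} (h : Pth G Q s t)
    (hst : s ≠ t) : 2 ≤ Q.card := by
  by_contra hc
  exact hst (h.eq_of_card_le_one (by omega))

/-- A vertex `u` of degree `k` off a longest cycle `f` of a graph in which no path can be closed to
a cycle longer than `f`; `O` is the set of the other vertices off the cycle. -/
structure Bs [Fintype V] (G : SimpleGraph V) (c : ℤ) (k : ℕ) (f : ℤ → V) (u : V)
    (O : Finset V) : Prop where
  cyc : Cyc G c f
  off : ∀ i, f i ≠ u
  deg : deg G u = k
  cover : ∀ v, (∃ i, f i = v) ∨ v ∈ O ∨ v = u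
  fO : ∀ i, f i ∉ O
  uO : u ∉ O
  max : ∀ Q x y, Pth G Q x y → G.Adj y x → 3 ≤ Q.card → (Q.card : ℤ) ≤ c
  dom : ∀ f, Cyc G c f → ∀ v, (∀ i, f i ≠ v) → ∀ w, G.Adj v w → ∃ i, f i = w

/-- The cycle `f` as a finset. -/
def cyf (f : ℤ → V) (c : ℤ) : Finset V := seg f 0 (c - 1)

theorem Cyc.mem_cyf {G : SimpleGraph V} {c : ℤ} {f : ℤ → V} (hf : Cyc G c f) {v : V} :
    v ∈ cyf f c ↔ ∃ i, f i = v := by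
  unfold cyf
  rw [mem_seg]
  constructor
  · rintro ⟨i, -, -, h⟩; exact ⟨i, h⟩
  · rintro ⟨i, rfl⟩
    obtain ⟨j, h1, h2, h3⟩ := hf.exists_rep i 0
    exact ⟨j, h1, by omega, h3⟩

theorem Cyc.card_cyf {G : SimpleGraph V} {c : ℤ} {f : ℤ → V} (hf : Cyc G c f) :
    ((cyf f c).card : ℤ) = c := by
  unfold cyf
  have := hf.three_le
  rw [hf.card_seg (by omega) (by omega)]
  omega

namespace Bs

variable [Fintype V] {G : SimpleGraph V} {c : ℤ} {k : ℕ} {f : ℤ → V} {u : V} {O : Finset V}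
  {Q : Finset V} {s t : V}

theorem card_univ (B : Bs G c k f u O) : (Fintype.card V : ℤ) = c + 1 + O.card := by
  have h1 : (Finset.univ : Finset V) = insert u (cyf f c ∪ O) := by
    ext v
    simp only [Finset.mem_univ, Finset.mem_insert, Finset.mem_union, true_iff, B.cyc.mem_cyf]
    have := B.cover v
    tauto
  rw [← Finset.card_univ, h1, Finset.card_insert_of_notMem, Finset.card_union_of_disjoint]
  · push_cast
    rw [B.cyc.card_cyf]; ring
  · rw [Finset.disjoint_left]
    intro v hv
    obtain ⟨i, rfl⟩ := B.cyc.mem_cyf.1 hv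
    exact B.fO i
  · simp only [Finset.mem_union, B.cyc.mem_cyf, not_or, not_exists]
    exact ⟨B.off, B.uO⟩

theorem nb_sub (B : Bs G c k f u O) {v : V} (h : G.Adj u v) : ∃ i, f i = v :=
  B.dom f B.cyc u B.off v h

theorem full (B : Bs G c k f u O) (h : Pth G Q s t) (hs : G.Adj u s) (ht : G.Adj u t)
    (hst : s ≠ t) (hu : u ∉ Q) : (Q.card : ℤ) < c := by
  have h2 := h.two_le_card hst
  have h1 := B.max _ _ _ (Pth.cons hs hu h) ht.symm (by
    rw [Finset.card_insert_of_notMem hu]; omega)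
  rw [Finset.card_insert_of_notMem hu] at h1
  push_cast at h1
  omega

theorem other (B : Bs G c k f u O) (h : Pth G Q s t) (hs : G.Adj u s) (ht : G.Adj u t)
    (hst : s ≠ t) (hu : u ∉ Q) (hc : (Q.card : ℤ) + 1 = c) :
    ∃ g, Cyc G c g ∧ ∀ v, (∃ i, g i = v) ↔ v ∈ Q ∨ v = u := by
  have h2 := h.two_le_card hst
  obtain ⟨g, h3, h4⟩ := (Pth.cons hs hu h).exists_cyc ht.symm (by
    rw [Finset.card_insert_of_notMem hu]; omega)
  rw [Finset.card_insert_of_notMem hu] at h3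
  refine ⟨g, ?_, fun v => ?_⟩
  · push_cast at h3; rwa [hc] at h3
  · rw [← h4]; simp [or_comm]

/-- The cycle itself, opened between two consecutive vertices. -/
theorem pth_cyc (B : Bs G c k f u O) (Z : Finset V) (i : ℤ) :
    Pth (Gz G f Z) (cyf f c) (f (i + 1)) (f i) := by
  have hf := B.cyc.gz Z
  have := hf.three_le
  have h1 := hf.pth (a := i + 1) (b := i + c) (by omega) (by omega)
  rw [hf.per] at h1
  convert h1 using 1
  ext v
  rw [B.cyc.mem_cyf, mem_seg]
  constructor
  · rintro ⟨j, rfl⟩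
    obtain ⟨l, h1, h2, h3⟩ := B.cyc.exists_rep j (i + 1)
    exact ⟨l, h1, by omega, h3⟩
  · rintro ⟨j, -, -, h⟩; exact ⟨j, h⟩

end Bs

/-- The graph of allowed edges, the attachment set `X` and the set `Y` of the vertices between two
vertices of `X`, for a vertex `u` off a longest cycle. Paths ending in `X` can be transformed to
paths ending in the neighbourhood of `u`. -/
structure Hp [Fintype V] (G : SimpleGraph V) (c : ℤ) (f : ℤ → V) (u : V) (X Y : Finset V) :
    Prop where
  Yeq : Y = sing f X
  sub : ∀ v, G.Adj u v → v ∈ X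
  ran : ∀ v ∈ X, ∃ i, f i = v
  nocons : ∀ i, f i ∈ X → f (i + 1) ∉ X
  disj : ∀ y ∈ Y, y ∉ X
  HN : ∀ y ∈ Y, ∀ v, G.Adj y v → v ∈ X
  hop : ∀ Q s t, Pth (Gz G f Y) Q s t → s ∈ X → t ∈ X → s ≠ t → Y ⊆ Q →
    ∃ s' t', s' ≠ t' ∧ G.Adj u s' ∧ G.Adj u t' ∧ Pth G Q s' t'
  hopY : ∀ i, f i ∈ Y →
    ∃ s' t', s' ≠ t' ∧ G.Adj u s' ∧ G.Adj u t' ∧ Pth G (seg f (i + 1) (i + c - 1)) s' t'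
  ex : ∀ x ∈ X, ¬ G.Adj u x → ∃ x ∈ X, ¬ G.Adj u x ∧ ∃ w ∈ sing f (nb G u), G.Adj w x

section Closure

variable [Fintype V] (G : SimpleGraph V) (f : ℤ → V) (u : V)

/-- Iterated neighbourhoods: start from the neighbours of `u` and repeatedly add the neighbours of
the cycle vertices enclosed by the current set. -/
def Xs : ℕ → Finset V
  | 0 => nb G u
  | n + 1 => Finset.univ.filter fun v => G.Adj u v ∨ ∃ y ∈ sing f (Xs n), G.Adj y v

variable {G f u}

theorem mem_Xs_succ {n : ℕ} {v : V} :
    v ∈ Xs G f u (n + 1) ↔ G.Adj u v ∨ ∃ y ∈ sing f (Xs G f u n), G.Adj y v := by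
  rw [Xs]; simp

theorem Xs_mono (n : ℕ) : Xs G f u n ⊆ Xs G f u (n + 1) := by
  induction n with
  | zero => intro v hv; rw [mem_Xs_succ]; exact .inl (mem_nb.1 hv)
  | succ n ih =>
    intro v hv
    rw [mem_Xs_succ] at hv ⊢
    exact hv.imp_right fun ⟨y, h1, h2⟩ => ⟨y, sing_mono ih h1, h2⟩

/-- The enclosed vertices, with index shift. -/
def Ys (G : SimpleGraph V) (f : ℤ → V) (u : V) : ℕ → Finset V
  | 0 => ∅
  | n + 1 => sing f (Xs G f u n)

theorem Ys_mono (n : ℕ) : Ys G f u n ⊆ Ys G f u (n + 1) := by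
  cases n with
  | zero => exact Finset.empty_subset _
  | succ n => exact sing_mono (Xs_mono n)

theorem mem_Xs {n : ℕ} {v : V} : v ∈ Xs G f u n ↔ G.Adj u v ∨ ∃ y ∈ Ys G f u n, G.Adj y v := by
  cases n with
  | zero => simp [Xs, Ys, mem_nb]
  | succ n => exact mem_Xs_succ

variable {c : ℤ} {k : ℕ} {O : Finset V}

/-- The statement that paths with ends in the `n`-th set can be moved. -/
def HopAt (G : SimpleGraph V) (f : ℤ → V) (u : V) (n : ℕ) : Prop :=
  ∀ Q s t, Pth (Gz G f (Ys G f u n)) Q s t → s ∈ Xs G f u n → t ∈ Xs G f u n → s ≠ t →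
    Ys G f u n ⊆ Q → ∃ s' t', s' ≠ t' ∧ G.Adj u s' ∧ G.Adj u t' ∧ Pth G Q s' t'

theorem Bs.u_notMem_cyf (B : Bs G c k f u O) : u ∉ cyf f c := by
  rw [B.cyc.mem_cyf]
  exact fun ⟨i, hi⟩ => B.off i hi

theorem Bs.sing_sub (B : Bs G c k f u O) (X : Finset V) : sing f X ⊆ cyf f c := by
  intro v hv
  obtain ⟨i, h, -⟩ := exists_of_mem_sing hv
  exact B.cyc.mem_cyf.2 ⟨i, h⟩

theorem Bs.Ys_sub (B : Bs G c k f u O) (n : ℕ) : Ys G f u n ⊆ cyf f c := by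
  cases n with
  | zero => exact Finset.empty_subset _
  | succ n => exact B.sing_sub _

theorem HopAt.nocons (B : Bs G c k f u O) {n : ℕ} (h : HopAt G f u n) (i : ℤ)
    (h1 : f i ∈ Xs G f u n) : f (i + 1) ∉ Xs G f u n := by
  intro h2
  obtain ⟨s', t', h3, h4, h5, h6⟩ := h _ _ _ (B.pth_cyc _ i) h2 h1
    (B.cyc.adj i).ne' (B.Ys_sub n)
  have := B.full h6 h4 h5 h3 B.u_notMem_cyf
  have := B.cyc.card_cyf
  omega

theorem HopAt.indep (B : Bs G c k f u O) {n : ℕ} (h : HopAt G f u n) {y : V}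
    (hy : y ∈ sing f (Xs G f u n)) : y ∉ Xs G f u (n + 1) := by
  have hnc := HopAt.nocons B h
  obtain ⟨i, rfl, hi1, hi2⟩ := exists_of_mem_sing hy
  have hiX : f i ∉ Xs G f u n := fun hh => hnc i hh hi2
  intro hX
  rcases mem_Xs_succ.1 hX with hX | ⟨z, hz, hzy⟩
  · exact hiX (mem_Xs.2 (.inl hX))
  obtain ⟨j, rfl, hj1, hj2⟩ := exists_of_mem_sing hz
  have hjX : f j ∉ Xs G f u n := fun hh => hnc j hh hj2
  have hiY : f i ∉ Ys G f u n := fun hh => hjX (mem_Xs.2 (.inr ⟨_, hh, hzy.symm⟩))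
  have hjY : f j ∉ Ys G f u n := fun hh => hiX (mem_Xs.2 (.inr ⟨_, hh, hzy⟩))
  obtain ⟨j, h1, h2, h3⟩ := B.cyc.exists_rep j (i + 1)
  have hj1' : f (j + 1) ∈ Xs G f u n := by rwa [B.cyc.congr_shift h3]
  rw [← h3] at hzy hjX hjY
  have hne1 : j ≠ i + 1 := by rintro rfl; exact hjX hi2
  have hne2 : j ≠ i + c := by
    rintro rfl; rw [B.cyc.per] at hzy; exact hzy.ne rfl
  have hf := B.cyc.gz (Ys G f u n)
  have hne3 : j + 1 ≠ i + c := by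
    intro he
    rw [he, B.cyc.per] at hj1'
    exact hiX hj1'
  have p1 := (hf.pth (a := i + 1) (b := j) (by omega) (by omega)).append
    (hf.pth (a := j + 1) (b := i + c) (by omega) (by omega)).symm
    (by rw [B.cyc.per]; exact Gz.of_notMem hzy hjY hiY) (by
      rw [Finset.disjoint_left]
      intro v hv hv'
      obtain ⟨a, h1, h2, h3⟩ := mem_seg.1 hv
      obtain ⟨b, h4, h5, h6⟩ := mem_seg.1 hv'
      have := B.cyc.eq_of (h3.trans h6.symm) (by omega) (by omega)
      omega)
  have hQ : seg f (i + 1) j ∪ seg f (j + 1) (i + c) = cyf f c := by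
    ext v
    rw [Finset.mem_union, mem_seg, mem_seg, B.cyc.mem_cyf]
    constructor
    · rintro (⟨a, -, -, h⟩ | ⟨a, -, -, h⟩) <;> exact ⟨a, h⟩
    · rintro ⟨a, rfl⟩
      obtain ⟨b, h4, h5, h6⟩ := B.cyc.exists_rep a (i + 1)
      by_cases hb : b ≤ j
      · exact .inl ⟨b, h4, hb, h6⟩
      · exact .inr ⟨b, by omega, by omega, h6⟩
  rw [hQ] at p1
  obtain ⟨s', t', g3, g4, g5, g6⟩ := h _ _ _ p1 hi2 hj1'
    (B.cyc.ne (by omega) (by omega)) (B.Ys_sub n)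
  have := B.full g6 g4 g5 g3 B.u_notMem_cyf
  have := B.cyc.card_cyf
  omega

theorem Bs.hopAt (B : Bs G c k f u O) (n : ℕ) : HopAt G f u n := by
  induction n with
  | zero =>
    intro Q s t h hs ht hst _
    exact ⟨s, t, hst, mem_nb.1 hs, mem_nb.1 ht, h.imp fun _ _ _ _ h => h.1⟩
  | succ n ih =>
    intro Q s t h hs ht hst hQ
    have hsY : s ∉ Ys G f u (n + 1) := fun hh => HopAt.indep B ih hh hs
    have htY : t ∉ Ys G f u (n + 1) := fun hh => HopAt.indep B ih hh ht
    have key : ∀ {v : V}, v ∈ Xs G f u (n + 1) → v ∉ Xs G f u n → ∃ i, f i ∈ Ys G f u (n + 1) ∧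
        f i ∉ Ys G f u n ∧ G.Adj (f i) v ∧
        ∀ a, a = f (i - 1) ∨ a = f (i + 1) → a ∈ Xs G f u n := by
      intro v hv hv'
      rw [mem_Xs, not_or, not_exists] at hv'
      rcases mem_Xs_succ.1 hv with hv | ⟨y, hy, hyv⟩
      · exact absurd hv hv'.1
      · obtain ⟨i, rfl, hi1, hi2⟩ := exists_of_mem_sing hy
        refine ⟨i, hy, fun hh => hv'.2 _ ⟨hh, hyv⟩, hyv, ?_⟩
        rintro a (rfl | rfl)
        exacts [hi1, hi2]
    have hmono := Ys_mono (G := G) (f := f) (u := u) n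
    by_cases hs1 : s ∈ Xs G f u n
    · by_cases ht1 : t ∈ Xs G f u n
      · exact ih Q s t (h.imp fun _ _ _ _ => Gz.anti hmono) hs1 ht1 hst (hmono.trans hQ)
      · obtain ⟨i, h1, h2, h3, h4⟩ := key ht ht1
        obtain ⟨a, ha, hat, p⟩ := Gz.rotate B.cyc h.symm h1 (hQ h1) htY hsY h3 hmono h2
        exact ih Q _ _ p (h4 a ha) hs1 hat (hmono.trans hQ)
    · obtain ⟨i, h1, h2, h3, h4⟩ := key hs hs1
      by_cases ht1 : t ∈ Xs G f u n
      · obtain ⟨a, ha, hat, p⟩ := Gz.rotate B.cyc h h1 (hQ h1) hsY htY h3 hmono h2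
        exact ih Q _ _ p (h4 a ha) ht1 hat (hmono.trans hQ)
      · obtain ⟨j, g1, g2, g3, g4⟩ := key ht ht1
        by_cases hij : f i = f j
        · obtain ⟨a, b, ha, hb, hab, p⟩ := Gz.rotate₂ B.cyc h h1 (hQ h1) hsY htY h3 (hij ▸ g3)
            hmono h2
          exact ih Q _ _ p (h4 a ha) (h4 b hb) hab (hmono.trans hQ)
        · obtain ⟨a, ha, hat, p⟩ := Gz.rotate B.cyc h h1 (hQ h1) hsY htY h3
            (Finset.erase_subset (f i) (Ys G f u (n + 1))) (by simp)
          have haX := h4 a ha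
          have hmem : ∀ v, v ∈ Ys G f u n → v ∈ (Ys G f u (n + 1)).erase (f i) := fun v hv =>
            Finset.mem_erase.2 ⟨fun he => h2 (he ▸ hv), hmono hv⟩
          obtain ⟨b, hb, hba, p'⟩ := Gz.rotate B.cyc p.symm
            (Finset.mem_erase.2 ⟨Ne.symm hij, g1⟩) (hQ g1)
            (fun hh => htY (Finset.mem_of_mem_erase hh))
            (fun hh => HopAt.indep B ih (Finset.mem_of_mem_erase hh) (Xs_mono n haX)) g3 hmem g2
          exact ih Q _ _ p' (g4 b hb) haX hba (hmono.trans hQ)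

theorem Bs.exists_hp (B : Bs G c k f u O) : ∃ X Y, Hp G c f u X Y := by
  obtain ⟨n, hn⟩ : ∃ n, Xs G f u n = Xs G f u (n + 1) := by
    by_contra! hne
    have hcard : ∀ n, n ≤ (Xs G f u n).card := by
      intro n
      induction n with
      | zero => omega
      | succ n ih =>
        have := Finset.card_lt_card ((Xs_mono n).ssubset_of_ne (hne n))
        omega
    have h1 := hcard (Fintype.card V + 1)
    have h2 := Finset.card_le_univ (Xs G f u (Fintype.card V + 1))
    omega
  have hYX : ∀ m i, f i ∈ sing f (Xs G f u m) → f i ∉ Ys G f u m → 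
      ∃ s' t', s' ≠ t' ∧ G.Adj u s' ∧ G.Adj u t' ∧ Pth G (seg f (i + 1) (i + c - 1)) s' t' := by
    intro m i hi hi'
    have h3 := B.cyc.three_le
    rw [mem_sing B.cyc] at hi
    refine B.hopAt m _ _ _ ((B.cyc.gz _).pth (a := i + 1) (b := i + c - 1) (by omega) (by omega))
      hi.2 ?_ (B.cyc.ne (by omega) (by omega)) ?_
    · rw [show i + c - 1 = i - 1 + c by ring, B.cyc.per]; exact hi.1
    · intro v hv
      obtain ⟨j, rfl⟩ := B.cyc.mem_cyf.1 (B.Ys_sub m hv)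
      obtain ⟨l, h4, h5, h6⟩ := B.cyc.exists_rep j i
      refine mem_seg.2 ⟨l, ?_, by omega, h6⟩
      have : l ≠ i := by rintro rfl; exact hi' (h6 ▸ hv)
      omega
  have hall : ∀ m i, f i ∈ Ys G f u m → 
      ∃ s' t', s' ≠ t' ∧ G.Adj u s' ∧ G.Adj u t' ∧ Pth G (seg f (i + 1) (i + c - 1)) s' t' := by
    intro m i
    induction m with
    | zero => intro h; exact absurd h (Finset.notMem_empty _)
    | succ m ih =>
      intro h
      by_cases h' : f i ∈ Ys G f u m
      · exact ih h'
      · exact hYX m i h h'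
  refine ⟨Xs G f u n, Ys G f u (n + 1), rfl, fun v hv => mem_Xs.2 (.inl hv), ?_,
    HopAt.nocons B (B.hopAt n), ?_, ?_, ?_, hall _, ?_⟩
  · intro v hv
    rcases mem_Xs.1 hv with hv | ⟨y, hy, hyv⟩
    · exact B.nb_sub hv
    · obtain ⟨i, rfl⟩ := B.cyc.mem_cyf.1 (B.Ys_sub n hy)
      by_contra! hne
      obtain ⟨j, hj⟩ := B.dom f B.cyc v hne _ hyv.symm
      obtain ⟨s', t', h1, h2, h3, h4⟩ := hall n i hy
      have h5 := B.cyc.three_le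
      have hcs : ((seg f (i + 1) (i + c - 1)).card : ℤ) + 1 = c := by
        rw [B.cyc.card_seg (by omega) (by omega)]; omega
      obtain ⟨g, hg, hg'⟩ := B.other h4 h2 h3 h1 (fun hu => by
        obtain ⟨l, -, -, hl⟩ := mem_seg.1 hu; exact B.off l hl) hcs
      have hgi : ∀ l, g l ≠ f i := by
        intro l hl
        rcases (hg' (f i)).1 ⟨l, hl⟩ with hm | hm
        · obtain ⟨l', h6, h7, h8⟩ := mem_seg.1 hm
          have := B.cyc.eq_of h8 (by omega) (by omega)
          omega
        · exact B.off i hm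
      obtain ⟨l, hl⟩ := B.dom g hg _ hgi _ hyv
      rcases (hg' v).1 ⟨l, hl⟩ with hm | hm
      · obtain ⟨l', -, -, h8⟩ := mem_seg.1 hm
        exact hne _ h8
      · subst hm
        have : f i ∈ Xs G f v n := mem_Xs.2 (.inl hyv.symm)
        exact HopAt.indep B (B.hopAt n) (Ys_mono n hy) (Xs_mono n this)
  · intro y hy hX
    exact HopAt.indep B (B.hopAt n) hy (Xs_mono n hX)
  · intro y hy v hv
    rw [hn]
    exact mem_Xs_succ.2 (.inr ⟨y, hy, hv⟩)
  · intro Q s t h hs ht hst hQ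
    exact B.hopAt (n + 1) Q s t h (Xs_mono n hs) (Xs_mono n ht) hst hQ
  · intro x hx hux
    have h1 : Xs G f u 0 ≠ Xs G f u 1 := by
      intro he
      have : ∀ m, Xs G f u m = Xs G f u 0 := by
        intro m
        induction m with
        | zero => rfl
        | succ m ih => 
          rw [he]
          ext v
          rw [mem_Xs_succ, mem_Xs_succ, ih]
      rw [this] at hx
      exact hux (mem_nb.1 hx)
    obtain ⟨x', hx', hx''⟩ := Finset.exists_of_ssubset ((Xs_mono 0).ssubset_of_ne h1)
    have hux' : ¬ G.Adj u x' := fun h => hx'' (mem_nb.2 h)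
    obtain ⟨w, hw, hwx⟩ := (mem_Xs_succ.1 hx').resolve_left hux'
    have hsub : Xs G f u 1 ⊆ Xs G f u n := by
      cases n with
      | zero => rw [hn]
      | succ n =>
        clear hn hx hYX hall
        induction n with
        | zero => exact subset_rfl
        | succ n ih => exact ih.trans (Xs_mono _)
    exact ⟨x', hsub hx', hux', w, hw, hwx⟩

end Closure

/-- The situation of the proof: `f` is a longest cycle avoiding the vertex `u` of maximal possible
degree `k` with as many enclosed vertices as possible, and the degree sums of independent triples
are large. -/
structure Ctx [Fintype V] (G : SimpleGraph V) (c : ℤ) (k : ℕ) (f : ℤ → V) (u : V)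
    (O X Y : Finset V) : Prop extends Bs G c k f u O, Hp G c f u X Y where
  mu : ∀ g, Cyc G c g → ∀ v, (∀ i, g i ≠ v) → Paper.deg G v ≤ k
  s3 : ∀ a b d, a ≠ b → a ≠ d → b ≠ d → ¬ G.Adj a b → ¬ G.Adj a d → ¬ G.Adj b d →
    Fintype.card V ≤ Paper.deg G a + Paper.deg G b + Paper.deg G d ∧
    Fintype.card V + (sing f (nb G u)).card ≤ Paper.deg G a + Paper.deg G b + Paper.deg G d + 3
  tmax : ∀ g, Cyc G c g → ∀ v, (∀ i, g i ≠ v) → Paper.deg G v = k →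
    (sing g (nb G v)).card ≤ (sing f (nb G u)).card

theorem Gz.mirror (G : SimpleGraph V) (f : ℤ → V) (Z : Finset V) :
    Gz G (fun i => f (-i)) Z = Gz G f Z := by
  ext v w
  simp only [Gz]
  refine and_congr_right fun _ => imp_congr_right fun _ => ?_
  constructor
  · rintro ⟨i, h | h⟩
    · exact ⟨-(i + 1), .inr ⟨h.2, by rw [← h.1]; congr 1; ring⟩⟩
    · exact ⟨-(i + 1), .inl ⟨h.2, by rw [← h.1]; congr 1; ring⟩⟩
  · rintro ⟨i, h | h⟩
    · exact ⟨-(i + 1), .inr ⟨by rw [neg_neg]; exact h.2, by rw [← h.1]; congr 1; ring⟩⟩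
    · exact ⟨-(i + 1), .inl ⟨by rw [neg_neg]; exact h.2, by rw [← h.1]; congr 1; ring⟩⟩

theorem sing_mirror [Fintype V] (f : ℤ → V) (A : Finset V) : sing (fun i => f (-i)) A = sing f A := by
  ext v
  simp only [sing, Finset.mem_filter, Finset.mem_univ, true_and]
  constructor
  · rintro ⟨i, h1, h2, h3⟩
    exact ⟨-i, h1, by rwa [show -i - 1 = -(i + 1) by ring], by rwa [show -i + 1 = -(i - 1) by ring]⟩
  · rintro ⟨i, h1, h2, h3⟩
    exact ⟨-i, by rwa [neg_neg], by rwa [show -(-i - 1) = i + 1 by ring],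
      by rwa [show -(-i + 1) = i - 1 by ring]⟩

namespace Ctx

variable [Fintype V] {G : SimpleGraph V} {c : ℤ} {k : ℕ} {f : ℤ → V} {u : V} {O X Y : Finset V}

theorem mirror (C : Ctx G c k f u O X Y) : Ctx G c k (fun i => f (-i)) u O X Y where
  cyc := C.cyc.mirror
  off i := C.off _
  deg := C.deg
  cover v := (C.cover v).imp_left fun ⟨i, h⟩ => ⟨-i, by rwa [neg_neg]⟩
  fO i := C.fO _
  uO := C.uO
  max := C.max
  dom := C.dom
  Yeq := by rw [sing_mirror]; exact C.Yeq
  sub := C.sub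
  ran v hv := by
    obtain ⟨i, h⟩ := C.ran v hv
    exact ⟨-i, by rwa [neg_neg]⟩
  nocons i h h' := C.nocons (-(i + 1)) h' (by rwa [show -(i + 1) + 1 = -i by ring])
  disj := C.disj
  HN := C.HN
  hop := by rw [Gz.mirror]; exact C.hop
  hopY i hi := by
    have := C.hopY (-i) hi
    have e : seg (fun i => f (-i)) (i + 1) (i + c - 1) = seg f (-i + 1) (-i + c - 1) := by
      ext v
      rw [mem_seg, mem_seg]
      constructor
      · rintro ⟨j, h1, h2, h3⟩
        exact ⟨-j + c, by omega, by omega, by rw [C.cyc.per]; exact h3⟩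
      · rintro ⟨j, h1, h2, h3⟩
        refine ⟨-j + c, by omega, by omega, ?_⟩
        rw [← h3, ← C.cyc.per]; congr 1; ring
    rw [e]; exact this
  ex := by rw [sing_mirror]; exact C.ex
  mu := C.mu
  s3 := by rw [sing_mirror]; exact C.s3
  tmax := by rw [sing_mirror]; exact C.tmax

variable (C : Ctx G c k f u O X Y)
include C

theorem mem_Y {i : ℤ} : f i ∈ Y ↔ f (i - 1) ∈ X ∧ f (i + 1) ∈ X := by
  rw [C.Yeq, mem_sing C.cyc]

theorem Y_ran {v : V} (h : v ∈ Y) : ∃ i, f i = v ∧ f (i - 1) ∈ X ∧ f (i + 1) ∈ X := by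
  rw [C.Yeq] at h
  exact exists_of_mem_sing h

theorem Y_indep {v w : V} (hv : v ∈ Y) (hw : w ∈ Y) : ¬ G.Adj v w :=
  fun h => C.disj w hw (C.HN v hv w h)

theorem u_notMem_X : u ∉ X := fun h => by
  obtain ⟨i, hi⟩ := C.ran u h
  exact C.off i hi

theorem u_notMem_Y : u ∉ Y := fun h => by
  obtain ⟨i, hi, -⟩ := C.Y_ran h
  exact C.off i hi

theorem O_notMem_X {r : V} (hr : r ∈ O) : r ∉ X := fun h => by
  obtain ⟨i, rfl⟩ := C.ran r h
  exact C.fO i hr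

theorem O_notMem_Y {r : V} (hr : r ∈ O) : r ∉ Y := fun h => by
  obtain ⟨i, rfl, -⟩ := C.Y_ran h
  exact C.fO i hr

theorem O_nb {r v : V} (hr : r ∈ O) (h : G.Adj r v) : ∃ i, f i = v :=
  C.dom f C.cyc r (fun i hi => C.fO i (hi ▸ hr)) v h

theorem u_not_adj_Y {y : V} (hy : y ∈ Y) : ¬ G.Adj u y := fun h => C.disj y hy (C.sub y h)

theorem not_X_of_next {i : ℤ} (h : f (i - 1) ∈ X) : f i ∉ X := by
  have := C.nocons (i - 1) h
  rwa [sub_add_cancel] at this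

theorem not_X_of_prev {i : ℤ} (h : f (i + 1) ∈ X) : f i ∉ X := fun h' => C.nocons i h' h

/-- Connections in terms of a single off-cycle vertex. -/
theorem cn_iff {v w : V} : Cn G O v w ↔ G.Adj v w ∨ ∃ r ∈ O, G.Adj r v ∧ G.Adj r w := by
  constructor
  · rintro (h | ⟨M, p, q, hM, hMO, h1, h2⟩)
    · exact .inl h
    · refine .inr ⟨p, hMO _ hM.left_mem, h1.symm, ?_⟩
      obtain ⟨i, hi⟩ | hpq : (∃ i, f i = q) ∨ p = q := by
        cases hM with
        | single => exact .inr rfl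
        | cons ha hb hc =>
          obtain ⟨i, hi⟩ := C.O_nb (hMO p (by simp)) ha
          exact absurd (hMO _ (Finset.mem_insert_of_mem hc.left_mem)) (hi ▸ C.fO i)
      · exact absurd (hMO _ hM.right_mem) (hi ▸ C.fO i)
      · rwa [hpq]
  · rintro (h | ⟨r, hr, h1, h2⟩)
    · exact .inl h
    · exact .of_common hr h1.symm h2.symm

theorem cn_gz {v w : V} (h : Cn G O v w) (hv : v ∉ X) (hw : w ∉ X) :
    Cn (Gz G f Y) O v w ∧ v ∉ Y ∧ w ∉ Y := by
  have key : ∀ {v w}, Cn G O v w → w ∉ X → v ∉ Y := by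
    intro v w h hw hv
    rcases C.cn_iff.1 h with h | ⟨r, hr, h1, h2⟩
    · exact hw (C.HN v hv w h)
    · exact C.O_notMem_X hr (C.HN v hv r h1.symm)
  have hv' := key h hw
  have hw' := key h.symm hv
  refine ⟨?_, hv', hw'⟩
  rcases C.cn_iff.1 h with h | ⟨r, hr, h1, h2⟩
  · exact .inl (Gz.of_notMem h hv' hw')
  · exact .of_common hr (Gz.of_notMem h1.symm hv' (C.O_notMem_Y hr))
      (Gz.of_notMem h2.symm hw' (C.O_notMem_Y hr))

theorem X_notMem_Y {v : V} (h : v ∈ X) : v ∉ Y := fun hY => C.disj v hY h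

theorem ip_sub {lo : ℤ} {S : ℤ → Prop} {Q : Finset V} (hS : ∀ k, lo ≤ k → k < lo + c → (f k ∈ Q ↔ S k))
    {k0 : ℤ} (hc : ∀ k, lo ≤ k → k < lo + c → S k ∨ k = k0) :
    (cyf f c).erase (f k0) ⊆ Q := by
  intro v hv
  obtain ⟨hv1, hv2⟩ := Finset.mem_erase.1 hv
  obtain ⟨i, rfl⟩ := C.cyc.mem_cyf.1 hv2
  obtain ⟨j, h1, h2, h3⟩ := C.cyc.exists_rep i lo
  rw [← h3] at hv1 ⊢
  exact (hS j h1 h2).2 ((hc j h1 h2).resolve_right fun e => hv1 (e ▸ rfl))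

theorem card_erase (k0 : ℤ) : (((cyf f c).erase (f k0)).card : ℤ) + 1 = c := by
  have h := C.cyc.card_cyf
  have h2 := Finset.card_erase_add_one (C.cyc.mem_cyf.2 ⟨k0, rfl⟩)
  omega

theorem u_notMem_ip {Q : Finset V} (h : ∀ x ∈ Q, (∃ k, f k = x) ∨ x ∈ (O : Set V)) : u ∉ Q := by
  intro hu
  rcases h u hu with ⟨k, hk⟩ | h
  · exact C.off k hk
  · exact C.uO h

/-- No path covering the cycle has both ends in `X`. -/
theorem full_ip {lo : ℤ} {S : ℤ → Prop} {s t : V} (h : IP (Gz G f Y) f lo c O S s t) (hs : s ∈ X)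
    (ht : t ∈ X) (hst : s ≠ t) (hS : ∀ k, lo ≤ k → k < lo + c → S k) : False := by
  obtain ⟨Q, h1, h2, h3⟩ := h
  have hsub : cyf f c ⊆ Q := by
    intro v hv
    obtain ⟨i, rfl⟩ := C.cyc.mem_cyf.1 hv
    obtain ⟨j, h4, h5, h6⟩ := C.cyc.exists_rep i lo
    rw [← h6]
    exact (h2 j h4 h5).2 (hS j h4 h5)
  obtain ⟨s', t', h4, h5, h6, h7⟩ := C.hop Q s t h1 hs ht hst
    ((C.Yeq ▸ C.sing_sub X).trans hsub)
  have := C.full h7 h5 h6 h4 (C.u_notMem_ip h3)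
  have := Finset.card_le_card hsub
  have := C.cyc.card_cyf
  omega

theorem full_ip' {lo : ℤ} {S : ℤ → Prop} {s t : V} (h : IP (Gz G f Y) f lo c ∅ S s t) (hs : s ∈ X)
    (ht : t ∈ X) (hst : s ≠ t) (hS : ∀ k, lo ≤ k → k < lo + c → S k) : False :=
  C.full_ip (h.mono (by simp)) hs ht hst hS

/-- A vertex missed by a path with ends in `X` covering the rest of the cycle is missed by a
longest cycle. -/
theorem miss_cyc {lo : ℤ} {S : ℤ → Prop} {s t : V} {k0 : ℤ} (h : IP (Gz G f Y) f lo c ∅ S s t)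
    (hs : s ∈ X) (ht : t ∈ X) (hst : s ≠ t) (hk : f k0 ∉ Y) (h0 : ¬ S k0) (hl : lo ≤ k0)
    (hr : k0 < lo + c) (hS : ∀ k, lo ≤ k → k < lo + c → S k ∨ k = k0) :
    ∃ g, Cyc G c g ∧ (∀ i, g i ≠ f k0) ∧ ∀ i, (∃ j, f j = g i) ∨ g i = u := by
  obtain ⟨Q, h1, h2, h3⟩ := h
  have hsub := C.ip_sub h2 hS
  have hQ : Q = (cyf f c).erase (f k0) := by
    refine Finset.Subset.antisymm (fun v hv => ?_) hsub
    refine Finset.mem_erase.2 ⟨?_, C.cyc.mem_cyf.2 ((h3 v hv).resolve_right id)⟩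
    rintro rfl
    exact h0 ((h2 k0 hl hr).1 hv)
  obtain ⟨s', t', h4, h5, h6, h7⟩ := C.hop Q s t h1 hs ht hst (by
    intro y hy
    refine hsub (Finset.mem_erase.2 ⟨fun e => hk (e ▸ hy), ?_⟩)
    obtain ⟨i, hi, -⟩ := C.Y_ran hy
    exact C.cyc.mem_cyf.2 ⟨i, hi⟩)
  have hcc := C.card_erase k0
  rw [← hQ] at hcc
  have hu : u ∉ Q := by
    rw [hQ]; exact fun h => C.u_notMem_cyf (Finset.mem_of_mem_erase h)
  obtain ⟨g, g1, g2⟩ := C.other h7 h5 h6 h4 hu hcc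
  refine ⟨g, g1, fun i hi => ?_, fun i => ?_⟩
  · rcases (g2 (f k0)).1 ⟨i, hi⟩ with h | h
    · rw [hQ] at h; exact Finset.notMem_erase _ _ h
    · exact C.off _ h
  · exact ((g2 _).1 ⟨i, rfl⟩).imp_left fun h => (h3 _ h).resolve_right id

/-- A vertex missed by a path with ends in `X` covering the rest of the cycle has small degree. -/
theorem miss_ip {lo : ℤ} {S : ℤ → Prop} {s t : V} {k0 : ℤ} (h : IP (Gz G f Y) f lo c ∅ S s t)
    (hs : s ∈ X) (ht : t ∈ X) (hst : s ≠ t) (hk : f k0 ∉ Y) (h0 : ¬ S k0) (hl : lo ≤ k0)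
    (hr : k0 < lo + c) (hS : ∀ k, lo ≤ k → k < lo + c → S k ∨ k = k0) :
    deg G (f k0) ≤ k ∧ (¬ G.Adj u (f k0) → ∀ v, G.Adj (f k0) v → ∃ i, f i = v) := by
  obtain ⟨g, g1, hg, g2⟩ := C.miss_cyc h hs ht hst hk h0 hl hr hS
  refine ⟨C.mu g g1 _ hg, fun hn v hv => ?_⟩
  obtain ⟨i, rfl⟩ := C.dom g g1 _ hg v hv
  exact (g2 i).resolve_right fun h => hn (h ▸ hv).symm

/-- Two paths joined through an off-cycle vertex cannot cover all but one vertex of the cycle. -/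
theorem full_via {lo : ℤ} {S T : ℤ → Prop} {s a b t r : V} {k0 : ℤ}
    (h : IP (Gz G f Y) f lo c ∅ S s a) (h' : IP (Gz G f Y) f lo c ∅ T b t) (hr : r ∈ O)
    (ha : G.Adj r a) (hb : G.Adj r b) (haY : a ∉ Y) (hbY : b ∉ Y) (hs : s ∈ X) (ht : t ∈ X)
    (hst : s ≠ t) (hk : f k0 ∉ Y) (hd : ∀ k, lo ≤ k → k < lo + c → S k → ¬ T k)
    (hS : ∀ k, lo ≤ k → k < lo + c → S k ∨ T k ∨ k = k0) : False := by
  obtain ⟨Q1, g1, g2, g3⟩ := h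
  obtain ⟨Q2, l1, l2, l3⟩ := h'
  have key : ∀ Q : Finset V, (∀ x ∈ Q, (∃ k, f k = x) ∨ x ∈ (∅ : Set V)) → r ∉ Q ∧ u ∉ Q := by
    refine fun Q hQ => ⟨fun h => ?_, fun h => ?_⟩
    · obtain ⟨i, hi⟩ := (hQ r h).resolve_right id
      exact C.fO i (hi ▸ hr)
    · obtain ⟨i, hi⟩ := (hQ u h).resolve_right id
      exact C.off i hi
  obtain ⟨hr1, hu1⟩ := key Q1 g3
  obtain ⟨hr2, hu2⟩ := key Q2 l3
  have hrY := C.O_notMem_Y hr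
  have hdis : Disjoint Q1 (insert r Q2) := by
    rw [Finset.disjoint_left]
    intro v hv hv'
    rcases Finset.mem_insert.1 hv' with rfl | hv'
    · exact hr1 hv
    · obtain ⟨i, rfl⟩ := (g3 v hv).resolve_right id
      obtain ⟨j, h1, h2, h3⟩ := C.cyc.exists_rep i lo
      rw [← h3] at hv hv'
      exact hd j h1 h2 ((g2 j h1 h2).1 hv) ((l2 j h1 h2).1 hv')
  have hP := g1.append (.cons (Gz.of_notMem hb hrY hbY) hr2 l1) (Gz.of_notMem ha hrY haY).symm hdis
  have hsub : insert r ((cyf f c).erase (f k0)) ⊆ Q1 ∪ insert r Q2 := by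
    refine Finset.insert_subset (by simp) fun v hv => ?_
    obtain ⟨hv1, hv2⟩ := Finset.mem_erase.1 hv
    obtain ⟨i, rfl⟩ := C.cyc.mem_cyf.1 hv2
    obtain ⟨j, h1, h2, h3⟩ := C.cyc.exists_rep i lo
    rw [← h3] at hv1 ⊢
    rcases hS j h1 h2 with h | h | h
    · exact Finset.mem_union_left _ ((g2 j h1 h2).2 h)
    · exact Finset.mem_union_right _ (Finset.mem_insert_of_mem ((l2 j h1 h2).2 h))
    · exact absurd (h ▸ rfl) hv1
  obtain ⟨s', t', h4, h5, h6, h7⟩ := C.hop _ s t hP hs ht hst (by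
    intro y hy
    refine hsub (Finset.mem_insert_of_mem (Finset.mem_erase.2 ⟨fun e => hk (e ▸ hy), ?_⟩))
    obtain ⟨i, hi, -⟩ := C.Y_ran hy
    exact C.cyc.mem_cyf.2 ⟨i, hi⟩)
  have hur : u ≠ r := fun h => C.uO (h ▸ hr)
  have h8 := C.full h7 h5 h6 h4 (by simp [hu1, hu2, hur])
  have h9 := Finset.card_le_card hsub
  rw [Finset.card_insert_of_notMem (fun h => by
    obtain ⟨i, hi⟩ := C.cyc.mem_cyf.1 (Finset.mem_of_mem_erase h)
    exact C.fO i (hi ▸ hr))] at h9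
  have := C.card_erase k0
  omega

end Ctx

theorem Cyc.nxt_inj {G : SimpleGraph V} {c : ℤ} {f : ℤ → V} (hf : Cyc G c f) {v w : V}
    (hv : ∃ i, f i = v) (hw : ∃ i, f i = w) (h : nxt f v = nxt f w) : v = w := by
  obtain ⟨i, rfl⟩ := hv
  obtain ⟨j, rfl⟩ := hw
  rw [nxt_apply hf, nxt_apply hf, hf.eq_iff] at h
  rw [hf.eq_iff]
  simpa using h

/-- The vertices of the cycle at distance at least three after the last vertex of `X`. -/
def exs [Fintype V] (f : ℤ → V) (X : Finset V) : Finset V :=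
  Finset.univ.filter fun v => ∃ i, f i = v ∧ f i ∉ X ∧ f (i - 1) ∉ X ∧ f (i - 2) ∉ X

theorem mem_exs [Fintype V] {G : SimpleGraph V} {c : ℤ} {f : ℤ → V} (hf : Cyc G c f)
    {X : Finset V} {i : ℤ} : f i ∈ exs f X ↔ f i ∉ X ∧ f (i - 1) ∉ X ∧ f (i - 2) ∉ X := by
  rw [exs, Finset.mem_filter]
  refine ⟨fun ⟨_, j, h, h1, h2, h3⟩ => ?_, fun h => ⟨Finset.mem_univ _, i, rfl, h⟩⟩
  have h4 := hf.congr_shift h (-1)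
  have h5 := hf.congr_shift h (-2)
  rw [← sub_eq_add_neg, ← sub_eq_add_neg] at h4 h5
  rw [← h, ← h4, ← h5]
  exact ⟨h1, h2, h3⟩

/-- The vertices of the cycle second after a vertex of `X`, unless there is an earlier vertex of
`X`. -/
def sec (f : ℤ → V) (X Y : Finset V) : Finset V := (X.image (nxt f) \ Y).image (nxt f)

namespace Ctx

variable [Fintype V] {G : SimpleGraph V} {c : ℤ} {k : ℕ} {f : ℤ → V} {u : V} {O X Y : Finset V}
  (C : Ctx G c k f u O X Y)
include C

theorem mem_first {i : ℤ} : f i ∈ X.image (nxt f) ↔ f (i - 1) ∈ X := by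
  rw [Finset.mem_image]
  constructor
  · rintro ⟨v, hv, h⟩
    obtain ⟨j, rfl⟩ := C.ran v hv
    rw [nxt_apply C.cyc] at h
    have := C.cyc.congr_shift h (-1)
    rw [← sub_eq_add_neg, ← sub_eq_add_neg, add_sub_cancel_right] at this
    rwa [← this]
  · intro h
    exact ⟨_, h, by rw [nxt_apply C.cyc, sub_add_cancel]⟩

theorem mem_sec {i : ℤ} : f i ∈ sec f X Y ↔ f (i - 2) ∈ X ∧ f i ∉ X := by
  rw [sec, Finset.mem_image]
  constructor
  · rintro ⟨v, hv, h⟩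
    obtain ⟨hv1, hv2⟩ := Finset.mem_sdiff.1 hv
    obtain ⟨w, hw, rfl⟩ := Finset.mem_image.1 hv1
    obtain ⟨j, rfl⟩ := C.ran w hw
    rw [nxt_apply C.cyc] at h hv2
    rw [nxt_apply C.cyc] at h
    have h' := C.cyc.congr_shift h (-2)
    rw [show j + 1 + 1 + -2 = j by ring, ← sub_eq_add_neg] at h'
    rw [← h', ← h]
    refine ⟨hw, fun h4 => hv2 (C.mem_Y.2 ⟨by rwa [add_sub_cancel_right], h4⟩)⟩
  · rintro ⟨h1, h2⟩
    refine ⟨f (i - 1), Finset.mem_sdiff.2 ⟨C.mem_first.2 ?_, fun h => h2 ?_⟩, ?_⟩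
    · rwa [show i - 1 - 1 = i - 2 by ring]
    · have := (C.mem_Y.1 h).2
      rwa [sub_add_cancel] at this
    · rw [nxt_apply C.cyc, sub_add_cancel]

theorem Y_sub_first : Y ⊆ X.image (nxt f) := by
  intro y hy
  obtain ⟨i, rfl, h, -⟩ := C.Y_ran hy
  exact C.mem_first.2 h

theorem card_first : (X.image (nxt f)).card = X.card :=
  Finset.card_image_of_injOn fun _ hv _ hw h => C.cyc.nxt_inj (C.ran _ hv) (C.ran _ hw) h

theorem card_sec : (sec f X Y).card + Y.card = X.card := by
  rw [sec, Finset.card_image_of_injOn, ← C.card_first,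
    Finset.card_sdiff_add_card_eq_card C.Y_sub_first]
  intro v hv w hw h
  have key : ∀ v ∈ X.image (nxt f) \ Y, ∃ i, f i = v := by
    intro v hv
    obtain ⟨w, hw, rfl⟩ := Finset.mem_image.1 (Finset.mem_sdiff.1 hv).1
    obtain ⟨j, rfl⟩ := C.ran w hw
    exact ⟨j + 1, (nxt_apply C.cyc j).symm⟩
  exact C.cyc.nxt_inj (key v hv) (key w hw) h

/-- Every vertex of the cycle belongs to exactly one of four classes. -/
theorem classes (i : ℤ) : f i ∈ X ∨ f i ∈ X.image (nxt f) ∨ f i ∈ sec f X Y ∨ f i ∈ exs f X := by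
  rw [C.mem_first, C.mem_sec, mem_exs C.cyc]
  tauto

theorem card_cyc : c + Y.card = 3 * X.card + (exs f X).card := by
  have h1 : cyf f c = X ∪ (X.image (nxt f) ∪ (sec f X Y ∪ exs f X)) := by
    ext v
    simp only [Finset.mem_union]
    constructor
    · intro h
      obtain ⟨i, rfl⟩ := C.cyc.mem_cyf.1 h
      exact C.classes i
    · rintro (h | h | h | h)
      · exact C.cyc.mem_cyf.2 (C.ran v h)
      · obtain ⟨w, hw, rfl⟩ := Finset.mem_image.1 h
        obtain ⟨j, rfl⟩ := C.ran w hw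
        exact C.cyc.mem_cyf.2 ⟨j + 1, (nxt_apply C.cyc j).symm⟩
      · obtain ⟨w, hw, rfl⟩ := Finset.mem_image.1 h
        obtain ⟨w', hw', rfl⟩ := Finset.mem_image.1 (Finset.mem_sdiff.1 hw).1
        obtain ⟨j, rfl⟩ := C.ran w' hw'
        exact C.cyc.mem_cyf.2 ⟨j + 1 + 1, by rw [nxt_apply C.cyc, nxt_apply C.cyc]⟩
      · obtain ⟨i, rfl, -⟩ := (Finset.mem_filter.1 h).2
        exact C.cyc.mem_cyf.2 ⟨i, rfl⟩
  have h2 : ∀ s : Finset V, (∀ v ∈ s, ∃ i, f i = v) → ∀ t : Finset V,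
      (∀ i, f i ∈ s → f i ∉ t) → Disjoint s t := by
    intro s hs t ht
    rw [Finset.disjoint_left]
    intro v hv
    obtain ⟨i, rfl⟩ := hs v hv
    exact ht i hv
  have hF : ∀ v ∈ X.image (nxt f), ∃ i, f i = v := by
    intro v hv
    obtain ⟨w, hw, rfl⟩ := Finset.mem_image.1 hv
    obtain ⟨j, rfl⟩ := C.ran w hw
    exact ⟨j + 1, (nxt_apply C.cyc j).symm⟩
  have hS : ∀ v ∈ sec f X Y, ∃ i, f i = v := by
    intro v hv
    obtain ⟨w, hw, rfl⟩ := Finset.mem_image.1 hv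
    obtain ⟨j, rfl⟩ := hF w (Finset.mem_sdiff.1 hw).1
    exact ⟨j + 1, (nxt_apply C.cyc j).symm⟩
  have h3 := congrArg Finset.card h1
  rw [Finset.card_union_of_disjoint (h2 _ C.ran _ fun i hi => ?_),
    Finset.card_union_of_disjoint (h2 _ hF _ fun i hi => ?_),
    Finset.card_union_of_disjoint (h2 _ hS _ fun i hi => ?_), C.card_first] at h3
  · have := C.card_sec
    have := C.cyc.card_cyf
    omega
  · rw [mem_exs C.cyc]
    rw [C.mem_sec] at hi
    tauto
  · rw [Finset.mem_union, mem_exs C.cyc, C.mem_sec]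
    rw [C.mem_first] at hi
    rintro (h | h)
    · have := C.not_X_of_next (i := i - 1) (by rw [show i - 1 - 1 = i - 2 by ring]; exact h.1)
      exact this hi
    · exact h.2.1 hi
  · rw [Finset.mem_union, Finset.mem_union, C.mem_first, mem_exs C.cyc, C.mem_sec]
    have := C.not_X_of_next (i := i)
    tauto

theorem card_univ_eq : Fintype.card V + Y.card = 3 * X.card + (exs f X).card + 1 + O.card := by
  have := C.card_cyc
  have := C.card_univ
  omega

theorem nb_sub_X : nb G u ⊆ X := fun v hv => C.sub v (mem_nb.1 hv)

theorem sing_sub_Y : sing f (nb G u) ⊆ Y := by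
  rw [C.Yeq]; exact sing_mono C.nb_sub_X

theorem le_card_X : k ≤ X.card := by
  have := Finset.card_le_card C.nb_sub_X
  rw [card_nb, C.deg] at this
  exact this

/-- The degree condition for independent triples. -/
theorem triple {a b d : V} (h1 : a ≠ b) (h2 : a ≠ d) (h3 : b ≠ d) (h4 : ¬ G.Adj a b)
    (h5 : ¬ G.Adj a d) (h6 : ¬ G.Adj b d) :
    3 * X.card + (exs f X).card + O.card + 1 ≤ Y.card + (Paper.deg G a + Paper.deg G b + Paper.deg G d) ∧
    3 * X.card + (exs f X).card + O.card + (sing f (nb G u)).card ≤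
      2 + Y.card + (Paper.deg G a + Paper.deg G b + Paper.deg G d) := by
  have := C.s3 a b d h1 h2 h3 h4 h5 h6
  have := C.card_univ_eq
  omega

theorem deg_Y {y : V} (hy : y ∈ Y) : Paper.deg G y ≤ k := by
  obtain ⟨i, rfl, -⟩ := C.Y_ran hy
  obtain ⟨s, t, h1, h2, h3, h4⟩ := C.hopY i hy
  have hne : f i ∉ seg f (i + 1) (i + c - 1) := by
    intro h
    obtain ⟨j, h5, h6, h7⟩ := mem_seg.1 h
    exact C.cyc.ne (i := i) (j := j) (by omega) (by omega) h7.symm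
  have hc := C.cyc.three_le
  obtain ⟨g, g1, g2⟩ := C.other h4 h2 h3 h1 (fun h => by
    obtain ⟨j, -, -, hj⟩ := mem_seg.1 h
    exact C.off j hj) (by rw [C.cyc.card_seg (by omega) (by omega)]; ring)
  refine C.mu g g1 _ fun j hj => ?_
  rcases (g2 _).1 ⟨j, hj⟩ with h | h
  · exact hne h
  · exact C.off i h

/-- The successors of two vertices of `X` are not connected. -/
theorem not_cn_firsts {i j : ℤ} (hi : f i ∈ X) (hj : f j ∈ X) (hij : f i ≠ f j) :
    ¬ Cn G O (f (i + 1)) (f (j + 1)) := by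
  intro h
  obtain ⟨j', h1, h2, h3⟩ := C.cyc.exists_rep j i
  rw [← h3] at hj hij
  rw [← C.cyc.congr_shift h3] at h
  have h4 : i ≠ j' := fun e => hij (e ▸ rfl)
  have h5 := (C.cn_gz h (C.nocons _ hi) (C.nocons _ hj)).1
  have a1 : IP (Gz G f Y) f (i + 1) c ∅ _ _ _ := .sgr (C.cyc.gz Y) (i + 1) j'
  have a2 : IP (Gz G f Y) f (i + 1) c ∅ _ _ _ := .sg (C.cyc.gz Y) (j' + 1) (i + c)
  refine C.full_ip (a1.join (C.cyc.gz Y) a2 (O := O) (fun x hx k hk => C.fO k (hk ▸ hx)) h5 ?_)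
    hj (C.cyc.per i ▸ hi) ?_ ?_
  · intros; omega
  · rw [C.cyc.per]; exact hij.symm
  · intros; omega

/-- The predecessors of two vertices of `X` are not connected. -/
theorem not_cn_lasts {i j : ℤ} (hi : f i ∈ X) (hj : f j ∈ X) (hij : f i ≠ f j) :
    ¬ Cn G O (f (i - 1)) (f (j - 1)) := by
  have := C.mirror.not_cn_firsts (i := -i) (j := -j) (by rwa [neg_neg]) (by rwa [neg_neg])
    (by rwa [neg_neg, neg_neg])
  rwa [show -(-i + 1) = i - 1 by ring, show -(-j + 1) = j - 1 by ring] at this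

end Ctx

/-- The case where the enclosed vertices force their number to be large. -/
structure Sx [Fintype V] (G : SimpleGraph V) (c : ℤ) (k : ℕ) (f : ℤ → V) (u : V)
    (O X Y : Finset V) : Prop extends Ctx G c k f u O X Y where
  ne : Y.Nonempty
  h1 : 3 * X.card + (exs f X).card + O.card + 1 ≤ Y.card + 3 * k
  h2 : 3 * X.card + (exs f X).card + O.card + (sing f (nb G u)).card ≤ 2 + Y.card + 3 * k

namespace Sx

variable [Fintype V] {G : SimpleGraph V} {c : ℤ} {k : ℕ} {f : ℤ → V} {u : V} {O X Y : Finset V}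

theorem mirror (C : Sx G c k f u O X Y) : Sx G c k (fun i => f (-i)) u O X Y := by
  have h1 := C.card_cyc
  have h2 := C.toCtx.mirror.card_cyc
  have h3 : (exs (fun i => f (-i)) X).card = (exs f X).card := by omega
  exact { C.toCtx.mirror with
    ne := C.ne
    h1 := by rw [h3]; exact C.h1
    h2 := by rw [h3, sing_mirror]; exact C.h2 }

end Sx

theorem Ctx.toSx [Fintype V] {G : SimpleGraph V} {c : ℤ} {k : ℕ} {f : ℤ → V} {u : V}
    {O X Y : Finset V} (C : Ctx G c k f u O X Y)
    (h : 2 ≤ Y.card ∨ Y.card = 1 ∧ X.card = k ∧ (exs f X).card = 0 ∧ O.card = 0) :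
    Sx G c k f u O X Y := by
  have hs := Finset.card_le_card C.sing_sub_Y
  rcases h with h | ⟨h1, h2, h3, h4⟩
  · obtain ⟨a, ha, b, hb, hab⟩ := Finset.one_lt_card.1 (by omega : 1 < Y.card)
    have ha' := C.deg_Y ha
    have hb' := C.deg_Y hb
    have hu := C.deg
    obtain ⟨h5, h6⟩ := C.triple (a := u) (b := a) (d := b) (fun e => C.u_notMem_Y (e ▸ ha))
      (fun e => C.u_notMem_Y (e ▸ hb)) hab (C.u_not_adj_Y ha) (C.u_not_adj_Y hb) (C.Y_indep ha hb)
    exact { C with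
      ne := ⟨a, ha⟩
      h1 := by omega
      h2 := by omega }
  · exact { C with
      ne := Finset.card_pos.1 (by omega)
      h1 := by omega
      h2 := by omega }

/-- The first vertex of one gap is adjacent to the last vertex of another gap, which has two
vertices. -/
structure Oc (G : SimpleGraph V) (c : ℤ) (f : ℤ → V) (X : Finset V) (i0 i1 j0 : ℤ) : Prop where
  pr : Pr f c X i0 i1 j0 (j0 + 3)
  adj : G.Adj (f (i0 + 1)) (f (j0 + 2))

theorem Oc.mirror {G : SimpleGraph V} {c : ℤ} {f : ℤ → V} {X : Finset V} {i0 i1 j0 : ℤ}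
    (H : Oc G c f X i0 i1 j0) (h : i1 = i0 + 3) :
    Oc G c (fun i => f (-i)) X (-(j0 + 3)) (-j0) (-i1) where
  pr := by
    have := H.pr.mirror
    rwa [show -i0 = -i1 + 3 by omega] at this
  adj := by
    rw [show -(-(j0 + 3) + 1) = j0 + 2 by ring, show -(-i1 + 2) = i0 + 1 by omega]
    exact H.adj.symm

namespace Ctx

variable [Fintype V] {G : SimpleGraph V} {c : ℤ} {k : ℕ} {f : ℤ → V} {u : V} {O X Y : Finset V}
  (C : Ctx G c k f u O X Y)
include C

theorem gzadj' {v w : V} (h : G.Adj v w) (hv : v ∉ X) (hv' : v ∉ Y) : (Gz G f Y).Adj v w :=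
  Gz.of_notMem h hv' fun hw => hv (C.HN w hw v h.symm)

/-- The positions of the enclosed vertices with respect to two gaps. -/
theorem Y_pos {i0 i1 j0 j1 : ℤ} (pr : Pr f c X i0 i1 j0 j1) {b : V} (hb : b ∈ Y) :
    ∃ β, f β = b ∧ (i1 < β ∧ β < j0 ∨ j1 < β ∧ β < i0 + c) ∧ f (β - 1) ∈ X ∧ f (β + 1) ∈ X := by
  obtain ⟨i, hi, h1, h2⟩ := C.Y_ran hb
  obtain ⟨j, h3, h4, h5⟩ := C.cyc.exists_rep i i0
  have e1 := C.cyc.congr_shift h5 (-1)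
  have e2 := C.cyc.congr_shift h5 1
  rw [← sub_eq_add_neg, ← sub_eq_add_neg] at e1
  rw [← e1] at h1
  rw [← e2] at h2
  rw [← h5] at hi
  have hX : f j ∉ X := hi ▸ C.disj b hb
  refine ⟨j, hi, ?_, h1, h2⟩
  have g : ∀ {a b : ℤ}, Gap f X a b → ¬ (a < j ∧ j < b) := by
    intro a b g ⟨g1, g2⟩
    have hl := g.len
    have := g.not_mem (j - 1)
    have := g.not_mem (j + 1)
    rcases lt_or_ge a (j - 1) with h | h
    · exact g.not_mem (j - 1) h (by omega) h1
    · exact g.not_mem (j + 1) (by omega) (by omega) h2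
  have g1 := g pr.gi
  have g2 := g pr.gj
  have n1 : j ≠ i0 := fun e => hX (e ▸ pr.gi.left)
  have n2 : j ≠ i1 := fun e => hX (e ▸ pr.gi.right)
  have n3 : j ≠ j0 := fun e => hX (e ▸ pr.gj.left)
  have n4 : j ≠ j1 := fun e => hX (e ▸ pr.gj.right)
  omega

theorem gap_notMem {a b l : ℤ} (g : Gap f X a b) (h1 : a < l) (h2 : l < b) : f l ∉ X ∧ f l ∉ Y := by
  refine ⟨g.not_mem l h1 h2, fun h => ?_⟩
  have := g.not_sing C.cyc h1 h2
  rw [← C.Yeq] at this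
  exact this h

/-- A path covering the cycle, of whose edges at enclosed vertices only those at `b` may be off the
cycle, has no end adjacent to `u` if the other end can be moved. -/
theorem full_erase {lo : ℤ} {S : ℤ → Prop} {b s t : V}
    (h : IP (Gz G f (Y.erase b)) f lo c ∅ S s t) (hs : s ∈ X) (ht : G.Adj u t) (hst : s ≠ t)
    (hcl : G.Adj u s ∨ ∃ w ∈ sing f (nb G u), w ≠ b ∧ G.Adj w s)
    (hS : ∀ k, lo ≤ k → k < lo + c → S k) : False := by
  obtain ⟨Q, h1, h2, h3⟩ := h
  have hsub : cyf f c ⊆ Q := by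
    intro v hv
    obtain ⟨i, rfl⟩ := C.cyc.mem_cyf.1 hv
    obtain ⟨j, h4, h5, h6⟩ := C.cyc.exists_rep i lo
    rw [← h6]
    exact (h2 j h4 h5).2 (hS j h4 h5)
  have hu : u ∉ Q := C.u_notMem_ip fun x hx => (h3 x hx).imp_right False.elim
  have hc := C.cyc.card_cyf
  have hle := Finset.card_le_card hsub
  have key : ∀ {s t}, Pth G Q s t → G.Adj u s → G.Adj u t → s ≠ t → False := by
    intro s t h a1 a2 a3
    have := C.full h a1 a2 a3 hu
    omega
  rcases hcl with h4 | ⟨w, hw, hwb, hws⟩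
  · exact key (h1.imp fun _ _ _ _ h => h.1) h4 ht hst
  · obtain ⟨i, rfl, g1, g2⟩ := exists_of_mem_sing hw
    have hY : f i ∈ Y := C.sing_sub_Y hw
    obtain ⟨a, ha, hat, hP⟩ := Gz.rotate C.cyc h1 (Z' := ∅) (i := i)
      (Finset.mem_erase.2 ⟨hwb, hY⟩) (hsub (C.cyc.mem_cyf.2 ⟨i, rfl⟩))
      (fun h => C.X_notMem_Y hs (Finset.mem_of_mem_erase h))
      (fun h => C.X_notMem_Y (C.sub t ht) (Finset.mem_of_mem_erase h)) hws (by simp) (by simp)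
    refine key (hP.imp fun _ _ _ _ h => h.1) ?_ ht hat
    rcases ha with rfl | rfl
    · exact mem_nb.1 g1
    · exact mem_nb.1 g2

variable {i0 i1 j0 : ℤ} (H : Oc G c f X i0 i1 j0)
include H

theorem oc_rel : i0 + 3 ≤ i1 ∧ i1 ≤ j0 ∧ j0 + 3 ≤ i0 + c ∧ f (i0 + c) ∈ X := by
  have := H.pr.gi.len
  have := H.pr.ij
  have := H.pr.ji
  exact ⟨by omega, by omega, by omega, by rw [C.cyc.per]; exact H.pr.gi.left⟩

/-- The other vertex of the gap can be missed by a longest cycle. -/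
theorem oc_miss : Paper.deg G (f (j0 + 1)) ≤ k ∧ ∀ v, G.Adj (f (j0 + 1)) v → ∃ i, f i = v := by
  obtain ⟨h1, h2, h3, h4⟩ := C.oc_rel H
  obtain ⟨n1, n2⟩ := C.gap_notMem H.pr.gj (l := j0 + 1) (by omega) (by omega)
  obtain ⟨n3, n4⟩ := C.gap_notMem H.pr.gj (l := j0 + 2) (by omega) (by omega)
  have p := (IP.sgr (lo := i0 + 1) (C.cyc.gz Y) (j0 + 2) (i0 + c)).fw (C.cyc.gz Y) (i0 + 1) j0
    (C.gzadj' H.adj.symm n3 n4)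
  obtain ⟨r1, r2⟩ := C.miss_ip p h4 H.pr.gj.left (C.cyc.ne (by omega) (by omega)).symm (k0 := j0 + 1) n2
    (by omega) (by omega) (by omega) (by intro k; omega)
  exact ⟨r1, r2 fun h => n1 (C.sub _ h)⟩

/-- The other vertex of the gap cannot be inserted elsewhere. -/
theorem oc_ins {l : ℤ} (hl : i0 < l ∧ l < j0 ∨ j0 + 1 < l ∧ l < i0 + c)
    (ha : G.Adj (f (j0 + 1)) (f l)) : ¬ G.Adj (f (j0 + 1)) (f (l + 1)) := by
  intro ha'
  obtain ⟨h1, h2, h3, h4⟩ := C.oc_rel H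
  obtain ⟨n1, n2⟩ := C.gap_notMem H.pr.gj (l := j0 + 1) (by omega) (by omega)
  obtain ⟨n3, n4⟩ := C.gap_notMem H.pr.gj (l := j0 + 2) (by omega) (by omega)
  have e1 := C.gzadj' H.adj.symm n3 n4
  have e2 := C.gzadj' ha n1 n2
  have e3 := C.gzadj' ha' n1 n2
  have ne := (C.cyc.ne (i := j0) (j := i0 + c) (by omega) (by omega)).symm
  rcases hl with hl | hl
  · exact C.full_ip' ((((IP.sgr (lo := i0 + 1) (C.cyc.gz Y) (j0 + 2) (i0 + c)).fw (C.cyc.gz Y) (i0 + 1) l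
      e1).fw (C.cyc.gz Y) (j0 + 1) (j0 + 1) e2.symm).fw (C.cyc.gz Y) (l + 1) j0 e3)
      h4 H.pr.gj.left ne (by intro k; omega)
  · exact C.full_ip' ((((IP.sgr (lo := i0 + 1) (C.cyc.gz Y) (l + 1) (i0 + c)).fw (C.cyc.gz Y) (j0 + 1)
      (j0 + 1) e3.symm).bw (C.cyc.gz Y) (j0 + 2) l e2).fw (C.cyc.gz Y) (i0 + 1) j0 e1)
      h4 H.pr.gj.left ne (by intro k; omega)

theorem oc_bound : Paper.deg G (f (j0 + 1)) +
    (Y.filter fun b => ¬ G.Adj (f (j0 + 1)) (nxt f b)).card ≤ X.card + (exs f X).card := by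
  obtain ⟨h1, h2, h3, h4⟩ := C.oc_rel H
  obtain ⟨n1, n2⟩ := C.gap_notMem H.pr.gj (l := j0 + 1) (by omega) (by omega)
  set q := f (j0 + 1) with hq
  set F := Y.filter fun b => ¬ G.Adj q (nxt f b) with hF
  have cyN : ∀ v ∈ nb G q, ∃ i, f i = v := fun v hv => (C.oc_miss H).2 v (mem_nb.1 hv)
  have inj : ∀ {S : Finset V}, (∀ v ∈ S, ∃ i, f i = v) → (S.image (nxt f)).card = S.card :=
    fun hS => Finset.card_image_of_injOn fun v hv w hw e =>
      C.cyc.nxt_inj (hS v hv) (hS w hw) e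
  have c1 := inj (S := nb G q ∩ sec f X Y) fun v hv => cyN v (Finset.mem_inter.1 hv).1
  have c2 := inj (S := F) fun v hv => by
    obtain ⟨i, hi, -⟩ := C.Y_ran (Finset.mem_filter.1 hv).1
    exact ⟨i, hi⟩
  have secN : ∀ l, f l ∈ nb G q → f l ∈ sec f X Y → f (l + 1) ∉ nb G q ∧
      f (l + 1) ∈ X ∪ exs f X := by
    intro l hl hs
    obtain ⟨s1, s2⟩ := C.mem_sec.1 hs
    have s3 : f (l - 1) ∉ X := C.not_X_of_next (by rwa [show l - 1 - 1 = l - 2 by ring])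
    constructor
    · obtain ⟨j, j1, j2, j3⟩ := C.cyc.exists_rep l (i0 + 1)
      have e := C.cyc.congr_shift j3 1
      rw [← e]
      rw [← j3] at hl s2
      intro ha
      have k1 : j ≠ j0 := fun e => s2 (e ▸ H.pr.gj.left)
      have k2 : j ≠ i0 + c := fun e => s2 (e ▸ h4)
      have k3 : j ≠ j0 + 1 := fun e => by
        subst e
        exact G.loopless.irrefl _ (mem_nb.1 hl)
      exact C.oc_ins H (l := j) (by omega) (mem_nb.1 hl) (mem_nb.1 ha)
    · by_cases hX : f (l + 1) ∈ X
      · exact Finset.mem_union_left _ hX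
      · refine Finset.mem_union_right _ ((mem_exs C.cyc).2 ⟨hX, ?_, ?_⟩)
        · rwa [add_sub_cancel_right]
        · rwa [show l + 1 - 2 = l - 1 by ring]
  have hsub : ((nb G q ∩ sec f X Y).image (nxt f) ∪ nb G q \ sec f X Y) ∪ F.image (nxt f) ⊆
      X ∪ exs f X := by
    intro v hv
    rcases Finset.mem_union.1 hv with hv | hv
    · rcases Finset.mem_union.1 hv with hv | hv
      · obtain ⟨w, hw, rfl⟩ := Finset.mem_image.1 hv
        obtain ⟨hw1, hw2⟩ := Finset.mem_inter.1 hw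
        obtain ⟨l, rfl⟩ := cyN w hw1
        rw [nxt_apply C.cyc]
        exact (secN l hw1 hw2).2
      · obtain ⟨hw1, hw2⟩ := Finset.mem_sdiff.1 hv
        obtain ⟨l, rfl⟩ := cyN v hw1
        rcases C.classes l with h | h | h | h
        · exact Finset.mem_union_left _ h
        · exfalso
          have h' := C.mem_first.1 h
          have hne : f j0 ≠ f (l - 1) := by
            intro e
            have := C.cyc.congr_shift e 1
            rw [sub_add_cancel] at this
            exact G.loopless.irrefl q (by
              have h5 := mem_nb.1 hw1
              rwa [← this] at h5)
          have := C.not_cn_firsts H.pr.gj.left h' hne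
          rw [sub_add_cancel] at this
          exact this (Or.inl (mem_nb.1 hw1))
        · exact absurd h hw2
        · exact Finset.mem_union_right _ h
    · obtain ⟨w, hw, rfl⟩ := Finset.mem_image.1 hv
      obtain ⟨i, rfl, -, hi⟩ := C.Y_ran (Finset.mem_filter.1 hw).1
      rw [nxt_apply C.cyc]
      exact Finset.mem_union_left _ hi
  have d1 : Disjoint ((nb G q ∩ sec f X Y).image (nxt f)) (nb G q \ sec f X Y) := by
    rw [Finset.disjoint_left]
    intro v hv hv'
    obtain ⟨w, hw, rfl⟩ := Finset.mem_image.1 hv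
    obtain ⟨hw1, hw2⟩ := Finset.mem_inter.1 hw
    obtain ⟨l, rfl⟩ := cyN w hw1
    rw [nxt_apply C.cyc] at hv'
    exact (secN l hw1 hw2).1 (Finset.mem_sdiff.1 hv').1
  have d2 : Disjoint ((nb G q ∩ sec f X Y).image (nxt f) ∪ nb G q \ sec f X Y)
      (F.image (nxt f)) := by
    rw [Finset.disjoint_left]
    intro v hv hv'
    obtain ⟨b, hb, rfl⟩ := Finset.mem_image.1 hv'
    obtain ⟨hb1, hb2⟩ := Finset.mem_filter.1 hb
    obtain ⟨i, rfl, hi, -⟩ := C.Y_ran hb1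
    rcases Finset.mem_union.1 hv with hv | hv
    · obtain ⟨w, hw, e⟩ := Finset.mem_image.1 hv
      obtain ⟨hw1, hw2⟩ := Finset.mem_inter.1 hw
      have := C.cyc.nxt_inj (cyN w hw1) ⟨i, rfl⟩ e
      subst this
      have := (C.mem_sec.1 hw2).1
      exact C.not_X_of_prev (i := i - 2) (by rwa [show i - 2 + 1 = i - 1 by ring]) this
    · exact hb2 (mem_nb.1 (Finset.mem_sdiff.1 hv).1)
  have t1 := Finset.card_le_card hsub
  rw [Finset.card_union_of_disjoint d2, Finset.card_union_of_disjoint d1, c1, c2] at t1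
  have t2 := Finset.card_union_le X (exs f X)
  have t3 := Finset.card_inter_add_card_sdiff (nb G q) (sec f X Y)
  have t4 := card_nb G q
  omega

end Ctx

/-- The vertices of `Y` next to a vertex of `M` on the cycle. -/
def touch (f : ℤ → V) (Y M : Finset V) : Finset V :=
  Y.filter fun y => ∃ i, f i = y ∧ (f (i - 1) ∈ M ∨ f (i + 1) ∈ M)

theorem touch_sub (f : ℤ → V) (Y M : Finset V) : touch f Y M ⊆ Y := Finset.filter_subset _ _

theorem card_touch {G : SimpleGraph V} {c : ℤ} {f : ℤ → V} (hf : Cyc G c f) (Y M : Finset V) :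
    (touch f Y M).card ≤ 2 * M.card := by
  have h : touch f Y M ⊆ M.image (nxt f) ∪ M.image (nxt fun i => f (-i)) := by
    intro y hy
    obtain ⟨-, i, rfl, h | h⟩ := Finset.mem_filter.1 hy
    · exact Finset.mem_union_left _ (Finset.mem_image.2 ⟨_, h, by
        rw [nxt_apply hf, sub_add_cancel]⟩)
    · refine Finset.mem_union_right _ (Finset.mem_image.2 ⟨_, h, ?_⟩)
      have := nxt_apply hf.mirror (-(i + 1))
      rw [neg_neg] at this
      rw [this]
      congr 1
      ring
  have h1 := Finset.card_le_card h
  have h2 := Finset.card_union_le (M.image (nxt f)) (M.image (nxt fun i => f (-i)))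
  have h3 := Finset.card_image_le (s := M) (f := nxt f)
  have h4 := Finset.card_image_le (s := M) (f := nxt fun i => f (-i))
  omega

theorem card_touch_lt {G : SimpleGraph V} {c : ℤ} {f : ℤ → V} (hf : Cyc G c f) {Y M : Finset V}
    {i : ℤ} (hi : f i ∈ M) (hY : f (i + 1) ∉ Y) : (touch f Y M).card < 2 * M.card := by
  have h : touch f Y M ⊆ (M.erase (f i)).image (nxt f) ∪ M.image (nxt fun i => f (-i)) := by
    intro y hy
    obtain ⟨hyY, j, rfl, h | h⟩ := Finset.mem_filter.1 hy
    · refine Finset.mem_union_left _ (Finset.mem_image.2 ⟨_, Finset.mem_erase.2 ⟨?_, h⟩, by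
        rw [nxt_apply hf, sub_add_cancel]⟩)
      intro e
      have := hf.congr_shift e 1
      rw [sub_add_cancel] at this
      exact hY (this ▸ hyY)
    · refine Finset.mem_union_right _ (Finset.mem_image.2 ⟨_, h, ?_⟩)
      have := nxt_apply hf.mirror (-(j + 1))
      rw [neg_neg] at this
      rw [this]
      congr 1
      ring
  have h1 := Finset.card_le_card h
  have h2 := Finset.card_union_le ((M.erase (f i)).image (nxt f)) (M.image (nxt fun i => f (-i)))
  have h3 := Finset.card_image_le (s := M.erase (f i)) (f := nxt f)
  have h4 := Finset.card_image_le (s := M) (f := nxt fun i => f (-i))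
  have h5 := Finset.card_erase_add_one hi
  omega

theorem touch_mirror {f : ℤ → V} {Y M : Finset V} : touch (fun i => f (-i)) Y M = touch f Y M := by
  have key : ∀ f : ℤ → V, touch f Y M ⊆ touch (fun i => f (-i)) Y M := by
    intro f y hy
    obtain ⟨hyY, j, rfl, h⟩ := Finset.mem_filter.1 hy
    refine Finset.mem_filter.2 ⟨hyY, -j, by simp, ?_⟩
    beta_reduce
    rw [show -(-j - 1) = j + 1 by ring, show -(-j + 1) = j - 1 by ring]
    exact h.symm
  refine Finset.Subset.antisymm ?_ (key f)
  have := key fun i => f (-i)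
  simpa using this

theorem card_touch_lt' {G : SimpleGraph V} {c : ℤ} {f : ℤ → V} (hf : Cyc G c f) {Y M : Finset V}
    {i : ℤ} (hi : f i ∈ M) (hY : f (i - 1) ∉ Y) : (touch f Y M).card < 2 * M.card := by
  have := card_touch_lt hf.mirror (Y := Y) (M := M) (i := -i) (by simpa using hi) (by
    rwa [show -(-i + 1) = i - 1 by ring])
  rwa [touch_mirror] at this

/-- Exchanging a vertex of a cycle for a vertex off the cycle with the same two neighbours. -/
theorem Cyc.exchange {G : SimpleGraph V} {c : ℤ} {f : ℤ → V} (hf : Cyc G c f) {u : V}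
    (hu : ∀ i, f i ≠ u) {β : ℤ} (h1 : G.Adj u (f (β - 1))) (h2 : G.Adj u (f (β + 1))) :
    Cyc G c fun i => if f i = f β then u else f i where
  three_le := hf.three_le
  per i := by simp only [hf.per]
  inj i j h := by
    by_cases hi : f i = f β <;> by_cases hj : f j = f β
    · exact hf.inj i j (hi.trans hj.symm)
    · simp only [hi, hj, if_true, if_false] at h
      exact absurd h.symm (hu j)
    · simp only [hi, hj, if_true, if_false] at h
      exact absurd h (hu i)
    · simp only [hi, hj, if_false] at h
      exact hf.inj i j h
  adj i := by
    have hi := hf.adj i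
    by_cases h : f i = f β
    · have h' := hf.congr_shift h 1
      have : f (i + 1) ≠ f β := fun e => G.loopless.irrefl _ ((h.trans e.symm) ▸ hi)
      simp only [h, this, if_true, if_false]
      rwa [h']
    · by_cases h' : f (i + 1) = f β
      · simp only [h, h', if_true, if_false]
        have := hf.congr_shift h' (-1)
        rw [← sub_eq_add_neg, ← sub_eq_add_neg, add_sub_cancel_right] at this
        rw [this]
        exact h1.symm
      · simp only [h, h', if_false]
        exact hi

namespace Ctx

variable [Fintype V] {G : SimpleGraph V} {c : ℤ} {k : ℕ} {f : ℤ → V} {u : V} {O X Y : Finset V}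
  (C : Ctx G c k f u O X Y)
include C

/-- The vertices `u` and those enclosed by neighbours of `u`. -/
theorem nb_core_sub {w : V} (hw : w = u ∨ w ∈ sing f (nb G u)) : nb G w ⊆ X := by
  rcases hw with rfl | hw
  · exact C.nb_sub_X
  · exact fun v hv => C.HN w (C.sing_sub_Y hw) v (mem_nb.1 hv)

omit C in
theorem card_missed {w : V} (hw : nb G w ⊆ X) (hd : Paper.deg G w = k) :
    (X \ nb G w).card + k = X.card := by
  rw [← hd, ← card_nb, Finset.card_sdiff_add_card_eq_card hw]

/-- By the choice of the cycle, the vertices of `X` not adjacent to such a vertex must be next to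
many vertices of `Y`. -/
theorem le_touch {w : V} (hw : w = u ∨ w ∈ sing f (nb G u)) (hd : Paper.deg G w = k) :
    Y.card ≤ (touch f Y (X \ nb G w)).card + (sing f (nb G u)).card := by
  have h1 : (touch f Y (X \ nb G w)).card + (Y \ touch f Y (X \ nb G w)).card = Y.card := by
    rw [add_comm, Finset.card_sdiff_add_card_eq_card (touch_sub f Y _)]
  have key : ∀ i, f i ∈ Y \ touch f Y (X \ nb G w) → f (i - 1) ∈ nb G w ∧ f (i + 1) ∈ nb G w := by
    intro i hi
    obtain ⟨hi1, hi2⟩ := Finset.mem_sdiff.1 hi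
    obtain ⟨g1, g2⟩ := C.mem_Y.1 hi1
    constructor <;> by_contra hn
    · exact hi2 (Finset.mem_filter.2 ⟨hi1, i, rfl, Or.inl (Finset.mem_sdiff.2 ⟨g1, hn⟩)⟩)
    · exact hi2 (Finset.mem_filter.2 ⟨hi1, i, rfl, Or.inr (Finset.mem_sdiff.2 ⟨g2, hn⟩)⟩)
  rcases hw with rfl | hw
  · have : Y \ touch f Y (X \ nb G w) ⊆ sing f (nb G w) := by
      intro y hy
      obtain ⟨i, rfl, -⟩ := C.Y_ran (Finset.mem_sdiff.1 hy).1
      exact (mem_sing C.cyc).2 (key i hy)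
    have := Finset.card_le_card this
    omega
  · obtain ⟨β, rfl, b1, b2⟩ := exists_of_mem_sing hw
    have hβY := C.sing_sub_Y hw
    have hg := C.cyc.exchange C.off (mem_nb.1 b1) (mem_nb.1 b2)
    have ht := C.tmax _ hg (f β) (by
      intro i h
      by_cases h' : f i = f β
      · rw [if_pos h'] at h
        exact C.off β h.symm
      · rw [if_neg h'] at h
        exact h' h) hd
    set g : ℤ → V := fun i => if f i = f β then u else f i with hgdef
    set S := Y \ touch f Y (X \ nb G (f β)) with hS
    have gX : ∀ i, f i ∈ X → g i = f i := fun i hi =>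
      if_neg fun e : f i = f β => C.X_notMem_Y hi (e.symm ▸ hβY)
    have himg : S.image (fun y => if y = f β then u else y) ⊆ sing g (nb G (f β)) := by
      intro v hv
      obtain ⟨y, hy, rfl⟩ := Finset.mem_image.1 hv
      obtain ⟨i, rfl, g1, g2⟩ := C.Y_ran (Finset.mem_sdiff.1 hy).1
      obtain ⟨k1, k2⟩ := key i hy
      refine (mem_sing (i := i) hg).2 ?_
      rw [gX _ g1, gX _ g2]
      exact ⟨k1, k2⟩
    have hinj : (S.image (fun y => if y = f β then u else y)).card = S.card := by
      refine Finset.card_image_of_injOn ?_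
      intro a ha b hb e
      have hua : a ≠ u := fun e => C.u_notMem_Y (e ▸ (Finset.mem_sdiff.1 ha).1)
      have hub : b ≠ u := fun e => C.u_notMem_Y (e ▸ (Finset.mem_sdiff.1 hb).1)
      simp only at e
      split_ifs at e with e1 e2 e2
      · exact e1.trans e2.symm
      · exact absurd e.symm hub
      · exact absurd e hua
      · exact e
    have := Finset.card_le_card himg
    omega

/-- If the inequality of `le_touch` is tight, missed vertices lie between two vertices of `Y`. -/
theorem adj_of_tight {w : V} (hw : w = u ∨ w ∈ sing f (nb G u)) (hd : Paper.deg G w = k)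
    (ht : Y.card + 2 * k = (sing f (nb G u)).card + 2 * X.card) {i : ℤ} (hi : f i ∈ X)
    (hY : f (i + 1) ∉ Y ∨ f (i - 1) ∉ Y) : G.Adj w (f i) := by
  by_contra hn
  have h1 := C.le_touch hw hd
  have h2 := card_missed (C.nb_core_sub hw) hd
  have h3 : f i ∈ X \ nb G w := Finset.mem_sdiff.2 ⟨hi, fun h => hn (mem_nb.1 h)⟩
  rcases hY with hY | hY
  · have := card_touch_lt C.cyc h3 hY
    omega
  · have := card_touch_lt' C.cyc h3 hY
    omega

theorem adj_of_unique {w : V} (hw : w = u ∨ w ∈ sing f (nb G u)) (hd : Paper.deg G w = k)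
    (hX : X.card = k + 1) (ht : (sing f (nb G u)).card < Y.card) {i : ℤ} (hi : f i ∈ X)
    (hY : f (i + 1) ∉ Y) (hY' : f (i - 1) ∉ Y) : G.Adj w (f i) := by
  by_contra hn
  have h1 := C.le_touch hw hd
  have h2 := card_missed (C.nb_core_sub hw) hd
  have h3 : f i ∈ X \ nb G w := Finset.mem_sdiff.2 ⟨hi, fun h => hn (mem_nb.1 h)⟩
  have h4 : 0 < (touch f Y (X \ nb G w)).card := by omega
  obtain ⟨y, hy⟩ := Finset.card_pos.1 h4
  obtain ⟨z, hz⟩ := Finset.card_eq_one.1 (show (X \ nb G w).card = 1 by omega)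
  rw [hz, Finset.mem_singleton] at h3
  rw [hz] at hy
  obtain ⟨hyY, j, rfl, h | h⟩ := Finset.mem_filter.1 hy
  · rw [Finset.mem_singleton, ← h3] at h
    have := C.cyc.congr_shift h 1
    rw [sub_add_cancel] at this
    exact hY (this ▸ hyY)
  · rw [Finset.mem_singleton, ← h3] at h
    have := C.cyc.congr_shift h (-1)
    rw [← sub_eq_add_neg, ← sub_eq_add_neg, add_sub_cancel_right] at this
    exact hY' (this ▸ hyY)

omit C in
theorem eq_of_missed {w a b : V} (hw : nb G w ⊆ X) (hd : Paper.deg G w = k) (hX : X.card = k + 1)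
    (ha : a ∈ X) (hb : b ∈ X) (ha' : ¬ G.Adj w a) (hb' : ¬ G.Adj w b) : a = b := by
  have h2 := card_missed hw hd
  exact Finset.card_le_one.1 (by omega : (X \ nb G w).card ≤ 1) a
    (Finset.mem_sdiff.2 ⟨ha, fun h => ha' (mem_nb.1 h)⟩) b
    (Finset.mem_sdiff.2 ⟨hb, fun h => hb' (mem_nb.1 h)⟩)

/-- The end `s` is a neighbour of `u`, or can be moved to one by rotating at a vertex other than
`b`. -/
def Mv (G : SimpleGraph V) (f : ℤ → V) (u b s : V) : Prop :=
  G.Adj u s ∨ ∃ w ∈ sing f (nb G u), w ≠ b ∧ G.Adj w s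

end Ctx

namespace Ctx

variable [Fintype V] {G : SimpleGraph V} {c : ℤ} {k : ℕ} {f : ℤ → V} {u : V} {O X Y : Finset V}
  (C : Ctx G c k f u O X Y) {i0 i1 j0 : ℤ} (H : Oc G c f X i0 i1 j0)
include C H

theorem oc_left {β : ℤ} (h1 : i1 < β) (h2 : β < j0) (ha : G.Adj (f β) (f i0))
    (hx : G.Adj u (f (β - 1)) ∨ G.Adj u (f (β + 1))) (hcl : Mv G f u (f β) (f (j0 + 3))) :
    False := by
  obtain ⟨r1, r2, r3, r4⟩ := C.oc_rel H
  obtain ⟨n3, n4⟩ := C.gap_notMem H.pr.gj (l := j0 + 2) (by omega) (by omega)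
  obtain ⟨n5, n6⟩ := C.gap_notMem H.pr.gi (l := i0 + 1) (by omega) (by omega)
  have hf := C.cyc.gz (Y.erase (f β))
  have e1 := Gz.anti (Finset.erase_subset (f β) Y) (C.gzadj' H.adj.symm n3 n4)
  have e2 : (Gz G f (Y.erase (f β))).Adj (f (i0 + c)) (f β) := Gz.of_notMem (by
    rw [C.cyc.per]; exact ha.symm) (fun h => C.X_notMem_Y r4 (Finset.mem_of_mem_erase h)) (by simp)
  rcases hx with hx | hx
  · exact C.full_erase ((((IP.sg (lo := i0 + 1) hf (j0 + 3) (i0 + c)).fw hf β (j0 + 2) e2)).fw hf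
      (i0 + 1) (β - 1) e1) H.pr.gj.right hx (C.cyc.ne (by omega) (by omega)).symm hcl
      (by intro k; omega)
  · exact C.full_erase ((((IP.sg (lo := i0 + 1) hf (j0 + 3) (i0 + c)).bw hf (i0 + 1) β e2)).bw hf
      (β + 1) (j0 + 2) e1.symm) H.pr.gj.right hx (C.cyc.ne (by omega) (by omega)).symm hcl
      (by intro k; omega)

theorem oc_right {β : ℤ} (h1 : i1 < β) (h2 : β < j0) 
    (ha : G.Adj (f β) (f (j0 + 3)))
    (hx : G.Adj u (f (β - 1)) ∨ G.Adj u (f (β + 1))) (hcl : Mv G f u (f β) (f i0)) :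
    False := by
  obtain ⟨r1, r2, r3, r4⟩ := C.oc_rel H
  obtain ⟨n3, n4⟩ := C.gap_notMem H.pr.gj (l := j0 + 2) (by omega) (by omega)
  obtain ⟨n5, n6⟩ := C.gap_notMem H.pr.gi (l := i0 + 1) (by omega) (by omega)
  have hf := C.cyc.gz (Y.erase (f β))
  have e1 := Gz.anti (Finset.erase_subset (f β) Y) (C.gzadj' H.adj.symm n3 n4)
  have e2 : (Gz G f (Y.erase (f β))).Adj (f (j0 + 3)) (f β) := Gz.of_notMem ha.symm
    (fun h => C.X_notMem_Y H.pr.gj.right (Finset.mem_of_mem_erase h)) (by simp)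
  have hcl' : Mv G f u (f β) (f (i0 + c)) := by rwa [C.cyc.per]
  rcases hx with hx | hx
  · exact C.full_erase ((((IP.sgr (lo := i0 + 1) hf (j0 + 3) (i0 + c)).fw hf β (j0 + 2) e2)).fw hf
      (i0 + 1) (β - 1) e1) r4 hx (C.cyc.ne (by omega) (by omega)).symm hcl'
      (by intro k; omega)
  · exact C.full_erase ((((IP.sgr (lo := i0 + 1) hf (j0 + 3) (i0 + c)).bw hf (i0 + 1) β e2)).bw hf
      (β + 1) (j0 + 2) e1.symm) r4 hx (C.cyc.ne (by omega) (by omega)).symm hcl'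
      (by intro k; omega)

theorem oc_outer {β : ℤ} (h1 : j0 + 3 < β) (h2 : β < i0 + c) 
    (ha : G.Adj (f β) (f j0))
    (hcl : Mv G f u (f β) (f i0) ∧ G.Adj u (f (j0 + 3)) ∨
      Mv G f u (f β) (f (j0 + 3)) ∧ G.Adj u (f i0)) : ¬ G.Adj (f (j0 + 1)) (f (β + 1)) := by
  intro hq
  obtain ⟨r1, r2, r3, r4⟩ := C.oc_rel H
  obtain ⟨n1, n2⟩ := C.gap_notMem H.pr.gj (l := j0 + 1) (by omega) (by omega)
  obtain ⟨n3, n4⟩ := C.gap_notMem H.pr.gj (l := j0 + 2) (by omega) (by omega)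
  have hf := C.cyc.gz (Y.erase (f β))
  have e1 := Gz.anti (Finset.erase_subset (f β) Y) (C.gzadj' H.adj.symm n3 n4)
  have e2 : (Gz G f (Y.erase (f β))).Adj (f β) (f j0) := Gz.of_notMem ha (by simp)
    (fun h => C.X_notMem_Y H.pr.gj.left (Finset.mem_of_mem_erase h))
  have e3 := Gz.anti (Finset.erase_subset (f β) Y) (C.gzadj' hq n1 n2)
  have P := (((IP.sg (lo := i0 + 1) hf (j0 + 3) β).bw hf (i0 + 1) j0 e2).bw hf (j0 + 1) (j0 + 2)
    e1.symm).fw hf (β + 1) (i0 + c) e3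
  have ne := C.cyc.ne (i := j0 + 3) (j := i0 + c) (by omega) (by omega)
  rw [← C.cyc.per i0] at hcl
  rcases hcl with ⟨c1, c2⟩ | ⟨c1, c2⟩
  · exact C.full_erase P.symm r4 c2 ne.symm c1 (by intro k; omega)
  · exact C.full_erase P H.pr.gj.right c2 ne c1 (by intro k; omega)

end Ctx

namespace Sx

variable [Fintype V] {G : SimpleGraph V} {c : ℤ} {k : ℕ} {f : ℤ → V} {u : V} {O X Y : Finset V}
  {i0 i1 j0 : ℤ}

theorem oc_nonadj (C : Sx G c k f u O X Y) (H : Oc G c f X i0 i1 j0) :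
    f (j0 + 1) ∉ X ∧ f (j0 + 1) ∉ Y ∧ ¬ G.Adj u (f (j0 + 1)) ∧ u ≠ f (j0 + 1) ∧
    ∀ b ∈ Y, ¬ G.Adj b (f (j0 + 1)) ∧ b ≠ f (j0 + 1) := by
  obtain ⟨n1, n2⟩ := C.gap_notMem H.pr.gj (l := j0 + 1) (by omega) (by omega)
  exact ⟨n1, n2, fun h => n1 (C.sub _ h), (C.off _).symm, fun b hb => ⟨fun h => n1 (C.HN b hb _ h),
    fun h => n2 (h ▸ hb)⟩⟩

theorem no_oc_tight (C : Sx G c k f u O X Y) (H : Oc G c f X i0 i1 j0)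
    (ht : Y.card + 2 * k = (sing f (nb G u)).card + 2 * X.card) : False := by
  obtain ⟨r1, r2, r3, r4⟩ := C.oc_rel H
  obtain ⟨q1, q2, q3, q4, q5⟩ := C.oc_nonadj H
  have hd := (C.oc_miss H).1
  have hb := C.oc_bound H
  have hY1 := C.sing_sub_Y
  have n1 := (C.gap_notMem H.pr.gi (l := i0 + 1) (by omega) (by omega)).2
  have n2 := (C.gap_notMem H.pr.gj (l := j0 + 1) (by omega) (by omega)).2
  have n3 := (C.gap_notMem H.pr.gj (l := j0 + 3 - 1) (by omega) (by omega)).2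
  have adj : ∀ w, (w = u ∨ w ∈ sing f (nb G u)) → Paper.deg G w = k →
      G.Adj w (f i0) ∧ G.Adj w (f j0) ∧ G.Adj w (f (j0 + 3)) := fun w hw hwk =>
    ⟨C.adj_of_tight hw hwk ht H.pr.gi.left (Or.inl n1),
      C.adj_of_tight hw hwk ht H.pr.gj.left (Or.inl n2),
      C.adj_of_tight hw hwk ht H.pr.gj.right (Or.inr n3)⟩
  obtain ⟨u1, u2, u3⟩ := adj u (Or.inl rfl) C.deg
  set D := Y.filter fun y => Paper.deg G y < k with hD
  have hsub : sing f (nb G u) \ D ⊆ Y.filter fun b => ¬ G.Adj (f (j0 + 1)) (nxt f b) := by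
    intro b hbm
    obtain ⟨b1, b2⟩ := Finset.mem_sdiff.1 hbm
    have bY := hY1 b1
    have bk : Paper.deg G b = k := by
      refine le_antisymm (C.deg_Y bY) ?_
      by_contra h
      exact b2 (Finset.mem_filter.2 ⟨bY, by omega⟩)
    refine Finset.mem_filter.2 ⟨bY, ?_⟩
    obtain ⟨a1, a2, a3⟩ := adj b (Or.inr b1) bk
    obtain ⟨β, rfl, hβ, x1, x2⟩ := C.Y_pos H.pr bY
    rcases hβ with ⟨h1, h2⟩ | ⟨h1, h2⟩
    · exact (C.oc_left H h1 h2 a1 (Or.inl (mem_nb.1 ((mem_sing C.cyc).1 b1).1)) (Or.inl u3)).elim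
    · rw [nxt_apply C.cyc]
      exact C.oc_outer H h1 h2 a2 (Or.inl ⟨Or.inl u1, u3⟩)
  have hc1 := Finset.card_le_card hsub
  have hc2 := Finset.le_card_sdiff D (sing f (nb G u))
  have dD : ∀ y ∈ D, y ∈ Y ∧ Paper.deg G y < k := fun y hy => Finset.mem_filter.1 hy
  have unadj : ∀ y ∈ Y, u ≠ y ∧ ¬ G.Adj u y := fun y hy =>
    ⟨fun h => C.u_notMem_Y (h ▸ hy), C.u_not_adj_Y hy⟩
  have hu := C.deg
  rcases Nat.lt_or_ge D.card 1 with h0 | h0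
  · obtain ⟨b, hbY⟩ := C.ne
    have := C.triple (unadj b hbY).1 q4 (q5 b hbY).2 (unadj b hbY).2 q3 (q5 b hbY).1
    have := C.deg_Y hbY
    omega
  rcases Nat.lt_or_ge D.card 2 with h1 | h1
  · obtain ⟨b, hbD⟩ := Finset.card_pos.1 h0
    obtain ⟨hbY, hbk⟩ := dD b hbD
    have := C.triple (unadj b hbY).1 q4 (q5 b hbY).2 (unadj b hbY).2 q3 (q5 b hbY).1
    omega
  rcases Nat.lt_or_ge D.card 3 with h2 | h2
  · obtain ⟨a, haD, b, hbD, hab⟩ := Finset.one_lt_card.1 h1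
    obtain ⟨haY, hak⟩ := dD a haD
    obtain ⟨hbY, hbk⟩ := dD b hbD
    have := C.triple hab (q5 a haY).2 (q5 b hbY).2 (C.Y_indep haY hbY) (q5 a haY).1 (q5 b hbY).1
    omega
  · obtain ⟨a, haD, b, hbD, d, hdD, hab, had, hbd⟩ := Finset.two_lt_card.1 h2
    obtain ⟨haY, hak⟩ := dD a haD
    obtain ⟨hbY, hbk⟩ := dD b hbD
    obtain ⟨hdY, hdk⟩ := dD d hdD
    have := Finset.card_le_card hY1
    have := C.triple hab had hbd (C.Y_indep haY hbY) (C.Y_indep haY hdY) (C.Y_indep hbY hdY)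
    omega

/-- The values of the parameters in the remaining case. -/
theorem slack (C : Sx G c k f u O X Y) (H : Oc G c f X i0 i1 j0) :
    X.card = k + 1 ∧ (exs f X).card = 0 ∧ O.card = 0 ∧ Y.card = (sing f (nb G u)).card + 1 ∧
      4 ≤ Y.card := by
  have h0 := C.no_oc_tight H
  have h1 := C.le_touch (Or.inl rfl) C.deg
  have h2 := Ctx.card_missed C.nb_sub_X C.deg
  have h3 := card_touch C.cyc Y (X \ nb G u)
  have h4 := Finset.card_le_card C.sing_sub_Y
  have := C.h1
  have := C.h2
  by_cases ht : Y.card + 2 * k = (sing f (nb G u)).card + 2 * X.card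
  · exact (h0 ht).elim
  · omega

theorem gap_len (C : Sx G c k f u O X Y) (he : (exs f X).card = 0) {a b : ℤ} (g : Gap f X a b) :
    b = a + 3 := by
  by_contra h
  have := g.len
  have : f (a + 3) ∈ exs f X := (mem_exs C.cyc).2 ⟨g.not_mem _ (by omega) (by omega),
    g.not_mem _ (by omega) (by omega), g.not_mem _ (by omega) (by omega)⟩
  exact (Finset.card_pos.2 ⟨_, this⟩).ne' he

theorem slack_deg (C : Sx G c k f u O X Y) (H : Oc G c f X i0 i1 j0) :
    (∀ y ∈ Y, Paper.deg G y = k) ∧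
      (Y.filter fun b => ¬ G.Adj (f (j0 + 1)) (nxt f b)).card ≤ 1 := by
  obtain ⟨e1, e2, e3, e4, e5⟩ := C.slack H
  obtain ⟨q1, q2, q3, q4, q5⟩ := C.oc_nonadj H
  have hd := (C.oc_miss H).1
  have hb := C.oc_bound H
  have hu := C.deg
  have unadj : ∀ y ∈ Y, u ≠ y ∧ ¬ G.Adj u y := fun y hy =>
    ⟨fun h => C.u_notMem_Y (h ▸ hy), C.u_not_adj_Y hy⟩
  have key : ∀ b ∈ Y, Paper.deg G b = k ∧ Paper.deg G (f (j0 + 1)) = k := by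
    intro b hbY
    have := C.triple (unadj b hbY).1 q4 (q5 b hbY).2 (unadj b hbY).2 q3 (q5 b hbY).1
    have := C.deg_Y hbY
    omega
  refine ⟨fun y hy => (key y hy).1, ?_⟩
  obtain ⟨b, hbY⟩ := C.ne
  have := (key b hbY).2
  omega

/-- The remaining case, up to symmetry. -/
theorem no_oc_aux (C : Sx G c k f u O X Y) (H : Oc G c f X i0 i1 j0) (hne : j0 + 3 ≠ i0 + c)
    (hu : G.Adj u (f (j0 + 3))) : False := by
  obtain ⟨e1, e2, e3, e4, e5⟩ := C.slack H
  obtain ⟨d1, d2⟩ := C.slack_deg H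
  obtain ⟨r1, r2, r3, r4⟩ := C.oc_rel H
  have hi := C.gap_len e2 H.pr.gi
  have d3 := (C.mirror.slack_deg (H.mirror hi)).2
  have nbY : ∀ y ∈ Y, nb G y ⊆ X := fun y hy v hv => C.HN y hy v (mem_nb.1 hv)
  obtain ⟨w0, hw0, hw0'⟩ : ∃ w0, (∀ b, b ≠ w0 → Ctx.Mv G f u b (f i0)) ∧
      (w0 ∈ Y → G.Adj w0 (f i0)) := by
    by_cases h : G.Adj u (f i0)
    · exact ⟨u, fun _ _ => Or.inl h, fun h => (C.u_notMem_Y h).elim⟩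
    · obtain ⟨x, hx, hux, w, hw, hwx⟩ := C.ex _ H.pr.gi.left h
      have := Ctx.eq_of_missed C.nb_sub_X C.deg e1 hx H.pr.gi.left hux h
      subst this
      exact ⟨w, fun b hb => Or.inr ⟨w, hw, hb.symm, hwx⟩, fun _ => hwx⟩
  have hout : ∀ b ∈ Y, ∃ β, f β = b ∧ j0 + 3 < β ∧ β < i0 + c ∧ f (β - 1) ∈ X ∧ f (β + 1) ∈ X := by
    intro b hb
    obtain ⟨β, rfl, hβ, x1, x2⟩ := C.Y_pos H.pr hb
    rcases hβ with ⟨h1, h2⟩ | ⟨h1, h2⟩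
    · exfalso
      have hx : G.Adj u (f (β - 1)) ∨ G.Adj u (f (β + 1)) := by
        by_contra! hn
        have := C.cyc.three_le
        have hc := C.card_cyc
        have := Ctx.eq_of_missed C.nb_sub_X C.deg e1 x1 x2 hn.1 hn.2
        exact C.cyc.ne (by omega) (by omega) this
      have l1 : ¬ G.Adj (f β) (f i0) := fun h => C.oc_left H h1 h2 h hx (Or.inl hu)
      have l2 : G.Adj (f β) (f (j0 + 3)) := by
        by_contra hn
        have := Ctx.eq_of_missed (nbY _ hb) (d1 _ hb) e1 H.pr.gj.right r4 hn (by
          rwa [C.cyc.per])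
        exact C.cyc.ne (by omega) (by omega) this
      exact C.oc_right H h1 h2 l2 hx (hw0 _ fun e => l1 (by
        have := hw0' (by rw [← e]; exact hb)
        rwa [← e] at this))
    · exact ⟨β, rfl, h1, h2, x1, x2⟩
  set F := Y.filter fun b => ¬ G.Adj (f (j0 + 1)) (nxt f b) with hF
  set F' := Y.filter fun b => ¬ G.Adj ((fun i => f (-i)) (-i1 + 1)) (nxt (fun i => f (-i)) b)
    with hF'
  have k1 : ∀ b ∈ Y, b ≠ w0 → G.Adj b (f j0) → b ∈ F := by
    intro b hb hbw ha
    obtain ⟨β, rfl, h1, h2, x1, x2⟩ := hout b hb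
    refine Finset.mem_filter.2 ⟨hb, ?_⟩
    rw [nxt_apply C.cyc]
    exact C.oc_outer H h1 h2 ha (Or.inl ⟨hw0 _ hbw, hu⟩)
  have k2 : ∀ b ∈ Y, b ≠ w0 → G.Adj b (f i1) → b ∈ F' := by
    intro b hb hbw ha
    obtain ⟨β, rfl, h1, h2, x1, x2⟩ := hout b hb
    refine Finset.mem_filter.2 ⟨hb, ?_⟩
    have hp : f (β - c) = f β := by rw [← C.cyc.per, sub_add_cancel]
    have := C.mirror.oc_outer (H.mirror hi) (β := -(β - c)) (by omega) (by omega) (by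
        rw [neg_neg, neg_neg, hp]; exact ha) (Or.inr (by
        have h := hw0 _ hbw
        unfold Ctx.Mv at h ⊢
        rw [sing_mirror, neg_neg, neg_neg, hp, show -(-i1 + 3) = i0 by omega]
        exact ⟨h, hu⟩))
    have e := nxt_apply C.mirror.cyc (-(β - c))
    rw [neg_neg, hp] at e
    rw [e]
    exact this
  by_cases hj : j0 = i1
  · have : (sing f (nb G u)).erase w0 ⊆ F := by
      intro b hb
      obtain ⟨b1, b2⟩ := Finset.mem_erase.1 hb
      refine k1 b (C.sing_sub_Y b2) b1 (C.adj_of_unique (Or.inr b2) (d1 _ (C.sing_sub_Y b2)) e1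
        (by omega) H.pr.gj.left ?_ ?_)
      · exact (C.gap_notMem H.pr.gj (l := j0 + 1) (by omega) (by omega)).2
      · exact (C.gap_notMem H.pr.gi (l := j0 - 1) (by omega) (by omega)).2
    have := Finset.card_le_card this
    have := Finset.pred_card_le_card_erase (s := sing f (nb G u)) (a := w0)
    omega
  · have : Y.erase w0 ⊆ F ∪ F' := by
      intro b hb
      obtain ⟨b1, b2⟩ := Finset.mem_erase.1 hb
      by_cases h : G.Adj b (f j0)
      · exact Finset.mem_union_left _ (k1 b b2 b1 h)
      · refine Finset.mem_union_right _ (k2 b b2 b1 ?_)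
        by_contra hn
        have := Ctx.eq_of_missed (nbY _ b2) (d1 _ b2) e1 H.pr.gi.right H.pr.gj.left hn h
        exact C.cyc.ne (by omega) (by omega) this
    have := Finset.card_le_card this
    have := Finset.card_union_le F F'
    have := Finset.pred_card_le_card_erase (s := Y) (a := w0)
    omega

/-- The first vertex of a gap is not adjacent to the last vertex of another gap with two
vertices. -/
theorem no_oc (C : Sx G c k f u O X Y) (H : Oc G c f X i0 i1 j0) : False := by
  obtain ⟨e1, e2, e3, e4, e5⟩ := C.slack H
  obtain ⟨d1, d2⟩ := C.slack_deg H
  obtain ⟨r1, r2, r3, r4⟩ := C.oc_rel H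
  have hi := C.gap_len e2 H.pr.gi
  by_cases hne : j0 + 3 = i0 + c
  · have hv : ∀ w, (w = u ∨ w ∈ sing f (nb G u)) → Paper.deg G w = k → G.Adj w (f i0) := by
      intro w hw hwk
      refine C.adj_of_unique hw hwk e1 (by omega) H.pr.gi.left ?_ ?_
      · exact (C.gap_notMem H.pr.gi (l := i0 + 1) (by omega) (by omega)).2
      · rw [← C.cyc.per]
        exact (C.gap_notMem H.pr.gj (l := i0 - 1 + c) (by omega) (by omega)).2
    obtain ⟨b, hb⟩ := Finset.card_pos.1 (show 0 < (sing f (nb G u)).card by omega)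
    have hbY := C.sing_sub_Y hb
    have ha := hv b (Or.inr hb) (d1 b hbY)
    obtain ⟨β, rfl, hβ, x1, x2⟩ := C.Y_pos H.pr hbY
    refine C.oc_left H (β := β) (by omega) (by omega) ha
      (Or.inl (mem_nb.1 ((mem_sing C.cyc).1 hb).1)) (Or.inl ?_)
    rw [hne, C.cyc.per]
    exact hv u (Or.inl rfl) C.deg
  · by_cases hu : G.Adj u (f (j0 + 3))
    · exact C.no_oc_aux H hne hu
    · refine C.mirror.no_oc_aux (H.mirror hi) (by omega) ?_
      by_contra hn
      rw [show -(-i1 + 3) = i0 by omega, ← C.cyc.per] at hn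
      have := Ctx.eq_of_missed C.nb_sub_X C.deg e1 H.pr.gj.right r4 hu hn
      exact C.cyc.ne (by omega) (by omega) this

end Sx

theorem Gap.pr {G : SimpleGraph V} {c : ℤ} {f : ℤ → V} (hf : Cyc G c f) {X : Finset V}
    {a b a' b' : ℤ} (g : Gap f X a b) (g' : Gap f X a' b') (hne : f a ≠ f a') :
    ∃ q, Pr f c X a b (a' + q * c) (b' + q * c) := by
  obtain ⟨j, h1, h2, h3⟩ := hf.exists_rep a' a
  obtain ⟨q, hq⟩ := hf.inj _ _ h3
  have e : j = a' + q * c := by linarith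
  subst e
  have sh : ∀ l, f (l + q * c) = f l := fun l => hf.per_mul l q
  have hab : a ≠ a' + q * c := fun h => hne (by rw [← h3, ← h])
  refine ⟨q, g, ⟨by rw [sh]; exact g'.left, by rw [sh]; exact g'.right, ?_, ?_⟩, ?_, ?_⟩
  · have := g'.len; omega
  · intro l l1 l2
    have := g'.not_mem (l - q * c) (by omega) (by omega)
    rwa [← sh, sub_add_cancel] at this
  · by_contra hn
    exact g.not_mem (a' + q * c) (by omega) (by omega) (by rw [h3]; exact g'.left)
  · by_contra hn
    refine g'.not_mem (a + c - q * c) (by omega) (by omega) ?_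
    rw [← sh, sub_add_cancel, hf.per]
    exact g.left

theorem Pr.card_exs [Fintype V] {G : SimpleGraph V} {c : ℤ} {f : ℤ → V} (hf : Cyc G c f)
    {X : Finset V} {i0 i1 j0 j1 : ℤ} (pr : Pr f c X i0 i1 j0 j1) :
    (i1 - i0 - 3) + (j1 - j0 - 3) ≤ (exs f X).card := by
  have h1 := pr.gi.len
  have h2 := pr.gj.len
  have h3 := pr.ij
  have h4 := pr.ji
  have key : ∀ a b, Gap f X a b → seg f (a + 3) (b - 1) ⊆ exs f X := by
    intro a b g v hv
    obtain ⟨l, l1, l2, rfl⟩ := mem_seg.1 hv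
    exact (mem_exs hf).2 ⟨g.not_mem _ (by omega) (by omega), g.not_mem _ (by omega) (by omega),
      g.not_mem _ (by omega) (by omega)⟩
  have e := Finset.card_le_card (Finset.union_subset (key _ _ pr.gi) (key _ _ pr.gj))
  rw [Finset.card_union_of_disjoint (hf.disj (by omega) (by omega))] at e
  have e1 := hf.card_seg (a := i0 + 3) (b := i1 - 1) (by omega) (by omega)
  have e2 := hf.card_seg (a := j0 + 3) (b := j1 - 1) (by omega) (by omega)
  omega

theorem Gap.card_exs [Fintype V] {G : SimpleGraph V} {c : ℤ} {f : ℤ → V} (hf : Cyc G c f)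
    {X : Finset V} {a b : ℤ} (g : Gap f X a b) (hb : b ≤ a + c) :
    b - a - 3 ≤ (exs f X).card := by
  have h1 := g.len
  have key : seg f (a + 3) (b - 1) ⊆ exs f X := by
    intro v hv
    obtain ⟨l, l1, l2, rfl⟩ := mem_seg.1 hv
    exact (mem_exs hf).2 ⟨g.not_mem _ (by omega) (by omega), g.not_mem _ (by omega) (by omega),
      g.not_mem _ (by omega) (by omega)⟩
  have e := Finset.card_le_card key
  have e1 := hf.card_seg (a := a + 3) (b := b - 1) (by omega) (by omega)
  omega

theorem deg_le_of_missed [Fintype V] {G : SimpleGraph V} {X M R : Finset V} {z : V} (hM : M ⊆ X)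
    (hz : ∀ v ∈ M, ¬ G.Adj z v) (hR : ∀ v, G.Adj z v → v ∉ X → v ∈ R) :
    deg G z + M.card ≤ X.card + R.card := by
  rw [← card_nb]
  have h1 : nb G z ⊆ (X \ M) ∪ R := by
    intro v hv
    have hv' := mem_nb.1 hv
    by_cases h : v ∈ X
    · exact Finset.mem_union_left _ (Finset.mem_sdiff.2 ⟨h, fun hm => hz v hm hv'⟩)
    · exact Finset.mem_union_right _ (hR v hv' h)
  have h2 := Finset.card_le_card h1
  have h3 := Finset.card_union_le (X \ M) R
  have h4 := Finset.card_sdiff_add_card_eq_card hM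
  omega

namespace Ctx

variable [Fintype V] {G : SimpleGraph V} {c : ℤ} {k : ℕ} {f : ℤ → V} {u : V} {O X Y : Finset V}
  (C : Ctx G c k f u O X Y)
include C

theorem full_u {lo : ℤ} {S : ℤ → Prop} {s t : V} (h : IP G f lo c ∅ S s t) (hs : G.Adj u s)
    (ht : G.Adj u t) (hst : s ≠ t) (hS : ∀ k, lo ≤ k → k < lo + c → S k) : False := by
  obtain ⟨Q, h1, h2, h3⟩ := h
  have hsub : cyf f c ⊆ Q := by
    intro v hv
    obtain ⟨i, rfl⟩ := C.cyc.mem_cyf.1 hv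
    obtain ⟨j, h4, h5, h6⟩ := C.cyc.exists_rep i lo
    rw [← h6]
    exact (h2 j h4 h5).2 (hS j h4 h5)
  have := C.full h1 hs ht hst (C.u_notMem_ip fun x hx => (h3 x hx).imp_right fun h => h.elim)
  have := Finset.card_le_card hsub
  have := C.cyc.card_cyf
  omega

/-- The first vertex of one gap and the last vertex of another gap, which has two vertices, have no
common neighbour off the cycle. -/
theorem not_via {i0 i1 j0 : ℤ} (pr : Pr f c X i0 i1 j0 (j0 + 3)) {r : V} (hr : r ∈ O)
    (h1 : G.Adj r (f (i0 + 1))) (h2 : G.Adj r (f (j0 + 2))) : False := by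
  have := pr.ij
  have := pr.ji
  have := pr.gi.len
  have a1 : IP (Gz G f Y) f (i0 + 1) c ∅ _ _ _ := .sgr (C.cyc.gz Y) (i0 + 1) j0
  have a2 : IP (Gz G f Y) f (i0 + 1) c ∅ _ _ _ := .sg (C.cyc.gz Y) (j0 + 2) (i0 + c)
  refine C.full_via (k0 := j0 + 1) a1 a2 hr h1 h2 (C.gap_notMem pr.gi (by omega) (by omega)).2
    (C.gap_notMem pr.gj (by omega) (by omega)).2 pr.gj.left ?_ ?_
    (C.gap_notMem pr.gj (by omega) (by omega)).2 ?_ ?_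
  · rw [C.cyc.per]; exact pr.gi.left
  · exact C.cyc.ne (by omega) (by omega)
  · intros; omega
  · intros; omega

/-- An off-cycle vertex has no two consecutive neighbours. -/
theorem not_insert {r : V} (hr : r ∈ O) {l : ℤ} (h1 : G.Adj r (f l)) : ¬ G.Adj r (f (l + 1)) := by
  intro h2
  have hP := (C.pth_cyc ∅ l).imp (G' := G) (fun v w _ _ h => h.1)
  have hr' : r ∉ cyf f c := fun h => by
    obtain ⟨i, hi⟩ := C.cyc.mem_cyf.1 h
    exact C.fO i (hi ▸ hr)
  have e := C.max _ _ _ (Pth.cons h2 hr' hP) h1.symm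
  rw [Finset.card_insert_of_notMem hr'] at e
  have h3 := C.cyc.card_cyf
  have h4 := C.cyc.three_le
  have := e (by omega)
  push_cast at this
  omega

end Ctx

namespace Sx

variable [Fintype V] {G : SimpleGraph V} {c : ℤ} {k : ℕ} {f : ℤ → V} {u : V} {O X Y : Finset V}

theorem bound (C : Sx G c k f u O X Y) : X.card + (exs f X).card + O.card ≤ k + 2 := by
  have h1 := C.le_touch (Or.inl rfl) C.deg
  have h2 := Ctx.card_missed C.nb_sub_X C.deg
  have h3 := card_touch C.cyc Y (X \ nb G u)
  have := C.h2
  omega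

theorem tight (C : Sx G c k f u O X Y) (he : 2 ≤ (exs f X).card) :
    X.card = k ∧ (exs f X).card = 2 ∧ O = ∅ ∧ (∀ x ∈ X, G.Adj u x) ∧
      (∀ y ∈ Y, ∀ x ∈ X, G.Adj y x) ∧ 3 ≤ Y.card ∧
      ∀ z, z ∉ X → z ≠ u → z ∉ Y → k ≤ Paper.deg G z := by
  have h0 := C.bound
  have h1 := C.le_card_X
  have hX : X.card = k := by omega
  have h2 : nb G u = X := Finset.eq_of_subset_of_card_le C.nb_sub_X (by
    rw [card_nb, C.deg]; omega)
  have h3 : (sing f (nb G u)).card = Y.card := by rw [h2, C.Yeq]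
  have h4 := C.h1
  have h5 := C.deg
  have hu : ∀ y ∈ Y, u ≠ y ∧ ¬ G.Adj u y := fun y hy =>
    ⟨fun h => C.u_notMem_Y (h ▸ hy), C.u_not_adj_Y hy⟩
  have hd : ∀ y ∈ Y, Paper.deg G y = k := by
    intro y hy
    obtain ⟨y', hy', hne⟩ := Finset.exists_mem_ne (by omega : 1 < Y.card) y
    have := C.triple (hu y hy).1 (hu y' hy').1 hne.symm (hu y hy).2 (hu y' hy').2
      (C.Y_indep hy hy')
    have := C.deg_Y hy
    have := C.deg_Y hy'
    omega
  refine ⟨hX, by omega, Finset.card_eq_zero.1 (by omega), fun x hx => mem_nb.1 (h2 ▸ hx), ?_,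
    by omega, ?_⟩
  · intro y hy x hx
    have : nb G y = X := Finset.eq_of_subset_of_card_le (fun v hv => C.HN y hy v (mem_nb.1 hv)) (by
      rw [card_nb, hd y hy]; omega)
    exact mem_nb.1 (this ▸ hx)
  · intro z h6 h7 h8
    obtain ⟨y, hy⟩ := C.ne
    have := C.triple (hu y hy).1 h7.symm (fun h => h8 (h ▸ hy)) (hu y hy).2
      (fun h => h6 (C.sub z h)) (fun h => h6 (C.HN y hy z h))
    have := C.deg_Y hy
    omega

theorem no_oc3 (C : Sx G c k f u O X Y) {i0 j0 : ℤ} (pr : Pr f c X i0 (i0 + 4) j0 (j0 + 4))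
    (h : G.Adj (f (i0 + 1)) (f (j0 + 3))) : False := by
  have he := pr.card_exs C.cyc
  obtain ⟨hX, e2, hO, hu, hY, ht, hz⟩ := C.tight (by omega)
  have hij := pr.ij
  have hji := pr.ji
  have hc : f (i0 + c) ∈ X := by rw [C.cyc.per]; exact pr.gi.left
  have hf := C.cyc
  have inII : ∀ b ∈ Y, ∃ β, f β = b ∧ j0 + 4 < β ∧ β < i0 + c ∧ f (β - 1) ∈ X ∧ f (β + 1) ∈ X := by
    intro b hb
    obtain ⟨β, rfl, hβ, x1, x2⟩ := C.Y_pos pr hb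
    rcases hβ with ⟨h1, h2⟩ | ⟨h1, h2⟩
    · exact (C.full_u (lo := i0 + 1) ((((IP.sg (lo := i0 + 1) hf (j0 + 4) (i0 + c)).fw hf β (j0 + 3)
        (hY _ hb _ hc).symm)).fw hf (i0 + 1) (β - 1) h.symm) (hu _ pr.gj.right) (hu _ x1)
        (hf.ne (by omega) (by omega)).symm (by intro k; omega)).elim
    · exact ⟨β, rfl, h1, h2, x1, x2⟩
  have nv : ¬ G.Adj (f (j0 + 1)) (f (i0 + c)) := fun ha =>
    C.full_u (lo := i0 + 1) (((IP.sg (lo := i0 + 1) hf (j0 + 4) (i0 + c)).fw hf (j0 + 1) (j0 + 3)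
      ha.symm).fw hf (i0 + 1) j0 h.symm) (hu _ pr.gj.right) (hu _ pr.gj.left)
      (hf.ne (by omega) (by omega)).symm (by intro k; omega)
  have nx : ∀ β, f β ∈ Y → j0 + 4 < β → β < i0 + c →
      ¬ G.Adj (f (j0 + 1)) (f (β - 1)) := fun β hb h1 h2 ha => 
    C.full_u (lo := i0 + 1) ((((IP.sg (lo := i0 + 1) hf (j0 + 4) (β - 1)).fw hf (j0 + 1) (j0 + 3)
      ha.symm).fw hf (i0 + 1) j0 h.symm).fw hf β (i0 + c) (hY _ hb _ pr.gj.left).symm)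
      (hu _ pr.gj.right) (hu _ hc) (hf.ne (by omega) (by omega)) (by intro k; omega)
  have ng : ¬ G.Adj (f (j0 + 1)) (f (i0 + 2)) := fun ha =>
    C.full_u (lo := i0 + 1) (((((IP.sg (lo := i0 + 1) hf (j0 + 4) (i0 + c)).fw hf (i0 + 1) (i0 + 1)
      (by rw [hf.per]; exact hf.adj _)).bw hf (j0 + 2) (j0 + 3) h).bw hf (j0 + 1) (j0 + 1)
      (by rw [show j0 + 2 = j0 + 1 + 1 by ring]; exact (hf.adj _).symm)).fw hf (i0 + 2) j0 ha)
      (hu _ pr.gj.right) (hu _ pr.gj.left)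
      (hf.ne (by omega) (by omega)).symm (by intro k; omega)
  have hex : exs f X = {f (i0 + 3), f (j0 + 3)} := by
    symm
    refine Finset.eq_of_subset_of_card_le ?_ ?_
    · have key : ∀ a, Gap f X a (a + 4) → f (a + 3) ∈ exs f X := fun a g => (mem_exs hf).2
        ⟨g.not_mem _ (by omega) (by omega), g.not_mem _ (by omega) (by omega),
          g.not_mem _ (by omega) (by omega)⟩
      intro v hv
      simp only [Finset.mem_insert, Finset.mem_singleton] at hv
      rcases hv with rfl | rfl
      · exact key _ pr.gi
      · exact key _ pr.gj
    · rw [Finset.card_pair (hf.ne (by omega) (by omega)), e2]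
  set M : Finset V := insert (f (i0 + c)) (Y.image (nxt fun i => f (-i))) with hM
  have nxm : ∀ β, nxt (fun i => f (-i)) (f β) = f (β - 1) := fun β => by
    have := nxt_apply hf.mirror (-β)
    rw [neg_neg, show -(-β + 1) = β - 1 by ring] at this
    exact this
  have cM : M.card = Y.card + 1 := by
    rw [hM, Finset.card_insert_of_notMem, Finset.card_image_of_injOn]
    · intro a ha b hb hab
      obtain ⟨i, hi, -⟩ := inII a ha
      obtain ⟨j, hj, -⟩ := inII b hb
      exact hf.mirror.nxt_inj ⟨-i, by rwa [neg_neg]⟩ ⟨-j, by rwa [neg_neg]⟩ hab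
    · intro hm
      obtain ⟨b, hb, e⟩ := Finset.mem_image.1 hm
      obtain ⟨β, rfl, h1, h2, -⟩ := inII b hb
      rw [nxm] at e
      exact hf.ne (by omega) (by omega) e
  have d := deg_le_of_missed (G := G) (z := f (j0 + 1)) (X := X) (M := M)
    (R := {f (j0 + 2), f (j0 + 3), f (i0 + 3)}) ?_ ?_ ?_
  · have d2 := hz _ (pr.gj.not_mem (j0 + 1) (by omega) (by omega)) (C.off _)
      (C.gap_notMem pr.gj (by omega) (by omega)).2
    have := Finset.card_le_three (a := f (j0 + 2)) (b := f (j0 + 3)) (c := f (i0 + 3))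
    omega
  · intro v hv
    rcases Finset.mem_insert.1 hv with rfl | hv
    · exact hc
    · obtain ⟨b, hb, rfl⟩ := Finset.mem_image.1 hv
      obtain ⟨β, rfl, h1, h2, x1, x2⟩ := inII b hb
      rwa [nxm]
  · intro v hv
    rcases Finset.mem_insert.1 hv with rfl | hv
    · exact nv
    · obtain ⟨b, hb, rfl⟩ := Finset.mem_image.1 hv
      obtain ⟨β, rfl, h1, h2, x1, x2⟩ := inII b hb
      rw [nxm]
      exact nx β hb h1 h2
  · intro v hv hvX
    obtain ⟨p, rfl⟩ : ∃ p, f p = v := by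
      rcases C.cover v with h | h | rfl
      · exact h
      · simp [hO] at h
      · exact ((pr.gj.not_mem (j0 + 1) (by omega) (by omega)) (C.sub _ hv.symm)).elim
    simp only [Finset.mem_insert, Finset.mem_singleton]
    rcases C.classes p with h1 | h1 | h1 | h1
    · exact (hvX h1).elim
    · exfalso
      rw [C.mem_first] at h1
      by_cases e : f (p - 1) = f j0
      · have := hf.congr_shift e 1
        rw [sub_add_cancel] at this
        exact G.loopless.irrefl _ (this ▸ hv)
      · exact C.not_cn_firsts pr.gj.left h1 (Ne.symm e) (Or.inl (by rwa [sub_add_cancel]))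
    · obtain ⟨h1, h3⟩ := C.mem_sec.1 h1
      have h4 : f (p - 1) ∉ X := C.not_X_of_next (by rwa [show p - 1 - 1 = p - 2 by ring])
      by_cases h5 : f (p + 1) ∈ X
      · exfalso
        have g : Gap f X (p - 2) (p - 2 + 3) := ⟨h1, by rwa [show p - 2 + 3 = p + 1 by ring],
          by omega, fun l l1 l2 => by
            obtain rfl | rfl : l = p - 1 ∨ l = p := by omega
            · exact h4
            · exact h3⟩
        obtain ⟨q, hq⟩ := pr.gj.pr hf g (fun e => by
          have := hf.congr_shift e 3
          refine pr.gj.not_mem (j0 + 3) (by omega) (by omega) (this ▸ g.right))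
        refine C.no_oc (i0 := j0) (i1 := j0 + 4) (j0 := p - 2 + q * c) ⟨?_, ?_⟩
        · rwa [add_right_comm] at hq
        · rwa [show p - 2 + q * c + 2 = p + q * c by ring, hf.per_mul]
      · have h6 : f (p + 1) ∈ exs f X := (mem_exs hf).2 ⟨h5, by rwa [add_sub_cancel_right], by
          rwa [show p + 1 - 2 = p - 1 by ring]⟩
        simp only [hex, Finset.mem_insert, Finset.mem_singleton] at h6
        rcases h6 with e | e
        · have := hf.congr_shift e (-1)
          rw [add_neg_cancel_right, show i0 + 3 + -1 = i0 + 2 by ring] at this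
          exact (ng (this ▸ hv)).elim
        · have := hf.congr_shift e (-1)
          rw [add_neg_cancel_right, show j0 + 3 + -1 = j0 + 2 by ring] at this
          exact Or.inl this
    · simp only [hex, Finset.mem_insert, Finset.mem_singleton] at h1
      tauto

/-- The first vertex of a gap is not connected to the last vertex of another gap. -/
theorem not_cn_fl (C : Sx G c k f u O X Y) {i0 i1 j0 j1 : ℤ} (pr : Pr f c X i0 i1 j0 j1) :
    ¬ Cn G O (f (i0 + 1)) (f (j1 - 1)) := by
  intro h
  have he := pr.card_exs C.cyc
  have l1 := pr.gi.len
  have l2 := pr.gj.len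
  have main : ∀ {f : ℤ → V} (C : Sx G c k f u O X Y) {i0 i1 j0 j1 : ℤ}, Pr f c X i0 i1 j0 j1 →
      Cn G O (f (i0 + 1)) (f (j1 - 1)) → j1 = j0 + 3 → False := by
    rintro f C i0 i1 j0 _ pr h rfl
    rw [show j0 + 3 - 1 = j0 + 2 by ring, C.cn_iff] at h
    rcases h with h | ⟨r, hr, h1, h2⟩
    · exact C.no_oc ⟨pr, h⟩
    · exact C.not_via pr hr h1 h2
  by_cases h1 : j1 = j0 + 3
  · exact main C pr h h1
  by_cases h2 : i1 = i0 + 3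
  · refine main C.mirror pr.mirror ?_ (by omega)
    rw [show -(-j1 + 1) = j1 - 1 by ring, show -(-i0 - 1) = i0 + 1 by ring]
    exact h.symm
  obtain ⟨hX, e2, hO, -⟩ := C.tight (by omega)
  obtain rfl : i1 = i0 + 4 := by omega
  obtain rfl : j1 = j0 + 4 := by omega
  refine C.no_oc3 pr ?_
  rw [C.cn_iff, hO] at h
  rw [show j0 + 4 - 1 = j0 + 3 by ring] at h
  simpa using h

end Sx

namespace Ctx
variable [Fintype V] {G : SimpleGraph V} {c : ℤ} {k : ℕ} {f : ℤ → V} {u : V} {O X Y : Finset V}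
  (C : Ctx G c k f u O X Y)
include C

/-- Cutting the cycle at `X` and some further vertices. -/
theorem not_tough (hT : OneTough G) (hne : X.Nonempty) (Z : Finset V) (hZf : ∀ v ∈ Z, ∃ i, f i = v)
    (hZ : ∀ i, f i ∈ Z → f (i + 1) ∉ X ∧ f (i + 1) ∉ Z ∧ f (i - 1) ∉ X)
    (hin : ∀ a b i j, Gap f X a b → b ≤ a + c → a < i → i < j → j < b → f i ∉ Z → f j ∉ Z →
      Cn G O (f i) (f j) → ∀ l, i ≤ l → l ≤ j → f l ∉ Z)
    (hout : ∀ a b a' b' i j, Pr f c X a b a' b' → a < i → i < b → a' < j → j < b' → f i ∉ Z →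
      f j ∉ Z → ¬ Cn G O (f i) (f j)) : False := by
  have hf := C.cyc
  have hX : ∃ i, f i ∈ X := by
    obtain ⟨x, hx⟩ := hne
    obtain ⟨i, rfl⟩ := C.ran x hx
    exact ⟨i, hx⟩
  have nY : ∀ y ∈ Y, ∀ v, v ∉ X → ¬ Cn G O y v := by
    intro y hy v hv hc
    rcases C.cn_iff.1 hc with h | ⟨r, hr, h, -⟩
    · exact hv (C.HN y hy v h)
    · exact C.O_notMem_X hr (C.HN y hy r h.symm)
  refine OneTough.arcs hT hf (S := X ∪ Z) (O := O) (H := {u}) (x := u) (by simp)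
    (hne.mono Finset.subset_union_left) ?_ C.fO ?_ ?_ ?_ ?_ ?_ ?_
  · intro v
    simpa using C.cover v
  · intro i
    simpa using C.off i
  · simpa using C.uO
  · intro h hh v ha
    rw [Finset.mem_singleton.1 hh] at ha
    exact Or.inl (Finset.mem_union_left _ (C.sub v ha))
  · intro v hv
    rcases Finset.mem_union.1 hv with hv | hv
    · exact C.ran v hv
    · exact hZf v hv
  · intro i hi hi'
    rcases Finset.mem_union.1 hi with hi | hi <;> rcases Finset.mem_union.1 hi' with hi' | hi'
    · exact C.nocons i hi hi'
    · exact (hZ _ hi').2.2 (by rwa [add_sub_cancel_right])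
    · exact (hZ _ hi).1 hi'
    · exact (hZ _ hi).2.1 hi'
  · intro i j hi hj hc
    rw [Finset.mem_union, not_or] at hi hj
    obtain ⟨a, b, h1, h2, h3, h4, h5, h6⟩ := hf.exists_gap hX i hi.1
    obtain ⟨a', b', h1', h2', h3', h4', h5', h6'⟩ := hf.exists_gap hX j hj.1
    have gp : ∀ a b i, a < i → i < b → f a ∈ X → f b ∈ X → (∀ l, a < l → l < b → f l ∉ X) →
        f i ∉ Y → Gap f X a b := by
      intro a b i h1 h2 h4 h5 h6 hy
      refine ⟨h4, h5, ?_, h6⟩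
      by_contra hl
      have e1 : i = a + 1 := by omega
      have e2 : b = i + 1 := by omega
      subst e1 e2
      exact hy (C.mem_Y.2 ⟨by rwa [add_sub_cancel_right], h5⟩)
    have g := gp a b i h1 h2 h4 h5 h6 fun hy => nY _ hy _ hj.1 hc
    have g' := gp a' b' j h1' h2' h4' h5' h6' fun hy => nY _ hy _ hi.1 hc.symm
    by_cases he : f a = f a'
    · obtain ⟨q, hq⟩ := hf.inj _ _ he
      have sh : ∀ l, f (l + q * c) = f l := fun l => hf.per_mul l q
      have e : a = a' + q * c := by linarith
      have eb : b = b' + q * c := by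
        rcases lt_trichotomy b (b' + q * c) with h | h | h
        · refine absurd h5 ?_
          rw [← sub_add_cancel b (q * c), sh]
          exact h6' _ (by omega) (by omega)
        · exact h
        · refine absurd h5' ?_
          rw [← sh]
          exact h6 _ (by omega) (by omega)
      refine ⟨j + q * c, sh j, fun l l1 l2 => ?_⟩
      rw [Finset.mem_union, not_or]
      refine ⟨h6 l (by omega) (by omega), ?_⟩
      have hj' : f (j + q * c) ∉ Z := by rw [sh]; exact hj.2
      have hc' : Cn G O (f i) (f (j + q * c)) := by rwa [sh]
      rcases lt_trichotomy i (j + q * c) with h | h | h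
      · exact hin a b i _ g h3 h1 h (by omega) hi.2 hj' hc' l (by omega) (by omega)
      · rw [show l = i by omega]
        exact hi.2
      · exact hin a b _ i g h3 (by omega) h (by omega) hj' hi.2 hc'.symm l (by omega) (by omega)
    · obtain ⟨q, pr⟩ := g.pr hf g' he
      have sh : ∀ l, f (l + q * c) = f l := fun l => hf.per_mul l q
      exact absurd hc (by
        rw [← sh j]
        exact hout _ _ _ _ i (j + q * c) pr h1 h2 (by omega) (by omega) hi.2
          (by rw [sh]; exact hj.2))

theorem head_first (hr1 : O.card ≤ 1) {i0 j0 j1 : ℤ} (pr : Pr f c X i0 (i0 + 4) j0 j1)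
    (h : Cn G O (f (i0 + 1)) (f (i0 + 3))) : ¬ Cn G O (f (i0 + 2)) (f (j0 + 1)) := by
  intro h'
  have hf := C.cyc
  have := pr.ij; have := pr.ji; have := pr.gj.len
  obtain ⟨x1, y1⟩ := C.gap_notMem pr.gi (l := i0 + 1) (by omega) (by omega)
  obtain ⟨x2, y2⟩ := C.gap_notMem pr.gi (l := i0 + 2) (by omega) (by omega)
  obtain ⟨x3, y3⟩ := C.gap_notMem pr.gi (l := i0 + 3) (by omega) (by omega)
  obtain ⟨x4, y4⟩ := C.gap_notMem pr.gj (l := j0 + 1) (by omega) (by omega)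
  have hO : ∀ x ∈ (O : Set V), ∀ k, f k ≠ x := fun x hx k e => C.fO k (e ▸ hx)
  have hX : f (i0 + c) ∈ X := by rw [hf.per]; exact pr.gi.left
  have ne : f j0 ≠ f (i0 + c) := hf.ne (by omega) (by omega)
  rcases C.cn_iff.1 h with ha | ⟨r, hr, r1, r2⟩
  · exact C.full_ip (lo := i0 + 1) (((IP.sgr (lo := i0 + 1) (hf.gz Y) (i0 + 3) j0).fw (hf.gz Y) (i0 + 1)
      (i0 + 2) (C.gzadj' ha.symm x3 y3)).join (hf.gz Y) (IP.sg (lo := i0 + 1) (hf.gz Y) (j0 + 1) (i0 + c)) hO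
      (C.cn_gz h' x2 x4).1 (by intros; omega)) pr.gj.left hX ne (by intros; omega)
  · rcases C.cn_iff.1 h' with ha' | ⟨r', hr', r3, r4⟩
    · exact C.full_ip (lo := i0 + 1) ((IP.sgr (lo := i0 + 1) (hf.gz Y) (i0 + 3) j0).join (hf.gz Y)
        ((IP.sg (lo := i0 + 1) (hf.gz Y) (i0 + 1) (i0 + 2)).fw (hf.gz Y) (j0 + 1) (i0 + c)
          (C.gzadj' ha' x2 y2)) hO
        (C.cn_gz h.symm x3 x1).1 (by intros; omega)) pr.gj.left hX ne (by intros; omega)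
    · rw [Finset.card_le_one.1 hr1 _ hr' _ hr] at r3
      exact C.not_insert hr r1 (by rwa [add_assoc])

theorem head_last (hr1 : O.card ≤ 1) {i0 j0 j1 : ℤ} (pr : Pr f c X i0 (i0 + 4) j0 j1)
    (h : Cn G O (f (i0 + 1)) (f (i0 + 3))) : ¬ Cn G O (f (i0 + 2)) (f (j1 - 1)) := by
  have hf := C.cyc
  have := head_first C.mirror hr1 (i0 := -(i0 + 4)) (j0 := -j1 + c) (j1 := -j0 + c)
    (by rw [show -(i0 + 4) + 4 = -i0 by ring]; exact pr.mirror' hf) (by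
      rw [show -(-(i0 + 4) + 1) = i0 + 3 by ring, show -(-(i0 + 4) + 3) = i0 + 1 by ring]
      exact h.symm)
  rwa [show -(-(i0 + 4) + 2) = i0 + 2 by ring,
    show -(-j1 + c + 1) = j1 - 1 + (-1) * c by ring, hf.per_mul] at this

/-- Some gap has at least four vertices. -/
theorem exists_large (hT : OneTough G) (hne : X.Nonempty)
    (hfl : ∀ {i0 i1 j0 j1}, Pr f c X i0 i1 j0 j1 → ¬ Cn G O (f (i0 + 1)) (f (j1 - 1)))
    (hO : ∀ {i0 j0 j1}, Pr f c X i0 (i0 + 4) j0 j1 → O.card ≤ 1)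
    (hhh : ∀ {i0 j0}, Pr f c X i0 (i0 + 4) j0 (j0 + 4) → Cn G O (f (i0 + 1)) (f (i0 + 3)) →
      Cn G O (f (j0 + 1)) (f (j0 + 3)) → ¬ Cn G O (f (i0 + 2)) (f (j0 + 2))) :
    ∃ a b, Gap f X a b ∧ b ≤ a + c ∧ a + 5 ≤ b := by
  by_contra hno
  push Not at hno
  have hf := C.cyc
  set Z : Finset V := Finset.univ.filter fun v => ∃ a, f (a + 2) = v ∧ Gap f X a (a + 4) ∧
    ¬ Cn G O (f (a + 1)) (f (a + 3)) with hZd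
  have mZ : ∀ i, f i ∈ Z ↔ Gap f X (i - 2) (i + 2) ∧ ¬ Cn G O (f (i - 1)) (f (i + 1)) := by
    intro i
    rw [hZd, Finset.mem_filter]
    constructor
    · rintro ⟨-, a, h1, h2, h3⟩
      have sh : ∀ l, f (a + 2 + l) = f (i + l) := fun l => hf.congr_shift h1 l
      have e1 := sh (-2); have e2 := sh (-1); have e3 := sh 1; have e4 := sh 2
      ring_nf at e1 e2 e3 e4 
      refine ⟨⟨?_, ?_, by omega, ?_⟩, ?_⟩
      · rw [show i - 2 = -2 + i by ring, ← e1]; exact h2.left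
      · rw [show i + 2 = 2 + i by ring, ← e4, add_comm]; exact h2.right
      · intro l l1 l2
        have := sh (l - i)
        rw [show i + (l - i) = l by ring] at this
        rw [← this]
        exact h2.not_mem _ (by omega) (by omega)
      · rw [show i - 1 = -1 + i by ring, ← e2, show i + 1 = 1 + i by ring, ← e3, add_comm 1 a,
          add_comm 3 a]
        exact h3
    · rintro ⟨h1, h2⟩
      refine ⟨Finset.mem_univ _, i - 2, by rw [sub_add_cancel], ?_, ?_⟩
      · rwa [show i - 2 + 4 = i + 2 by ring]
      · rwa [show i - 2 + 1 = i - 1 by ring, show i - 2 + 3 = i + 1 by ring]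
  refine C.not_tough hT hne Z ?_ ?_ ?_ ?_
  · intro v hv
    obtain ⟨-, a, h, -⟩ := Finset.mem_filter.1 hv
    exact ⟨_, h⟩
  · intro i hi
    have g := ((mZ i).1 hi).1
    refine ⟨g.not_mem _ (by omega) (by omega), fun h => ?_, g.not_mem _ (by omega) (by omega)⟩
    have g' := ((mZ _).1 h).1
    exact g'.not_mem (i + 2) (by omega) (by omega) g.right
  · intro a b i j g hb h1 h2 h3 hi hj hc l l1 l2 hl
    have := hno a b g hb
    have g' := (mZ l).1 hl
    have : l ≠ i := fun e => hi (e ▸ hl)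
    have : l ≠ j := fun e => hj (e ▸ hl)
    have e1 : i = l - 1 := by omega
    have e2 : j = l + 1 := by omega
    exact g'.2 (e1 ▸ e2 ▸ hc)
  · intro a b a' b' i j pr h1 h2 h3 h4 hi hj hc
    have q1 := pr.ij; have q2 := pr.ji; have q3 := pr.gi.len; have q4 := pr.gj.len
    have b1 := hno a b pr.gi (by omega)
    have b2 := hno a' b' pr.gj (by omega)
    have hd : ∀ a b i, Gap f X a b → b < a + 5 → a < i → i < b → f i ∉ Z → i = a + 1 ∨ i = b - 1 ∨
        (i = a + 2 ∧ b = a + 4 ∧ Cn G O (f (a + 1)) (f (a + 3))) := by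
      intro a b i g h1 h2 h3 h4
      by_cases h5 : i = a + 1
      · exact Or.inl h5
      by_cases h6 : i = b - 1
      · exact Or.inr (Or.inl h6)
      have e1 : i = a + 2 := by omega
      have e2 : b = a + 4 := by omega
      subst e1 e2
      refine Or.inr (Or.inr ⟨rfl, rfl, ?_⟩)
      by_contra h7
      refine h4 ((mZ _).2 ⟨?_, ?_⟩)
      · rwa [show a + 2 - 2 = a by ring, show a + 2 + 2 = a + 4 by ring]
      · rwa [show a + 2 - 1 = a + 1 by ring, show a + 2 + 1 = a + 3 by ring]
    have sw := pr.swap hf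
    have d1 : f a ≠ f a' := hf.ne (by omega) (by omega)
    have d2 : f b ≠ f b' := by
      intro e
      have := hf.eq_of e (by omega) (by omega)
      omega
    rcases hd a b i pr.gi b1 h1 h2 hi with rfl | rfl | ⟨rfl, rfl, h5⟩ <;>
      rcases hd a' b' j pr.gj b2 h3 h4 hj with rfl | rfl | ⟨rfl, rfl, h6⟩
    · exact C.not_cn_firsts pr.gi.left pr.gj.left d1 hc
    · exact hfl pr hc
    · have := C.head_first (hO sw) (i0 := a') (j0 := a + c) (j1 := b + c) sw h6
      rw [show a + c + 1 = a + 1 + c by ring, hf.per] at this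
      exact this hc.symm
    · have := hfl sw
      rw [show b + c - 1 = b - 1 + c by ring, hf.per] at this
      exact this hc.symm
    · exact C.not_cn_lasts pr.gi.right pr.gj.right d2 hc
    · have := C.head_last (hO sw) (i0 := a') (j0 := a + c) (j1 := b + c) sw h6
      rw [show b + c - 1 = b - 1 + c by ring, hf.per] at this
      exact this hc.symm
    · exact C.head_first (hO pr) pr h5 hc
    · exact C.head_last (hO pr) pr h5 hc
    · exact hhh pr h5 h6 hc

end Ctx

namespace Sx
variable [Fintype V] {G : SimpleGraph V} {c : ℤ} {k : ℕ} {f : ℤ → V} {u : V} {O X Y : Finset V}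

theorem X_nonempty (C : Sx G c k f u O X Y) : X.Nonempty := by
  obtain ⟨y, hy⟩ := C.ne
  obtain ⟨i, -, h, -⟩ := C.Y_ran hy
  exact ⟨_, h⟩

theorem head_head (C : Sx G c k f u O X Y) {i0 j0 : ℤ} (pr : Pr f c X i0 (i0 + 4) j0 (j0 + 4))
    (h : Cn G O (f (i0 + 1)) (f (i0 + 3))) (h' : Cn G O (f (j0 + 1)) (f (j0 + 3))) :
    ¬ Cn G O (f (i0 + 2)) (f (j0 + 2)) := by
  intro h''
  have hf := C.cyc
  have := pr.ij; have := pr.ji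
  have he := pr.card_exs hf
  obtain ⟨-, -, hO, hu, -⟩ := C.tight (by omega)
  have ad : ∀ {v w}, Cn G O v w → G.Adj v w := by
    intro v w h
    rcases C.cn_iff.1 h with h | ⟨r, hr, -⟩
    · exact h
    · simp [hO] at hr
  have hX : f (i0 + c) ∈ X := by rw [hf.per]; exact pr.gi.left
  exact C.full_u (lo := i0 + 1) (((((IP.sgr (lo := i0 + 1) hf (i0 + 3) j0).fw hf (i0 + 1) (i0 + 2)
    (ad h.symm)).fw hf (j0 + 2) (j0 + 2) (ad h'')).bw hf (j0 + 1) (j0 + 1)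
    (by rw [show j0 + 2 = j0 + 1 + 1 by ring]; exact (hf.adj _).symm)).fw hf (j0 + 3) (i0 + c) (ad h'))
    (hu _ pr.gj.left) (hu _ hX) (hf.ne (by omega) (by omega)) (by intros; omega)

/-- Some gap has at least four vertices. -/
theorem exists_large (C : Sx G c k f u O X Y) (hT : OneTough G) :
    ∃ a b, Gap f X a b ∧ b ≤ a + c ∧ a + 5 ≤ b := by
  refine Ctx.exists_large C.toCtx hT C.X_nonempty C.not_cn_fl (fun pr => ?_) C.head_head
  have := pr.card_exs C.cyc
  have := pr.gj.len
  have := C.bound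
  have := C.le_card_X
  omega

end Sx

/-- A gap with four vertices; in particular all inequalities between the parameters are tight. -/
structure Lg [Fintype V] (G : SimpleGraph V) (c : ℤ) (k : ℕ) (f : ℤ → V) (u : V)
    (O X Y : Finset V) (a : ℤ) : Prop extends Sx G c k f u O X Y where
  gap : Gap f X a (a + 5)
  five : 5 ≤ c
  cX : X.card = k
  ce : (exs f X).card = 2
  O0 : O = ∅
  uX : ∀ x ∈ X, G.Adj u x
  YX : ∀ y ∈ Y, ∀ x ∈ X, G.Adj y x
  cY : 3 ≤ Y.card
  dg : ∀ z, z ∉ X → z ≠ u → z ∉ Y → k ≤ Paper.deg G z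

namespace Lg
variable [Fintype V] {G : SimpleGraph V} {c : ℤ} {k : ℕ} {f : ℤ → V} {u : V} {O X Y : Finset V}
  {a : ℤ}

theorem of_large (C : Sx G c k f u O X Y) {a b : ℤ} (g : Gap f X a b) (hb : b ≤ a + c)
    (h : a + 5 ≤ b) : Lg G c k f u O X Y a := by
  have he := g.card_exs C.cyc hb
  obtain ⟨h1, h2, h3, h4, h5, h6, h7⟩ := C.tight (by omega)
  have e : b = a + 5 := by omega
  subst e
  exact { C with gap := g, five := by omega, cX := h1, ce := h2, O0 := h3, uX := h4, YX := h5, cY := h6, dg := h7 }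

theorem mirror (C : Lg G c k f u O X Y a) :
    Lg G c k (fun i => f (-i)) u O X Y (-(a + 5)) := by
  refine of_large C.toSx.mirror (b := -a) C.gap.mirror ?_ (by omega)
  have := C.five
  omega

variable (C : Lg G c k f u O X Y a)
include C

theorem adj_of_cn {v w : V} (h : Cn G O v w) : G.Adj v w := by
  rcases C.cn_iff.1 h with h | ⟨r, hr, -⟩
  · exact h
  · simp [C.O0] at hr

theorem full {lo : ℤ} {S : ℤ → Prop} {s t : V} (h : IP G f lo c ∅ S s t) (hs : s ∈ X)
    (ht : t ∈ X) (hst : s ≠ t) (hS : ∀ k, lo ≤ k → k < lo + c → S k) : False :=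
  C.full_u h (C.uX s hs) (C.uX t ht) hst hS

theorem other {a' b' : ℤ} (pr : Pr f c X a (a + 5) a' b') : b' = a' + 3 := by
  have := pr.card_exs C.cyc
  have := C.ce
  have := pr.gj.len
  omega

/-- A vertex outside `X` misses few vertices of `X`. -/
theorem few_missed {i j : ℤ} (hi : a < i) (hi' : i < a + 5) (hj : f j ∈ X)
    (hz : ∀ v, G.Adj (f i) v → v ∉ X → ∃ l, a < l ∧ l < a + 5 ∧ l ≠ i ∧ f l = v)
    (hja : ¬ G.Adj (f i) (f j))
    (h : ∀ y ∈ Y, ∃ β, f β = y ∧ f (β - 1) ∈ X ∧ ¬ G.Adj (f i) (f (β - 1)) ∧ f (β - 1) ≠ f j) :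
    False := by
  have hf := C.cyc
  obtain ⟨hX, hY⟩ := C.gap_notMem C.gap hi hi'
  have hd := C.dg (f i) hX (C.off i) hY
  have hR := deg_le_of_missed (X := X) (M := X.filter fun v => ¬ G.Adj (f i) v)
    (R := ((Finset.Ioo a (a + 5)).erase i).image f) (z := f i) (Finset.filter_subset _ _)
    (fun v hv => (Finset.mem_filter.1 hv).2) (fun v hv hvX => by
      obtain ⟨l, h1, h2, h3, h4⟩ := hz v hv hvX
      exact Finset.mem_image.2 ⟨l, by simp [h1, h2, h3], h4⟩)
  have c1 : (((Finset.Ioo a (a + 5)).erase i).image f).card ≤ 3 := by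
    refine Finset.card_image_le.trans ?_
    rw [Finset.card_erase_of_mem (by simp [hi, hi'])]
    simp
  have c2 : Y ⊆ ((X.filter fun v => ¬ G.Adj (f i) v).erase (f j)).image (nxt f) := by
    intro y hy
    obtain ⟨β, rfl, h1, h2, h3⟩ := h y hy
    refine Finset.mem_image.2 ⟨f (β - 1), Finset.mem_erase.2 ⟨h3, Finset.mem_filter.2 ⟨h1, h2⟩⟩, ?_⟩
    rw [nxt_apply hf, sub_add_cancel]
  have c3 := (Finset.card_le_card c2).trans Finset.card_image_le
  have hm : f j ∈ X.filter fun v => ¬ G.Adj (f i) v := Finset.mem_filter.2 ⟨hj, hja⟩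
  have c4 := Finset.card_erase_add_one hm
  have := C.cY
  have := C.cX
  omega

/-- The end vertices of the gap have no neighbours in other gaps. -/
theorem ends {a' j : ℤ} (pr : Pr f c X a (a + 5) a' (a' + 3)) (hj : j = a' + 1 ∨ j = a' + 2) :
    ¬ G.Adj (f (a + 1)) (f j) ∧ ¬ G.Adj (f (a + 4)) (f j) := by
  have hf := C.cyc
  have := pr.ij; have := pr.ji
  have sw := C.not_cn_fl (pr.swap hf)
  rw [show a + 5 + c - 1 = a + 4 + c by ring, hf.per] at sw
  have d1 : f a ≠ f a' := hf.ne (by omega) (by omega)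
  have d2 : f (a + 5) ≠ f (a' + 3) := hf.ne (by omega) (by omega)
  have fl := C.not_cn_fl pr
  rw [show a' + 3 - 1 = a' + 2 by ring] at fl
  have ll := C.not_cn_lasts pr.gi.right pr.gj.right d2
  rw [show a' + 3 - 1 = a' + 2 by ring, show a + 5 - 1 = a + 4 by ring] at ll
  rcases hj with rfl | rfl
  · exact ⟨fun h => C.not_cn_firsts pr.gi.left pr.gj.left d1 (Or.inl h), fun h => sw (Or.inl h.symm)⟩
  · exact ⟨fun h => fl (Or.inl h), fun h => ll (Or.inl h)⟩

/-- A neighbour of a vertex of the gap lies in `X`, in the gap, or in a gap with two vertices. -/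
theorem nbr {i : ℤ} (hi : a < i) (hi' : i < a + 5) {v : V} (h : G.Adj (f i) v) (hv : v ∉ X) :
    (∃ l, a < l ∧ l < a + 5 ∧ l ≠ i ∧ f l = v) ∨
      ∃ a' j, Pr f c X a (a + 5) a' (a' + 3) ∧ (j = a' + 1 ∨ j = a' + 2) ∧ f j = v := by
  have hf := C.cyc
  obtain ⟨hX, hY⟩ := C.gap_notMem C.gap hi hi'
  have hvu : v ≠ u := fun e => hX (C.sub _ (e ▸ h.symm))
  have hvY : v ∉ Y := fun e => hX (C.HN v e _ h.symm)
  obtain ⟨j, rfl⟩ : ∃ j, f j = v := by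
    rcases C.cover v with h | h | h
    · exact h
    · simp [C.O0] at h
    · exact absurd h hvu
  obtain ⟨l, l1, l2, l3⟩ := hf.exists_rep j (a + 1)
  rw [← l3] at hv hvY h ⊢
  by_cases hl : l < a + 5
  · exact Or.inl ⟨l, by omega, hl, fun e => G.loopless.irrefl _ (e ▸ h), rfl⟩
  have e1 : l ≠ a + 5 := fun e => hv (e ▸ C.gap.right)
  obtain ⟨p, p1, p2, p3, p4⟩ := exists_prev (P := fun i => f i ∈ X) (a := a + 5) (b := l) (by omega)
    C.gap.right
  obtain ⟨q, q1, q2, q3, q4⟩ := exists_next (P := fun i => f i ∈ X) (a := l) (b := a + c) (by omega)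
    (by rw [hf.per]; exact C.gap.left)
  have hp : p ≠ l := fun e => hv (e ▸ p3)
  have hq : q ≠ l := fun e => hv (e ▸ q3)
  have hlen : p + 3 ≤ q := by
    by_contra hlen
    have e2 : p = l - 1 := by omega
    have e3 : q = l + 1 := by omega
    exact hvY (C.mem_Y.2 ⟨e2 ▸ p3, e3 ▸ q3⟩)
  have pr : Pr f c X a (a + 5) p q := ⟨C.gap, ⟨p3, q3, hlen, fun m m1 m2 => by
    rcases le_or_gt m l with h | h
    · exact p4 m m1 h
    · exact q4 m (by omega) m2⟩, p1, q2⟩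
  have := C.other pr
  subst this
  exact Or.inr ⟨p, l, pr, by omega, rfl⟩

theorem out_one {v : V} (h : G.Adj (f (a + 1)) v) (hv : v ∉ X) :
    ∃ l, a < l ∧ l < a + 5 ∧ l ≠ a + 1 ∧ f l = v := by
  rcases C.nbr (by omega) (by omega) h hv with h | ⟨a', j, pr, hj, rfl⟩
  · exact h
  · exact absurd h (C.ends pr hj).1

theorem out_four {v : V} (h : G.Adj (f (a + 4)) v) (hv : v ∉ X) :
    ∃ l, a < l ∧ l < a + 5 ∧ l ≠ a + 4 ∧ f l = v := by
  rcases C.nbr (by omega) (by omega) h hv with h | ⟨a', j, pr, hj, rfl⟩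
  · exact h
  · exact absurd h (C.ends pr hj).2

theorem attached (hT : OneTough G) (Z : Finset V) (hZf : ∀ v ∈ Z, ∃ i, f i = v)
    (hZ : ∀ i, f i ∈ Z → f (i + 1) ∉ X ∧ f (i + 1) ∉ Z ∧ f (i - 1) ∉ X)
    (hin : ∀ i j, a < i → i < j → j < a + 5 → f i ∉ Z → f j ∉ Z → G.Adj (f i) (f j) →
      ∀ l, i ≤ l → l ≤ j → f l ∉ Z) :
    ∃ i a', Pr f c X a (a + 5) a' (a' + 3) ∧ (i = a + 2 ∨ i = a + 3) ∧ f i ∉ Z ∧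
      (G.Adj (f i) (f (a' + 1)) ∨ G.Adj (f i) (f (a' + 2))) := by
  by_contra hno
  push Not at hno
  have hf := C.cyc
  have sh : ∀ l q, f (l + q * c) = f l := hf.per_mul
  have hc5 := C.five
  have core : ∀ a' b' i j, Pr f c X a (a + 5) a' b' → a < i → i < a + 5 → a' < j → j < b' →
      f i ∉ Z → ¬ G.Adj (f i) (f j) := by
    intro a' b' i j pr h1 h2 h3 h4 hi ha
    have := C.other pr
    subst this
    have hj : j = a' + 1 ∨ j = a' + 2 := by omega
    by_cases e1 : i = a + 1
    · exact (C.ends pr hj).1 (e1 ▸ ha)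
    by_cases e4 : i = a + 4
    · exact (C.ends pr hj).2 (e4 ▸ ha)
    have := hno i a' pr (by omega) hi
    rcases hj with rfl | rfl
    · exact this.1 ha
    · exact this.2 ha
  have big : ∀ a0 b0, Gap f X a0 b0 → f a = f a0 → ∃ q, a0 = a + q * c ∧ b0 = a + 5 + q * c := by
    intro a0 b0 g h
    obtain ⟨q, hq⟩ := hf.inj _ _ h.symm
    have e : a0 = a + q * c := by linarith
    refine ⟨q, e, ?_⟩
    rcases lt_trichotomy b0 (a + 5 + q * c) with h | h | h
    · refine absurd g.right ?_
      have := g.len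
      rw [← sub_add_cancel b0 (q * c), sh]
      exact C.gap.not_mem _ (by omega) (by omega)
    · exact h
    · refine absurd C.gap.right ?_
      rw [← sh _ q]
      exact g.not_mem _ (by omega) (by omega)
  have hmain : ∀ a1 b1 a2 b2 i j, Gap f X a1 b1 → Gap f X a2 b2 → f a1 ≠ f a2 → f a = f a1 →
      a1 < i → i < b1 → a2 < j → j < b2 → f i ∉ Z → ¬ G.Adj (f i) (f j) := by
    intro a1 b1 a2 b2 i j g1 g2 hne h h1 h2 h3 h4 hi ha
    obtain ⟨q, rfl, rfl⟩ := big a1 b1 g1 h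
    obtain ⟨q', pr⟩ := C.gap.pr hf g2 (h ▸ hne)
    rw [← sub_add_cancel i (q * c), sh] at hi ha
    rw [← sh j q'] at ha
    exact core _ _ _ _ pr (by omega) (by omega) (by omega) (by omega) hi ha
  refine C.not_tough hT C.X_nonempty Z hZf hZ ?_ ?_
  · intro a0 b0 i j g hb h1 h2 h3 hi hj hcn l l1 l2
    by_cases h : f a = f a0
    · obtain ⟨q, rfl, rfl⟩ := big a0 b0 g h
      have ha := C.adj_of_cn hcn
      rw [← sub_add_cancel i (q * c), sh] at hi ha
      rw [← sub_add_cancel j (q * c), sh] at hj ha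
      rw [← sub_add_cancel l (q * c), sh]
      exact hin _ _ (by omega) (by omega) (by omega) hi hj ha _ (by omega) (by omega)
    · obtain ⟨q, pr⟩ := C.gap.pr hf g h
      have := C.other pr
      have : l = i ∨ l = j := by omega
      rcases this with rfl | rfl
      · exact hi
      · exact hj
  · intro a1 b1 a2 b2 i j pr h1 h2 h3 h4 hi hj hcn
    have ha := C.adj_of_cn hcn
    have q1 := pr.ij; have q2 := pr.ji; have q3 := pr.gi.len; have q4 := pr.gj.len
    have hne : f a1 ≠ f a2 := hf.ne (by omega) (by omega)
    by_cases h : f a = f a1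
    · exact hmain _ _ _ _ i j pr.gi pr.gj hne h h1 h2 h3 h4 hi ha
    by_cases h' : f a = f a2
    · exact hmain _ _ _ _ j i pr.gj pr.gi hne.symm h' h3 h4 h1 h2 hj ha.symm
    obtain ⟨_, pr1⟩ := C.gap.pr hf pr.gi h
    obtain ⟨_, pr2⟩ := C.gap.pr hf pr.gj h'
    have e1 := C.other pr1
    have e2 := C.other pr2
    have e1 : b1 = a1 + 3 := by omega
    have e2 : b2 = a2 + 3 := by omega
    subst e1 e2
    have d2 : f (a1 + 3) ≠ f (a2 + 3) := hf.ne (by omega) (by omega)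
    have ff := C.not_cn_firsts pr.gi.left pr.gj.left hne
    have ll := C.not_cn_lasts pr.gi.right pr.gj.right d2
    have fl := C.not_cn_fl pr
    have lf := C.not_cn_fl (pr.swap hf)
    rw [show a1 + 3 + c - 1 = a1 + 2 + c by ring, hf.per] at lf
    rw [show a2 + 3 - 1 = a2 + 2 by ring] at fl ll
    rw [show a1 + 3 - 1 = a1 + 2 by ring] at ll
    have e3 : i = a1 + 1 ∨ i = a1 + 2 := by omega
    have e4 : j = a2 + 1 ∨ j = a2 + 2 := by omega
    rcases e3 with rfl | rfl <;> rcases e4 with rfl | rfl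
    · exact ff hcn
    · exact fl hcn
    · exact lf hcn.symm
    · exact ll hcn

end Lg

theorem Cyc.nx {G : SimpleGraph V} {c : ℤ} {f : ℤ → V} (h : Cyc G c f) {i j : ℤ}
    (e : j = i + 1 := by omega) : G.Adj (f i) (f j) := e ▸ h.adj i

theorem Cyc.pv {G : SimpleGraph V} {c : ℤ} {f : ℤ → V} (h : Cyc G c f) {i j : ℤ}
    (e : i = j + 1 := by omega) : G.Adj (f i) (f j) := (h.nx e).symm

theorem Cyc.wr {G : SimpleGraph V} {c : ℤ} {f : ℤ → V} (h : Cyc G c f) (a : ℤ) :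
    G.Adj (f (a + c)) (f (a + 1)) := h.per a ▸ h.adj a

namespace Lg
variable [Fintype V] {G : SimpleGraph V} {c : ℤ} {k : ℕ} {f : ℤ → V} {u : V} {O X Y : Finset V}
  {a a' : ℤ} (C : Lg G c k f u O X Y a)
include C

theorem memX (pr : Pr f c X a (a + 5) a' (a' + 3)) :
    f a ∈ X ∧ f (a + c) ∈ X ∧ f (a + 5) ∈ X ∧ f a' ∈ X ∧ f (a' + 3) ∈ X ∧ a + 5 ≤ a' ∧ a' + 3 ≤ a + c :=
  ⟨pr.gi.left, by rw [C.cyc.per]; exact pr.gi.left, pr.gi.right, pr.gj.left, pr.gj.right, pr.ij,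
    pr.ji⟩

theorem pos (pr : Pr f c X a (a + 5) a' (a' + 3)) {y : V} (hy : y ∈ Y) :
    ∃ β, f β = y ∧ (a + 5 < β ∧ β < a' ∨ a' + 3 < β ∧ β < a + c) ∧ f (β - 1) ∈ X ∧
      f (β + 1) ∈ X ∧ ∀ x ∈ X, G.Adj (f β) x := by
  obtain ⟨β, rfl, h1, h2, h3⟩ := Ctx.Y_pos C.toCtx pr hy
  exact ⟨β, rfl, h1, h2, h3, C.YX _ hy⟩

theorem not_three_of_four (pr : Pr f c X a (a + 5) a' (a' + 3))
    (e14 : G.Adj (f (a + 1)) (f (a + 4))) : ¬ G.Adj (f (a + 3)) (f (a' + 1)) := by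
  intro h
  have hf := C.cyc
  obtain ⟨h1, h2, h3, h4, h5, h6, h7⟩ := C.memX pr
  have h8 := hf.three_le
  refine C.full ((((IP.sgr (lo := a + 1) hf (a + 5) a').bw hf (a + 4) (a + 4) hf.pv).fw hf
    (a + 1) (a + 3) e14.symm).fw hf (a' + 1) (a + c) h) h4 h2 (hf.ne (by omega) (by omega)) ?_
  intro k h1 h2
  omega

theorem not_two_of_four (pr : Pr f c X a (a + 5) a' (a' + 3))
    (e14 : G.Adj (f (a + 1)) (f (a + 4))) : ¬ G.Adj (f (a + 2)) (f (a' + 1)) := by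
  intro h
  have hf := C.cyc
  obtain ⟨h1, h2, h3, h4, h5, h6, h7⟩ := C.memX pr
  have h8 := hf.three_le
  refine C.few_missed (i := a + 1) (j := a') (by omega) (by omega) h4 (fun v => C.out_one) ?_ ?_
  · intro ha
    refine C.full ((((IP.sg (lo := a + 1) hf (a + 5) a').fw hf (a + 1) (a + 1) ha.symm).bw hf
      (a + 2) (a + 4) e14).fw hf (a' + 1) (a + c) h) h3 h2 (hf.ne (by omega) (by omega)) ?_
    intro k h1 h2
    omega
  · intro y hy
    obtain ⟨β, rfl, hβ, h9, h10, h11⟩ := C.pos pr hy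
    rcases hβ with ⟨hβ, hβ'⟩ | ⟨hβ, hβ'⟩
    · refine ⟨β, rfl, h9, fun ha => ?_, hf.ne (by omega) (by omega)⟩
      refine C.full (((((IP.sg (lo := a + 1) hf (a + 5) (β - 1)).fw hf (a + 1) (a + 1) ha.symm).bw hf
        (a + 2) (a + 4) e14).fw hf (a' + 1) (a + c) h).fw hf β a' (h11 _ h2).symm) h3 h4
        (hf.ne (by omega) (by omega)) ?_
      intro k h1 h2
      omega
    · exfalso
      refine C.full (((((IP.sgr (lo := a + 1) hf (a + 5) a').fw hf β (a + c) (h11 _ h3).symm).fw hf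
        (a + 1) (a + 1) (hf.wr a)).bw hf
        (a + 2) (a + 4) e14).fw hf (a' + 1) (β - 1) h) h4 h9 (hf.ne (by omega) (by omega)) ?_
      intro k h1 h2
      omega

theorem mirror_pr (pr : Pr f c X a (a + 5) a' (a' + 3)) :
    Pr (fun i => f (-i)) c X (-(a + 5)) (-(a + 5) + 5) (-(a' + 3) + c) (-(a' + 3) + c + 3) := by
  have := pr.mirror' C.cyc
  convert this using 1 <;> ring

theorem mirror_apply (i : ℤ) : (fun i => f (-i)) (-(a' + 3) + c + i) = f (a' + 3 - i) := by
  have := C.cyc.per (a' + 3 - i - c)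
  simp only
  rw [← C.cyc.per (-(-(a' + 3) + c + i))]
  congr 1
  ring

theorem not_one_four (hT : OneTough G) : ¬ G.Adj (f (a + 1)) (f (a + 4)) := by
  intro e14
  have e14' : G.Adj (f (-(-(a + 5) + 1))) (f (-(-(a + 5) + 4))) := by
    convert e14.symm using 2 <;> ring
  obtain ⟨i, a', pr, hi, -, h⟩ := C.attached hT ∅ (by simp) (by simp) (by simp)
  have pm := C.mirror_pr pr
  have n1 := C.mirror.not_three_of_four pm e14'
  have n2 := C.mirror.not_two_of_four pm e14'
  have s1 := C.mirror_apply (a' := a') 1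
  simp only at s1
  rw [s1] at n1 n2
  rw [show a' + 3 - 1 = a' + 2 by ring, show -(-(a + 5) + 3) = a + 2 by ring] at n1
  rw [show a' + 3 - 1 = a' + 2 by ring, show -(-(a + 5) + 2) = a + 3 by ring] at n2
  rcases hi with rfl | rfl <;> rcases h with h | h
  · exact C.not_two_of_four pr e14 h
  · exact n1 h
  · exact C.not_three_of_four pr e14 h
  · exact n2 h

theorem not_two_first (pr : Pr f c X a (a + 5) a' (a' + 3))
    (e13 : G.Adj (f (a + 1)) (f (a + 3))) : ¬ G.Adj (f (a + 2)) (f (a' + 1)) := by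
  intro h
  have hf := C.cyc
  obtain ⟨h1, h2, h3, h4, h5, h6, h7⟩ := C.memX pr
  refine C.full ((((IP.sgr (lo := a + 1) hf (a + 5) a').bw hf (a + 3) (a + 4) hf.pv).fw hf
    (a + 1) (a + 2) e13.symm).fw hf (a' + 1) (a + c) h) h4 h2 (hf.ne (by omega) (by omega)) ?_
  intro k h1 h2
  omega

theorem not_two_second (pr : Pr f c X a (a + 5) a' (a' + 3))
    (e13 : G.Adj (f (a + 1)) (f (a + 3))) (e24 : G.Adj (f (a + 2)) (f (a + 4))) :
    ¬ G.Adj (f (a + 2)) (f (a' + 2)) := by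
  intro h
  have hf := C.cyc
  obtain ⟨h1, h2, h3, h4, h5, h6, h7⟩ := C.memX pr
  refine C.full (((((IP.sg (lo := a + 1) hf (a + 5) (a' + 2)).fw hf (a + 2) (a + 2) h.symm).bw hf
    (a + 3) (a + 4) e24).fw hf (a + 1) (a + 1) e13.symm).bw hf (a' + 3) (a + c) (hf.wr a).symm)
    h3 h5 (hf.ne (by omega) (by omega)) ?_
  intro k h1 h2
  omega

theorem not_both (hT : OneTough G) (e13 : G.Adj (f (a + 1)) (f (a + 3))) :
    ¬ G.Adj (f (a + 2)) (f (a + 4)) := by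
  intro e24
  have e13' : G.Adj (f (-(-(a + 5) + 1))) (f (-(-(a + 5) + 3))) := by
    convert e24.symm using 2 <;> ring
  have e24' : G.Adj (f (-(-(a + 5) + 2))) (f (-(-(a + 5) + 4))) := by
    convert e13.symm using 2 <;> ring
  obtain ⟨i, a', pr, hi, -, h⟩ := C.attached hT ∅ (by simp) (by simp) (by simp)
  have pm := C.mirror_pr pr
  have n1 := C.mirror.not_two_first pm e13'
  have n2 := C.mirror.not_two_second pm e13' e24'
  have s1 := C.mirror_apply (a' := a') 1
  have s2 := C.mirror_apply (a' := a') 2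
  simp only at s1 s2
  rw [s1, show a' + 3 - 1 = a' + 2 by ring, show -(-(a + 5) + 2) = a + 3 by ring] at n1
  rw [s2, show a' + 3 - 2 = a' + 1 by ring, show -(-(a + 5) + 2) = a + 3 by ring] at n2
  rcases hi with rfl | rfl <;> rcases h with h | h
  · exact C.not_two_first pr e13 h
  · exact C.not_two_second pr e13 e24 h
  · exact n2 h
  · exact n1 h

/-- Attachments of the second vertex of the gap. -/
theorem attached_two (hT : OneTough G) (e24 : ¬ G.Adj (f (a + 2)) (f (a + 4))) :
    ∃ a', Pr f c X a (a + 5) a' (a' + 3) ∧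
      (G.Adj (f (a + 2)) (f (a' + 1)) ∨ G.Adj (f (a + 2)) (f (a' + 2))) := by
  have hf := C.cyc
  have h5 := C.five
  have e14 := C.not_one_four hT
  have hX := C.gap.not_mem
  have pos : ∀ i, f i = f (a + 3) → ∃ q, i = a + 3 + q * c := by
    intro i h
    obtain ⟨q, hq⟩ := hf.inj _ _ h
    exact ⟨q, by linarith⟩
  have key := C.attached hT {f (a + 3)} (fun v hv => ⟨_, (Finset.mem_singleton.1 hv).symm⟩)
  refine Exists.elim (key ?_ ?_) ?_
  · intro i hi
    obtain ⟨q, rfl⟩ := pos i (Finset.mem_singleton.1 hi)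
    have e1 : f (a + 3 + q * c + 1) = f (a + 4) := by
      rw [← hf.per_mul (a + 4) q]; congr 1; ring
    have e2 : f (a + 3 + q * c - 1) = f (a + 2) := by
      rw [← hf.per_mul (a + 2) q]; congr 1; ring
    rw [e1, e2, Finset.mem_singleton]
    exact ⟨hX _ (by omega) (by omega), (hf.ne (by omega) (by omega)).symm, hX _ (by omega) (by omega)⟩
  · intro i j h1 h2 h3 hi hj ha l l1 l2 hl
    rw [Finset.mem_singleton] at hi hj hl
    have : l = a + 3 := hf.eq_of hl (by omega) (by omega)
    have n1 : i ≠ a + 3 := fun e => hi (e ▸ rfl)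
    have n2 : j ≠ a + 3 := fun e => hj (e ▸ rfl)
    have ej : j = a + 4 := by omega
    subst ej
    have : i = a + 1 ∨ i = a + 2 := by omega
    rcases this with rfl | rfl
    · exact e14 ha
    · exact e24 ha
  · rintro i ⟨a', pr, hi, hZ, h⟩
    rcases hi with rfl | rfl
    · exact ⟨a', pr, h⟩
    · simp at hZ

theorem not_one_three (hT : OneTough G) : ¬ G.Adj (f (a + 1)) (f (a + 3)) := by
  intro e13
  obtain ⟨a', pr, h⟩ := C.attached_two hT (C.not_both hT e13)
  have h := h.resolve_left (C.not_two_first pr e13)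
  have hf := C.cyc
  obtain ⟨h1, h2, h3, h4, h5, h6, h7⟩ := C.memX pr
  refine C.few_missed (i := a + 4) (j := a + c) (by omega) (by omega) h2 (fun v => C.out_four) ?_ ?_
  · intro ha
    refine C.full ((((IP.sg (lo := a + 1) hf (a' + 3) (a + c)).bw hf (a + 3) (a + 4) ha.symm).fw hf
      (a + 1) (a + 2) e13.symm).bw hf (a + 5) (a' + 2) h) h5 h3 (hf.ne (by omega) (by omega)).symm ?_
    intro k h1 h2
    omega
  · intro y hy
    obtain ⟨β, rfl, hβ, h9, h10, h11⟩ := C.pos pr hy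
    rcases hβ with ⟨hβ, hβ'⟩ | ⟨hβ, hβ'⟩
    · exfalso
      refine C.full ((((IP.sgr (lo := a + 1) hf (a' + 3) (a + c)).fw hf β (a' + 2)
        (h11 _ h5).symm).bw hf (a + 1) (a + 2) h.symm).fw hf
        (a + 3) (β - 1) e13) h2 h9 (hf.ne (by omega) (by omega)).symm ?_
      intro k h1 h2
      omega
    · refine ⟨β, rfl, h9, fun ha => ?_, hf.ne (by omega) (by omega)⟩
      refine C.full (((((IP.sg (lo := a + 1) hf (a' + 3) (β - 1)).bw hf (a + 3) (a + 4)
        ha.symm).fw hf (a + 1) (a + 2) e13.symm).bw hf (a + 5) (a' + 2) h).fw hf β (a + c)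
        (h11 _ h3).symm) h5 h2 (hf.ne (by omega) (by omega)) ?_
      intro k h1 h2
      omega

theorem not_two_four (hT : OneTough G) : ¬ G.Adj (f (a + 2)) (f (a + 4)) := by
  have := C.mirror.not_one_three hT
  rw [show -(-(a + 5) + 1) = a + 4 by ring, show -(-(a + 5) + 3) = a + 2 by ring] at this
  exact fun h => this h.symm

end Lg

namespace Lg
variable [Fintype V] {G : SimpleGraph V} {c : ℤ} {k : ℕ} {f : ℤ → V} {u : V} {O X Y : Finset V}
  {a a' : ℤ} (C : Lg G c k f u O X Y a)
include C

theorem nb_eq {y : V} (hy : y ∈ Y) : nb G y = X := by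
  ext v
  exact ⟨fun h => C.HN y hy v (mem_nb.1 h), fun h => mem_nb.2 (C.YX y hy v h)⟩

theorem nb_u : nb G u = X := by
  ext v
  exact ⟨fun h => C.sub v (mem_nb.1 h), fun h => mem_nb.2 (C.uX v h)⟩

/-- A vertex adjacent to almost all of `X` cannot be missed by a longest cycle through `u`. -/
theorem no_miss {lo : ℤ} {S : ℤ → Prop} {s t : V} {k0 : ℤ} (h : IP G f lo c ∅ S s t)
    (hs : s ∈ X) (ht : t ∈ X) (hst : s ≠ t) (hY : f k0 ∉ Y) (h0 : ¬ S k0)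
    (hl : lo ≤ k0) (hr : k0 < lo + c) (hS : ∀ k, lo ≤ k → k < lo + c → S k ∨ k = k0)
    (hM : (X \ nb G (f k0)).card ≤ 1) : False := by
  have hf := C.cyc
  obtain ⟨Q, hQ, hQS, hQ'⟩ := h
  have hu : u ∉ Q := C.u_notMem_ip (fun x hx => (hQ' x hx).imp id (by simp))
  have hQe : Q = (cyf f c).erase (f k0) := by
    refine Finset.Subset.antisymm (fun x hx => ?_) (C.ip_sub hQS hS)
    obtain ⟨i, hi⟩ | hi := hQ' x hx
    · refine Finset.mem_erase.2 ⟨?_, hf.mem_cyf.2 ⟨i, hi⟩⟩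
      rintro rfl
      exact h0 ((hQS k0 hl hr).1 hx)
    · exact hi.elim
  have hc := C.card_erase k0
  rw [← hQe] at hc
  obtain ⟨g, hg, hgv⟩ := C.toBs.other hQ (C.uX s hs) (C.uX t ht) hst hu hc
  have hgk : ∀ i, g i ≠ f k0 := by
    intro i hi
    rcases (hgv _).1 ⟨i, hi⟩ with h | h
    · exact h0 ((hQS k0 hl hr).1 h)
    · exact C.off k0 h
  have hon : ∀ y ∈ Y, ∃ i, g i = y := by
    intro y hy
    refine (hgv y).2 (Or.inl ?_)
    obtain ⟨i, rfl, -⟩ := C.Y_ran hy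
    rw [hQe]
    exact Finset.mem_erase.2 ⟨fun e => hY (e ▸ hy), hf.mem_cyf.2 ⟨i, rfl⟩⟩
  have hnx : ∀ i, g i = u ∨ g i ∈ Y → g (i - 1) ∈ X ∧ g (i + 1) ∈ X := by
    have : ∀ v, v = u ∨ v ∈ Y → ∀ w, G.Adj v w → w ∈ X := by
      rintro v (rfl | hv) w hw
      · exact C.sub w hw
      · exact C.HN v hv w hw
    exact fun i hi => ⟨this _ hi _ hg.pv, this _ hi _ hg.nx⟩
  obtain ⟨b, hb, hbt⟩ : ∃ b ∈ Y, b ∉ touch g Y (X \ nb G (f k0)) := by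
    by_contra! hcon
    have h1 := Finset.card_le_card hcon
    have h2 := card_touch hg Y (X \ nb G (f k0))
    have h3 := C.cY
    omega
  obtain ⟨β, rfl⟩ := hon b hb
  obtain ⟨hβ1, hβ2⟩ := hnx β (Or.inr hb)
  have hadj : ∀ x ∈ X, x ∉ X \ nb G (f k0) → G.Adj (f k0) x := by
    intro x hx hn
    by_contra ha
    exact hn (Finset.mem_sdiff.2 ⟨hx, fun h => ha (mem_nb.1 h)⟩)
  have ht1 := hadj _ hβ1 fun h => hbt (Finset.mem_filter.2 ⟨hb, β, rfl, Or.inl h⟩)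
  have ht2 := hadj _ hβ2 fun h => hbt (Finset.mem_filter.2 ⟨hb, β, rfl, Or.inr h⟩)
  have hg' := hg.exchange hgk ht1 ht2
  have hbX : g β ∉ X := C.disj _ hb
  have hmiss : ∀ i, (fun i => if g i = g β then f k0 else g i) i ≠ g β := by
    intro i
    simp only
    split_ifs with h
    · exact (hgk β).symm
    · exact h
  have hdeg : Paper.deg G (g β) = k := by rw [← card_nb, C.nb_eq hb, C.cX]
  have hle := C.tmax _ hg' (g β) hmiss hdeg
  rw [C.nb_eq hb, C.nb_u, ← C.Yeq] at hle
  have hsub : insert u (insert (f k0) (Y.erase (g β))) ⊆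
      sing (fun i => if g i = g β then f k0 else g i) X := by
    have key : ∀ i, g i = u ∨ g i ∈ Y →
        (if g i = g β then f k0 else g i) ∈ sing (fun i => if g i = g β then f k0 else g i) X := by
      intro i hi
      obtain ⟨e1, e2⟩ := hnx i hi
      refine (mem_sing (i := i) hg').2 ⟨?_, ?_⟩
      · rwa [if_neg fun e : g (i - 1) = g β => hbX (e ▸ e1)]
      · rwa [if_neg fun e : g (i + 1) = g β => hbX (e ▸ e2)]
    intro v hv
    rw [Finset.mem_insert, Finset.mem_insert, Finset.mem_erase] at hv
    rcases hv with rfl | rfl | ⟨h1, h2⟩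
    · obtain ⟨i, hi⟩ := (hgv v).2 (Or.inr rfl)
      have := key i (Or.inl hi)
      rwa [if_neg, hi] at this
      rw [hi]
      rintro rfl
      exact C.u_notMem_Y hb
    · have := key β (Or.inr hb)
      rwa [if_pos rfl] at this
    · obtain ⟨i, rfl⟩ := hon v h2
      have := key i (Or.inr h2)
      rwa [if_neg h1] at this
  have hcard := Finset.card_le_card hsub
  rw [Finset.card_insert_of_notMem, Finset.card_insert_of_notMem,
    Finset.card_erase_of_mem hb] at hcard
  · have := C.cY
    omega
  · exact fun h => hY (Finset.mem_of_mem_erase h)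
  · intro h
    rcases Finset.mem_insert.1 h with h | h
    · exact C.off k0 h.symm
    · exact C.u_notMem_Y (Finset.mem_of_mem_erase h)

variable (hT : OneTough G)
include hT

theorem missed_one : (X \ nb G (f (a + 1))).card ≤ 1 := by
  obtain ⟨hX, hY⟩ := C.gap_notMem C.gap (l := a + 1) (by omega) (by omega)
  have h1 := C.dg (f (a + 1)) hX (C.off _) hY
  have h2 := deg_le_of_missed (G := G) (X := X) (M := X \ nb G (f (a + 1))) (R := {f (a + 2)})
    (z := f (a + 1)) Finset.sdiff_subset
    (fun v hv h => (Finset.mem_sdiff.1 hv).2 (mem_nb.2 h)) (fun v hv hvX => ?_)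
  · have := C.cX
    simp only [Finset.card_singleton] at h2
    omega
  · obtain ⟨l, h3, h4, h5, rfl⟩ := C.out_one hv hvX
    have : l = a + 2 ∨ l = a + 3 ∨ l = a + 4 := by omega
    rcases this with rfl | rfl | rfl
    · simp
    · exact (C.not_one_three hT hv).elim
    · exact (C.not_one_four hT hv).elim

theorem not_two_fst (pr : Pr f c X a (a + 5) a' (a' + 3)) : ¬ G.Adj (f (a + 2)) (f (a' + 1)) := by
  intro h
  have hf := C.cyc
  obtain ⟨h1, h2, h3, h4, h5, h6, h7⟩ := C.memX pr
  obtain ⟨-, hY⟩ := C.gap_notMem C.gap (l := a + 1) (by omega) (by omega)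
  refine C.no_miss (k0 := a + 1) (((IP.sgr (lo := a + 1) hf (a + 5) a').bw hf (a + 2) (a + 4)
    hf.pv).fw hf (a' + 1) (a + c) h) h4 h2 (hf.ne (by omega) (by omega)) hY ?_ (by omega)
    (by omega) ?_ (C.missed_one hT)
  · omega
  · intro k h1 h2
    omega

theorem attached_two' : ∃ a', Pr f c X a (a + 5) a' (a' + 3) ∧ G.Adj (f (a + 2)) (f (a' + 2)) := by
  obtain ⟨a', pr, h⟩ := C.attached_two hT (C.not_two_four hT)
  exact ⟨a', pr, h.resolve_left (C.not_two_fst hT pr)⟩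

theorem attached_three : ∃ a', Pr f c X a (a + 5) a' (a' + 3) ∧ G.Adj (f (a + 3)) (f (a' + 1)) := by
  obtain ⟨d, pr, h⟩ := C.mirror.attached_two' hT
  refine ⟨-(d + 3) + c, ?_, ?_⟩
  · have := pr.mirror' C.cyc.mirror
    simp only [neg_neg] at this
    convert this using 1 <;> ring
  · rw [show -(-(a + 5) + 2) = a + 3 by ring] at h
    convert h using 1
    rw [← C.cyc.per (-(d + 2))]
    congr 1
    ring

theorem false : False := by
  have hf := C.cyc
  obtain ⟨a', pr, h⟩ := C.attached_two' hT
  obtain ⟨d, pr', h'⟩ := C.attached_three hT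
  obtain ⟨h1, h2, h3, h4, h5, h6, h7⟩ := C.memX pr
  obtain ⟨-, -, -, h8, h9, h10, h11⟩ := C.memX pr'
  rcases lt_trichotomy a' d with hd | rfl | hd
  · have hd : a' + 3 ≤ d := by
      by_contra hd
      exact pr.gj.not_mem d (by omega) (by omega) h8
    have n1 : ¬ G.Adj (f (a + 1)) (f (a' + 3)) := by
      intro ha
      refine C.full (((((IP.sgr (lo := a + 1) hf (a' + 3) d).fw hf (a + 1) (a + 2) ha.symm).bw hf
        (a + 5) (a' + 2) h).bw hf (a + 3) (a + 4) hf.pv).fw hf (d + 1) (a + c) h') h8 h2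
        (hf.ne (by omega) (by omega)) ?_
      intro k h1 h2
      omega
    have n2 : ¬ G.Adj (f (a + 1)) (f d) := by
      intro ha
      refine C.full (((((IP.sg (lo := a + 1) hf (a' + 3) d).fw hf (a + 1) (a + 2) ha.symm).bw hf
        (a + 5) (a' + 2) h).bw hf (a + 3) (a + 4) hf.pv).fw hf (d + 1) (a + c) h') h5 h2
        (hf.ne (by omega) (by omega)) ?_
      intro k h1 h2
      omega
    have e := Finset.card_le_one.1 (C.missed_one hT) (f (a' + 3))
      (Finset.mem_sdiff.2 ⟨h5, fun h => n1 (mem_nb.1 h)⟩) (f d)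
      (Finset.mem_sdiff.2 ⟨h8, fun h => n2 (mem_nb.1 h)⟩)
    have e : a' + 3 = d := hf.eq_of e (by omega) (by omega)
    obtain ⟨y, hy⟩ := C.ne
    obtain ⟨β, rfl, hβ, h12, h13, h14⟩ := C.pos pr hy
    have hβX := C.disj _ hy
    rcases hβ with ⟨hβ, hβ'⟩ | ⟨hβ, hβ'⟩
    · refine C.full (((((IP.sg (lo := a + 1) hf (a' + 3) d).fw hf β (a' + 2) (h14 _ h8).symm).bw hf
        (a + 1) (a + 2) h.symm).bw hf (d + 1) (a + c) (hf.wr a).symm).fw hf (a + 3) (β - 1) h'.symm)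
        h5 h12 (hf.ne (by omega) (by omega)).symm ?_
      intro k h1 h2
      omega
    · have hβd : d + 3 < β := by
        by_contra hcon
        rcases eq_or_ne β (d + 3) with e | e
        · exact hβX (e ▸ h9)
        · exact (C.gap_notMem pr'.gj (by omega) (by omega)).2 hy
      refine C.full (((((IP.sg (lo := a + 1) hf (a' + 3) d).fw hf β (a + c) (h14 _ h8).symm).fw hf
        (a + 1) (a + 2) (hf.wr a)).bw hf (a + 3) (a' + 2) h).fw hf (d + 1) (β - 1) h')
        h5 h12 (hf.ne (by omega) (by omega)) ?_
      intro k h1 h2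
      omega
  · refine C.full ((((IP.sgr (lo := a + 1) hf (a + 3) a').fw hf (a' + 1) (a' + 2) h').bw hf
      (a + 1) (a + 2) h.symm).bw hf (a' + 3) (a + c) (hf.wr a).symm) h4 h5
      (hf.ne (by omega) (by omega)) ?_
    intro k h1 h2
    omega
  · have hd : d + 3 ≤ a' := by
      by_contra hd
      exact pr'.gj.not_mem a' (by omega) (by omega) h4
    refine C.full ((((IP.sgr (lo := a + 1) hf (a + 3) d).fw hf (d + 1) (a' + 2) h').bw hf
      (a + 1) (a + 2) h.symm).bw hf (a' + 3) (a + c) (hf.wr a).symm) h8 h5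
      (hf.ne (by omega) (by omega)) ?_
    intro k h1 h2
    omega

end Lg

theorem Sx.false [Fintype V] {G : SimpleGraph V} {c : ℤ} {k : ℕ} {f : ℤ → V} {u : V}
    {O X Y : Finset V} (C : Sx G c k f u O X Y) (hT : OneTough G) : False := by
  obtain ⟨a, b, g, hb, h⟩ := C.exists_large hT
  exact (Lg.of_large C g hb h).false hT

/-- Some longest cycle avoids `g`. -/
def Missable (G : SimpleGraph V) (c : ℤ) (g : V) : Prop := ∃ h, Cyc G c h ∧ ∀ i, h i ≠ g

namespace Ctx
variable [Fintype V] {G : SimpleGraph V} {c : ℤ} {k : ℕ} {f : ℤ → V} {u : V} {O X Y : Finset V}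

theorem two_le (C : Ctx G c k f u O X Y) (hT : OneTough G) : 2 ≤ k := by
  by_contra hk
  have hcard : (nb G u).card ≤ 1 := by rw [card_nb, C.deg]; omega
  obtain ⟨i, hi⟩ : ∃ i, nb G u ⊆ {f i} := by
    rcases (nb G u).eq_empty_or_nonempty with h | ⟨v, hv⟩
    · exact ⟨0, by simp [h]⟩
    · obtain ⟨i, rfl⟩ := C.nb_sub (mem_nb.1 hv)
      exact ⟨i, fun w hw => Finset.mem_singleton.2 (Finset.card_le_one.1 hcard _ hw _ hv)⟩
  have h := hT.reps (S := {f i}) (R := {u, f (i + 1)}) (by simp) (by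
    intro r hr
    rcases Finset.mem_insert.1 hr with rfl | hr
    · exact fun h => C.off i (Finset.mem_singleton.1 h).symm
    · rw [Finset.mem_singleton.1 hr]
      exact fun h => (C.cyc.adj i).ne (Finset.mem_singleton.1 h).symm) (by
    intro r hr
    have hu : ∀ w, G.Adj u w → w = f i := fun w hw => Finset.mem_singleton.1 (hi (mem_nb.2 hw))
    rcases Finset.mem_insert.1 hr with rfl | hr
    · refine ⟨{r}, rfl, fun v hv w hw ha => ?_, fun r' _ h => h⟩
      rw [Set.mem_singleton_iff.1 hv] at ha
      exact absurd (Finset.mem_singleton.2 (hu w ha)) hw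
    · rw [Finset.mem_singleton.1 hr]
      refine ⟨{v | v ≠ u ∧ v ≠ f i}, ⟨C.off _, (C.cyc.adj i).ne'⟩, fun v hv w hw ha => ?_, fun r' hr' h => ?_⟩
      · refine ⟨?_, fun h => hw (Finset.mem_singleton.2 h)⟩
        rintro rfl
        exact hv.2 (hu v ha.symm)
      · exact Finset.mem_singleton.1 ((Finset.mem_insert.1 hr').resolve_left h.1))
  rw [Finset.card_pair (C.off _).symm, Finset.card_singleton] at h
  omega

/-- Some vertex outside `X` and `Y` other than `u` can be missed by a longest cycle, or a degree sum
is small. -/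
theorem exists_missable (C : Ctx G c k f u O X Y) (hT : OneTough G) (hO : O = ∅)
    (hd : ∀ z z', z ∉ X → z' ∉ X → z ∉ Y → z' ∉ Y → z ≠ u → z' ≠ u → z ≠ z' → ¬ G.Adj z z' →
      2 * X.card + (exs f X).card + 1 ≤ Paper.deg G z + Paper.deg G z') :
    ∃ g, g ∉ X ∧ g ∉ Y ∧ g ≠ u ∧ Missable G c g := by
  by_contra! hm
  have hdeg : ∀ z, z ∉ X → z ∉ Y → Paper.deg (Gz G f Y) z = Paper.deg G z := by
    intro z hz hz'
    rw [deg_eq, deg_eq]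
    congr 1
    ext w
    simp only [Finset.mem_filter, Finset.mem_univ, true_and]
    exact ⟨fun h => h.1, fun h => C.gzadj' h hz hz'⟩
  have hcov : ∀ v, (∃ i, f i = v) ∨ v = u := by
    intro v
    rcases C.cover v with h | h | h
    · exact .inl h
    · simp [hO] at h
    · exact .inr h
  have hD : Dn (Gz G f Y) c f X ∅ {u} :=
    { cyc := C.cyc.gz Y
      cover := fun v => (hcov v).imp_right fun h => .inr (Finset.mem_singleton.2 h)
      fO := by simp
      fH := fun i h => C.off i (Finset.mem_singleton.1 h)
      OH := by simp
      A_sub := C.ran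
      HN := by
        intro h hh v hv
        rw [Finset.mem_singleton.1 hh] at hv
        exact .inl (C.sub v hv.1)
      kill := by
        intro Q s t w hQ hs ht hst hH hw
        have h1 : IP (Gz G f Y) f 0 c ∅ (fun k => f k ∈ Q) s t :=
          ⟨Q, hQ, fun _ _ _ => Iff.rfl, fun x hx =>
            .inl ((hcov x).resolve_right fun h => hH x hx (Finset.mem_singleton.2 h))⟩
        by_cases hall : ∀ i, f i ∈ Q
        · exact C.full_ip' h1 hs ht hst fun i _ _ => hall i
        · push Not at hall
          obtain ⟨i, hi⟩ := hall
          obtain ⟨j, h2, h3, h4⟩ := C.cyc.exists_rep i 0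
          rw [← h4] at hi
          obtain ⟨h5, h6, h7⟩ := (hw j).resolve_left hi
          have hY : f j ∉ Y := fun h => h7 (C.mem_Y.1 h)
          refine hm (f j) h6 hY (C.off j) ?_
          obtain ⟨g, g1, g2, -⟩ := C.miss_cyc h1 hs ht hst hY hi h2 h3 fun l l1 l2 => by
            refine or_iff_not_imp_left.2 fun hl => ?_
            exact C.cyc.eq_of (((hw l).resolve_left hl).1.trans h5.symm) (by omega) (by omega)
          exact ⟨g, g1, g2⟩
      deg_le := by
        intro z z' h1 h2 h3 h4 h5 h6 h7 h8
        rw [← C.Yeq] at h5 h6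
        have h9 := hd z z' h1 h2 h5 h6 (fun h => h3 (by simp [h])) (fun h => h4 (by simp [h])) h7
          fun h => h8 (C.gzadj' h h1 h5)
        rw [hdeg z h1 h5, hdeg z' h2 h6, ← C.Yeq]
        have := C.card_cyc
        simp only [Finset.card_empty]
        push_cast
        omega }
  refine hD.not_tough hT C.cyc (by simp) ?_ ?_ ?_ ?_
  · have := C.two_le hT
    have := C.le_card_X
    exact Finset.card_pos.1 (by omega)
  · exact fun i h1 h2 v hv => C.HN _ (C.mem_Y.2 ⟨h1, h2⟩) v hv
  · intro h hh v hv
    rw [Finset.mem_singleton.1 hh] at hv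
    exact .inl (C.sub v hv)
  · intro i j h1 h2 h3 h4 h
    subst hO
    exact (C.cn_gz h h1 h2).1

/-- The case of a single enclosed vertex. -/
theorem false_of_card_one (C : Ctx G c k f u O X Y) (hT : OneTough G) (hY : Y.card = 1) :
    False := by
  obtain ⟨a, rfl⟩ := Finset.card_eq_one.1 hY
  have ha : a ∈ ({a} : Finset V) := by simp
  have hua := C.u_not_adj_Y ha
  have hne : u ≠ a := fun h => C.u_notMem_Y (by simp [h])
  have hda := C.deg_Y ha
  have hkX := C.le_card_X
  have hO : O = ∅ := by
    rw [Finset.eq_empty_iff_forall_notMem]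
    intro r hr
    have h1 : ¬ G.Adj u r := fun h => C.O_notMem_X hr (C.sub r h)
    have h2 : ¬ G.Adj a r := fun h => C.O_notMem_X hr (C.HN a ha r h)
    have h3 := (C.triple hne (fun h => C.uO (h ▸ hr))
      (fun h => C.O_notMem_Y hr (by simp [h])) hua h1 h2).1
    have h4 := C.mu f C.cyc r fun i h => C.fO i (h ▸ hr)
    have h5 : 0 < O.card := Finset.card_pos.2 ⟨r, hr⟩
    have h6 := C.deg
    omega
  by_cases hs : X.card = k ∧ (exs f X).card = 0
  · exact (C.toSx (.inr ⟨hY, hs.1, hs.2, by simp [hO]⟩)).false hT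
  have hd : ∀ z, z ∉ X → z ∉ ({a} : Finset V) → z ≠ u →
      3 * X.card + (exs f X).card ≤ Paper.deg G z + 2 * k := by
    intro z h1 h2 h3
    have h4 := (C.triple hne h3.symm (fun h => h2 (by simp [h])) hua
      (fun h => h1 (C.sub z h)) fun h => h1 (C.HN a ha z h)).1
    have h6 := C.deg
    omega
  obtain ⟨g, h1, h2, h3, h, h4, h5⟩ := C.exists_missable hT hO fun z z' h1 h2 h3 h4 h5 h6 _ _ => by
    have := hd z h1 h3 h5
    have := hd z' h2 h4 h6
    omega
  have := hd g h1 h2 h3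
  have := C.mu h h4 g h5
  omega

end Ctx

/-- The degree sum of the successors of two cycle vertices which are not joined by a path covering
the cycle. -/
theorem Cyc.label_firsts [Fintype V] {G : SimpleGraph V} {c : ℤ} {f : ℤ → V} (hf : Cyc G c f)
    {i0 j0 : ℤ} (hij : i0 < j0) (hji : j0 < i0 + c) {O : Finset V} (fO : ∀ i, f i ∉ O)
    (hN : ∀ v, G.Adj (f (i0 + 1)) v → v ∈ O ∨ ∃ i, f i = v)
    (hN' : ∀ v, G.Adj (f (j0 + 1)) v → v ∈ O ∨ ∃ i, f i = v)
    (kill : ∀ S, IP G f (i0 + 1) c O S (f (i0 + c)) (f j0) →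
      (∀ k, i0 + 1 ≤ k → k < i0 + 1 + c → S k) → False)
    (U : Finset V) (hU : ∀ v ∈ U, (∃ i, f i = v) ∧ ¬ G.Adj (f (i0 + 1)) v ∧
      ¬ G.Adj (f (j0 + 1)) v ∧ ¬ G.Adj (f (i0 + 1)) (nxt f v) ∧ ¬ G.Adj (f (j0 + 1)) (nxt f v)) :
    ((deg G (f (i0 + 1)) + deg G (f (j0 + 1)) + U.card : ℕ) : ℤ) ≤ c + O.card := by
  have h3c := hf.three_le
  have hO : ∀ x ∈ (O : Set V), ∀ k, f k ≠ x := fun x hx k h => fO k (h ▸ hx)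
  have hrep : ∀ v, (∃ i, f i = v) → ∃ k, i0 + 1 ≤ k ∧ k ≤ i0 + c ∧ f k = v := by
    rintro _ ⟨i, rfl⟩
    obtain ⟨k, h1, h2, h3⟩ := hf.exists_rep i (i0 + 1)
    exact ⟨k, h1, by omega, h3⟩
  refine (label_count (g := f) (a := i0 + 1) (b := j0) (e := i0 + c) (by omega) hji
    (fun i j _ _ _ => hf.ne (by omega) (by omega)) rfl rfl (O := O) (fun k _ _ => fO k)
    (fun v hv => (hN v hv).imp_right (hrep v)) (fun v hv => (hN' v hv).imp_right (hrep v))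
    ?_ ?_ ?_ U ?_).trans (by omega)
  · rintro k h1 h2 ⟨h4, h5⟩
    exact kill _ (((((IP.sgr (lo := i0 + 1) hf (j0 + 1) (i0 + c)).bw hf (i0 + 1) k h4).fw hf
      (k + 1) j0 h5)).mono (by simp)) fun l _ _ => by omega
  · rintro k h1 h2 ⟨h4, h5⟩
    exact kill _ (((((IP.sgr (lo := i0 + 1) hf (k + 1) (i0 + c)).fw hf (j0 + 1) k h5.symm).fw hf
      (i0 + 1) j0 h4.symm)).mono (by simp)) fun l _ _ => by omega
  · rintro r hr ⟨h4, h5⟩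
    exact kill _ ((IP.sgr (lo := i0 + 1) hf (j0 + 1) (i0 + c)).join hf
      (IP.sg (lo := i0 + 1) hf (i0 + 1) j0) hO (.of_common (O := (O : Set V)) hr h5 h4)
      fun l _ _ => by omega) fun l _ _ => by omega
  · intro v hv
    obtain ⟨h1, h2, h3, h4, h5⟩ := hU v hv
    obtain ⟨k, h6, h7, rfl⟩ := hrep v h1
    rw [nxt_apply hf] at h4 h5
    by_cases hk : k ≤ j0
    · exact .inl ⟨k, h6, hk, rfl, h3, fun _ => h4⟩
    · exact .inr (.inl ⟨k, by omega, h7, rfl, h2, fun _ => h5⟩)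

namespace Ctx
variable [Fintype V] {G : SimpleGraph V} {c : ℤ} {k : ℕ} {f : ℤ → V} {u : V} {O : Finset V}
  {X : Finset V} (C : Ctx G c k f u O X ∅)
include C

theorem adj_u {x : V} (hx : x ∈ X) : G.Adj u x := by
  by_contra h
  obtain ⟨-, -, -, w, hw, -⟩ := C.ex x hx h
  exact absurd (C.sing_sub_Y hw) (Finset.notMem_empty _)

theorem card_eq : X.card = k := by
  rw [← C.deg, ← card_nb]
  exact congrArg _ (Finset.ext fun v => ⟨fun h => mem_nb.2 (C.adj_u h), fun h => C.sub v (mem_nb.1 h)⟩)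

theorem count {a b : V} (ha : a ∉ X) (hb : b ∉ X) (hau : a ≠ u) (hbu : b ≠ u) (hab : a ≠ b)
    (h : ¬ G.Adj a b) : 2 * k + (exs f X).card + O.card + 1 ≤ Paper.deg G a + Paper.deg G b := by
  have := (C.triple hau.symm hbu.symm hab (fun h => ha (C.sub _ h)) (fun h => hb (C.sub _ h)) h).1
  rw [C.card_eq, C.deg, Finset.card_empty] at this
  omega

/-- Two vertices of small degree are adjacent. -/
theorem adj_of_low {a b : V} (ha : a ∉ X) (hb : b ∉ X) (hau : a ≠ u) (hbu : b ≠ u) (hab : a ≠ b)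
    (h : Paper.deg G a ≤ k) (h' : Paper.deg G b ≤ k) : G.Adj a b := by
  by_contra hn
  have := C.count ha hb hau hbu hab hn
  omega

theorem low_of_missable {a : V} (h : Missable G c a) : Paper.deg G a ≤ k := by
  obtain ⟨g, hg, hga⟩ := h
  exact C.mu g hg a hga

theorem low_of_O {r : V} (hr : r ∈ O) : Paper.deg G r ≤ k :=
  C.mu f C.cyc r fun i e => C.fO i (e ▸ hr)

theorem card_O_le : O.card ≤ 1 := by
  rw [Finset.card_le_one]
  intro r hr s hs
  by_contra hne
  obtain ⟨i, hi⟩ := C.O_nb hr (C.adj_of_low (C.O_notMem_X hr) (C.O_notMem_X hs)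
    (fun e => C.uO (e ▸ hr)) (fun e => C.uO (e ▸ hs)) hne (C.low_of_O hr) (C.low_of_O hs))
  exact C.fO i (hi ▸ hs)

/-- The gap starting at a vertex of `X`. -/
theorem exists_gap {a : ℤ} (h : f a ∈ X) : ∃ b, Gap f X a b ∧ b ≤ a + c := by
  obtain ⟨a', b, h1, h2, h3, h4, h5, h6⟩ := C.cyc.exists_gap ⟨a, h⟩ (a + 1) (C.nocons a h)
  have e : a' = a := by
    by_contra hne
    exact h6 a (by omega) (by omega) h
  subst e
  refine ⟨b, ⟨h4, h5, ?_, h6⟩, h3⟩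
  by_contra hl
  have e : b = a' + 2 := by omega
  subst e
  refine absurd ((C.mem_Y (i := a' + 1)).2 ⟨?_, ?_⟩) (Finset.notMem_empty _)
  · rwa [add_sub_cancel_right]
  · rwa [add_assoc]

theorem no_oc22 {i0 j0 : ℤ} (pr : Pr f c X i0 (i0 + 3) j0 (j0 + 3)) :
    ¬ G.Adj (f (i0 + 1)) (f (j0 + 2)) := by
  intro h
  have hf := C.cyc
  have H : Oc G c f X i0 (i0 + 3) j0 := ⟨pr, h⟩
  have h1 := (C.oc_miss H).1
  have h2 := (C.mirror.oc_miss (H.mirror rfl)).1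
  rw [show -(-(i0 + 3) + 1) = i0 + 2 by ring] at h2
  have := pr.ij; have := pr.ji
  obtain ⟨x1, y1⟩ := C.gap_notMem pr.gi (l := i0 + 1) (by omega) (by omega)
  obtain ⟨x2, y2⟩ := C.gap_notMem pr.gi (l := i0 + 2) (by omega) (by omega)
  obtain ⟨x3, y3⟩ := C.gap_notMem pr.gj (l := j0 + 1) (by omega) (by omega)
  obtain ⟨x4, y4⟩ := C.gap_notMem pr.gj (l := j0 + 2) (by omega) (by omega)
  have ha := C.adj_of_low x3 x2 (C.off _) (C.off _) (hf.ne (by omega) (by omega)).symm h1 h2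
  have hX : f (i0 + c) ∈ X := by rw [hf.per]; exact pr.gi.left
  exact C.full_u (lo := i0 + 1) (((((IP.sgr (lo := i0 + 1) hf (j0 + 3) (i0 + c)).fw hf (j0 + 2) (j0 + 2)
    (by rw [show j0 + 3 = j0 + 2 + 1 by ring]; exact (hf.adj _).symm)).fw hf (i0 + 1) (i0 + 2)
    h.symm).fw hf (j0 + 1) (j0 + 1) ha.symm).bw hf (i0 + 3) j0 (hf.adj _).symm)
    (C.adj_u hX) (C.adj_u pr.gi.right) (hf.ne (by omega) (by omega)).symm (by intros; omega)

theorem no_oc32 (hO : O.card = 0) (he : (exs f X).card = 1) (hk : 3 ≤ k) {i0 j0 : ℤ}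
    (pr : Pr f c X i0 (i0 + 4) j0 (j0 + 3)) : ¬ G.Adj (f (i0 + 1)) (f (j0 + 2)) := by
  intro h
  have hf := C.cyc
  have H : Oc G c f X i0 (i0 + 4) j0 := ⟨pr, h⟩
  have lq := (C.oc_miss H).1
  have h1 := pr.ij; have h2 := pr.ji
  obtain ⟨m, m1, m2, m3, m4⟩ : ∃ m, f m ∈ X ∧ i0 < m ∧ m < i0 + c ∧ m ≠ j0 := by
    obtain ⟨x, hx, hx'⟩ := Finset.exists_mem_notMem_of_card_lt_card (s := {f i0, f j0}) (t := X) (by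
      rw [C.card_eq]
      exact lt_of_le_of_lt Finset.card_le_two hk)
    obtain ⟨i, rfl⟩ := C.ran x hx
    obtain ⟨m, m1, m2, m3⟩ := hf.exists_rep i i0
    rw [← m3] at hx hx'
    simp only [Finset.mem_insert, Finset.mem_singleton, not_or] at hx'
    refine ⟨m, hx, lt_of_le_of_ne m1 ?_, m2, ?_⟩
    · rintro rfl; exact hx'.1 rfl
    · rintro rfl; exact hx'.2 rfl
  have gp : ∀ a b, Gap f X a b → i0 < a → a < i0 + c → b = a + 3 ∧ Pr f c X i0 (i0 + 4) a (a + 3) := by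
    intro a b g a1 a2
    have hXc : f (i0 + c) ∈ X := by rw [hf.per]; exact pr.gi.left
    have q1 : i0 + 4 ≤ a := by
      by_contra hq
      exact pr.gi.not_mem a a1 (by omega) g.left
    have q2 : b ≤ i0 + c := by
      by_contra hq
      exact g.not_mem (i0 + c) (by omega) (by omega) hXc
    have p : Pr f c X i0 (i0 + 4) a b := ⟨pr.gi, g, q1, q2⟩
    have := p.card_exs hf
    have := g.len
    have e : b = a + 3 := by omega
    exact ⟨e, e ▸ p⟩
  obtain ⟨m', gm, -⟩ := C.exists_gap m1
  obtain ⟨e, pm⟩ := gp m m' gm m2 m3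
  subst e
  have h3 := pm.ij; have h4 := pm.ji
  obtain ⟨x1, -⟩ := C.gap_notMem pr.gi (l := i0 + 1) (by omega) (by omega)
  obtain ⟨xq, -⟩ := C.gap_notMem pr.gj (l := j0 + 1) (by omega) (by omega)
  obtain ⟨xp, -⟩ := C.gap_notMem pm.gj (l := m + 1) (by omega) (by omega)
  obtain ⟨xp2, -⟩ := C.gap_notMem pm.gj (l := m + 2) (by omega) (by omega)
  have ne : f j0 ≠ f m := fun e => m4 (hf.eq_of e (by omega) (by omega)).symm
  have nadj : ¬ G.Adj (f (j0 + 1)) (f (m + 1)) := fun h =>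
    C.not_cn_firsts pr.gj.left m1 ne (Or.inl h)
  have hd := C.count xq xp (C.off _) (C.off _) (fun e => m4 (by
    have := hf.eq_of e (by omega) (by omega)
    omega)) nadj
  have jm : j0 + 3 ≤ m ∨ m + 3 ≤ j0 := by
    by_contra hc
    push Not at hc
    rcases lt_trichotomy j0 m with h | h | h
    · exact pr.gj.not_mem m (by omega) (by omega) m1
    · exact m4 h.symm
    · exact gm.not_mem j0 (by omega) (by omega) pr.gj.left
  have pjm : ∀ a b, f a ∈ X → f b ∈ X → i0 < a → a < i0 + c → i0 < b → b < i0 + c → a ≠ b →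
      ¬ G.Adj (f (a + 1)) (f (b + 2)) := by
    intro a b ha hb a1 a2 b1 b2 hab
    obtain ⟨a', ga, -⟩ := C.exists_gap ha
    obtain ⟨b', gb, -⟩ := C.exists_gap hb
    obtain ⟨ea, pa⟩ := gp a a' ga a1 a2
    obtain ⟨eb, pb⟩ := gp b b' gb b1 b2
    have := pa.ij; have := pa.ji; have := pb.ij; have := pb.ji
    have ga := pa.gj
    have gb := pb.gj
    rcases lt_or_gt_of_ne hab with h | h
    · refine C.no_oc22 ⟨ga, gb, ?_, by omega⟩
      by_contra hq
      exact ga.not_mem b h (by omega) hb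
    · have : b + 3 ≤ a := by
        by_contra hq
        exact gb.not_mem a h (by omega) ha
      have := C.no_oc22 (i0 := a - c) (j0 := b) ⟨by
        have := ga.sub hf
        rwa [show a + 3 - c = a - c + 3 by ring] at this, gb, by omega, by omega⟩
      rwa [show a - c + 1 = a + 1 + (-1) * c by ring, hf.per_mul] at this
  have hN := deg_le_of_missed (z := f (m + 1)) (M := ∅) (X := X) (R := {f (m + 2)}) (by simp) (by simp) (by
    intro v hv hvX
    obtain ⟨l, l1, l2, rfl⟩ : ∃ l, i0 ≤ l ∧ l < i0 + c ∧ f l = v := by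
      rcases C.cover v with ⟨i, rfl⟩ | hv' | rfl
      · exact hf.exists_rep i i0
      · rw [Finset.card_eq_zero.1 hO] at hv'
        exact absurd hv' (Finset.notMem_empty _)
      · exact absurd (C.sub _ hv.symm) xp
    rw [Finset.mem_singleton]
    obtain ⟨a, b, b1, b2, b3, b4, b5, b6⟩ := hf.exists_gap ⟨m, m1⟩ l hvX
    have la : i0 ≤ a := by
      by_contra hq
      have : l ≠ i0 := fun e => hvX (e ▸ pr.gi.left)
      exact b6 i0 (by omega) (by omega) pr.gi.left
    rcases eq_or_lt_of_le la with rfl | la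
    · have : l < i0 + 4 := by
        by_contra hq
        exact b6 (i0 + 4) (by omega) (by omega) pr.gi.right
      rcases (by omega : l = i0 + 1 ∨ l = i0 + 2 ∨ l = i0 + 3) with rfl | rfl | rfl
      · exact absurd (Or.inl hv) (C.not_cn_firsts m1 pr.gi.left (hf.ne (by omega) (by omega)).symm)
      · have := (C.miss_ip (lo := i0 + 1) (k0 := i0 + 1) ((IP.sgr (lo := i0 + 1) (hf.gz ∅) (i0 + 2) m).fw (hf.gz ∅)
          (m + 1) (i0 + c) (C.gzadj' hv.symm hvX (Finset.notMem_empty _))) m1 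
          (by rw [hf.per]; exact pr.gi.left) (hf.ne (by omega) (by omega))
          (Finset.notMem_empty _) (by omega) (by omega) (by omega) (by intros; omega)).1
        exact absurd (Or.inl (C.adj_of_low x1 xq (C.off _) (C.off _) (hf.ne (by omega) (by omega))
          this lq)) (C.not_cn_firsts pr.gi.left pr.gj.left (hf.ne (by omega) (by omega)))
      · have pm' := pm.mirror' hf
        have H' : Oc G c (fun i => f (-i)) X (-(i0 + 4)) (-i0) (-(m + 3) + c) := by
          refine ⟨by rwa [show -(m + 3) + c + 3 = -m + c by ring], ?_⟩
          show G.Adj (f (-(-(i0 + 4) + 1))) (f (-(-(m + 3) + c + 2)))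
          rw [show -(-(i0 + 4) + 1) = i0 + 3 by ring, show -(-(m + 3) + c + 2) = m + 1 + (-1) * c by ring,
            hf.per_mul]
          exact hv.symm
        have := (C.mirror.oc_miss H').1
        rw [show -(-(m + 3) + c + 1) = m + 2 + (-1) * c by ring, hf.per_mul] at this
        exact absurd (C.adj_of_low xq xp2 (C.off _) (C.off _) (fun e => m4 (by
          have := hf.eq_of e (by omega) (by omega)
          omega)) lq this) (pjm j0 m pr.gj.left m1 (by omega) (by omega) m2 m3 m4.symm)
    · have hac : a < i0 + c := by omega
      obtain ⟨a', ga, -⟩ := C.exists_gap b4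
      obtain ⟨ea, pa⟩ := gp a a' ga la hac
      have : l < a + 3 := by
        by_contra hq
        exact b6 (a + 3) (by omega) (by omega) pa.gj.right
      rcases (by omega : l = a + 1 ∨ l = a + 2) with rfl | rfl
      · by_cases ham : a = m
        · rw [ham] at hv
          exact absurd hv (G.loopless.irrefl _)
        · exact absurd (Or.inl hv) (C.not_cn_firsts m1 b4 fun e => ham
            (hf.eq_of e (by omega) (by omega)).symm)
      · by_cases ham : a = m
        · rw [ham]
        · exact absurd hv (pjm m a m1 b4 m2 m3 la hac (Ne.symm ham)))
  rw [C.card_eq, Finset.card_empty, Finset.card_singleton] at hN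
  omega

theorem no_fl (hE : (exs f X).card = 0 ∨ (exs f X).card = 1 ∧ O.card = 0 ∧ 3 ≤ k) {i0 i1 j0 j1 : ℤ}
    (pr : Pr f c X i0 i1 j0 j1) : ¬ Cn G O (f (i0 + 1)) (f (j1 - 1)) := by
  intro h
  have he := pr.card_exs C.cyc
  have := pr.gi.len; have := pr.gj.len
  rcases C.cn_iff.1 h with h | ⟨r, hr, r1, r2⟩
  · rcases (by omega : i1 = i0 + 3 ∧ j1 = j0 + 3 ∨ i1 = i0 + 4 ∧ j1 = j0 + 3 ∨
      i1 = i0 + 3 ∧ j1 = j0 + 4) with ⟨rfl, rfl⟩ | ⟨rfl, rfl⟩ | ⟨rfl, rfl⟩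
    · rw [show j0 + 3 - 1 = j0 + 2 by ring] at h
      exact C.no_oc22 pr h
    · rw [show j0 + 3 - 1 = j0 + 2 by ring] at h
      exact C.no_oc32 (by omega) (by omega) (by omega) pr h
    · have p := pr.mirror
      refine C.mirror.no_oc32 (by omega) ?_ (by omega) (i0 := -(j0 + 4)) (j0 := -(i0 + 3))
        (by rwa [show -(j0 + 4) + 4 = -j0 by ring, show -(i0 + 3) + 3 = -i0 by ring]) ?_
      · have h1 := C.mirror.card_cyc
        have h2 := C.card_cyc
        omega
      · show G.Adj (f (-(-(j0 + 4) + 1))) (f (-(-(i0 + 3) + 2)))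
        rw [show -(-(j0 + 4) + 1) = j0 + 4 - 1 by ring, show -(-(i0 + 3) + 2) = i0 + 1 by ring]
        exact h.symm
  · have e : j1 = j0 + 3 := by
      by_contra hne
      have := Finset.card_pos.2 ⟨r, hr⟩
      omega
    subst e
    rw [show j0 + 3 - 1 = j0 + 2 by ring] at r2
    exact C.not_via pr hr r1 r2

theorem X_nonempty (hT : OneTough G) : X.Nonempty := by
  have := C.two_le hT
  have := C.card_eq
  exact Finset.card_pos.1 (by omega)

theorem false_of_small (hT : OneTough G)
    (hE : (exs f X).card = 0 ∨ (exs f X).card = 1 ∧ O.card = 0 ∧ 3 ≤ k) : False := by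
  obtain ⟨a, b, g, h1, h2⟩ := C.exists_large hT (C.X_nonempty hT) (C.no_fl hE) (fun _ => C.card_O_le)
    (fun pr => by
      have := pr.card_exs C.cyc
      omega)
  have := g.card_exs C.cyc h1
  omega

end Ctx

namespace Ctx
variable [Fintype V] {G : SimpleGraph V} {c : ℤ} {k : ℕ} {f : ℤ → V} {u : V} {O : Finset V}
  {X : Finset V} (C : Ctx G c k f u O X ∅)
include C

theorem exs_mirror : (exs (fun i => f (-i)) X).card = (exs f X).card := by
  have h1 := C.mirror.card_cyc
  have h2 := C.card_cyc
  omega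

/-- If a vertex following a vertex of `X` is adjacent to the second vertex of another gap, the first
vertex of that gap can be missed. -/
theorem low_of_second {a j : ℤ} (ha : f a ∈ X) (hj : f j ∈ X) (haj : a < j) (hja : j < a + c)
    (h : G.Adj (f (j + 1)) (f (a + 2))) : Paper.deg G (f (a + 1)) ≤ k := by
  have hf := C.cyc
  have h1 := C.nocons a ha
  have : j ≠ a + 1 := fun e => h1 (e ▸ hj)
  exact (C.miss_ip (lo := a + 1) (k0 := a + 1) ((IP.sgr (lo := a + 1) (hf.gz ∅) (a + 2) j).fw (hf.gz ∅)
    (j + 1) (a + c) (C.gzadj' h.symm (fun h' => by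
      have := (C.mem_Y (i := a + 1)).2 ⟨by rwa [add_sub_cancel_right], by rwa [add_assoc]⟩
      exact absurd this (Finset.notMem_empty _)) (Finset.notMem_empty _))) hj 
    (by rw [hf.per]; exact ha) (hf.ne (by omega) (by omega))
    (Finset.notMem_empty _) (by omega) (by omega) (by omega) (by intros; omega)).1

theorem exists_low (hT : OneTough G) :
    ∃ g, g ∉ X ∧ g ≠ u ∧ Paper.deg G g ≤ k ∧ (O ≠ ∅ → g ∈ O) := by
  by_cases hO : O = ∅
  · obtain ⟨g, h1, -, h2, h3⟩ := C.exists_missable hT hO fun z z' h1 h2 _ _ h3 h4 h5 h6 => by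
      have := C.count h1 h2 h3 h4 h5 h6
      rw [C.card_eq]
      omega
    exact ⟨g, h1, h2, C.low_of_missable h3, fun h => absurd hO h⟩
  · obtain ⟨r, hr⟩ := Finset.nonempty_iff_ne_empty.2 hO
    exact ⟨r, C.O_notMem_X hr, fun e => C.uO (e ▸ hr), C.low_of_O hr, fun _ => hr⟩

variable {g : V} (hg : g ∉ X) (hgu : g ≠ u) (hd : Paper.deg G g ≤ k)
include hg hgu hd

/-- All but at most one of the vertices following a vertex of `X` are equal or adjacent to a vertex
of small degree. -/
theorem firsts_near (hE : 2 ≤ (exs f X).card + O.card ∨ k = 2 ∧ 1 ≤ (exs f X).card) {i j : ℤ}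
    (hi : f i ∈ X) (hj : f j ∈ X) (hij : f i ≠ f j) (h1 : f (i + 1) ≠ g) (h2 : f (j + 1) ≠ g)
    (h3 : ¬ G.Adj (f (i + 1)) g) : G.Adj (f (j + 1)) g := by
  by_contra h4
  have hf := C.cyc
  obtain ⟨j', j1, j2, j3⟩ := hf.exists_rep j i
  have ej : f (j + 1) = f (j' + 1) := (hf.congr_shift j3 1).symm
  rw [← j3] at hj hij
  rw [ej] at h2 h4
  clear ej j3
  have hlt : i < j' := lt_of_le_of_ne j1 fun e => hij (by rw [e])
  have nu : ∀ {z v}, z ∉ X → G.Adj z v → v ∈ O ∨ ∃ i, f i = v := by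
    intro z v hz h
    rcases C.cover v with h' | h' | rfl
    · exact Or.inr h'
    · exact Or.inl h'
    · exact absurd (C.sub _ h.symm) hz
  have xi := C.nocons i hi
  have xj := C.nocons j' hj
  have d1 := C.count xi hg (C.off _) hgu h1 h3
  have d2 := C.count xj hg (C.off _) hgu h2 h4
  set F := X.image (nxt f) with hF
  have hFc : F.card = k := by rw [hF, C.card_first, C.card_eq]
  have mF : ∀ v ∈ F, ∃ a, f a ∈ X ∧ v = f (a + 1) := by
    intro v hv
    obtain ⟨x, hx, rfl⟩ := Finset.mem_image.1 hv
    obtain ⟨a, rfl⟩ := C.ran x hx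
    exact ⟨a, hx, nxt_apply hf a⟩
  set B := F.filter fun v => Paper.deg G v ≤ k with hB
  have hBc : B.card ≤ 1 := by
    rw [Finset.card_le_one]
    intro v hv w hw
    rw [hB, Finset.mem_filter] at hv hw
    obtain ⟨a, ha, rfl⟩ := mF _ hv.1
    obtain ⟨b, hb, rfl⟩ := mF _ hw.1
    by_contra hne
    exact C.not_cn_firsts ha hb (fun e => hne (hf.congr_shift e 1)) (Or.inl
      (C.adj_of_low (C.nocons a ha) (C.nocons b hb) (C.off _) (C.off _) hne hv.2 hw.2))
  set U := (F \ {f (i + 1), f (j' + 1)}) \ B with hU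
  have hUc : k ≤ U.card + 3 := by
    have e1 := Finset.le_card_sdiff B (F \ {f (i + 1), f (j' + 1)})
    have e2 := Finset.le_card_sdiff {f (i + 1), f (j' + 1)} F
    have e3 := Finset.card_le_two (a := f (i + 1)) (b := f (j' + 1))
    rw [← hU] at e1
    omega
  have ns : ∀ {a l}, f a ∈ X → f l ∈ X → f a ≠ f l → ¬ Paper.deg G (f (a + 1)) ≤ k →
      ¬ G.Adj (f (l + 1)) (f (a + 2)) := by
    intro a l ha hl hne hlow h
    obtain ⟨l', l1, l2, l3⟩ := hf.exists_rep l a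
    rw [← hf.congr_shift l3 1] at h
    rw [← l3] at hl hne
    exact hlow (C.low_of_second ha hl (lt_of_le_of_ne l1 fun e => hne (by rw [e])) l2 h)
  have key := hf.label_firsts hlt j2 (O := O) C.fO (fun v => nu xi) (fun v => nu xj) (by
      intro S hS hc
      have e : Gz G f ∅ = G := by
        ext v w
        simp [Gz]
      rw [← e] at hS
      exact C.full_ip hS (by rw [hf.per]; exact hi) hj (hf.ne (by omega) (by omega)).symm hc) U (by
    intro v hv
    simp only [hU, hB, Finset.mem_sdiff, Finset.mem_insert, Finset.mem_singleton, not_or,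
      Finset.mem_filter, not_and] at hv
    obtain ⟨⟨hvF, v1, v2⟩, v3⟩ := hv
    have v3 := v3 hvF
    obtain ⟨a, ha, rfl⟩ := mF v hvF
    have n1 : f a ≠ f i := fun e => v1 (hf.congr_shift e 1)
    have n2 : f a ≠ f j' := fun e => v2 (hf.congr_shift e 1)
    rw [nxt_apply hf, add_assoc]
    exact ⟨⟨_, rfl⟩, fun h => C.not_cn_firsts hi ha n1.symm (Or.inl h),
      fun h => C.not_cn_firsts hj ha n2.symm (Or.inl h), ns ha hi n1 v3, ns ha hj n2 v3⟩)
  have hc := C.card_cyc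
  rw [Finset.card_empty, C.card_eq] at hc
  push_cast at key
  omega

/-- The neighbours of `g` among the vertices following a vertex of `X`. -/
theorem card_firsts_near (hE : 2 ≤ (exs f X).card + O.card ∨ k = 2 ∧ 1 ≤ (exs f X).card) 
    (hk : 3 ≤ k) :
    (∀ i, f i ∈ X → f (i + 1) ≠ g) ∧
      k ≤ ((X.image (nxt f)).filter fun v => G.Adj v g).card + 1 := by
  have hf := C.cyc
  have hFc : (X.image (nxt f)).card = k := by rw [C.card_first, C.card_eq]
  have mF : ∀ v ∈ X.image (nxt f), ∃ a, f a ∈ X ∧ v = f (a + 1) := by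
    intro v hv
    obtain ⟨x, hx, rfl⟩ := Finset.mem_image.1 hv
    obtain ⟨a, rfl⟩ := C.ran x hx
    exact ⟨a, hx, nxt_apply hf a⟩
  have h1 : ∀ i, f i ∈ X → f (i + 1) ≠ g := by
    rintro i hi rfl
    have : 1 < ((X.image (nxt f)).erase (f (i + 1))).card := by
      have := Finset.pred_card_le_card_erase (s := X.image (nxt f)) (a := f (i + 1))
      omega
    obtain ⟨v, hv, w, hw, hvw⟩ := Finset.one_lt_card.1 this
    rw [Finset.mem_erase] at hv hw
    obtain ⟨a, ha, rfl⟩ := mF v hv.2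
    obtain ⟨b, hb, rfl⟩ := mF w hw.2
    refine C.not_cn_firsts hb hi (fun e => hw.1 (hf.congr_shift e 1)) (Or.inl
      (C.firsts_near hg hgu hd hE ha hb (fun e => hvw (hf.congr_shift e 1)) hv.1 hw.1 fun h =>
      C.not_cn_firsts ha hi (fun e => hv.1 (hf.congr_shift e 1)) (Or.inl h)))
  refine ⟨h1, ?_⟩
  have h2 : ((X.image (nxt f)).filter fun v => ¬ G.Adj v g).card ≤ 1 := by
    rw [Finset.card_le_one]
    intro v hv w hw
    rw [Finset.mem_filter] at hv hw
    obtain ⟨a, ha, rfl⟩ := mF v hv.1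
    obtain ⟨b, hb, rfl⟩ := mF w hw.1
    by_contra hne
    exact hw.2 (C.firsts_near hg hgu hd hE ha hb (fun e => hne (hf.congr_shift e 1)) (h1 a ha)
      (h1 b hb) hv.2)
  have := Finset.card_filter_add_card_filter_not (s := X.image (nxt f)) (fun v => G.Adj v g)
  omega

theorem false_of_three_le (hE : 2 ≤ (exs f X).card + O.card) (hk : 3 ≤ k) : False := by
  obtain ⟨h1, h2⟩ := C.card_firsts_near hg hgu hd (Or.inl hE) hk
  obtain ⟨h3, h4⟩ := C.mirror.card_firsts_near hg hgu hd (Or.inl (by rwa [C.exs_mirror])) hk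
  have hf := C.cyc
  have hdis : Disjoint ((X.image (nxt f)).filter fun v => G.Adj v g)
      ((X.image (nxt fun i => f (-i))).filter fun v => G.Adj v g) := by
    rw [Finset.disjoint_left]
    intro v hv hw
    obtain ⟨x, hx, rfl⟩ := Finset.mem_image.1 (Finset.mem_filter.1 hv).1
    obtain ⟨y, hy, e⟩ := Finset.mem_image.1 (Finset.mem_filter.1 hw).1
    obtain ⟨a, rfl⟩ := C.ran x hx
    obtain ⟨b, rfl⟩ := C.mirror.ran y hy
    rw [nxt_apply hf, nxt_apply hf.mirror b] at e
    have e2 := hf.congr_shift e 1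
    rw [show -(b + 1) + 1 = -b by ring] at e2
    have := (C.mem_Y (i := a + 1)).2 ⟨by rwa [add_sub_cancel_right], by rw [← e2]; exact hy⟩
    exact absurd this (Finset.notMem_empty _)
  have hs : ((X.image (nxt f)).filter fun v => G.Adj v g) ∪
      ((X.image (nxt fun i => f (-i))).filter fun v => G.Adj v g) ⊆ nb G g := by
    intro v hv
    rw [Finset.mem_union, Finset.mem_filter, Finset.mem_filter] at hv
    exact mem_nb.2 (hv.elim (fun h => h.2.symm) fun h => h.2.symm)
  have := Finset.card_le_card hs
  rw [Finset.card_union_of_disjoint hdis, card_nb] at this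
  omega

end Ctx

theorem eq_or_eq_of_deg_le_two [Fintype V] {G : SimpleGraph V} {g p q v : V} (hd : deg G g ≤ 2)
    (hp : G.Adj g p) (hq : G.Adj g q) (hpq : p ≠ q) (hv : G.Adj g v) : v = p ∨ v = q := by
  by_contra! h
  have hs : ({p, q, v} : Finset V) ⊆ nb G g := by
    intro x hx
    simp only [Finset.mem_insert, Finset.mem_singleton] at hx
    rcases hx with rfl | rfl | rfl <;> rwa [mem_nb]
  have := Finset.card_le_card hs
  rw [card_nb, Finset.card_eq_three.2 ⟨p, q, v, hpq, h.1.symm, h.2.symm, rfl⟩] at this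
  omega

namespace Ctx
variable [Fintype V] {G : SimpleGraph V} {c : ℤ} {k : ℕ} {f : ℤ → V} {u : V} {O : Finset V}
  {X : Finset V} (C : Ctx G c k f u O X ∅) (hk : k = 2)
include C hk

/-- The two gaps. -/
theorem two_gaps {a : ℤ} (ha : f a ∈ X) : ∃ b, Pr f c X a b b (a + c) ∧ X = {f a, f b} := by
  have hf := C.cyc
  obtain ⟨b, g, hb⟩ := C.exists_gap ha
  have hX := C.card_eq
  have hgl := g.len
  have hall : ∀ x ∈ X, ∃ i, a ≤ i ∧ i < a + c ∧ (i = a ∨ b ≤ i) ∧ f i = x := by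
    intro x hx
    obtain ⟨i, rfl⟩ := C.ran x hx
    obtain ⟨j, j1, j2, j3⟩ := hf.exists_rep i a
    refine ⟨j, j1, j2, ?_, j3⟩
    by_contra! h
    exact g.not_mem j (by omega) (by omega) (by rwa [j3])
  have hb' : b < a + c := by
    by_contra hb'
    have : X ⊆ {f a} := by
      intro x hx
      obtain ⟨i, i1, i2, i3, rfl⟩ := hall x hx
      rw [show i = a by omega]
      simp
    have := Finset.card_le_card this
    simp at this
    omega
  have hs : ({f a, f b} : Finset V) ⊆ X := by
    intro x hx
    simp only [Finset.mem_insert, Finset.mem_singleton] at hx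
    rcases hx with rfl | rfl
    · exact ha
    · exact g.right
  have hab : f a ≠ f b := hf.ne (by omega) hb'
  have hXe : X = {f a, f b} :=
    (Finset.eq_of_subset_of_card_le hs (by rw [Finset.card_pair hab]; omega)).symm
  obtain ⟨b', g', hb''⟩ := C.exists_gap g.right
  have hgl' := g'.len
  have : b' = a + c := by
    have h1 : b' ≤ a + c := by
      by_contra! h
      exact g'.not_mem (a + c) (by omega) (by omega) (by rwa [hf.per])
    have h2 := g'.right
    rw [hXe] at h2
    simp only [Finset.mem_insert, Finset.mem_singleton] at h2
    rcases h2 with h2 | h2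
    · rw [← hf.per a] at h2
      exact hf.eq_of h2 (by omega) (by omega)
    · exact absurd h2 (hf.ne (by omega) (by omega)).symm
  subst this
  exact ⟨b, ⟨g, g', le_refl _, le_refl _⟩, hXe⟩

variable {g : V} (hg : g ∉ X) (hgu : g ≠ u) (hd : Paper.deg G g ≤ k)
include hg hgu hd

theorem adj_of_not_near {z w v : V} (hz : z ∉ X) (hw : w ∉ X) (hzu : z ≠ u) (hwu : w ≠ u)
    (hzg : z ≠ g) (hwg : w ≠ g) (hzw : z ≠ w) (h : ¬ G.Adj z g) (h' : ¬ G.Adj z w) (hvz : v ≠ z)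
    (hvu : v ≠ u) (hvg : v ≠ g) (hvw : v ≠ w) : G.Adj z v := by
  by_contra hn
  have h1 := C.count hz hg hzu hgu hzg h
  have hu : ¬ G.Adj z u := fun h => hz (C.sub _ h.symm)
  have hs : nb G z ⊆ Finset.univ \ {z, u, g, w, v} := by
    intro x hx
    rw [mem_nb] at hx
    simp only [Finset.mem_sdiff, Finset.mem_univ, true_and, Finset.mem_insert,
      Finset.mem_singleton, not_or]
    refine ⟨?_, ?_, ?_, ?_, ?_⟩ <;> rintro rfl
    exacts [G.loopless.irrefl _ hx, hu hx, h hx, h' hx, hn hx]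
  have h5 : ({z, u, g, w, v} : Finset V).card = 5 := by
    rw [Finset.card_insert_of_notMem, Finset.card_insert_of_notMem, Finset.card_insert_of_notMem,
      Finset.card_pair hvw.symm]
    · simp [hwg.symm, hvg.symm]
    · simp [hgu.symm, hwu.symm, hvu.symm]
    · simp [hzu, hzg, hzw, hvz.symm]
  have h2 := Finset.card_le_card hs
  rw [card_nb, Finset.card_sdiff_of_subset (Finset.subset_univ _), h5, Finset.card_univ] at h2
  have h3 := C.card_univ_eq
  rw [C.card_eq, Finset.card_empty] at h3
  omega

theorem not_adj_of_O (hgO : g ∈ O) {a : ℤ} (ha : f a ∈ X) : ¬ G.Adj (f (a + 1)) g := by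
  intro h
  have hf := C.cyc
  obtain ⟨b, pr, hX⟩ := C.two_gaps hk ha
  have := pr.gi.len
  have := pr.gj.len
  have hb := pr.gi.right
  have hab : f a ≠ f b := hf.ne (by omega) (by omega)
  have hfg : ∀ i, f i ≠ g := fun i e => C.fO i (e ▸ hgO)
  have h1 : ¬ G.Adj (f (b + 1)) g := fun h' =>
    C.not_cn_firsts ha hb hab (Cn.of_common hgO h h')
  have h2 := C.adj_of_not_near hk hg hgu hd (C.nocons b hb) (C.nocons a ha) (C.off _) (C.off _)
    (hfg _) (hfg _) (hf.ne (i := a + 1) (j := b + 1) (by omega) (by omega)).symm h1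
    (fun h' => C.not_cn_firsts hb ha hab.symm (Or.inl h')) (v := f (a + 2))
    (hf.ne (by omega) (by omega)) (C.off _) (hfg _) (hf.ne (by omega) (by omega)).symm
  have h3 := C.low_of_second ha hb (by omega) (by omega) h2
  rw [hk] at h3
  have e1 := (hf.adj a).symm
  have e2 := hf.adj (a + 1)
  rw [add_assoc, one_add_one_eq_two] at e2
  rcases eq_or_eq_of_deg_le_two h3 e1 e2 (hf.ne (by omega) (by omega)) h with h | h
  · exact hfg _ h.symm
  · exact hfg _ h.symm

theorem first_ne (hT : OneTough G) (hO : O = ∅) (he : 1 ≤ (exs f X).card) {a : ℤ} (ha : f a ∈ X) :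
    f (a + 1) ≠ g := by
  rintro rfl
  have hf := C.cyc
  obtain ⟨b, pr, hX⟩ := C.two_gaps hk ha
  have hl1 := pr.gi.len
  have hl2 := pr.gj.len
  have hb := pr.gi.right
  have hac := pr.gj.right
  have hab : f a ≠ f b := hf.ne (by omega) (by omega)
  have e1 := (hf.adj a).symm
  have e2 := hf.adj (a + 1)
  rw [add_assoc, one_add_one_eq_two] at e2
  have hN : ∀ {v}, G.Adj v (f (a + 1)) → v = f a ∨ v = f (a + 2) := fun h =>
    eq_or_eq_of_deg_le_two (hk ▸ hd) e1 e2 (hf.ne (by omega) (by omega)) h.symm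
  have hNi : ∀ {i}, a + 2 < i → i < a + c → ¬ G.Adj (f i) (f (a + 1)) := by
    intro i h1 h2 h
    rcases hN h with h | h
    · exact hf.ne (i := a) (j := i) (by omega) (by omega) h.symm
    · exact hf.ne (i := a + 2) (j := i) (by omega) (by omega) h.symm
  have hyl := hNi (i := a + c - 1) (by omega) (by omega)
  have hb3 : b = a + 3 := by
    by_contra hb3
    have := C.mirror.firsts_near hg hgu hd (Or.inr ⟨hk, by rwa [C.exs_mirror]⟩)
      (i := -b) (j := -(a + c)) (by simpa using hb) (by simpa using hac)
      (by simpa [hf.per] using hab.symm)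
    simp only [neg_add_rev, neg_neg] at this
    rw [show -1 + b = b - 1 by ring, show -1 + (a + c) = a + c - 1 by ring] at this
    exact hyl (this (hf.ne (by omega) (by omega)).symm (hf.ne (by omega) (by omega)).symm
      (hNi (by omega) (by omega)))
  subst hb3
  have nX : ∀ {i}, a < i → i < a + c → i ≠ a + 3 → f i ∉ X := by
    intro i h1 h2 h3
    rcases lt_or_ge i (a + 3) with h | h
    · exact pr.gi.not_mem i h1 h
    · exact pr.gj.not_mem i (by omega) h2
  have hlast : ¬ G.Adj (f (a + c - 1)) (f (a + 2)) := by
    have := C.not_cn_lasts hac hb (by rw [hf.per]; exact hab)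
    rw [show a + 3 - 1 = a + 2 by ring] at this
    exact fun h => this (Or.inl h)
  have near : ∀ {v}, v ≠ f (a + c - 1) → v ≠ u → v ≠ f (a + 1) → v ≠ f (a + 2) →
      G.Adj (f (a + c - 1)) v := fun h1 h2 h3 h4 =>
    C.adj_of_not_near hk hg hgu hd (nX (by omega) (by omega) (by omega))
      (nX (by omega) (by omega) (by omega)) (C.off _) (C.off _)
      (hf.ne (by omega) (by omega)).symm (hf.ne (by omega) (by omega)).symm
      (hf.ne (by omega) (by omega)).symm hyl hlast h1 h2 h3 h4
  have hrange : ∀ v, v ≠ u → v ∉ X → v = f (a + 1) ∨ v = f (a + 2) ∨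
      ∃ i, a + 3 < i ∧ i < a + c ∧ f i = v := by
    intro v hv hvX
    rcases C.cover v with ⟨i, rfl⟩ | h | h
    · obtain ⟨j, j1, j2, j3⟩ := hf.exists_rep i a
      rw [← j3] at hvX ⊢
      have h1 : j ≠ a := fun e => hvX (e ▸ ha)
      have h2 : j ≠ a + 3 := fun e => hvX (e ▸ hb)
      rcases lt_or_ge (a + 3) j with h | h
      · exact Or.inr (Or.inr ⟨j, h, j2, rfl⟩)
      · rcases (show j = a + 1 ∨ j = a + 2 by omega) with rfl | rfl <;> simp
    · simp [hO] at h
    · exact absurd h hv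
  have nu : ∀ {v}, v ∉ X → ¬ G.Adj u v := fun h h' => h (C.sub _ h')
  obtain ⟨r, r1, r2, r3⟩ : ∃ r, a + 3 < r ∧ r < a + c ∧ G.Adj (f (a + 2)) (f r) := by
    by_contra! hno
    have := hT.reps (S := X) (R := {u, f (a + 2), f (a + c - 1)}) ⟨_, ha⟩ (by
        intro v hv
        simp only [Finset.mem_insert, Finset.mem_singleton] at hv
        rcases hv with rfl | rfl | rfl
        · exact C.u_notMem_X
        · exact nX (by omega) (by omega) (by omega)
        · exact nX (by omega) (by omega) (by omega)) (by
        intro v hv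
        simp only [Finset.mem_insert, Finset.mem_singleton] at hv
        rcases hv with rfl | rfl | rfl
        · refine ⟨{v}, rfl, ?_, ?_⟩
          · rintro _ rfl w hw h
            exact absurd h (nu hw)
          · rintro w _ rfl
            rfl
        · refine ⟨{f (a + 1), f (a + 2)}, by simp, ?_, ?_⟩
          · rintro v (rfl | rfl) w hw h
            · rcases hN h.symm with rfl | rfl
              · exact absurd ha hw
              · simp
            · rcases hrange w (fun e => nu (nX (by omega) (by omega) (by omega))
                (e ▸ h.symm)) hw with rfl | rfl | ⟨i, i1, i2, rfl⟩
              · simp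
              · simp
              · exact absurd h (hno i i1 i2)
          · intro w hw hw'
            simp only [Finset.mem_insert, Finset.mem_singleton] at hw
            rcases hw with rfl | rfl | rfl
            · rcases hw' with h | h <;> exact absurd h.symm (C.off _)
            · rfl
            · rcases hw' with h | h <;> exact absurd h.symm (hf.ne (by omega) (by omega))
        · refine ⟨{v | ∃ i, a + 3 < i ∧ i < a + c ∧ f i = v}, ⟨_, by omega, by omega, rfl⟩, ?_, ?_⟩
          · rintro _ ⟨i, i1, i2, rfl⟩ w hw h
            rcases hrange w (fun e => nu (nX (by omega) i2 (by omega))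
                (e ▸ h.symm)) hw with rfl | rfl | h'
            · exact absurd h (hNi (by omega) i2)
            · exact absurd h.symm (hno i i1 i2)
            · exact h'
          · intro w hw hw'
            simp only [Finset.mem_insert, Finset.mem_singleton] at hw
            obtain ⟨i, i1, i2, i3⟩ := hw'
            rcases hw with rfl | rfl | rfl
            · exact absurd i3 (C.off _)
            · exact absurd i3 (hf.ne (by omega) (by omega)).symm
            · rfl)
    rw [C.card_eq, Finset.card_eq_three.2 ⟨u, f (a + 2), f (a + c - 1), (C.off _).symm,
      (C.off _).symm, hf.ne (by omega) (by omega), rfl⟩] at this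
    omega
  have r4 : r ≠ a + c - 1 := fun e => hlast (e ▸ r3.symm)
  have h1 := near (v := f (r - 1)) (hf.ne (by omega) (by omega)) (C.off _)
    (hf.ne (by omega) (by omega)).symm (hf.ne (by omega) (by omega)).symm
  exact C.full_u (lo := a) (((IP.sg (lo := a) hf a (a + 2)).fw hf r (a + c - 1) r3).bw hf (a + 3)
    (r - 1) h1) (C.adj_u ha) (C.adj_u hb) hab (by intros; omega)

theorem false_of_eq_two (hT : OneTough G) (he : 1 ≤ (exs f X).card) (hgO : O ≠ ∅ → g ∈ O) :
    False := by
  have hf := C.cyc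
  obtain ⟨x, hx⟩ := C.X_nonempty hT
  obtain ⟨a, rfl⟩ := C.ran x hx
  obtain ⟨b, pr, hX⟩ := C.two_gaps hk hx
  have hab : f a ≠ f b := hf.ne (by have := pr.gi.len; omega) (by have := pr.gj.len; omega)
  by_cases hO : O = ∅
  swap
  · have hgO := hgO hO
    have hfg : ∀ i, f i ≠ g := fun i e => C.fO i (e ▸ hgO)
    exact C.not_adj_of_O hk hg hgu hd hgO pr.gi.right (C.firsts_near hg hgu hd (Or.inr ⟨hk, he⟩) hx
      pr.gi.right hab (hfg _) (hfg _) (C.not_adj_of_O hk hg hgu hd hgO hx))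
  have he' : 1 ≤ (exs (fun i => f (-i)) X).card := by rwa [C.exs_mirror]
  have first : ∃ i, f i ∈ X ∧ G.Adj (f (i + 1)) g := by
    by_contra! h
    exact h _ pr.gi.right (C.firsts_near hg hgu hd (Or.inr ⟨hk, he⟩) hx pr.gi.right hab
      (C.first_ne hk hg hgu hd hT hO he hx) (C.first_ne hk hg hgu hd hT hO he pr.gi.right) (h _ hx))
  have lne : ∀ {i}, f i ∈ X → f (i - 1) ≠ g := by
    intro i hi
    have := C.mirror.first_ne hk hg hgu hd hT hO he' (a := -i) (by simpa using hi)
    simpa [add_comm, ← sub_eq_add_neg] using this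
  have last : ∃ i, f i ∈ X ∧ G.Adj (f (i - 1)) g := by
    by_contra! h
    have := C.mirror.firsts_near hg hgu hd (Or.inr ⟨hk, he'⟩)
      (i := -b) (j := -a) (by simpa using pr.gi.right) (by simpa using hx) (by simpa using hab.symm)
    simp only [neg_add_rev, neg_neg] at this
    rw [show -1 + b = b - 1 by ring, show -1 + a = a - 1 by ring] at this
    exact h _ hx (this (lne pr.gi.right) (lne hx) (h _ pr.gi.right))
  clear hab pr hX hx a b
  obtain ⟨m, rfl⟩ : ∃ m, f m = g := by
    rcases C.cover g with h | h | h
    · exact h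
    · simp [hO] at h
    · exact absurd h hgu
  have hN : ∀ {v}, G.Adj v (f m) → v = f (m - 1) ∨ v = f (m + 1) := fun h =>
    eq_or_eq_of_deg_le_two (hk ▸ hd) (by simpa using (hf.adj (m - 1)).symm) (hf.adj m)
      (hf.ne (by omega) (by have := hf.three_le; omega)) h.symm
  have hm2 : f (m - 2) ∈ X := by
    obtain ⟨i, hi, h⟩ := first
    rcases hN h with h | h
    · have := hf.congr_shift h (-1)
      rw [add_neg_cancel_right] at this
      rw [show m - 2 = m - 1 + -1 by ring, ← this]
      exact hi
    · have := hf.congr_shift h (-1)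
      rw [add_neg_cancel_right, add_neg_cancel_right] at this
      exact absurd (this ▸ hi) hg
  have hp2 : f (m + 2) ∈ X := by
    obtain ⟨i, hi, h⟩ := last
    rcases hN h with h | h
    · have := hf.congr_shift h 1
      rw [sub_add_cancel, sub_add_cancel] at this
      exact absurd (this ▸ hi) hg
    · have := hf.congr_shift h 1
      rw [sub_add_cancel, add_assoc, one_add_one_eq_two] at this
      exact this ▸ hi
  obtain ⟨a, rfl⟩ : ∃ a, m = a + 2 := ⟨m - 2, by ring⟩
  rw [add_sub_cancel_right] at hm2
  rw [show a + 2 - 1 = a + 1 by ring, show a + 2 + 1 = a + 3 by ring] at hN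
  rw [show a + 2 + 2 = a + 4 by ring] at hp2
  obtain ⟨b, pr, hX⟩ := C.two_gaps hk hm2
  have hl1 := pr.gi.len
  have hl2 := pr.gj.len
  have hb := pr.gi.right
  have hac := pr.gj.right
  have h3 : f (a + 3) ∉ X := fun h => C.nocons _ h (by rwa [show a + 3 + 1 = a + 4 by ring])
  have hb4 : b = a + 4 := by
    have h1 : b ≤ a + 4 := by
      by_contra! h
      exact pr.gi.not_mem (a + 4) (by omega) h hp2
    have h2 : b ≠ a + 3 := fun e => h3 (e ▸ hb)
    omega
  subst hb4
  have hab : f a ≠ f (a + 4) := hf.ne (by omega) (by omega)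
  have hNi : ∀ {i}, a + 3 < i → i < a + c → ¬ G.Adj (f i) (f (a + 2)) := by
    intro i h1 h2 h
    rcases hN h with h | h
    · exact hf.ne (i := a + 1) (j := i) (by omega) (by omega) h.symm
    · exact hf.ne (i := a + 3) (j := i) (by omega) (by omega) h.symm
  have c1 : ¬ G.Adj (f (a + 4 + 1)) (f (a + 1)) := fun h =>
    C.not_cn_firsts hb hm2 hab.symm (Or.inl h)
  have c2 : ¬ G.Adj (f (a + c - 1)) (f (a + 3)) := by
    have := C.not_cn_lasts hac hb (by rw [hf.per]; exact hab)
    rw [show a + 4 - 1 = a + 3 by ring] at this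
    exact fun h => this (Or.inl h)
  have h4 := C.adj_of_not_near hk hg hgu hd (C.nocons _ hb) (C.nocons _ hm2) (C.off _) (C.off _)
    (hf.ne (by omega) (by omega)).symm (hf.ne (by omega) (by omega))
    (hf.ne (by omega) (by omega)).symm (hNi (by omega) (by omega)) c1 (v := f (a + 3))
    (hf.ne (by omega) (by omega)) (C.off _) (hf.ne (by omega) (by omega)).symm
    (hf.ne (by omega) (by omega)).symm
  have h5 := C.adj_of_not_near hk hg hgu hd (pr.gj.not_mem (a + c - 1) (by omega) (by omega)) h3
    (C.off _) (C.off _) (hf.ne (by omega) (by omega)).symm (hf.ne (by omega) (by omega)).symm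
    (hf.ne (by omega) (by omega)).symm (hNi (by omega) (by omega)) c2 (v := f (a + 4))
    (hf.ne (by omega) (by omega)) (C.off _) (hf.ne (by omega) (by omega)).symm
    (hf.ne (by omega) (by omega)).symm
  exact C.full_u (lo := a) (((IP.sg (lo := a) hf a (a + 3)).fw hf (a + 4 + 1) (a + c - 1)
    h4.symm).fw hf (a + 4) (a + 4) h5) (C.adj_u hm2) (C.adj_u hb) hab (by intros; omega)

omit hk hg hgu hd in
theorem false_of_empty (hT : OneTough G) : False := by
  have h2 := C.two_le hT
  by_cases h : (exs f X).card = 0 ∨ (exs f X).card = 1 ∧ O.card = 0 ∧ 3 ≤ k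
  · exact C.false_of_small hT h
  · obtain ⟨g, hg, hgu, hd, hgO⟩ := C.exists_low hT
    rcases h2.lt_or_eq with hk | hk
    · exact C.false_of_three_le hg hgu hd (by omega) hk
    · exact C.false_of_eq_two hk.symm hg hgu hd hT (by omega) hgO

end Ctx

/-- A connected set `H` of vertices off a longest cycle `f`, attached to the cycle at `A`. -/
structure Hc [Fintype V] (G : SimpleGraph V) (c : ℤ) (f : ℤ → V) (A O H : Finset V) : Prop where
  cyc : Cyc G c f
  cover : ∀ v, (∃ i, f i = v) ∨ v ∈ O ∨ v ∈ H
  fO : ∀ i, f i ∉ O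
  fH : ∀ i, f i ∉ H
  OH : Disjoint O H
  mem_A : ∀ v, v ∈ A ↔ (∃ i, f i = v) ∧ ∃ h ∈ H, G.Adj v h
  HN : ∀ h ∈ H, ∀ v, G.Adj h v → v ∈ A ∨ v ∈ H
  conn : ∀ p ∈ H, ∀ q ∈ H, ∃ L, Pth G L p q ∧ L ⊆ H
  max : ∀ Q x y, Pth G Q x y → G.Adj y x → 3 ≤ Q.card → (Q.card : ℤ) ≤ c
  s3 : ∀ a b d, a ≠ b → a ≠ d → b ≠ d → ¬ G.Adj a b → ¬ G.Adj a d → ¬ G.Adj b d →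
    Fintype.card V ≤ deg G a + deg G b + deg G d

namespace Hc
variable [Fintype V] {G : SimpleGraph V} {c : ℤ} {f : ℤ → V} {A O H : Finset V}
  (D : Hc G c f A O H)
include D

theorem close {Q : Finset V} {s t p q : V} (h : Pth G Q s t) (hst : s ≠ t) (hQ : ∀ x ∈ Q, x ∉ H)
    (hp : p ∈ H) (hq : q ∈ H) (hsp : G.Adj s p) (htq : G.Adj t q) :
    (Q.card : ℤ) < c ∧ (p ≠ q → (Q.card : ℤ) + 1 < c) := by
  obtain ⟨L, hL, hLH⟩ := D.conn q hq p hp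
  have hd : Disjoint Q L := Finset.disjoint_left.2 fun x h1 h2 => hQ x h1 (hLH h2)
  have h2 := h.two_le_card hst
  have h1 : 1 ≤ L.card := Finset.card_pos.2 ⟨_, hL.left_mem⟩
  have := D.max _ _ _ (h.append hL htq hd) hsp.symm (by
    rw [Finset.card_union_of_disjoint hd]
    omega)
  rw [Finset.card_union_of_disjoint hd] at this
  refine ⟨by omega, fun hpq => ?_⟩
  have := hL.two_le_card hpq.symm
  omega

theorem card_univ : (Fintype.card V : ℤ) = c + O.card + H.card := by
  have h : (Finset.univ : Finset V) = (cyf f c ∪ O) ∪ H := by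
    ext v
    simp only [Finset.mem_univ, Finset.mem_union, true_iff, D.cyc.mem_cyf, or_assoc]
    exact D.cover v
  rw [← Finset.card_univ, h, Finset.card_union_of_disjoint, Finset.card_union_of_disjoint]
  · have := D.cyc.card_cyf
    push_cast
    omega
  · rw [Finset.disjoint_left]
    intro x hx
    obtain ⟨i, rfl⟩ := D.cyc.mem_cyf.1 hx
    exact D.fO i
  · rw [Finset.disjoint_left]
    intro x hx hH
    rcases Finset.mem_union.1 hx with hx | hx
    · obtain ⟨i, rfl⟩ := D.cyc.mem_cyf.1 hx
      exact D.fH i hH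
    · exact Finset.disjoint_left.1 D.OH hx hH

theorem ip_path {lo : ℤ} {S : ℤ → Prop} {s t : V} (h : IP G f lo c O S s t) (k0 : ℤ)
    (hS : ∀ k, lo ≤ k → k < lo + c → S k ∨ k = k0) :
    ∃ Q, Pth G Q s t ∧ (∀ x ∈ Q, x ∉ H) ∧ c ≤ Q.card + 1 ∧
      ((∀ k, lo ≤ k → k < lo + c → S k) → c ≤ Q.card) := by
  obtain ⟨Q, h1, h2, h3⟩ := h
  refine ⟨Q, h1, ?_, ?_, ?_⟩
  · intro x hx hH
    rcases h3 x hx with ⟨i, rfl⟩ | h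
    · exact D.fH i hH
    · exact Finset.disjoint_left.1 D.OH h hH
  · have hs : (cyf f c).erase (f k0) ⊆ Q := by
      intro v hv
      rw [Finset.mem_erase] at hv
      obtain ⟨i, rfl⟩ := D.cyc.mem_cyf.1 hv.2
      obtain ⟨j, h4, h5, h6⟩ := D.cyc.exists_rep i lo
      rw [← h6] at hv ⊢
      exact (h2 j h4 h5).2 ((hS j h4 h5).resolve_right fun e => hv.1 (by rw [e]))
    have h4 := Finset.card_le_card hs
    have h5 := Finset.pred_card_le_card_erase (s := cyf f c) (a := f k0)
    have := D.cyc.card_cyf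
    omega
  · intro hS
    have hs : cyf f c ⊆ Q := by
      intro v hv
      obtain ⟨i, rfl⟩ := D.cyc.mem_cyf.1 hv
      obtain ⟨j, h4, h5, h6⟩ := D.cyc.exists_rep i lo
      rw [← h6]
      exact (h2 j h4 h5).2 (hS j h4 h5)
    have h4 := Finset.card_le_card hs
    have := D.cyc.card_cyf
    omega

theorem kill_full {lo : ℤ} {S : ℤ → Prop} {s t : V} (h : IP G f lo c O S s t) (hs : s ∈ A)
    (ht : t ∈ A) (hst : s ≠ t) (hS : ∀ k, lo ≤ k → k < lo + c → S k) : False := by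
  obtain ⟨Q, h1, h2, -, h3⟩ := D.ip_path h lo fun k h1 h2 => Or.inl (hS k h1 h2)
  obtain ⟨-, p, hp, hsp⟩ := (D.mem_A s).1 hs
  obtain ⟨-, q, hq, htq⟩ := (D.mem_A t).1 ht
  have := (D.close h1 hst h2 hp hq hsp htq).1
  have := h3 hS
  omega

theorem kill_miss {lo : ℤ} {S : ℤ → Prop} {s t p q : V} (h : IP G f lo c O S s t) (hst : s ≠ t)
    (hp : p ∈ H) (hq : q ∈ H) (hsp : G.Adj s p) (htq : G.Adj t q) (hpq : p ≠ q) (k0 : ℤ)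
    (hS : ∀ k, lo ≤ k → k < lo + c → S k ∨ k = k0) : False := by
  obtain ⟨Q, h1, h2, h3, -⟩ := D.ip_path h k0 hS
  have := (D.close h1 hst h2 hp hq hsp htq).2 hpq
  omega

theorem nocons {i : ℤ} (h : f i ∈ A) : f (i + 1) ∉ A := fun h' => by
  have := D.cyc.three_le
  exact D.kill_full ((IP.sg (lo := i + 1) D.cyc (i + 1) (i + c)).mono (Set.empty_subset _)) h'
    (by rwa [D.cyc.per]) (D.cyc.ne (by omega) (by omega)) (by intros; omega)

theorem not_adj_firsts {i j : ℤ} (hi : f i ∈ A) (hj : f j ∈ A) (hij : f i ≠ f j) :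
    ¬ G.Adj (f (i + 1)) (f (j + 1)) := by
  intro h
  have hf := D.cyc
  obtain ⟨j', h1, h2, h3⟩ := hf.exists_rep j i
  rw [← hf.congr_shift h3 1] at h
  rw [← h3] at hij hj
  have : i ≠ j' := fun e => hij (by rw [e])
  exact D.kill_full (lo := i + 1) (((IP.sgr (lo := i + 1) hf (i + 1) j').fw hf (j' + 1) (i + c)
    h).mono (Set.empty_subset _)) hj (by rwa [hf.per]) (by rw [hf.per]; exact hij.symm)
    (by intros; omega)

theorem not_adj_second {i j : ℤ} {p q : V} (hp : p ∈ H) (hq : q ∈ H) (hi : G.Adj (f i) p)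
    (hj : G.Adj (f j) q) (hpq : p ≠ q) (hij : f i ≠ f j) :
    ¬ G.Adj (f (i + 1)) (f (j + 2)) := by
  intro h
  have hf := D.cyc
  have hiA : f i ∈ A := (D.mem_A _).2 ⟨⟨_, rfl⟩, p, hp, hi⟩
  obtain ⟨j', h1, h2, h3⟩ := hf.exists_rep j i
  rw [← hf.congr_shift h3 2] at h
  rw [← h3] at hij hj
  have hjA : f j' ∈ A := (D.mem_A _).2 ⟨⟨_, rfl⟩, q, hq, hj⟩
  have n1 : i ≠ j' := fun e => hij (by rw [e])
  have n2 : j' + 1 ≠ i + c := fun e => D.nocons hjA (by rw [e, hf.per]; exact hiA)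
  exact D.kill_miss (lo := i + 1) (((IP.sgr (lo := i + 1) hf (i + 1) j').fw hf (j' + 2) (i + c)
    h).mono (Set.empty_subset _)) (by rw [hf.per]; exact hij.symm) hq hp hj
    (by rwa [hf.per]) hpq.symm (j' + 1) (by intros; omega)

theorem deg_le {h : V} (hh : h ∈ H) :
    deg G h + 1 ≤ H.card + (A.filter fun v => G.Adj v h).card := by
  have hs : nb G h ⊆ H.erase h ∪ A.filter fun v => G.Adj v h := by
    intro v hv
    rw [mem_nb] at hv
    rw [Finset.mem_union, Finset.mem_erase, Finset.mem_filter]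
    rcases D.HN h hh v hv with h' | h'
    · exact Or.inr ⟨h', hv.symm⟩
    · exact Or.inl ⟨hv.ne', h'⟩
  have h1 := Finset.card_le_card hs
  have h2 := Finset.card_union_le (H.erase h) (A.filter fun v => G.Adj v h)
  have h3 := Finset.card_erase_add_one hh
  rw [card_nb] at h1
  omega

theorem not_adj_H {v h : V} (hv : v ∉ A) (hv' : v ∉ H) (hh : h ∈ H) : ¬ G.Adj h v := fun h' =>
  (D.HN h hh v h').elim hv hv'

/-- Two attachment vertices are joined by a long link through `H`. -/
theorem exists_link {s t : V} (hs : s ∈ A) (ht : t ∈ A) (hst : s ≠ t) (hH : 2 ≤ H.card) :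
    ∃ p ∈ H, ∃ q ∈ H, G.Adj s p ∧ G.Adj t q ∧ p ≠ q := by
  by_contra! hno
  have hf := D.cyc
  obtain ⟨⟨i, rfl⟩, p, hp, hsp⟩ := (D.mem_A s).1 hs
  obtain ⟨⟨j, rfl⟩, q, hq, htq⟩ := (D.mem_A t).1 ht
  obtain ⟨j', j1, j2, j3⟩ := hf.exists_rep j i
  rw [← j3] at hst ht hno htq
  have hlt : i < j' := lt_of_le_of_ne j1 fun e => hst (by rw [e])
  obtain ⟨h, hh, hne⟩ := Finset.exists_mem_ne (by omega : 1 < H.card) p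
  have ui : ∀ x ∈ H, G.Adj (f i) x → x = p := fun x hx hxi =>
    (hno x hx q hq hxi htq).trans (hno p hp q hq hsp htq).symm
  have uj : ∀ x ∈ H, G.Adj (f j') x → x = p := fun x hx hxj => (hno p hp x hx hsp hxj).symm
  have hpq : q = p := uj q hq htq
  subst hpq
  have zi := D.nocons hs
  have zj := D.nocons ht
  have hN : ∀ {l v}, f l ∉ A → G.Adj (f l) v → v ∈ O ∨ ∃ i, f i = v := by
    intro l v hl hv
    rcases D.cover v with h | h | h
    · exact Or.inr h
    · exact Or.inl h
    · exact absurd hv.symm (D.not_adj_H hl (D.fH l) h)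
  have ma : ∀ {v}, v ∈ A.filter (fun v => G.Adj v h) → ∃ a, f a = v ∧ f a ∈ A ∧ G.Adj (f a) h ∧
      f i ≠ f a ∧ f j' ≠ f a := by
    intro v hv
    obtain ⟨hv, hvh⟩ := Finset.mem_filter.1 hv
    obtain ⟨⟨a, rfl⟩, -⟩ := (D.mem_A v).1 hv
    exact ⟨a, rfl, hv, hvh, fun e => hne (ui h hh (e ▸ hvh)), fun e => hne (uj h hh (e ▸ hvh))⟩
  have hU : ((A.filter fun v => G.Adj v h).image (nxt f)).card =
      (A.filter fun v => G.Adj v h).card := by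
    refine Finset.card_image_of_injOn fun v hv w hw e => ?_
    obtain ⟨a, rfl, -⟩ := ma hv
    obtain ⟨b, rfl, -⟩ := ma hw
    exact hf.nxt_inj ⟨a, rfl⟩ ⟨b, rfl⟩ e
  have key := hf.label_firsts hlt j2 (O := O) D.fO (fun v => hN zi) (fun v => hN zj)
    (fun S hS hc => D.kill_full hS (by rwa [hf.per]) ht (by rw [hf.per]; exact hst) hc)
    ((A.filter fun v => G.Adj v h).image (nxt f)) (by
      intro v hv
      obtain ⟨x, hx, rfl⟩ := Finset.mem_image.1 hv
      obtain ⟨a, rfl, ha, hah, n1, n2⟩ := ma hx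
      rw [nxt_apply hf, nxt_apply hf, add_assoc, one_add_one_eq_two]
      exact ⟨⟨_, rfl⟩, D.not_adj_firsts hs ha n1, D.not_adj_firsts ht ha n2,
        D.not_adj_second hp hh hsp hah hne.symm n1, D.not_adj_second hp hh htq hah hne.symm n2⟩)
  rw [hU] at key
  have h1 := D.deg_le hh
  have h2 := D.s3 h (f (i + 1)) (f (j' + 1)) (fun e => D.fH _ (e ▸ hh)) (fun e => D.fH _ (e ▸ hh))
    (hf.ne (by omega) (by omega)) (D.not_adj_H zi (D.fH _) hh) (D.not_adj_H zj (D.fH _) hh)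
    (D.not_adj_firsts hs ht hst)
  have h3 := D.card_univ
  push_cast at key
  omega

theorem not_tough (hH : 2 ≤ H.card) (hT : OneTough G) : False := by
  have hf := D.cyc
  have h3 := hf.three_le
  obtain ⟨h, hh⟩ : H.Nonempty := Finset.card_pos.1 (by omega)
  have hA : A.Nonempty := by
    by_contra hA
    rw [Finset.not_nonempty_iff_eq_empty] at hA
    have := hT.reps (S := {f 0}) (R := {h, f 1}) ⟨_, Finset.mem_singleton_self _⟩ (by
        intro r hr
        simp only [Finset.mem_insert, Finset.mem_singleton] at hr ⊢
        rcases hr with rfl | rfl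
        · exact fun e => D.fH 0 (e ▸ hh)
        · exact (hf.ne (by omega) (by omega)).symm) (by
        intro r hr
        have hcl : ∀ x ∈ H, ∀ w, G.Adj x w → w ∈ H := fun x hx w hw =>
          (D.HN x hx w hw).resolve_left (by simp [hA])
        simp only [Finset.mem_insert, Finset.mem_singleton] at hr ⊢
        rcases hr with rfl | rfl
        · exact ⟨H, hh, fun v hv w _ hw => hcl v hv w hw, fun r' hr hr' =>
            hr.resolve_right fun e => D.fH 1 (e ▸ hr')⟩
        · exact ⟨{v | v ∉ H}, D.fH 1, fun v hv w _ hw hw' => hv (hcl w hw' v hw.symm),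
            fun r' hr hr' => hr.resolve_left fun e => hr' (e ▸ hh)⟩)
    have hne : h ≠ f 1 := fun e => D.fH 1 (e ▸ hh)
    rw [Finset.card_pair hne] at this
    simp at this
  have hs : ∀ i, f (i - 1) ∈ A → f (i + 1) ∈ A → False := by
    intro i h1 h2
    have hne : f (i + 1) ≠ f (i - 1) := by
      intro e
      have := hf.inj _ _ e
      have := Int.le_of_dvd (by omega) this
      omega
    obtain ⟨p, hp, q, hq, h4, h5, h6⟩ := D.exists_link h2 h1 hne hH
    have h1' : f (i + c - 1) = f (i - 1) := by rw [show i + c - 1 = i - 1 + c by ring, hf.per]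
    exact D.kill_miss ((IP.sg (lo := i) hf (i + 1) (i + c - 1)).mono (Set.empty_subset _))
      (by rwa [h1']) hp hq h4 (by rwa [h1']) h6 i (by intros; omega)
  have hse : sing f A = ∅ := by
    rw [Finset.eq_empty_iff_forall_notMem]
    intro v hv
    obtain ⟨i, -, h1, h2⟩ := exists_of_mem_sing hv
    exact hs i h1 h2
  have hDn : Dn G c f A O H := by
    refine ⟨hf, D.cover, D.fO, D.fH, D.OH, fun v hv => ((D.mem_A v).1 hv).1, D.HN, ?_, ?_⟩
    · intro Q s t w hQ h1 h2 hst hQH hQf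
      obtain ⟨p, hp, q, hq, h4, h5, h6⟩ := D.exists_link h1 h2 hst hH
      have := (D.close hQ hst hQH hp hq h4 h5).2 h6
      have hsub : (cyf f c).erase w ⊆ Q := by
        intro v hv
        rw [Finset.mem_erase] at hv
        obtain ⟨i, rfl⟩ := hf.mem_cyf.1 hv.2
        exact (hQf i).resolve_right fun e => hv.1 e.1
      have h7 := Finset.card_le_card hsub
      have h8 := Finset.pred_card_le_card_erase (s := cyf f c) (a := w)
      have := hf.card_cyf
      omega
    · intro z z' h1 h2 h4 h5 _ _ hne hadj
      have h6 := D.s3 h z z' (fun e => h4 (e ▸ hh)) (fun e => h5 (e ▸ hh)) hne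
        (D.not_adj_H h1 h4 hh) (D.not_adj_H h2 h5 hh) hadj
      have h7 := D.deg_le hh
      have h8 := Finset.card_filter_le A (fun v => G.Adj v h)
      have h9 := D.card_univ
      rw [hse, Finset.card_empty]
      omega
  exact hDn.not_tough hT hf ⟨h, hh⟩ hA (fun i h1 h2 => (hs i h1 h2).elim) D.HN
    fun i j _ _ _ _ h => h

end Hc

/-- Longest cycles are dominating. -/
theorem dominating [Fintype V] {G : SimpleGraph V} {c : ℤ} (hT : OneTough G)
    (max : ∀ Q x y, Pth G Q x y → G.Adj y x → 3 ≤ Q.card → (Q.card : ℤ) ≤ c)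
    (s3 : ∀ a b d, a ≠ b → a ≠ d → b ≠ d → ¬ G.Adj a b → ¬ G.Adj a d → ¬ G.Adj b d →
      Fintype.card V ≤ deg G a + deg G b + deg G d) {f : ℤ → V} (hf : Cyc G c f) {u : V}
    (hu : ∀ i, f i ≠ u) {w : V} (huw : G.Adj u w) : ∃ i, f i = w := by
  by_contra! hw
  let G' : SimpleGraph V :=
    { Adj := fun v w => G.Adj v w ∧ (∀ i, f i ≠ v) ∧ ∀ i, f i ≠ w
      symm := ⟨fun v w h => ⟨h.1.symm, h.2.2, h.2.1⟩⟩
      loopless := ⟨fun v h => G.loopless.irrefl v h.1⟩ }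
  have hoff : ∀ v, G'.Reachable u v → ∀ i, f i ≠ v := by
    rintro v ⟨p⟩
    cases p.reverse with
    | nil => exact hu
    | cons h _ => exact h.2.1
  set H : Finset V := Finset.univ.filter fun v => G'.Reachable u v with hH
  have mH : ∀ {v}, v ∈ H ↔ G'.Reachable u v := by simp [hH]
  have huH : u ∈ H := mH.2 (SimpleGraph.Reachable.refl u)
  have hwH : w ∈ H := mH.2 (SimpleGraph.Adj.reachable (show G'.Adj u w from ⟨huw, hu, hw⟩))
  have D : Hc G c f (Finset.univ.filter fun v => (∃ i, f i = v) ∧ ∃ h ∈ H, G.Adj v h)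
      (Finset.univ.filter fun v => (∀ i, f i ≠ v) ∧ v ∉ H) H := by
    refine ⟨hf, ?_, ?_, fun i h => hoff _ (mH.1 h) i rfl, ?_, by simp, ?_, ?_, max, s3⟩
    · intro v
      by_cases h1 : ∃ i, f i = v
      · exact Or.inl h1
      · by_cases h2 : v ∈ H
        · exact Or.inr (Or.inr h2)
        · push Not at h1
          exact Or.inr (Or.inl (by simp [h1, h2]))
    · intro i h
      exact (Finset.mem_filter.1 h).2.1 i rfl
    · rw [Finset.disjoint_left]
      intro v hv
      exact (Finset.mem_filter.1 hv).2.2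
    · intro h hh v hv
      by_cases h1 : ∃ i, f i = v
      · exact Or.inl (Finset.mem_filter.2 ⟨Finset.mem_univ _, h1, h, hh, hv.symm⟩)
      · push Not at h1
        exact Or.inr (mH.2 ((mH.1 hh).trans (SimpleGraph.Adj.reachable
          (show G'.Adj h v from ⟨hv, hoff _ (mH.1 hh), h1⟩))))
    · intro p hp q hq
      obtain ⟨r⟩ := (mH.1 hp).symm.trans (mH.1 hq)
      refine ⟨_, (Pth.of_walk r.bypass_isPath).imp fun v w _ _ h => h.1, fun x hx => ?_⟩
      rw [List.mem_toFinset] at hx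
      exact mH.2 ((mH.1 hp).trans ⟨r.bypass.takeUntil x hx⟩)
  exact D.not_tough (Finset.one_lt_card.2 ⟨u, huH, w, hwH, huw.ne⟩) hT

theorem Cyc.exists_walk_support {G : SimpleGraph V} {c : ℤ} {f : ℤ → V} (hf : Cyc G c f) (n : ℕ) :
    ∃ p : G.Walk (f 1) (f (n + 1)),
      p.support = (List.range (n + 1)).map fun i : ℕ => f (i + 1) := by
  induction n with
  | zero => exact ⟨SimpleGraph.Walk.nil.copy rfl (by simp), by simp⟩
  | succ n ih =>
    obtain ⟨p, hp⟩ := ih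
    refine ⟨(p.concat (hf.adj (n + 1))).copy rfl (by simp), ?_⟩
    rw [SimpleGraph.Walk.support_copy, SimpleGraph.Walk.support_concat, hp,
      List.range_succ (n := n + 1)]
    simp

/-- The closed walk along a cycle. -/
theorem Cyc.exists_walk {G : SimpleGraph V} {c : ℤ} {f : ℤ → V} (hf : Cyc G c f) :
    ∃ p : G.Walk (f c) (f c), p.IsCycle ∧ (p.length : ℤ) = c ∧
      p.support.tail = (List.range c.toNat).map fun i : ℕ => f (i + 1) := by
  have h3 := hf.three_le
  obtain ⟨n, hn⟩ : ∃ n : ℕ, c = n + 1 := ⟨(c - 1).toNat, by omega⟩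
  obtain ⟨p, hp⟩ := hf.exists_walk_support n
  have hcn : c.toNat = n + 1 := by omega
  have hl : p.length = n := by
    have := p.length_support
    rw [hp] at this
    simpa using this.symm
  have hadj : G.Adj (f c) (f 1) := by
    have := hf.adj c
    rwa [add_comm c 1, hf.per] at this
  have hpath : p.IsPath := by
    rw [SimpleGraph.Walk.isPath_def, hp]
    refine List.Nodup.map_on (fun i hi j hj h => ?_) List.nodup_range
    rw [List.mem_range] at hi hj
    have := hf.eq_of h (by omega) (by omega)
    omega
  have he : f c = f (n + 1) := by rw [hn]
  refine ⟨.cons hadj (p.copy rfl he.symm), ?_, by simp [hl, hn], by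
    rw [hcn, SimpleGraph.Walk.support_cons, List.tail_cons, SimpleGraph.Walk.support_copy, hp]⟩
  rw [SimpleGraph.Walk.cons_isCycle_iff]
  have hpath' : (p.copy rfl he.symm).IsPath := by simpa using hpath
  refine ⟨hpath', fun hm => ?_⟩
  have hl' := hpath'.length_eq_one_of_mem_edges (by rwa [Sym2.eq_swap] at hm)
  rw [SimpleGraph.Walk.length_copy] at hl'
  omega

section Walk
variable {G : SimpleGraph V} {c : ℤ} {f : ℤ → V} {a : V} {p : G.Walk a a}

theorem Cyc.nodup_tail (hf : Cyc G c f) :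
    ((List.range c.toNat).map fun i : ℕ => f (i + 1)).Nodup := by
  refine List.Nodup.map_on (fun i hi j hj h => ?_) List.nodup_range
  rw [List.mem_range] at hi hj
  have := hf.eq_of h (by omega) (by omega)
  omega

theorem Cyc.exists_index (hf : Cyc G c f) (i : ℤ) :
    ∃ j : ℕ, j < c.toNat ∧ f (j + 1) = f i := by
  obtain ⟨j, h1, h2, h3⟩ := hf.exists_rep i 1
  exact ⟨(j - 1).toNat, by omega, by rw [← h3]; congr 1; omega⟩

theorem Cyc.mem_tail (hf : Cyc G c f)
    (hp : p.support.tail = (List.range c.toNat).map fun i : ℕ => f (i + 1)) (i : ℤ) :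
    f i ∈ p.support.tail := by
  obtain ⟨j, h1, h2⟩ := hf.exists_index i
  rw [hp, ← h2]
  exact List.mem_map.2 ⟨j, List.mem_range.2 h1, rfl⟩

theorem Cyc.mem_support (hf : Cyc G c f) (hc : ¬ p.Nil)
    (hp : p.support.tail = (List.range c.toNat).map fun i : ℕ => f (i + 1)) {v : V} :
    v ∈ p.support ↔ ∃ i, f i = v := by
  constructor
  · intro h
    have : v ∈ p.support.tail := by
      rcases (SimpleGraph.Walk.mem_support_iff p).1 h with rfl | h
      · exact SimpleGraph.Walk.end_mem_tail_support hc
      · exact h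
    rw [hp] at this
    obtain ⟨j, -, hj⟩ := List.mem_map.1 this
    exact ⟨_, hj⟩
  · rintro ⟨i, rfl⟩
    exact List.mem_of_mem_tail (hf.mem_tail hp i)

theorem Cyc.cSucc_eq [DecidableEq V] (hf : Cyc G c f)
    (hp : p.support.tail = (List.range c.toNat).map fun i : ℕ => f (i + 1)) (i : ℤ) :
    cSucc p (f i) = f (i + 1) := by
  have h3 := hf.three_le
  have hm := hf.mem_tail hp i
  obtain ⟨j, h1, h2⟩ := hf.exists_index i
  have hlen : ((List.range c.toNat).map fun i : ℕ => f (i + 1)).length = c.toNat := by simp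
  have key := List.next_getElem _ hf.nodup_tail j (by omega)
  simp only [List.getElem_map, List.getElem_range, hlen] at key
  rw [cSucc, dif_pos hm]
  simp only [hp, ← h2]
  rw [key, hf.congr_shift h2.symm 1]
  rcases eq_or_lt_of_le (Nat.succ_le_of_lt h1) with h | h
  · have hj : (j : ℤ) + 1 = c := by omega
    rw [Nat.succ_eq_add_one] at h
    rw [h, Nat.mod_self, hj, add_comm c 1, hf.per]
    simp
  · rw [Nat.mod_eq_of_lt h]
    push_cast
    rfl

theorem Cyc.cPred_eq [DecidableEq V] (hf : Cyc G c f)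
    (hp : p.support.tail = (List.range c.toNat).map fun i : ℕ => f (i + 1)) (i : ℤ) :
    cPred p (f i) = f (i - 1) := by
  have hm := hf.mem_tail hp (i - 1)
  have h := hf.cSucc_eq hp (i - 1)
  rw [sub_add_cancel, cSucc, dif_pos hm] at h
  have hn : p.support.tail.Nodup := hp ▸ hf.nodup_tail
  rw [cPred, dif_pos (hf.mem_tail hp i)]
  have h' := List.prev_next p.support.tail hn (f (i - 1)) hm
  simp only [h] at h'
  exact h'

theorem exists_cyc_of_isCycle (hp : p.IsCycle) :
    ∃ f, Cyc G p.length f ∧ ∀ v, v ∈ p.support ↔ ∃ i, f i = v := by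
  cases p with
  | nil => exact absurd hp SimpleGraph.Walk.not_isCycle_nil
  | cons h q =>
    have h3 := hp.three_le_length
    have hq := ((SimpleGraph.Walk.cons_isCycle_iff q h).1 hp).1
    have hcard : q.support.toFinset.card = q.length + 1 := by
      rw [List.toFinset_card_of_nodup hq.support_nodup, SimpleGraph.Walk.length_support]
    rw [SimpleGraph.Walk.length_cons] at h3 ⊢
    obtain ⟨f, hf, hv⟩ := (Pth.of_walk hq).exists_cyc h (by omega)
    rw [hcard] at hf
    refine ⟨f, hf, fun v => ?_⟩
    rw [← hv v, SimpleGraph.Walk.support_cons, List.mem_cons, List.mem_toFinset]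
    exact ⟨fun h => h.elim (fun h => h ▸ q.end_mem_support) id, .inr⟩

end Walk

theorem OneTough.exists_isCycle [Fintype V] {G : SimpleGraph V} (hT : OneTough G)
    (hn : 3 ≤ Fintype.card V) : ∃ (a : V) (p : G.Walk a a), p.IsCycle := by
  by_contra! hcon
  have hac : G.IsAcyclic := fun a p => hcon a p
  have : Nontrivial V := Fintype.one_lt_card_iff_nontrivial.1 (by omega)
  have hthird : ∀ x y : V, ∃ z, z ≠ x ∧ z ≠ y := by
    intro x y
    obtain ⟨z, -, hz⟩ := Finset.exists_mem_notMem_of_card_lt_card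
      (s := {x, y}) (t := (Finset.univ : Finset V))
      ((Finset.card_le_two).trans_lt (by rw [Finset.card_univ]; omega))
    exact ⟨z, by simpa [not_or] using hz⟩
  have hpair : ∀ s x y : V, x ≠ s → y ≠ s → x ≠ y → ∀ C : Set V, x ∈ C → y ∉ C →
      (∀ v ∈ C, ∀ w, w ≠ s → G.Adj v w → w ∈ C) →
      (∀ v ∉ C, v ≠ s → ∀ w, w ≠ s → G.Adj v w → w ∉ C) → False := by
    intro s x y hxs hys hxy C hx hy h1 h2
    have := hT.reps (S := {s}) (R := {x, y}) (by simp) (by simp [hxs, hys]) (by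
      intro r hr
      simp only [Finset.mem_insert, Finset.mem_singleton] at hr ⊢
      rcases hr with rfl | rfl
      · exact ⟨C, hx, h1, fun r' hr hr' => hr.resolve_right fun e => hy (e ▸ hr')⟩
      · exact ⟨{v | v ∉ C ∧ v ≠ s}, ⟨hy, hys⟩, fun v hv w hw h => ⟨h2 v hv.1 hv.2 w hw h, hw⟩,
          fun r' hr hr' => hr.resolve_left fun e => hr'.1 (e ▸ hx)⟩)
    rw [Finset.card_pair hxy] at this
    simp at this
  have hconn : G.Preconnected := by
    intro x y
    by_contra hxy
    obtain ⟨s, hsx, hsy⟩ := hthird x y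
    refine hpair s x y hsx.symm hsy.symm (fun e => hxy (e ▸ SimpleGraph.Reachable.refl _))
      {v | G.Reachable x v} (SimpleGraph.Reachable.refl _) hxy
      (fun v hv w _ h => hv.trans h.reachable) (fun v hv _ w _ h hw => hv (hw.trans h.symm.reachable))
  have htree : G.IsTree := ⟨⟨hconn⟩, hac⟩
  obtain ⟨v, hv⟩ := htree.exists_vert_degree_one_of_nontrivial
  obtain ⟨s, hs⟩ := Finset.card_eq_one.1 hv
  have hvs : ∀ w, G.Adj v w ↔ w = s := fun w => by
    rw [← SimpleGraph.mem_neighborFinset, hs, Finset.mem_singleton]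
  obtain ⟨y, hyv, hys⟩ := hthird v s
  refine hpair s v y ((hvs s).2 rfl).ne hys hyv.symm {v} rfl hyv ?_ ?_
  · rintro _ rfl w hw h
    exact absurd ((hvs w).1 h) hw
  · rintro w - hws _ - h rfl
    exact hws ((hvs w).1 h.symm)

theorem IsLongestCycle.max {G : SimpleGraph V} {a : V} {p : G.Walk a a} (hp : IsLongestCycle G p)
    {Q : Finset V} {x y : V} (h : Pth G Q x y) (hyx : G.Adj y x) (hQ : 3 ≤ Q.card) :
    (Q.card : ℤ) ≤ p.length := by
  obtain ⟨w, h1, h2, -⟩ := h.exists_cycle hyx hQ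
  have := hp.2 _ w h1
  omega

theorem IsLongestCycle.of_cyc {G : SimpleGraph V} {a : V} {p : G.Walk a a}
    (hp : IsLongestCycle G p) {f : ℤ → V} (hf : Cyc G p.length f) :
    ∃ q : G.Walk (f p.length) (f p.length), IsLongestCycle G q ∧
      (∀ v, v ∈ q.support ↔ ∃ i, f i = v) ∧
      q.support.tail = (List.range (p.length : ℤ).toNat).map fun i : ℕ => f (i + 1) := by
  obtain ⟨q, h1, h2, h3⟩ := hf.exists_walk
  exact ⟨q, ⟨h1, fun b w hw => (hp.2 b w hw).trans (by omega)⟩,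
    fun v => hf.mem_support h1.not_nil h3, h3⟩

theorem IsLongestCycle.length_eq {G : SimpleGraph V} {a b : V} {p : G.Walk a a} {q : G.Walk b b}
    (hp : IsLongestCycle G p) (hq : IsLongestCycle G q) : q.length = p.length :=
  le_antisymm (hp.2 _ q hq.1) (hq.2 _ p hp.1)

theorem OneTough.exists_isLongestCycle [Fintype V] {G : SimpleGraph V} (hT : OneTough G)
    (hn : 3 ≤ Fintype.card V) : ∃ (a : V) (p : G.Walk a a), IsLongestCycle G p := by
  obtain ⟨a, p, hp⟩ := hT.exists_isCycle hn
  have hne : {m | ∃ (a : V) (p : G.Walk a a), p.IsCycle ∧ p.length = m}.Nonempty :=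
    ⟨_, a, p, hp, rfl⟩
  have hb : BddAbove {m | ∃ (a : V) (p : G.Walk a a), p.IsCycle ∧ p.length = m} := by
    refine ⟨Fintype.card V, ?_⟩
    rintro _ ⟨b, q, hq, rfl⟩
    have h := hq.support_nodup.length_le_card
    rwa [List.length_tail, SimpleGraph.Walk.length_support, Nat.add_sub_cancel] at h
  obtain ⟨b, q, hq, he⟩ := Nat.sSup_mem hne hb
  exact ⟨b, q, hq, fun d w hw => he ▸ le_csSup hb ⟨d, w, hw, rfl⟩⟩

theorem sSup_mem_of_mem {s : Set ℕ} (hb : BddAbove s) {m : ℕ} (hm : m ∈ s) : sSup s ∈ s :=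
  Nat.sSup_mem ⟨m, hm⟩ hb

theorem deg_le_card [Fintype V] (G : SimpleGraph V) (v : V) : deg G v ≤ Fintype.card V := by
  rw [← card_nb, ← Finset.card_univ]
  exact Finset.card_le_univ _

theorem bddAbove_off [Fintype V] (G : SimpleGraph V) :
    BddAbove {d | ∃ (a : V) (c : G.Walk a a), IsLongestCycle G c ∧
      ∃ x : V, x ∉ c.support ∧ deg G x = d} :=
  ⟨Fintype.card V, by
    rintro _ ⟨a, c, -, x, -, rfl⟩
    exact deg_le_card G x⟩

theorem sigma3_le [Fintype V] {G : SimpleGraph V} {a b d : V} (hab : a ≠ b) (had : a ≠ d)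
    (hbd : b ≠ d) (nab : ¬ G.Adj a b) (nad : ¬ G.Adj a d) (nbd : ¬ G.Adj b d) :
    sigma3 G ≤ deg G a + deg G b + deg G d := by
  have h : IsIndepTriple G {a, b, d} := by
    refine ⟨Finset.card_eq_three.2 ⟨a, b, d, hab, had, hbd, rfl⟩, ?_⟩
    have := fun h => nab (SimpleGraph.Adj.symm h)
    have := fun h => nad (SimpleGraph.Adj.symm h)
    have := fun h => nbd (SimpleGraph.Adj.symm h)
    simp only [Finset.mem_insert, Finset.mem_singleton]
    rintro x (rfl | rfl | rfl) y (rfl | rfl | rfl) hxy <;> first | exact absurd rfl hxy | assumption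
  rw [sigma3, if_pos ⟨_, h⟩]
  refine Nat.sInf_le ⟨_, h, ?_⟩
  rw [Finset.sum_insert (by simp [hab, had]), Finset.sum_pair hbd, add_assoc]

/-- A vertex off a longest cycle whose degree is maximal, chosen with as many enclosed vertices as
possible, has many enclosed vertices. -/
theorem sigma3_add_four_le [Fintype V] {G : SimpleGraph V} (hT : OneTough G)
    (hsig : Fintype.card V ≤ sigma3 G) {c : ℤ} {k : ℕ} {f : ℤ → V} {u : V} (hf : Cyc G c f)
    (hu : ∀ i, f i ≠ u) (hk : deg G u = k)
    (max : ∀ Q x y, Pth G Q x y → G.Adj y x → 3 ≤ Q.card → (Q.card : ℤ) ≤ c)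
    (mu : ∀ g, Cyc G c g → ∀ v, (∀ i, g i ≠ v) → deg G v ≤ k)
    (tmax : ∀ g, Cyc G c g → ∀ v, (∀ i, g i ≠ v) → deg G v = k →
      (sing g (nb G v)).card ≤ (sing f (nb G u)).card) :
    sigma3 G + 4 ≤ Fintype.card V + (sing f (nb G u)).card ∧
      ∀ i, G.Adj u (f i) → ¬ G.Adj u (f (i + 1)) := by
  have s3 : ∀ a b d, a ≠ b → a ≠ d → b ≠ d → ¬ G.Adj a b → ¬ G.Adj a d → ¬ G.Adj b d →
      sigma3 G ≤ deg G a + deg G b + deg G d := fun _ _ _ h1 h2 h3 h4 h5 h6 =>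
    sigma3_le h1 h2 h3 h4 h5 h6
  have B : Bs G c k f u (Finset.univ.filter fun v => v ≠ u ∧ ∀ i, f i ≠ v) :=
    { cyc := hf
      off := hu
      deg := hk
      cover := fun v => by
        by_cases h : ∃ i, f i = v
        · exact .inl h
        · by_cases h' : v = u
          · exact .inr (.inr h')
          · exact .inr (.inl (Finset.mem_filter.2 ⟨Finset.mem_univ _, h', not_exists.1 h⟩))
      fO := fun i h => (Finset.mem_filter.1 h).2.2 i rfl
      uO := fun h => (Finset.mem_filter.1 h).2.1 rfl
      max := max
      dom := fun g hg v hv w hw => dominating hT max (fun a b d h1 h2 h3 h4 h5 h6 =>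
        hsig.trans (s3 a b d h1 h2 h3 h4 h5 h6)) hg hv hw }
  obtain ⟨X, Y, H⟩ := B.exists_hp
  refine ⟨?_, fun i h h' => H.nocons i (H.sub _ h) (H.sub _ h')⟩
  by_contra! hcon
  have C : Ctx G c k f u _ X Y :=
    { toBs := B
      toHp := H
      mu := mu
      s3 := fun a b d h1 h2 h3 h4 h5 h6 => by
        have := s3 a b d h1 h2 h3 h4 h5 h6
        omega
      tmax := tmax }
  rcases Nat.lt_or_ge Y.card 2 with h | h
  · rcases Nat.lt_or_ge Y.card 1 with h0 | h1
    · obtain rfl : Y = ∅ := Finset.card_eq_zero.1 (by omega)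
      exact C.false_of_empty hT
    · exact C.false_of_card_one hT (by omega)
  · exact (C.toSx (.inl h)).false hT

theorem stmt9 {V : Type*} [Fintype V] [DecidableEq V] (G : SimpleGraph V)
    (hn : 3 ≤ Fintype.card V) (htough : OneTough G) (hsig : Fintype.card V ≤ sigma3 G)
    (hham : ¬ G.IsHamiltonian) :
    ∃ (a : V) (c : G.Walk a a), IsLongestCycle G c ∧
      ∃ u : V, u ∉ c.support ∧ deg G u = muG G ∧
        sigma3 G - Fintype.card V + 4 ≤
          {x | x ∈ c.support ∧ cPred c x ∈ G.neighborSet u ∧ cSucc c x ∈ G.neighborSet u ∧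
            x ∉ G.neighborSet u}.ncard := by
  obtain ⟨a, p, hp⟩ := htough.exists_isLongestCycle hn
  have hoff : ∃ x, x ∉ p.support := by
    by_contra! hall
    refine hham fun _ => ⟨a, p, ?_⟩
    rw [SimpleGraph.Walk.isHamiltonianCycle_iff_isCycle_and_support_count_tail_eq_one]
    refine ⟨hp.1, fun v => List.count_eq_one_of_mem hp.1.support_nodup ?_⟩
    rcases (SimpleGraph.Walk.mem_support_iff p).1 (hall v) with rfl | h
    · exact SimpleGraph.Walk.end_mem_tail_support hp.1.not_nil
    · exact h
  obtain ⟨x, hx⟩ := hoff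
  have hb := bddAbove_off G
  obtain ⟨b, q, hq, y, hy, hk⟩ := sSup_mem_of_mem hb ⟨a, p, hp, x, hx, rfl⟩
  change deg G y = muG G at hk
  have mu : ∀ g, Cyc G p.length g → ∀ v, (∀ i, g i ≠ v) → deg G v ≤ muG G := by
    intro g hg v hv
    obtain ⟨w, h1, h2, -⟩ := hp.of_cyc hg
    exact le_csSup hb ⟨_, w, h1, v, fun h => ((h2 v).1 h).elim hv, rfl⟩
  obtain ⟨f₀, hf₀, hs₀⟩ := exists_cyc_of_isCycle hq.1
  rw [hp.length_eq hq] at hf₀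
  have hbs : BddAbove {m | ∃ f u, Cyc G p.length f ∧ (∀ i, f i ≠ u) ∧ deg G u = muG G ∧
      (sing f (nb G u)).card = m} := by
    refine ⟨Fintype.card V, ?_⟩
    rintro _ ⟨f, u, -, -, -, rfl⟩
    exact Finset.card_le_univ _
  obtain ⟨f, u, hf, hu, hdeg, hm⟩ := sSup_mem_of_mem hbs
    ⟨f₀, y, hf₀, fun i hi => hy ((hs₀ y).2 ⟨i, hi⟩), hk, rfl⟩
  obtain ⟨hcard, hcons⟩ := sigma3_add_four_le htough hsig hf hu hdeg
    (fun Q s t h h1 h2 => hp.max h h1 h2) mu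
    (fun g hg v hv hd => hm ▸ le_csSup hbs ⟨g, v, hg, hv, hd, rfl⟩)
  obtain ⟨w, hw, hws, hwt⟩ := hp.of_cyc hf
  refine ⟨_, w, hw, u, fun h => ((hws u).1 h).elim hu, hdeg, ?_⟩
  refine le_trans (show _ ≤ (sing f (nb G u)).card by omega) ?_
  rw [← Set.ncard_coe_finset]
  refine Set.ncard_le_ncard (fun v hv => ?_) (Set.toFinite _)
  obtain ⟨i, rfl, h1, h2⟩ := exists_of_mem_sing (Finset.mem_coe.1 hv)
  rw [mem_nb] at h1 h2
  refine ⟨(hws _).2 ⟨i, rfl⟩, ?_, ?_, fun h => hcons i h h2⟩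
  · rwa [hf.cPred_eq hwt]
  · rwa [hf.cSucc_eq hwt]

end
end Paper
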